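/- Let n ≥ 2 be an integer, M > 1, and let p be the positive root of the equation (3n−2)p² − 3np − 6 = 0 (the critical exponent p_crit(n)). Let f, g ∈ C_c^∞(ℝⁿ) be supported in the ball B(0,M), nonnegative, and each positive at some point. Then there is no global solution u ∈ C²([0,∞)×ℝⁿ) of ∂_t²u − tΔu = |u|^p with u(0,·) = f, ∂_t u(0,·) = g, satisfying the finite-propagation property that for every t ≥ 0 the support of u(t,·) is contained in {x ∈ ℝⁿ : |x| ≤ M + (2/3)t^{3/2}}; i.e. every such solution blows up in finite time. -/

import Mathlib

open MeasureTheory Metric Set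

/-- The (flat) Laplacian in the space variables, written as the sum of the second partial
derivatives in the coordinate directions of `ℝⁿ`. -/
noncomputable def spatialLaplacian {n : ℕ} (v : EuclideanSpace ℝ (Fin n) → ℝ)
    (x : EuclideanSpace ℝ (Fin n)) : ℝ :=
  ∑ i : Fin n,
    fderiv ℝ (fun y => fderiv ℝ v y (EuclideanSpace.single i (1 : ℝ))) x
      (EuclideanSpace.single i (1 : ℝ))

namespace Tric

/-- space -/
abbrev Sp (n : ℕ) := EuclideanSpace ℝ (Fin n)

/-- characteristic function -/
noncomputable def phi (t : ℝ) : ℝ := (2 / 3) * t ^ ((3 : ℝ) / 2)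

lemma phi_cont : Continuous phi := by
  unfold phi
  exact continuous_const.mul (Real.continuous_rpow_const (by norm_num))

lemma phi_nonneg {t : ℝ} (ht : 0 ≤ t) : 0 ≤ phi t := by
  unfold phi; positivity

lemma phi_pos {t : ℝ} (ht : 0 < t) : 0 < phi t := by
  unfold phi; positivity

lemma phi_mono {s t : ℝ} (hs : 0 ≤ s) (h : s ≤ t) : phi s ≤ phi t := by
  unfold phi
  have := Real.rpow_le_rpow hs h (by norm_num : (0:ℝ) ≤ 3/2)
  linarith

lemma phi_deriv {t : ℝ} (ht : 0 < t) : HasDerivAt phi (t ^ ((1:ℝ)/2)) t := by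
  unfold phi
  have := (Real.hasDerivAt_rpow_const (x := t) (p := 3/2) (Or.inl ht.ne')).const_mul (2/3)
  have e : (2:ℝ)/3 * (3/2 * t ^ ((3:ℝ)/2 - 1)) = t ^ ((1:ℝ)/2) := by norm_num; ring
  rwa [e] at this

/-- the open half space t>0 -/
def Om (n : ℕ) : Set (ℝ × Sp n) := Ioi 0 ×ˢ univ

/-- cone -/
def cone (n : ℕ) (M : ℝ) : Set (ℝ × Sp n) := {q | ‖q.2‖ ≤ M + phi q.1}

/-- truncated cone -/
def slab (n : ℕ) (M t1 R : ℝ) : Set (ℝ × Sp n) := {q | (t1 ≤ q.1 ∧ q.1 ≤ R) ∧ ‖q.2‖ ≤ M + phi q.1}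

lemma Om_open (n : ℕ) : IsOpen (Om n) := isOpen_Ioi.prod isOpen_univ

lemma mem_Om {n : ℕ} {q : ℝ × Sp n} : q ∈ Om n ↔ 0 < q.1 := by simp [Om]

lemma cone_closed (n : ℕ) (M : ℝ) : IsClosed (cone n M) :=
  isClosed_le (by fun_prop) (continuous_const.add (phi_cont.comp continuous_fst))

lemma slab_compact (n : ℕ) (M t1 R : ℝ) (ht1 : 0 ≤ t1) : IsCompact (slab n M t1 R) := by
  have hc : IsCompact (Icc t1 R ×ˢ closedBall (0 : Sp n) (M + phi R)) :=
    isCompact_Icc.prod (isCompact_closedBall _ _)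
  refine hc.of_isClosed_subset ?_ ?_
  · have h1 : IsClosed {q : ℝ × Sp n | t1 ≤ q.1 ∧ q.1 ≤ R} := by
      exact (isClosed_le continuous_const continuous_fst).inter
        (isClosed_le continuous_fst continuous_const)
    exact h1.inter (cone_closed n M)
  · rintro ⟨t, x⟩ ⟨⟨h1, h2⟩, h3⟩
    refine ⟨⟨h1, h2⟩, ?_⟩
    simp only [mem_closedBall, dist_zero_right]
    have := phi_mono (ht1.trans h1) h2
    simp only at h1 h2 h3
    linarith

lemma fderiv_off {n : ℕ} {M : ℝ} {F : ℝ × Sp n → ℝ}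
    (hs : ∀ q ∈ Om n, q ∉ cone n M → F q = 0) {q : ℝ × Sp n} (hq : q ∈ Om n) (hc : q ∉ cone n M) :
    fderiv ℝ F q = 0 := by
  have : F =ᶠ[nhds q] fun _ => (0:ℝ) := by
    have ho : IsOpen (Om n ∩ (cone n M)ᶜ) := (Om_open n).inter (cone_closed n M).isOpen_compl
    filter_upwards [ho.mem_nhds ⟨hq, hc⟩] with z hz
    exact hs z hz.1 hz.2
  rw [this.fderiv_eq]
  simp

lemma slice_cont {n : ℕ} {G : ℝ × Sp n → ℝ} (hG : ContinuousOn G (Om n)) {t : ℝ} (ht : 0 < t) :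
    Continuous fun x => G (t, x) := by
  have : Continuous fun x : Sp n => (t, x) := by fun_prop
  exact hG.comp_continuous this (fun x => mem_Om.2 ht)

lemma slice_int {n : ℕ} {M : ℝ} {G : ℝ × Sp n → ℝ} (hG : ContinuousOn G (Om n))
    (hs : ∀ q ∈ Om n, q ∉ cone n M → G q = 0) {t : ℝ} (ht : 0 < t) :
    Integrable fun x => G (t, x) := by
  refine (slice_cont hG ht).integrable_of_hasCompactSupport ?_
  refine HasCompactSupport.intro (isCompact_closedBall (0 : Sp n) (M + phi t)) ?_
  intro x hx
  refine hs _ (mem_Om.2 ht) ?_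
  simpa [cone] using hx

lemma slab_bdd {n : ℕ} {M t1 R : ℝ} {G : ℝ × Sp n → ℝ} (hG : ContinuousOn G (Om n))
    (h1 : 0 < t1) : ∃ C, 0 ≤ C ∧ ∀ q ∈ slab n M t1 R, |G q| ≤ C := by
  obtain ⟨C, hC⟩ := (slab_compact n M t1 R h1.le).exists_bound_of_continuousOn
    (hG.mono (fun q hq => mem_Om.2 (h1.trans_le hq.1.1)))
  refine ⟨max C 0, le_max_right _ _, fun q hq => (hC q hq).trans (le_max_left _ _)⟩

lemma C1_fderiv {n : ℕ} {F : ℝ × Sp n → ℝ} (hF : ContDiffOn ℝ 1 F (Om n)) (v : ℝ × Sp n) :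
    ContinuousOn (fun q => fderiv ℝ F q v) (Om n) :=
  (hF.continuousOn_fderiv_of_isOpen (Om_open n) le_rfl).clm_apply continuousOn_const

lemma C1_diff {n : ℕ} {F : ℝ × Sp n → ℝ} (hF : ContDiffOn ℝ 1 F (Om n)) {q : ℝ × Sp n}
    (hq : q ∈ Om n) : DifferentiableAt ℝ F q :=
  (hF.contDiffAt ((Om_open n).mem_nhds hq)).differentiableAt one_ne_zero

lemma hasDerivAt_t {n : ℕ} {F : ℝ × Sp n → ℝ} {t : ℝ} {x : Sp n} (h : DifferentiableAt ℝ F (t, x)) :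
    HasDerivAt (fun s => F (s, x)) (fderiv ℝ F (t, x) (1, 0)) t := by
  have h1 : HasDerivAt (fun s : ℝ => (s, x)) ((1 : ℝ), (0 : Sp n)) t :=
    (hasDerivAt_id t).prodMk (hasDerivAt_const t x)
  exact h.hasFDerivAt.comp_hasDerivAt t h1

/-- differentiation of spatial integrals -/
lemma div_a {n : ℕ} {M : ℝ} {F : ℝ × Sp n → ℝ} (hF : ContDiffOn ℝ 1 F (Om n))
    (hs : ∀ q ∈ Om n, q ∉ cone n M → F q = 0) {t : ℝ} (ht : 0 < t) :
    HasDerivAt (fun s => ∫ x, F (s, x)) (∫ x, fderiv ℝ F (t, x) (1, 0)) t := by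
  obtain ⟨C, hC0, hC⟩ := slab_bdd (M := M) (t1 := t/2) (R := 2*t) (C1_fderiv hF (1, 0)) (by linarith)
  refine (hasDerivAt_integral_of_dominated_loc_of_deriv_le (μ := volume)
    (F := fun s x => F (s, x)) (F' := fun s x => fderiv ℝ F (s, x) (1, 0))
    (bound := (closedBall (0 : Sp n) (M + phi (2*t))).indicator (fun _ => C))
    (s := Ioo (t/2) (2*t)) (x₀ := t) (Ioo_mem_nhds (by linarith) (by linarith)) ?_ ?_ ?_ ?_ ?_ ?_).2
  · filter_upwards [lt_mem_nhds ht] with s hs'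
    exact (slice_cont hF.continuousOn hs').aestronglyMeasurable
  · exact slice_int hF.continuousOn hs ht
  · exact (slice_cont (C1_fderiv hF (1,0)) ht).aestronglyMeasurable
  · refine Filter.Eventually.of_forall fun x s hs' => ?_
    have hs0 : 0 < s := by linarith [hs'.1]
    by_cases hx : (s, x) ∈ cone n M
    · have hm := phi_mono hs0.le hs'.2.le
      have : x ∈ closedBall (0 : Sp n) (M + phi (2*t)) := by
        simp only [cone, mem_ofPred_eq] at hx
        simp only [mem_closedBall, dist_zero_right]; linarith
      rw [indicator_of_mem this]
      exact hC (s, x) ⟨⟨hs'.1.le, hs'.2.le⟩, hx⟩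
    · rw [fderiv_off hs (mem_Om.2 hs0) hx]
      simp only [zero_apply, norm_zero]
      exact indicator_nonneg (fun _ _ => hC0) _
  · refine (integrable_indicator_iff measurableSet_closedBall).2 ?_
    exact integrableOn_const (isCompact_closedBall _ _).measure_lt_top.ne
  · refine Filter.Eventually.of_forall fun x s hs' => ?_
    exact hasDerivAt_t (C1_diff hF (mem_Om.2 (by linarith [hs'.1])))

lemma fderiv_slice {n : ℕ} {F : ℝ × Sp n → ℝ} {t : ℝ} {x : Sp n} (h : DifferentiableAt ℝ F (t, x))
    (e : Sp n) : fderiv ℝ (fun y => F (t, y)) x e = fderiv ℝ F (t, x) (0, e) := by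
  have h1 : HasFDerivAt (fun y : Sp n => (t, y)) (ContinuousLinearMap.inr ℝ ℝ (Sp n)) x :=
    hasFDerivAt_prodMk_right t x
  have h2 := h.hasFDerivAt.comp x h1
  have h3 : fderiv ℝ (fun y => F (t, y)) x = _ := h2.fderiv
  rw [h3]; simp

lemma div_b {n : ℕ} {M : ℝ} {F : ℝ × Sp n → ℝ} (hF : ContDiffOn ℝ 1 F (Om n))
    (hs : ∀ q ∈ Om n, q ∉ cone n M → F q = 0) {t : ℝ} (ht : 0 < t) (e : Sp n) :
    ∫ x, fderiv ℝ F (t, x) (0, e) = 0 := by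
  have hd : ∀ x, DifferentiableAt ℝ F (t, x) := fun x => C1_diff hF (mem_Om.2 ht)
  have hi : Integrable fun x => fderiv ℝ F (t, x) (0, e) := by
    refine slice_int (C1_fderiv hF (0, e)) (M := M) ?_ ht
    intro q hq hc
    simp [fderiv_off hs hq hc]
  have key := integral_mul_fderiv_eq_neg_fderiv_mul_of_integrable (μ := (volume : Measure (Sp n)))
    (f := fun _ => (1:ℝ)) (g := fun y => F (t, y)) (v := e) (by simp)
    (by simpa [fderiv_slice (hd _)] using hi) (by simpa using slice_int hF.continuousOn hs ht)
    (fun x _ => differentiableAt_const _)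
    (fun x _ => (hd x).comp x (by fun_prop))
  simpa [fderiv_slice (hd _)] using key

/-- gluing -/
lemma glue {n : ℕ} {M : ℝ} {F Ξ : ℝ × Sp n → ℝ} {O : Set (ℝ × Sp n)} (hO : IsOpen O)
    (hsub : ∀ q ∈ Om n, q ∈ cone n M → q ∈ O) (hF : ContDiffOn ℝ 1 F (Om n))
    (hs : ∀ q ∈ Om n, q ∉ cone n M → F q = 0) (hΞ : ContDiffOn ℝ 1 Ξ O) :
    ContDiffOn ℝ 1 (fun q => F q * Ξ q) (Om n) := by
  intro q hq
  by_cases hc : q ∈ cone n M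
  · have h1 := hF.contDiffAt ((Om_open n).mem_nhds hq)
    have h2 := hΞ.contDiffAt (hO.mem_nhds (hsub q hq hc))
    exact (h1.mul h2).contDiffWithinAt
  · have : (fun q => F q * Ξ q) =ᶠ[nhds q] fun _ => (0:ℝ) := by
      have ho : IsOpen (Om n ∩ (cone n M)ᶜ) := (Om_open n).inter (cone_closed n M).isOpen_compl
      filter_upwards [ho.mem_nhds ⟨hq, hc⟩] with z hz
      simp [hs z hz.1 hz.2]
    exact (contDiffAt_const.congr_of_eventuallyEq this).contDiffWithinAt

lemma C2_D1 {n : ℕ} {F : ℝ × Sp n → ℝ} {O : Set (ℝ × Sp n)} (hO : IsOpen O)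
    (hF : ContDiffOn ℝ 2 F O) (v : ℝ × Sp n) :
    ContDiffOn ℝ 1 (fun q => fderiv ℝ F q v) O :=
  (hF.fderiv_of_isOpen hO (by norm_num)).clm_apply contDiffOn_const

/-- unit vectors -/
noncomputable def eX (n : ℕ) (i : Fin n) : ℝ × Sp n := (0, EuclideanSpace.single i (1:ℝ))

/-- The Tricomi operator -/
noncomputable def Pop {n : ℕ} (F : ℝ × Sp n → ℝ) (q : ℝ × Sp n) : ℝ :=
  fderiv ℝ (fun z => fderiv ℝ F z (1, 0)) q (1, 0) -
    q.1 * ∑ i, fderiv ℝ (fun z => fderiv ℝ F z (eX n i)) q (eX n i)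

/-- global solutions, on t > 0 -/
structure Sol (n : ℕ) (M p : ℝ) (u : ℝ × Sp n → ℝ) : Prop where
  hn : 2 ≤ n
  hM : 1 < M
  hp : 1 < p
  hcrit : (3 * (n : ℝ) - 2) * p ^ 2 - 3 * (n : ℝ) * p - 6 = 0
  c2 : ContDiffOn ℝ 2 u (Om n)
  pde : ∀ q ∈ Om n, Pop u q = |u q| ^ p
  supp : ∀ q ∈ Om n, q ∉ cone n M → u q = 0

lemma Sol.cont {n : ℕ} {M p : ℝ} {u : ℝ × Sp n → ℝ} (S : Sol n M p u) : ContinuousOn u (Om n) :=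
  S.c2.continuousOn

lemma Sol.contU {n : ℕ} {M p : ℝ} {u : ℝ × Sp n → ℝ} (S : Sol n M p u) :
    ContinuousOn (fun q => |u q| ^ p) (Om n) :=
  S.cont.abs.rpow_const (fun _ _ => Or.inr (by linarith [S.hp]))

lemma Sol.suppU {n : ℕ} {M p : ℝ} {u : ℝ × Sp n → ℝ} (S : Sol n M p u) :
    ∀ q ∈ Om n, q ∉ cone n M → |u q| ^ p = 0 := by
  intro q hq hc
  rw [S.supp q hq hc, abs_zero, Real.zero_rpow (by linarith [S.hp])]

/-- the time-slice form -/
noncomputable def Dat {n : ℕ} (u Ξ Ξ' : ℝ × Sp n → ℝ) (t : ℝ) : ℝ :=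
  ∫ x, (fderiv ℝ u (t, x) (1, 0) * Ξ (t, x) - u (t, x) * Ξ' (t, x))

lemma green_deriv {n : ℕ} {M p : ℝ} {u Ξ : ℝ × Sp n → ℝ} (S : Sol n M p u)
    {O : Set (ℝ × Sp n)} (hO : IsOpen O)
    (hsub : ∀ q ∈ Om n, q ∈ cone n M → q ∈ O) (hΞ : ContDiffOn ℝ 2 Ξ O) {t : ℝ} (ht : 0 < t) :
    HasDerivAt (fun s => Dat u Ξ (fun q => fderiv ℝ Ξ q (1, 0)) s)
      (∫ x, (|u (t, x)| ^ p * Ξ (t, x) - u (t, x) * Pop Ξ (t, x))) t := by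
  have hu1 := fun v => C2_D1 (Om_open n) S.c2 v
  have hΞ1 := fun v => C2_D1 hO hΞ v
  have hu0 : ContDiffOn ℝ 1 u (Om n) := S.c2.of_le (by norm_num)
  have hΞ0 : ContDiffOn ℝ 1 Ξ O := hΞ.of_le (by norm_num)
  have hs1 : ∀ v, ∀ q ∈ Om n, q ∉ cone n M → fderiv ℝ u q v = 0 := by
    intro v q hq hc; simp [fderiv_off S.supp hq hc]
  -- the fluxes
  have hF : ∀ v, ContDiffOn ℝ 1 (fun q => fderiv ℝ u q v * Ξ q - u q * fderiv ℝ Ξ q v) (Om n) :=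
    fun v => (glue hO hsub (hu1 v) (hs1 v) hΞ0).sub (glue hO hsub hu0 S.supp (hΞ1 v))
  have hFs : ∀ v, ∀ q ∈ Om n, q ∉ cone n M →
      fderiv ℝ u q v * Ξ q - u q * fderiv ℝ Ξ q v = 0 := by
    intro v q hq hc; simp [hs1 v q hq hc, S.supp q hq hc]
  have hder : ∀ v w, ∀ q ∈ Om n, q ∈ cone n M →
      fderiv ℝ (fun q => fderiv ℝ u q v * Ξ q - u q * fderiv ℝ Ξ q v) q v =
      fderiv ℝ (fun q => fderiv ℝ u q v) q v * Ξ q - u q * fderiv ℝ (fun q => fderiv ℝ Ξ q v) q v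
        + 0 * w := by
    intro v w q hq hc
    have a1 := (C1_diff (hu1 v) hq).hasFDerivAt
    have a2 := (C1_diff hu0 hq).hasFDerivAt
    have hqO := hO.mem_nhds (hsub q hq hc)
    have b1 := (((hΞ1 v).contDiffAt hqO).differentiableAt one_ne_zero).hasFDerivAt
    have b2 := ((hΞ0.contDiffAt hqO).differentiableAt one_ne_zero).hasFDerivAt
    have := ((a1.mul b2).sub (a2.mul b1)).fderiv
    have e : (fun q => fderiv ℝ u q v * Ξ q - u q * fderiv ℝ Ξ q v) =
      ((fun q => fderiv ℝ u q v) * Ξ - u * fun q => fderiv ℝ Ξ q v) := rfl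
    rw [e, this]
    simp
    ring
  have key := div_a (hF (1, 0)) (hFs (1, 0)) ht
  have keyb := fun i : Fin n => div_b (hF (eX n i)) (hFs (eX n i)) ht (EuclideanSpace.single i (1:ℝ))
  refine key.congr_deriv ?_
  have hi : ∀ i : Fin n, Integrable fun x => fderiv ℝ
      (fun q => fderiv ℝ u q (eX n i) * Ξ q - u q * fderiv ℝ Ξ q (eX n i)) (t, x) (eX n i) := by
    intro i
    refine slice_int (C1_fderiv (hF (eX n i)) _) (M := M) ?_ ht
    intro q hq hc
    simp [fderiv_off (hFs (eX n i)) hq hc]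
  have h0 : Integrable fun x => fderiv ℝ
      (fun q => fderiv ℝ u q (1, 0) * Ξ q - u q * fderiv ℝ Ξ q (1, 0)) (t, x) (1, 0) := by
    refine slice_int (C1_fderiv (hF (1, 0)) _) (M := M) ?_ ht
    intro q hq hc
    simp [fderiv_off (hFs (1, 0)) hq hc]
  have e1 : ∫ x, t * ∑ i, fderiv ℝ
      (fun q => fderiv ℝ u q (eX n i) * Ξ q - u q * fderiv ℝ Ξ q (eX n i)) (t, x) (eX n i) = 0 := by
    rw [integral_const_mul, integral_finsetSum _ (fun i _ => hi i)]
    have : ∀ i : Fin n, ∫ x, fderiv ℝ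
      (fun q => fderiv ℝ u q (eX n i) * Ξ q - u q * fderiv ℝ Ξ q (eX n i)) (t, x) (eX n i) = 0 :=
      fun i => keyb i
    simp [this]
  rw [← sub_zero (∫ x, fderiv ℝ _ (t, x) (1, 0)), ← e1, ← integral_sub h0
    ((integrable_finsetSum _ (fun i _ => hi i)).const_mul t)]
  congr 1
  ext x
  have hq : (t, x) ∈ Om n := mem_Om.2 ht
  by_cases hc : (t, x) ∈ cone n M
  · have := hder (1, 0) 0 _ hq hc
    rw [this]
    have h2 : ∀ i, _ := fun i => hder (eX n i) 0 _ hq hc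
    rw [Finset.sum_congr rfl (fun i _ => h2 i)]
    rw [← S.pde _ hq]
    unfold Pop
    simp only [mul_zero, add_zero, Finset.sum_sub_distrib, ← Finset.sum_mul, ← Finset.mul_sum]
    ring
  · rw [S.suppU _ hq hc]
    simp only [fderiv_off (hFs _) hq hc, S.supp _ hq hc]
    simp

lemma slab_meas (n : ℕ) (M t1 R : ℝ) (h1 : 0 ≤ t1) : MeasurableSet (slab n M t1 R) :=
  (slab_compact n M t1 R h1).isClosed.measurableSet

lemma Pop_cont {n : ℕ} {Ξ : ℝ × Sp n → ℝ} {O : Set (ℝ × Sp n)} (hO : IsOpen O)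
    (hΞ : ContDiffOn ℝ 2 Ξ O) : ContinuousOn (Pop Ξ) O := by
  have h : ∀ v, ContinuousOn (fun q => fderiv ℝ (fun z => fderiv ℝ Ξ z v) q v) O := fun v =>
    ((C2_D1 hO hΞ v).continuousOn_fderiv_of_isOpen hO le_rfl).clm_apply continuousOn_const
  unfold Pop
  exact (h _).sub (continuousOn_fst.mul (continuousOn_finsetSum _ fun i _ => h _))

lemma slab_sub_Om {n : ℕ} {M t1 R : ℝ} (h1 : 0 < t1) : slab n M t1 R ⊆ Om n :=
  fun _ hq => mem_Om.2 (h1.trans_le hq.1.1)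

lemma slab_sub_cone {n : ℕ} {M t1 R : ℝ} : slab n M t1 R ⊆ cone n M :=
  fun _ hq => hq.2

lemma int_slab {n : ℕ} {M t1 R : ℝ} {G : ℝ × Sp n → ℝ} (h1 : 0 < t1)
    (hG : ContinuousOn G (slab n M t1 R))
    (hs : ∀ q ∈ Om n, q ∉ cone n M → G q = 0) :
    IntegrableOn G (Icc t1 R ×ˢ univ) ∧
    ∫ q in slab n M t1 R, G q = ∫ t in Icc t1 R, ∫ x, G (t, x) := by
  have hi : IntegrableOn G (slab n M t1 R) :=
    hG.integrableOn_compact (slab_compact n M t1 R h1.le)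
  have hm : MeasurableSet (Icc t1 R ×ˢ (univ : Set (Sp n))) := measurableSet_Icc.prod .univ
  have hz : ∀ q ∈ (Icc t1 R ×ˢ (univ : Set (Sp n))) \ slab n M t1 R, G q = 0 := by
    rintro q ⟨⟨ha, -⟩, hb⟩
    exact hs q (mem_Om.2 (h1.trans_le ha.1)) (fun hc => hb ⟨ha, hc⟩)
  have hi2 := hi.of_forall_sdiff_eq_zero hm hz
  refine ⟨hi2, ?_⟩
  rw [← setIntegral_eq_of_subset_of_forall_sdiff_eq_zero hm
    (fun q hq => ⟨hq.1, mem_univ _⟩) hz]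
  rw [Measure.volume_eq_prod] at hi2 ⊢
  rw [setIntegral_prod _ hi2]
  simp

lemma green {n : ℕ} {M p : ℝ} {u Ξ : ℝ × Sp n → ℝ} (S : Sol n M p u)
    {O : Set (ℝ × Sp n)} (hO : IsOpen O)
    (hsub : ∀ q ∈ Om n, q ∈ cone n M → q ∈ O) (hΞ : ContDiffOn ℝ 2 Ξ O) {t1 R : ℝ} (h1 : 0 < t1)
    (h2 : t1 ≤ R) :
    ∫ q in slab n M t1 R, (|u q| ^ p * Ξ q - u q * Pop Ξ q) =
      Dat u Ξ (fun q => fderiv ℝ Ξ q (1, 0)) R - Dat u Ξ (fun q => fderiv ℝ Ξ q (1, 0)) t1 := by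
  have hsO : slab n M t1 R ⊆ O := fun q hq => hsub q (slab_sub_Om h1 hq) (slab_sub_cone hq)
  have hG : ContinuousOn (fun q => |u q| ^ p * Ξ q - u q * Pop Ξ q) (slab n M t1 R) :=
    ((S.contU.mono (slab_sub_Om h1)).mul (hΞ.continuousOn.mono hsO)).sub
      ((S.cont.mono (slab_sub_Om h1)).mul ((Pop_cont hO hΞ).mono hsO))
  have hs : ∀ q ∈ Om n, q ∉ cone n M → |u q| ^ p * Ξ q - u q * Pop Ξ q = 0 := by
    intro q hq hc
    rw [S.suppU q hq hc, S.supp q hq hc]; simp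
  obtain ⟨hi, he⟩ := int_slab h1 hG hs
  rw [he, integral_Icc_eq_integral_Ioc, ← intervalIntegral.integral_of_le h2]
  refine intervalIntegral.integral_eq_sub_of_hasDerivAt
    (f := fun s => Dat u Ξ (fun q => fderiv ℝ Ξ q (1, 0)) s) ?_ ?_
  · intro t ht
    rw [uIcc_of_le h2] at ht
    exact green_deriv S hO hsub hΞ (h1.trans_le ht.1)
  · rw [intervalIntegrable_iff_integrableOn_Icc_of_le h2]
    rw [IntegrableOn, Measure.volume_eq_prod, ← Measure.prod_restrict] at hi
    have := hi.integral_prod_left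
    rw [Measure.restrict_univ] at this
    exact this

lemma lin4 {α : Type*} [MeasurableSpace α] {μ : Measure α} {a b c d : α → ℝ} (ha : Integrable a μ)
    (hb : Integrable b μ) (hc : Integrable c μ) (hd : Integrable d μ) :
    ∫ x, (a x - b x - c x - d x) ∂μ = ∫ x, a x ∂μ - ∫ x, b x ∂μ - ∫ x, c x ∂μ - ∫ x, d x ∂μ := by
  rw [← integral_sub ha hb]
  have h1 : Integrable (fun x => a x - b x) μ := ha.sub hb
  rw [← integral_sub h1 hc]
  have h2 : Integrable (fun x => a x - b x - c x) μ := h1.sub hc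
  rw [← integral_sub h2 hd]

lemma swapL {α β : Type*} [MeasurableSpace α] [MeasurableSpace β] (ν : Measure β) [SFinite ν]
    (μ : Measure α) [IsFiniteMeasure μ] {w : α → ℝ} {C : ℝ}
    (hw : AEStronglyMeasurable w μ) (hb : ∀ᵐ q ∂μ, |w q| ≤ C) {h : β → α → ℝ}
    (hh : Measurable (Function.uncurry h)) {G : β → ℝ} (hG : Integrable G ν)
    (hbd : ∀ᵐ q ∂μ, ∀ r, |h r q| ≤ G r) :
    Integrable (fun r => ∫ q, w q * h r q ∂μ) ν ∧ Integrable (fun q => w q * ∫ r, h r q ∂ν) μ ∧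
    ∫ r, (∫ q, w q * h r q ∂μ) ∂ν = ∫ q, w q * (∫ r, h r q ∂ν) ∂μ := by
  have hi : Integrable (Function.uncurry fun r q => w q * h r q) (ν.prod μ) := by
    have hg : Integrable (fun z : β × α => G z.1 * C) (ν.prod μ) :=
      hG.mul_prod (integrable_const C)
    refine hg.mono' ?_ ?_
    · have h1 : AEStronglyMeasurable (fun z : β × α => w z.2) (ν.prod μ) :=
        hw.comp_snd
      exact h1.mul hh.aestronglyMeasurable
    · have h3 : ∀ᵐ z ∂(ν.prod μ), |w z.2| ≤ C ∧ ∀ r, |h r z.2| ≤ G r :=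
        (Measure.quasiMeasurePreserving_snd (μ := ν) (ν := μ)).ae (hb.and hbd)
      filter_upwards [h3] with z hz
      simp only [Function.uncurry, norm_mul, Real.norm_eq_abs]
      rw [mul_comm]
      exact mul_le_mul (hz.2 _) hz.1 (abs_nonneg _) ((abs_nonneg _).trans (hz.2 z.1))
  refine ⟨hi.integral_prod_left, ?_, ?_⟩
  · have := hi.integral_prod_right
    refine this.congr (Filter.Eventually.of_forall fun q => ?_)
    simp [Function.uncurry, integral_const_mul]
  · rw [integral_integral_swap hi]
    simp [integral_const_mul]

/-- product with a time cutoff -/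
lemma cutoff {n : ℕ} {h : ℝ × Sp n → ℝ} {O : Set (ℝ × Sp n)} (hO : IsOpen O)
    (hh : ContDiffOn ℝ 2 h O) {ψ ψ1 ψ2 : ℝ → ℝ} (hψ : ContDiff ℝ 2 ψ)
    (hd1 : ∀ t, HasDerivAt ψ (ψ1 t) t) (hd2 : ∀ t, HasDerivAt ψ1 (ψ2 t) t) :
    ContDiffOn ℝ 2 (fun q => h q * ψ q.1) O ∧
    (∀ q ∈ O, fderiv ℝ (fun q => h q * ψ q.1) q (1, 0) =
      fderiv ℝ h q (1, 0) * ψ q.1 + h q * ψ1 q.1) ∧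
    (∀ q ∈ O, Pop (fun q => h q * ψ q.1) q =
      Pop h q * ψ q.1 + (2 * fderiv ℝ h q (1, 0) * ψ1 q.1 + h q * ψ2 q.1)) := by
  have hψ' : ∀ q : ℝ × Sp n, HasFDerivAt (fun q : ℝ × Sp n => ψ q.1)
      ((ContinuousLinearMap.smulRight (1 : ℝ →L[ℝ] ℝ) (ψ1 q.1)).comp
        (ContinuousLinearMap.fst ℝ ℝ (Sp n))) q :=
    fun q => (hd1 q.1).hasFDerivAt.comp q hasFDerivAt_fst
  have hψ1' : ∀ q : ℝ × Sp n, HasFDerivAt (fun q : ℝ × Sp n => ψ1 q.1)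
      ((ContinuousLinearMap.smulRight (1 : ℝ →L[ℝ] ℝ) (ψ2 q.1)).comp
        (ContinuousLinearMap.fst ℝ ℝ (Sp n))) q :=
    fun q => (hd2 q.1).hasFDerivAt.comp q hasFDerivAt_fst
  have hdh : ∀ q ∈ O, HasFDerivAt h (fderiv ℝ h q) q := fun q hq =>
    ((hh.contDiffAt (hO.mem_nhds hq)).differentiableAt two_ne_zero).hasFDerivAt
  have hdh1 : ∀ v, ∀ q ∈ O, HasFDerivAt (fun z => fderiv ℝ h z v)
      (fderiv ℝ (fun z => fderiv ℝ h z v) q) q := fun v q hq =>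
    (((C2_D1 hO hh v).contDiffAt (hO.mem_nhds hq)).differentiableAt one_ne_zero).hasFDerivAt
  have hf : ∀ v : ℝ × Sp n, ∀ q ∈ O, fderiv ℝ (fun q => h q * ψ q.1) q v =
      fderiv ℝ h q v * ψ q.1 + h q * (v.1 * ψ1 q.1) := by
    intro v q hq
    have := ((hdh q hq).mul (hψ' q)).fderiv
    have e : (fun q => h q * ψ q.1) = h * fun q : ℝ × Sp n => ψ q.1 := rfl
    rw [e, this]; simp; ring
  refine ⟨hh.mul ((hψ.comp contDiff_fst).contDiffOn), ?_, ?_⟩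
  · intro q hq
    rw [hf _ q hq]; simp
  · intro q hq
    unfold Pop
    have h2 : ∀ v : ℝ × Sp n, fderiv ℝ (fun z => fderiv ℝ (fun q => h q * ψ q.1) z v) q v =
        fderiv ℝ (fun z => fderiv ℝ h z v) q v * ψ q.1 + 2 * (v.1 * (fderiv ℝ h q v * ψ1 q.1))
        + v.1 * (v.1 * (h q * ψ2 q.1)) := by
      intro v
      have ev : (fun z => fderiv ℝ (fun q => h q * ψ q.1) z v) =ᶠ[nhds q]
          fun z => fderiv ℝ h z v * ψ z.1 + h z * (v.1 * ψ1 z.1) := by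
        filter_upwards [hO.mem_nhds hq] with z hz using hf v z hz
      rw [ev.fderiv_eq]
      have := (((hdh1 v q hq).mul (hψ' q)).add ((hdh q hq).mul ((hψ1' q).const_mul v.1))).fderiv
      have e : (fun z => fderiv ℝ h z v * ψ z.1 + h z * (v.1 * ψ1 z.1)) =
        (fun z => fderiv ℝ h z v) * (fun z : ℝ × Sp n => ψ z.1) +
          h * fun z : ℝ × Sp n => v.1 * ψ1 z.1 := rfl
      rw [e, this]; simp; ring
    rw [h2, Finset.sum_congr rfl (fun i _ => h2 (eX n i))]
    simp [eX, ← Finset.sum_mul]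
    ring

theorem lemT {β : Type*} [MeasurableSpace β] (ν : Measure β) [SFinite ν] {n : ℕ} {M p : ℝ} {u : ℝ × Sp n → ℝ} (S : Sol n M p u)
    {O : Set (ℝ × Sp n)} (hO : IsOpen O)
    (hsub : ∀ q ∈ Om n, q ∈ cone n M → q ∈ O) {t1 R : ℝ} (h1 : 0 < t1) (h2 : t1 ≤ R)
    {h0 h1' h2' : β → ℝ × Sp n → ℝ} (hC : ∀ r, ContDiffOn ℝ 2 (h0 r) O)
    (hd1 : ∀ r, ∀ q ∈ Om n, q ∈ cone n M → fderiv ℝ (h0 r) q (1, 0) = h1' r q)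
    (hd2 : ∀ r, ∀ q ∈ Om n, q ∈ cone n M → Pop (h0 r) q = h2' r q)
    (m0 : Measurable (Function.uncurry h0)) (m1 : Measurable (Function.uncurry h1'))
    (m2 : Measurable (Function.uncurry h2')) {G : β → ℝ} (hG : Integrable G ν)
    (b0 : ∀ r, ∀ q ∈ slab n M t1 R, |h0 r q| ≤ G r)
    (b1 : ∀ r, ∀ q ∈ slab n M t1 R, |h1' r q| ≤ G r)
    (b2 : ∀ r, ∀ q ∈ slab n M t1 R, |h2' r q| ≤ G r)
    (hz : ∀ q ∈ slab n M t1 R, ∫ r, h2' r q ∂ν = 0)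
    {ψ ψ1 ψ2 : ℝ → ℝ} (hψ : ContDiff ℝ 2 ψ) (cψ1 : Continuous ψ1) (cψ2 : Continuous ψ2)
    (hψ1 : ∀ t, HasDerivAt ψ (ψ1 t) t) (hψ2 : ∀ t, HasDerivAt ψ1 (ψ2 t) t)
    (hR0 : ψ R = 0) (hR1 : ψ1 R = 0) :
    IntegrableOn (fun q => |u q| ^ p * ψ q.1 * ∫ r, h0 r q ∂ν) (slab n M t1 R) ∧
    IntegrableOn (fun q => u q * (2 * ψ1 q.1 * (∫ r, h1' r q ∂ν) + ψ2 q.1 * ∫ r, h0 r q ∂ν))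
      (slab n M t1 R) ∧
    (∫ q in slab n M t1 R, |u q| ^ p * ψ q.1 * ∫ r, h0 r q ∂ν) +
      Dat u (fun q => (∫ r, h0 r q ∂ν) * ψ q.1)
        (fun q => (∫ r, h1' r q ∂ν) * ψ q.1 + (∫ r, h0 r q ∂ν) * ψ1 q.1) t1 =
    ∫ q in slab n M t1 R, u q * (2 * ψ1 q.1 * (∫ r, h1' r q ∂ν) + ψ2 q.1 * ∫ r, h0 r q ∂ν) := by
  set K := slab n M t1 R with hK
  have hKm : MeasurableSet K := slab_meas n M t1 R h1.le
  have hKc : IsCompact K := slab_compact n M t1 R h1.le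
  have : IsFiniteMeasure ((volume : Measure (ℝ × Sp n)).restrict K) :=
    ⟨by simpa using hKc.measure_lt_top⟩
  set B := closedBall (0 : Sp n) (M + phi t1) with hB
  have hBc : IsCompact B := isCompact_closedBall _ _
  have : IsFiniteMeasure ((volume : Measure (Sp n)).restrict B) :=
    ⟨by simpa using hBc.measure_lt_top⟩
  -- general facts on the slab
  have gen : ∀ (w : ℝ × Sp n → ℝ) (hw : ContinuousOn w (Om n)) (h : β → ℝ × Sp n → ℝ)
      (mh : Measurable (Function.uncurry h)) (hb : ∀ r, ∀ q ∈ K, |h r q| ≤ G r),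
      Integrable (fun r => ∫ q in K, w q * h r q) ν ∧
      Integrable (fun q => w q * ∫ r, h r q ∂ν) ((volume : Measure (ℝ × Sp n)).restrict K) ∧
      ∫ r, (∫ q in K, w q * h r q) ∂ν = ∫ q in K, w q * ∫ r, h r q ∂ν := by
    intro w hw h mh hb
    obtain ⟨C, -, hC⟩ := slab_bdd (M := M) (R := R) hw h1
    refine swapL ν _ (C := C) ((hw.mono (slab_sub_Om h1)).aestronglyMeasurable hKm) ?_ mh hG ?_
    · exact (ae_restrict_iff' hKm).2 (Filter.Eventually.of_forall hC)
    · exact (ae_restrict_iff' hKm).2 (Filter.Eventually.of_forall fun q hq r => hb r q hq)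
  have hB1 : ∀ x ∈ B, (t1, x) ∈ K := by
    intro x hx
    refine ⟨⟨le_rfl, h2⟩, ?_⟩
    simpa [hB] using hx
  have genB : ∀ (w : ℝ × Sp n → ℝ) (hw : ContinuousOn w (Om n)) (h : β → ℝ × Sp n → ℝ)
      (mh : Measurable (Function.uncurry h)) (hb : ∀ r, ∀ q ∈ K, |h r q| ≤ G r),
      Integrable (fun r => ∫ x in B, w (t1, x) * h r (t1, x)) ν ∧
      Integrable (fun x => w (t1, x) * ∫ r, h r (t1, x) ∂ν) ((volume : Measure (Sp n)).restrict B) ∧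
      ∫ r, (∫ x in B, w (t1, x) * h r (t1, x)) ∂ν = ∫ x in B, w (t1, x) * ∫ r, h r (t1, x) ∂ν := by
    intro w hw h mh hb
    obtain ⟨C, -, hC⟩ := slab_bdd (M := M) (R := R) hw h1
    refine swapL ν _ (C := C) (slice_cont hw h1).aestronglyMeasurable ?_
      (h := fun r x => h r (t1, x)) ?_ hG ?_
    · exact (ae_restrict_iff' measurableSet_closedBall).2
        (Filter.Eventually.of_forall fun x hx => hC _ (hB1 x hx))
    · have : Measurable fun z : β × Sp n => (z.1, ((t1, z.2) : ℝ × Sp n)) := by fun_prop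
      exact mh.comp this
    · exact (ae_restrict_iff' measurableSet_closedBall).2
        (Filter.Eventually.of_forall fun x hx r => hb r _ (hB1 x hx))
  have cψ : ContinuousOn (fun q : ℝ × Sp n => ψ q.1) (Om n) :=
    (hψ.continuous.comp continuous_fst).continuousOn
  have cψ1' : ContinuousOn (fun q : ℝ × Sp n => ψ1 q.1) (Om n) :=
    (cψ1.comp continuous_fst).continuousOn
  have cψ2' : ContinuousOn (fun q : ℝ × Sp n => ψ2 q.1) (Om n) :=
    (cψ2.comp continuous_fst).continuousOn
  have cut : ContinuousOn (fun q => fderiv ℝ u q (1, 0)) (Om n) :=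
    C1_fderiv (S.c2.of_le (by norm_num)) _
  obtain ⟨i1, j1, e1⟩ := gen (fun q => |u q| ^ p * ψ q.1) (S.contU.mul cψ) h0 m0 b0
  obtain ⟨i2, j2, e2⟩ := gen (fun q => u q * ψ q.1) (S.cont.mul cψ) h2' m2 b2
  obtain ⟨i3, j3, e3⟩ := gen (fun q => u q * (2 * ψ1 q.1)) (S.cont.mul (continuousOn_const.mul cψ1')) h1' m1 b1
  obtain ⟨i4, j4, e4⟩ := gen (fun q => u q * ψ2 q.1) (S.cont.mul cψ2') h0 m0 b0
  obtain ⟨i5, j5, e5⟩ := genB (fun q => fderiv ℝ u q (1, 0) * ψ q.1 - u q * ψ1 q.1)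
    ((cut.mul cψ).sub (S.cont.mul cψ1')) h0 m0 b0
  obtain ⟨i6, j6, e6⟩ := genB (fun q => u q * ψ q.1) (S.cont.mul cψ) h1' m1 b1
  have hu1 : ∀ q ∈ Om n, q ∉ cone n M → fderiv ℝ u q (1, 0) = 0 := by
    intro q hq hc; simp [fderiv_off S.supp hq hc]
  -- Dat as integral over the ball
  have DatB : ∀ (Ξ Ξ' : ℝ × Sp n → ℝ), Dat u Ξ Ξ' t1 =
      ∫ x in B, (fderiv ℝ u (t1, x) (1, 0) * Ξ (t1, x) - u (t1, x) * Ξ' (t1, x)) := by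
    intro Ξ Ξ'
    unfold Dat
    rw [setIntegral_eq_integral_of_forall_compl_eq_zero]
    intro x hx
    have hc : (t1, x) ∉ cone n M := by simpa [cone, hB] using hx
    rw [hu1 _ (mem_Om.2 h1) hc, S.supp _ (mem_Om.2 h1) hc]; simp
  have per : ∀ r, (∫ q in K, (|u q| ^ p * ψ q.1) * h0 r q) - (∫ q in K, (u q * ψ q.1) * h2' r q)
      - (∫ q in K, (u q * (2 * ψ1 q.1)) * h1' r q) - (∫ q in K, (u q * ψ2 q.1) * h0 r q)
      + ((∫ x in B, (fderiv ℝ u (t1, x) (1, 0) * ψ t1 - u (t1, x) * ψ1 t1) * h0 r (t1, x))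
      - (∫ x in B, (u (t1, x) * ψ t1) * h1' r (t1, x))) = 0 := by
    intro r
    obtain ⟨c1, c2, c3⟩ := cutoff hO (hC r) hψ hψ1 hψ2
    have g := green S hO hsub c1 h1 h2
    have hDR : Dat u (fun q => h0 r q * ψ q.1)
        (fun q => fderiv ℝ (fun q => h0 r q * ψ q.1) q (1, 0)) R = 0 := by
      unfold Dat
      rw [show (0:ℝ) = ∫ _ : Sp n, (0:ℝ) by simp]
      congr 1; ext x
      have hRpos : (R, x) ∈ Om n := mem_Om.2 (h1.trans_le h2)
      by_cases hc : (R, x) ∈ cone n M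
      · simp only [c2 _ (hsub _ hRpos hc)]; simp [hR0, hR1]
      · rw [hu1 _ hRpos hc, S.supp _ hRpos hc]; simp
    rw [hDR, DatB, ← hK] at g
    have bint : ∀ (w : ℝ × Sp n → ℝ) (hw : ContinuousOn w (Om n)) (h : β → ℝ × Sp n → ℝ)
        (mh : Measurable (Function.uncurry h)) (hb : ∀ r, ∀ q ∈ K, |h r q| ≤ G r),
        IntegrableOn (fun q => w q * h r q) K := by
      intro w hw h mh hb
      obtain ⟨C, -, hC⟩ := slab_bdd (M := M) (R := R) hw h1
      refine Integrable.of_bound (((hw.mono (slab_sub_Om h1)).aestronglyMeasurable hKm).mul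
        (mh.comp (measurable_prodMk_left (x := r))).aestronglyMeasurable) (C * G r) ?_
      refine (ae_restrict_iff' hKm).2 (Filter.Eventually.of_forall fun q hq => ?_)
      simp only [norm_mul, Real.norm_eq_abs]
      exact mul_le_mul (hC q hq) (hb r q hq) (abs_nonneg _) ((abs_nonneg _).trans (hC q hq))
    have bintB : ∀ (w : ℝ × Sp n → ℝ) (hw : ContinuousOn w (Om n)) (h : β → ℝ × Sp n → ℝ)
        (mh : Measurable (Function.uncurry h)) (hb : ∀ r, ∀ q ∈ K, |h r q| ≤ G r),
        IntegrableOn (fun x => w (t1, x) * h r (t1, x)) B := by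
      intro w hw h mh hb
      obtain ⟨C, -, hC⟩ := slab_bdd (M := M) (R := R) hw h1
      have mm : Measurable fun x : Sp n => (r, ((t1, x) : ℝ × Sp n)) := by fun_prop
      refine Integrable.of_bound
        ((slice_cont hw h1).aestronglyMeasurable.mul (mh.comp mm).aestronglyMeasurable) (C * G r) ?_
      refine (ae_restrict_iff' measurableSet_closedBall).2
        (Filter.Eventually.of_forall fun x hx => ?_)
      simp only [norm_mul, Real.norm_eq_abs]
      exact mul_le_mul (hC _ (hB1 x hx)) (hb r _ (hB1 x hx)) (abs_nonneg _)
        ((abs_nonneg _).trans (hC _ (hB1 x hx)))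
    have I1 := bint (fun q => |u q| ^ p * ψ q.1) (S.contU.mul cψ) h0 m0 b0
    have I2 := bint (fun q => u q * ψ q.1) (S.cont.mul cψ) h2' m2 b2
    have I3 := bint (fun q => u q * (2 * ψ1 q.1)) (S.cont.mul (continuousOn_const.mul cψ1')) h1' m1 b1
    have I4 := bint (fun q => u q * ψ2 q.1) (S.cont.mul cψ2') h0 m0 b0
    have I5 := bintB (fun q => fderiv ℝ u q (1, 0) * ψ q.1 - u q * ψ1 q.1)
      ((cut.mul cψ).sub (S.cont.mul cψ1')) h0 m0 b0
    have I6 := bintB (fun q => u q * ψ q.1) (S.cont.mul cψ) h1' m1 b1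
    rw [← lin4 I1 I2 I3 I4, ← integral_sub I5 I6]
    have A : ∫ q in K, (|u q| ^ p * (h0 r q * ψ q.1) - u q * Pop (fun q => h0 r q * ψ q.1) q) =
        ∫ q in K, (|u q| ^ p * ψ q.1 * h0 r q - u q * ψ q.1 * h2' r q -
          u q * (2 * ψ1 q.1) * h1' r q - u q * ψ2 q.1 * h0 r q) := by
      refine setIntegral_congr_fun hKm fun q hq => ?_
      have ho := slab_sub_Om h1 hq
      have hc := slab_sub_cone hq
      beta_reduce
      rw [c3 q (hsub q ho hc), hd1 r q ho hc, hd2 r q ho hc]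
      ring
    have Bq : ∫ x in B, (fderiv ℝ u (t1, x) (1, 0) * (h0 r (t1, x) * ψ t1) -
          u (t1, x) * fderiv ℝ (fun q => h0 r q * ψ q.1) (t1, x) (1, 0)) =
        ∫ x in B, ((fderiv ℝ u (t1, x) (1, 0) * ψ t1 - u (t1, x) * ψ1 t1) * h0 r (t1, x)
        - (u (t1, x) * ψ t1) * h1' r (t1, x)) := by
      refine setIntegral_congr_fun measurableSet_closedBall fun x hx => ?_
      have hq := hB1 x hx
      have ho := slab_sub_Om h1 hq
      have hc := slab_sub_cone hq
      beta_reduce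
      rw [c2 _ (hsub _ ho hc), hd1 r _ ho hc]
      ring
    rw [← A, ← Bq]
    linarith
  have tot := congrArg (fun f : β → ℝ => ∫ r, f r ∂ν) (funext per)
  simp only [integral_zero] at tot
  have k1 : Integrable (fun r => (∫ q in K, (|u q| ^ p * ψ q.1) * h0 r q) -
      (∫ q in K, (u q * ψ q.1) * h2' r q) - (∫ q in K, (u q * (2 * ψ1 q.1)) * h1' r q) -
      (∫ q in K, (u q * ψ2 q.1) * h0 r q)) ν := ((i1.sub i2).sub i3).sub i4
  have k2 : Integrable (fun r =>
      ((∫ x in B, (fderiv ℝ u (t1, x) (1, 0) * ψ t1 - u (t1, x) * ψ1 t1) * h0 r (t1, x))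
      - (∫ x in B, (u (t1, x) * ψ t1) * h1' r (t1, x)))) ν := i5.sub i6
  rw [integral_add k1 k2, integral_sub i5 i6, lin4 i1 i2 i3 i4, e1, e2, e3, e4, e5, e6] at tot
  have z2 : ∫ q in K, (u q * ψ q.1) * ∫ r, h2' r q ∂ν = 0 := by
    rw [setIntegral_congr_fun hKm (g := fun _ => (0:ℝ)) (fun q hq => by simp [hz q hq])]
    simp
  refine ⟨j1, ?_, ?_⟩
  · refine (j3.add j4).congr (Filter.Eventually.of_forall fun q => ?_)
    simp only [Pi.add_apply]; ring
  · have E1 : ∫ q in K, u q * (2 * ψ1 q.1 * (∫ r, h1' r q ∂ν) + ψ2 q.1 * ∫ r, h0 r q ∂ν) =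
        (∫ q in K, u q * (2 * ψ1 q.1) * ∫ r, h1' r q ∂ν) + ∫ q in K, u q * ψ2 q.1 * ∫ r, h0 r q ∂ν := by
      rw [← integral_add j3 j4]
      congr 1; ext q; ring
    have E2 : Dat u (fun q => (∫ r, h0 r q ∂ν) * ψ q.1)
        (fun q => (∫ r, h1' r q ∂ν) * ψ q.1 + (∫ r, h0 r q ∂ν) * ψ1 q.1) t1 =
        (∫ x in B, (fderiv ℝ u (t1, x) (1, 0) * ψ t1 - u (t1, x) * ψ1 t1) * ∫ r, h0 r (t1, x) ∂ν) -
          ∫ x in B, u (t1, x) * ψ t1 * ∫ r, h1' r (t1, x) ∂ν := by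
      rw [DatB, ← integral_sub j5 j6]
      congr 1; ext x; ring
    rw [E1, E2]
    rw [z2] at tot
    linarith

end Tric

namespace Tric

lemma ode_false {p k c C0 C R0 : ℝ} (hp : 1 < p) (hk : 0 < k) (hc : 0 < c) (hC : 0 < C)
    (hR0 : 1 < R0) {Y V : ℝ → ℝ} (hd : ∀ R, R0 ≤ R → HasDerivAt Y (k * V R / R) R)
    (hV : ∀ R, R0 ≤ R → c ≤ V R)
    (hY : ∀ R, R0 ≤ R → Y R ≤ C0 + C * (V R ^ (1/p) * (1 + Real.log R) ^ (1 - 1/p))) : False := by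
  set W : ℝ → ℝ := fun R => Y R - k * c * Real.log R with hW
  have dW : ∀ R, R0 ≤ R → HasDerivAt W (k * V R / R - k * c * R⁻¹) R := fun R hR =>
    (hd R hR).sub ((Real.hasDerivAt_log (by linarith)).const_mul _)
  have mW : MonotoneOn W (Ici R0) := by
    refine monotoneOn_of_deriv_nonneg (convex_Ici _) (fun R hR => (dW R hR).continuousAt.continuousWithinAt)
      (fun R hR => (dW R (interior_subset hR)).differentiableAt.differentiableWithinAt) fun R hR => ?_
    have hR' : R0 ≤ R := interior_subset hR
    rw [(dW R hR').deriv]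
    have : (0:ℝ) < R := by linarith
    have h := hV R hR'
    rw [← div_eq_mul_inv, ← sub_div]
    exact div_nonneg (by nlinarith) this.le
  set X : ℝ → ℝ := fun R => Y R - C0 with hX
  have hlog := Real.tendsto_log_atTop
  obtain ⟨R1, hR1, hR1'⟩ : ∃ R1, R0 ≤ R1 ∧ ∀ R, R1 ≤ R → k * c / 2 * (1 + Real.log R) ≤ X R := by
    have := (hlog.const_mul_atTop (show 0 < k * c / 2 by positivity)).eventually_ge_atTop
      (k * c / 2 + C0 - W R0)
    obtain ⟨R1, h⟩ := (Filter.eventually_atTop.1 this)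
    refine ⟨max R0 R1, le_max_left _ _, fun R hR => ?_⟩
    have h1 := h R ((le_max_right _ _).trans hR)
    have h2 := mW (a := R0) (b := R) (by simp) ((le_max_left _ _).trans hR) ((le_max_left _ _).trans hR)
    simp only [hW, hX] at *
    linarith
  set c' := k * c / 2 with hc'
  have hc'0 : 0 < c' := by positivity
  set ε := min 1 (p - 1) with hε
  have hε0 : 0 < ε := lt_min one_pos (by linarith)
  have hε1 : ε ≤ 1 := min_le_left _ _
  have hεp : ε ≤ p - 1 := min_le_right _ _
  set κ := C ^ (-p) * c' ^ (p - 1 - ε) with hκ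
  have hκ0 : 0 < κ := by positivity
  have key : ∀ R, R1 ≤ R → κ * X R ^ (1 + ε) * (1 + Real.log R)⁻¹ ≤ V R := by
    intro R hR
    have hRR : R0 ≤ R := hR1.trans hR
    have hl : 1 ≤ 1 + Real.log R := by
      have := Real.log_nonneg (show (1:ℝ) ≤ R by linarith); linarith
    set l := 1 + Real.log R
    have hx := hR1' R hR
    have hX0 : 0 < X R := lt_of_lt_of_le (by positivity) hx
    have hV0 : 0 < V R := hc.trans_le (hV R hRR)
    have h1 : X R ≤ C * (V R ^ (1/p) * l ^ (1 - 1/p)) := by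
      have := hY R hRR; simp only [hX]; linarith
    have h2 : X R ^ p ≤ C ^ p * (V R * l ^ (p - 1)) := by
      have := Real.rpow_le_rpow hX0.le h1 (show 0 ≤ p by linarith)
      rw [Real.mul_rpow hC.le (by positivity), Real.mul_rpow (by positivity) (by positivity),
        ← Real.rpow_mul hV0.le, ← Real.rpow_mul (by linarith)] at this
      rwa [one_div_mul_cancel (by linarith), Real.rpow_one, show (1 - 1/p) * p = p - 1 by
        field_simp] at this
    have h3 : X R ^ p = X R ^ (1 + ε) * X R ^ (p - 1 - ε) := by
      rw [← Real.rpow_add hX0]; congr 1; ring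
    have h4 : c' ^ (p - 1 - ε) * l ^ (p - 1 - ε) ≤ X R ^ (p - 1 - ε) := by
      rw [← Real.mul_rpow hc'0.le (by linarith)]
      exact Real.rpow_le_rpow (by positivity) hx (by linarith)
    have h5 : l ^ (p - 1) ≤ l ^ (p - 1 - ε) * l := by
      nth_rewrite 3 [← Real.rpow_one l]
      rw [← Real.rpow_add (by linarith)]
      exact Real.rpow_le_rpow_of_exponent_le hl (by linarith)
    have hlp : 0 < l ^ (p - 1 - ε) := by positivity
    have hCp : C ^ (-p) * C ^ p = 1 := by
      rw [← Real.rpow_add hC]; simp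
    have hXe : 0 < X R ^ (1 + ε) := by positivity
    have h6 : X R ^ (1 + ε) * (c' ^ (p - 1 - ε) * l ^ (p - 1 - ε)) ≤
        C ^ p * (V R * (l ^ (p - 1 - ε) * l)) := by
      calc _ ≤ X R ^ p := by rw [h3]; gcongr
        _ ≤ _ := h2
        _ ≤ _ := by gcongr
    have h7 : X R ^ (1 + ε) * c' ^ (p - 1 - ε) ≤ C ^ p * (V R * l) := by
      refine le_of_mul_le_mul_right ?_ hlp
      calc _ = X R ^ (1 + ε) * (c' ^ (p - 1 - ε) * l ^ (p - 1 - ε)) := by ring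
        _ ≤ _ := h6
        _ = _ := by ring
    rw [← div_eq_mul_inv, div_le_iff₀ (by linarith)]
    calc κ * X R ^ (1 + ε) = C ^ (-p) * (X R ^ (1 + ε) * c' ^ (p - 1 - ε)) := by rw [hκ]; ring
      _ ≤ C ^ (-p) * (C ^ p * (V R * l)) := by gcongr
      _ = V R * l := by rw [← mul_assoc, hCp, one_mul]
  -- Z
  have hl1 : ∀ R, R1 ≤ R → 1 ≤ 1 + Real.log R := by
    intro R hR
    have := Real.log_nonneg (show (1:ℝ) ≤ R by linarith); linarith
  have hXp : ∀ R, R1 ≤ R → 0 < X R := fun R hR =>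
    lt_of_lt_of_le (mul_pos hc'0 (by linarith [hl1 R hR])) (hR1' R hR)
  set Z : ℝ → ℝ := fun R => X R ^ (-ε) + ε * k * κ * Real.log (1 + Real.log R) with hZ
  have dZ : ∀ R, R1 ≤ R → HasDerivAt Z ((k * V R / R) * (-ε) * X R ^ (-ε - 1) +
      ε * k * κ * (R⁻¹ / (1 + Real.log R))) R := by
    intro R hR
    have d1 : HasDerivAt X (k * V R / R) R := (hd R (hR1.trans hR)).sub_const _
    refine (d1.rpow_const (p := -ε) (Or.inl (hXp R hR).ne')).add ?_
    refine HasDerivAt.const_mul _ ?_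
    exact ((Real.hasDerivAt_log (by linarith)).const_add 1).log (by linarith [hl1 R hR])
  have mZ : AntitoneOn Z (Ici R1) := by
    refine antitoneOn_of_deriv_nonpos (convex_Ici _) (fun R hR => (dZ R hR).continuousAt.continuousWithinAt)
      (fun R hR => (dZ R (interior_subset hR)).differentiableAt.differentiableWithinAt) fun R hR => ?_
    have hR' : R1 ≤ R := interior_subset hR
    rw [(dZ R hR').deriv]
    have hRp : (0:ℝ) < R := by linarith
    have h := key R hR'
    have hx := hXp R hR'
    have e : X R ^ (-ε - 1) * X R ^ (1 + ε) = 1 := by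
      rw [← Real.rpow_add hx, show -ε - 1 + (1 + ε) = 0 by ring, Real.rpow_zero]
    have h8 : κ * (1 + Real.log R)⁻¹ ≤ X R ^ (-ε - 1) * V R := by
      calc κ * (1 + Real.log R)⁻¹ = X R ^ (-ε - 1) * (κ * X R ^ (1 + ε) * (1 + Real.log R)⁻¹) := by
            rw [show X R ^ (-ε - 1) * (κ * X R ^ (1 + ε) * (1 + Real.log R)⁻¹) =
              (X R ^ (-ε - 1) * X R ^ (1 + ε)) * (κ * (1 + Real.log R)⁻¹) by ring, e, one_mul]
        _ ≤ _ := by gcongr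
    have h9 : ε * k * R⁻¹ * (κ * (1 + Real.log R)⁻¹) ≤ ε * k * R⁻¹ * (X R ^ (-ε - 1) * V R) := by
      gcongr
    have e2 : (k * V R / R) * (-ε) * X R ^ (-ε - 1) + ε * k * κ * (R⁻¹ / (1 + Real.log R)) =
      ε * k * R⁻¹ * (κ * (1 + Real.log R)⁻¹) - ε * k * R⁻¹ * (X R ^ (-ε - 1) * V R) := by
      simp only [div_eq_mul_inv]; ring
    rw [e2]; linarith
  have tl : Filter.Tendsto (fun R => ε * k * κ * Real.log (1 + Real.log R)) Filter.atTop Filter.atTop :=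
    (hlog.comp (Filter.tendsto_atTop_add_const_left _ 1 hlog)).const_mul_atTop (by positivity)
  obtain ⟨R2, h⟩ := Filter.eventually_atTop.1 (tl.eventually_gt_atTop (Z R1))
  have h1 := h (max R1 R2) (le_max_right _ _)
  have h2 := mZ (a := R1) (b := max R1 R2) (by simp) (le_max_left R1 R2) (le_max_left _ _)
  have h3 : 0 < X (max R1 R2) ^ (-ε) := Real.rpow_pos_of_pos (hXp _ (le_max_left _ _)) _
  simp only [hZ] at h1 h2
  linarith

/-- iterated primitive -/
lemma Fk_deriv (k : ℕ) : ∀ {w : ℝ → ℝ}, ContinuousOn w (Ioi 0) → ∀ {R : ℝ}, 0 < R →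
    HasDerivAt (fun R => ∫ t in (1:ℝ)..R, w t * (R - t) ^ (k + 1))
      ((k + 1) * ∫ t in (1:ℝ)..R, w t * (R - t) ^ k) R := by
  have hsub : ∀ {R : ℝ}, 0 < R → uIcc 1 R ⊆ Ioi 0 := by
    intro R hR x hx
    exact lt_of_lt_of_le (lt_min one_pos hR) hx.1
  have ii : ∀ {w : ℝ → ℝ}, ContinuousOn w (Ioi 0) → ∀ {R : ℝ}, 0 < R →
      IntervalIntegrable w volume 1 R := fun hw R hR => (hw.mono (hsub hR)).intervalIntegrable
  have ftc : ∀ {w : ℝ → ℝ}, ContinuousOn w (Ioi 0) → ∀ {R : ℝ}, 0 < R →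
      HasDerivAt (fun R => ∫ t in (1:ℝ)..R, w t) (w R) R := by
    intro w hw R hR
    exact intervalIntegral.integral_hasDerivAt_right (ii hw hR)
      (hw.stronglyMeasurableAtFilter isOpen_Ioi R hR) (hw.continuousAt (Ioi_mem_nhds hR))
  have hrec : ∀ (k : ℕ) {w : ℝ → ℝ}, ContinuousOn w (Ioi 0) → ∀ {R : ℝ}, 0 < R →
      ∫ t in (1:ℝ)..R, w t * (R - t) ^ (k + 1) =
      R * (∫ t in (1:ℝ)..R, w t * (R - t) ^ k) - (∫ t in (1:ℝ)..R, (t * w t) * (R - t) ^ k) := by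
    intro k w hw R hR
    rw [← intervalIntegral.integral_const_mul, ← intervalIntegral.integral_sub]
    · congr 1; ext t; ring
    · exact ii (w := fun t => R * (w t * (R - t) ^ k)) (by fun_prop) hR
    · exact ii (w := fun t => (t * w t) * (R - t) ^ k) (by fun_prop) hR
  induction k with
  | zero =>
    intro w hw R hR
    have hw2 : ContinuousOn (fun t => t * w t) (Ioi 0) := by fun_prop
    have h := ((hasDerivAt_id R).mul (ftc hw hR)).sub (ftc hw2 hR)
    have h2 : HasDerivAt (fun R => ∫ t in (1:ℝ)..R, w t * (R - t) ^ (0 + 1))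
        (1 * (∫ t in (1:ℝ)..R, w t) + id R * w R - R * w R) R := by
      refine h.congr_of_eventuallyEq ?_
      filter_upwards [Ioi_mem_nhds hR] with S hS
      rw [hrec 0 hw hS]; simp
    refine h2.congr_deriv ?_
    simp
  | succ k ih =>
    intro w hw R hR
    have hw2 : ContinuousOn (fun t => t * w t) (Ioi 0) := by fun_prop
    have h := ((hasDerivAt_id R).mul (ih hw hR)).sub (ih hw2 hR)
    have h2 := h.congr_of_eventuallyEq (f₁ := fun R => ∫ t in (1:ℝ)..R, w t * (R - t) ^ (k + 1 + 1)) ?_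
    · refine h2.congr_deriv ?_
      rw [hrec k hw hR]
      push_cast
      simp only [id]
      ring
    · filter_upwards [Ioi_mem_nhds hR] with S hS
      rw [hrec (k+1) hw hS]; simp

/-- the function Y and its derivative -/
lemma Yk_deriv (k : ℕ) {w : ℝ → ℝ} (hw : ContinuousOn w (Ioi 0)) {R : ℝ} (hR : 0 < R) :
    HasDerivAt (fun R => ∫ t in (1:ℝ)..R, w t * (1 - t / R) ^ (k + 1))
      ((k + 1) * (∫ t in (1:ℝ)..R, w t * (t / R * (1 - t / R) ^ k)) / R) R := by
  have hsub : uIcc 1 R ⊆ Ioi 0 := by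
    intro x hx
    exact lt_of_lt_of_le (lt_min one_pos hR) hx.1
  have h := (Fk_deriv k hw hR).mul ((hasDerivAt_pow (k + 1) R).inv (by positivity))
  have h2 := h.congr_of_eventuallyEq (f₁ := fun R => ∫ t in (1:ℝ)..R, w t * (1 - t / R) ^ (k + 1)) ?_
  · refine h2.congr_deriv ?_
    have e1 : ∫ t in (1:ℝ)..R, w t * (R - t) ^ k =
        R ^ k * ∫ t in (1:ℝ)..R, w t * (1 - t / R) ^ k := by
      rw [← intervalIntegral.integral_const_mul]; congr 1; ext t
      rw [show R - t = R * (1 - t / R) by field_simp, mul_pow]; ring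
    have e2 : ∫ t in (1:ℝ)..R, w t * (R - t) ^ (k + 1) =
        R ^ (k + 1) * ∫ t in (1:ℝ)..R, w t * (1 - t / R) ^ (k + 1) := by
      rw [← intervalIntegral.integral_const_mul]; congr 1; ext t
      rw [show R - t = R * (1 - t / R) by field_simp, mul_pow]; ring
    have e3 : ∫ t in (1:ℝ)..R, w t * (t / R * (1 - t / R) ^ k) =
        (∫ t in (1:ℝ)..R, w t * (1 - t / R) ^ k) - ∫ t in (1:ℝ)..R, w t * (1 - t / R) ^ (k + 1) := by
      rw [← intervalIntegral.integral_sub]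
      · congr 1; ext t; ring
      · exact ContinuousOn.intervalIntegrable ((hw.mono hsub).mul (by fun_prop))
      · exact ContinuousOn.intervalIntegrable ((hw.mono hsub).mul (by fun_prop))
    simp only [Pi.inv_apply]
    rw [e1, e2, e3]
    push_cast
    field_simp
    ring
  · filter_upwards [Ioi_mem_nhds hR] with S hS
    have hS' : (0:ℝ) < S := hS
    rw [Pi.mul_apply, Pi.inv_apply]
    rw [mul_comm, ← intervalIntegral.integral_const_mul]; congr 1; ext t
    rw [show S - t = S * (1 - t / S) by field_simp, mul_pow]; field_simp

end Tric

namespace Tric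

noncomputable def tau (ρ : ℝ) : ℝ := Real.sqrt (1 + ρ ^ 6)

lemma tau_sq (ρ : ℝ) : tau ρ ^ 2 = 1 + ρ ^ 6 := Real.sq_sqrt (by positivity)
lemma one_le_tau (ρ : ℝ) : 1 ≤ tau ρ := Real.one_le_sqrt.2 (by nlinarith [sq_nonneg (ρ^3)])
lemma tau_pos (ρ : ℝ) : 0 < tau ρ := one_pos.trans_le (one_le_tau ρ)
lemma tau_cont : Continuous tau := by unfold tau; fun_prop
lemma tau_inv_le (ρ : ℝ) : (tau ρ)⁻¹ ≤ 2 * (1 + ρ ^ 2)⁻¹ := by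
  have h : (1 + ρ ^ 2) / 2 ≤ tau ρ := by
    refine Real.le_sqrt_of_sq_le ?_
    nlinarith [sq_nonneg (8 * ρ^2 - 5), sq_nonneg (ρ^2), sq_nonneg (ρ * (8 * ρ^2 - 5)), sq_nonneg ρ]
  have h2 : 0 < (1 + ρ ^ 2) / 2 := by positivity
  calc (tau ρ)⁻¹ ≤ ((1 + ρ ^ 2) / 2)⁻¹ := inv_anti₀ h2 h
    _ = _ := by rw [inv_div]; ring
lemma tau_inv_int : Integrable fun ρ => (tau ρ)⁻¹ := by
  refine (integrable_inv_one_add_sq.const_mul 2).mono'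
    (tau_cont.inv₀ fun ρ => (tau_pos ρ).ne').aestronglyMeasurable (Filter.Eventually.of_forall fun ρ => ?_)
  rw [Real.norm_eq_abs, abs_of_pos (inv_pos.2 (tau_pos ρ))]
  exact tau_inv_le ρ
lemma abs_le_tau (ρ : ℝ) : |ρ| ≤ tau ρ := by
  refine Real.le_sqrt_of_sq_le ?_
  rw [sq_abs]
  nlinarith [sq_nonneg (ρ^2 - 1), sq_nonneg (ρ * (ρ^2 - 1)), sq_nonneg ρ, sq_nonneg (ρ^3)]
lemma tau_deriv (ρ : ℝ) : HasDerivAt tau (3 * ρ ^ 5 / tau ρ) ρ := by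
  have h := ((hasDerivAt_pow 6 ρ).const_add 1).sqrt (by positivity)
  refine h.congr_deriv ?_
  have := (tau_pos ρ).ne'
  change _ / (2 * tau ρ) = _
  field_simp; norm_num

lemma half_sq {t : ℝ} (ht : 0 < t) : t ^ ((1:ℝ)/2) * t ^ ((1:ℝ)/2) = t := by
  rw [← Real.rpow_add ht]; norm_num

lemma phi_half {t : ℝ} (ht : 0 < t) : 3 * phi t = 2 * (t * t ^ ((1:ℝ)/2)) := by
  unfold phi
  rw [show (3:ℝ)/2 = 1 + 1/2 by norm_num, Real.rpow_add ht, Real.rpow_one]; ring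

noncomputable def Wf (n : ℕ) (c κ : ℝ) (q : ℝ × Sp n) : ℝ := (c + κ * phi q.1) ^ 2 - ‖q.2‖ ^ 2

lemma phi_fd {n : ℕ} {q : ℝ × Sp n} (hq : 0 < q.1) :
    HasFDerivAt (fun q : ℝ × Sp n => phi q.1) ((q.1 ^ ((1:ℝ)/2)) • ContinuousLinearMap.fst ℝ ℝ (Sp n)) q := by
  have h := (phi_deriv hq).comp_hasFDerivAt q (hasFDerivAt_fst (𝕜 := ℝ) (p := q))
  exact h

lemma Wf_fd {n : ℕ} {c κ : ℝ} {q : ℝ × Sp n} (hq : 0 < q.1) :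
    ∃ L : (ℝ × Sp n) →L[ℝ] ℝ, HasFDerivAt (Wf n c κ) L q ∧ L (1, 0) = 2 * (c + κ * phi q.1) * (κ * q.1 ^ ((1:ℝ)/2)) ∧
      ∀ i, L (eX n i) = - (2 * q.2 i) := by
  have h1 := (((phi_fd hq).const_mul κ).const_add c).pow 2
  have h2 := (hasFDerivAt_snd (𝕜 := ℝ) (p := q)).norm_sq
  refine ⟨_, h1.sub h2, ?_, fun i => ?_⟩
  · simp; left; ring
  · simp [eX, EuclideanSpace.inner_single_right]

lemma Wf_rp {n : ℕ} {c κ e : ℝ} {q : ℝ × Sp n} (hq : 0 < q.1) (hW : 0 < Wf n c κ q) :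
    ∃ L : (ℝ × Sp n) →L[ℝ] ℝ, HasFDerivAt (fun q => Wf n c κ q ^ e) L q ∧
      L (1, 0) = e * Wf n c κ q ^ (e - 1) * (2 * (c + κ * phi q.1) * (κ * q.1 ^ ((1:ℝ)/2))) ∧
      ∀ i, L (eX n i) = e * Wf n c κ q ^ (e - 1) * (- (2 * q.2 i)) := by
  obtain ⟨L, hL, h1, h2⟩ := Wf_fd (c := c) (κ := κ) hq
  refine ⟨_, hL.rpow_const (p := e) (Or.inl hW.ne'), ?_, fun i => ?_⟩
  · simp [h1]
  · simp [h2]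

def On (n : ℕ) (c κ : ℝ) : Set (ℝ × Sp n) := {q | 0 < q.1 ∧ ‖q.2‖ < c + κ * phi q.1}

lemma On_open (n : ℕ) (c κ : ℝ) : IsOpen (On n c κ) := by
  have h1 : IsOpen {q : ℝ × Sp n | 0 < q.1} := isOpen_lt continuous_const continuous_fst
  have h2 : IsOpen {q : ℝ × Sp n | ‖q.2‖ < c + κ * phi q.1} :=
    isOpen_lt continuous_snd.norm
      (continuous_const.add (continuous_const.mul (phi_cont.comp continuous_fst)))
  exact h1.inter h2

lemma Wf_pos {n : ℕ} {c κ : ℝ} {q : ℝ × Sp n} (h : q ∈ On n c κ) : 0 < Wf n c κ q := by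
  have := h.2
  unfold Wf
  nlinarith [norm_nonneg q.2]

lemma Wf_cd {n : ℕ} {c κ e : ℝ} : ContDiffOn ℝ 2 (fun q => Wf n c κ q ^ e) (On n c κ) := by
  refine ContDiffOn.rpow_const_of_ne ?_ fun q hq => (Wf_pos hq).ne'
  unfold Wf
  have h1 : ContDiffOn ℝ 2 (fun q : ℝ × Sp n => phi q.1) (On n c κ) := by
    unfold phi
    exact contDiffOn_const.mul (contDiffOn_fst.rpow_const_of_ne fun q hq => hq.1.ne')
  exact ((contDiffOn_const.add (contDiffOn_const.mul h1)).pow 2).sub (contDiffOn_snd.norm_sq ℝ)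

lemma Wf_t {n : ℕ} {c κ m : ℝ} {q : ℝ × Sp n} (h : q ∈ On n c κ) :
    fderiv ℝ (fun q => Wf n c κ q ^ (-m)) q (1, 0) =
      -(2 * m * κ) * ((c + κ * phi q.1) * q.1 ^ ((1:ℝ)/2) * Wf n c κ q ^ (-m-1)) := by
  obtain ⟨L, hL, h1, h2⟩ := Wf_rp (e := -m) h.1 (Wf_pos h)
  rw [hL.fderiv, h1]; ring

lemma Wf_i {n : ℕ} {c κ m : ℝ} {q : ℝ × Sp n} (h : q ∈ On n c κ) (i : Fin n) :
    fderiv ℝ (fun q => Wf n c κ q ^ (-m)) q (eX n i) = 2 * m * (q.2 i * Wf n c κ q ^ (-m-1)) := by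
  obtain ⟨L, hL, h1, h2⟩ := Wf_rp (e := -m) h.1 (Wf_pos h)
  rw [hL.fderiv, h2]; ring

/-- H_zz and H_z -/
noncomputable def Hz (m z W : ℝ) : ℝ := -(2 * m) * (z * W ^ (-m-1))
noncomputable def Hzz (m z W : ℝ) : ℝ := -(2 * m) * W ^ (-m-1) + 4 * m * (m+1) * (z ^ 2 * W ^ (-m-2))

lemma Wf_Pop {n : ℕ} {c κ m : ℝ} (hm : 2 * m = n - 1) {q : ℝ × Sp n} (h : q ∈ On n c κ) :
    Pop (fun q => Wf n c κ q ^ (-m)) q =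
      q.1 * (κ ^ 2 - 1) * Hzz m (c + κ * phi q.1) (Wf n c κ q) +
      κ / (2 * q.1 ^ ((1:ℝ)/2)) * Hz m (c + κ * phi q.1) (Wf n c κ q) := by
  have hO := (On_open n c κ).mem_nhds h
  have hq := h.1
  have hW := Wf_pos h
  obtain ⟨L, hL, h1, h2⟩ := Wf_rp (e := -m-1) hq hW
  unfold Pop
  have e1 : (fun z => fderiv ℝ (fun q => Wf n c κ q ^ (-m)) z (1, 0)) =ᶠ[nhds q]
      fun q => -(2 * m * κ) * ((c + κ * phi q.1) * q.1 ^ ((1:ℝ)/2) * Wf n c κ q ^ (-m-1)) := by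
    filter_upwards [hO] with z hz using Wf_t hz
  have e2 : ∀ i, (fun z => fderiv ℝ (fun q => Wf n c κ q ^ (-m)) z (eX n i)) =ᶠ[nhds q]
      fun q => 2 * m * (q.2 i * Wf n c κ q ^ (-m-1)) := by
    intro i; filter_upwards [hO] with z hz using Wf_i hz i
  have d1 : HasFDerivAt (fun q : ℝ × Sp n => q.1 ^ ((1:ℝ)/2))
      ((1/2 * q.1 ^ ((1:ℝ)/2 - 1)) • ContinuousLinearMap.fst ℝ ℝ (Sp n)) q :=
    (hasFDerivAt_fst (𝕜 := ℝ) (p := q)).rpow_const (p := 1/2) (Or.inl hq.ne')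
  have D1 : HasFDerivAt (fun q : ℝ × Sp n =>
      -(2 * m * κ) * ((c + κ * phi q.1) * q.1 ^ ((1:ℝ)/2) * Wf n c κ q ^ (-m-1))) _ q :=
    ((((phi_fd hq).const_mul κ).const_add c).mul d1).mul hL |>.const_mul (-(2*m*κ))
  rw [e1.fderiv_eq, D1.fderiv]
  have D2 : ∀ i, fderiv ℝ (fun z => fderiv ℝ (fun q => Wf n c κ q ^ (-m)) z (eX n i)) q (eX n i) =
      2 * m * Wf n c κ q ^ (-m-1) + 4 * m * (m + 1) * Wf n c κ q ^ (-m-2) * (q.2 i) ^ 2 := by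
    intro i
    rw [(e2 i).fderiv_eq]
    have hx : HasFDerivAt (fun q : ℝ × Sp n => q.2 i)
        ((EuclideanSpace.proj i).comp (ContinuousLinearMap.snd ℝ ℝ (Sp n))) q :=
      ((EuclideanSpace.proj (𝕜 := ℝ) i).comp (ContinuousLinearMap.snd ℝ ℝ (Sp n))).hasFDerivAt
    have D : HasFDerivAt (fun q : ℝ × Sp n => 2 * m * (q.2 i * Wf n c κ q ^ (-m-1))) _ q :=
      (hx.mul hL).const_mul (2*m)
    rw [D.fderiv]
    simp only [smul_apply, add_apply, h2, smul_eq_mul]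
    simp [eX]
    rw [show -m-1-1 = -m-2 by ring]; ring
  rw [Finset.sum_congr rfl fun i _ => D2 i, Finset.sum_add_distrib, ← Finset.mul_sum, ← Finset.mul_sum,
    ← EuclideanSpace.real_norm_sq_eq]
  simp only [smul_apply, add_apply, h1, smul_eq_mul]
  have hs := half_sq hq
  have hs0 : 0 < q.1 ^ ((1:ℝ)/2) := by positivity
  have es : q.1 ^ ((1:ℝ)/2 - 1) = (q.1 ^ ((1:ℝ)/2))⁻¹ := by
    rw [← Real.rpow_neg hq.le]; norm_num
  have eW : Wf n c κ q ^ (-m-1) = Wf n c κ q * Wf n c κ q ^ (-m-2) := by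
    nth_rewrite 2 [← Real.rpow_one (Wf n c κ q)]
    rw [← Real.rpow_add hW]; congr 1; ring
  have er : ‖q.2‖ ^ 2 = (c + κ * phi q.1) ^ 2 - Wf n c κ q := by unfold Wf; ring
  unfold Hz Hzz
  rw [es, show -m-1-1 = -m-2 by ring, er, eW]
  have hn : (n:ℝ) = 2 * m + 1 := by linarith
  clear D1 e1 e2 D2 d1
  generalize hsd : q.1 ^ ((1:ℝ)/2) = s at *
  have hsd2 : q.1 ^ ((2:ℝ)⁻¹) = s := by rw [← hsd]; norm_num
  simp [hn, hsd, hsd2]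
  generalize Wf n c κ q = W at *
  generalize W ^ (-m-2) = B at *
  generalize c + κ * phi q.1 = z at *
  rw [← hs]
  field_simp
  ring
end Tric

namespace Tric

noncomputable def mm (n : ℕ) : ℝ := ((n:ℝ) - 1) / 2
noncomputable def Zf (M : ℝ) (z : ℝ × ℝ) (t : ℝ) : ℝ := M + 1 + |z.2| + tau z.1 * phi t
noncomputable def Wz (n : ℕ) (M : ℝ) (z : ℝ × ℝ) (q : ℝ × Sp n) : ℝ := Wf n (M + 1 + |z.2|) (tau z.1) q
noncomputable def k0 (n : ℕ) (M : ℝ) (z : ℝ × ℝ) (q : ℝ × Sp n) : ℝ :=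
  (tau z.1)⁻¹ * Wz n M z q ^ (-mm n)
noncomputable def k1 (n : ℕ) (M : ℝ) (z : ℝ × ℝ) (q : ℝ × Sp n) : ℝ :=
  q.1 ^ ((1:ℝ)/2) * Hz (mm n) (Zf M z q.1) (Wz n M z q)
noncomputable def k2 (n : ℕ) (M : ℝ) (z : ℝ × ℝ) (q : ℝ × Sp n) : ℝ :=
  q.1 * ((tau z.1) ^ 2 - 1) / tau z.1 * Hzz (mm n) (Zf M z q.1) (Wz n M z q) +
    1 / (2 * q.1 ^ ((1:ℝ)/2)) * Hz (mm n) (Zf M z q.1) (Wz n M z q)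

lemma mm_pos {n : ℕ} (hn : 2 ≤ n) : 1 / 2 ≤ mm n := by
  have : (2:ℝ) ≤ n := by exact_mod_cast hn
  unfold mm; linarith

lemma Wz_eq {n : ℕ} {M : ℝ} {z : ℝ × ℝ} {q : ℝ × Sp n} :
    Wz n M z q = (Zf M z q.1 - ‖q.2‖) * (Zf M z q.1 + ‖q.2‖) := by
  unfold Wz Wf Zf; ring

lemma Zf_sub {n : ℕ} {M : ℝ} {z : ℝ × ℝ} {q : ℝ × Sp n} :
    Zf M z q.1 - ‖q.2‖ = (M + 1 + phi q.1 - ‖q.2‖) + |z.2| + (tau z.1 - 1) * phi q.1 := by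
  unfold Zf; ring

lemma d_ge {n : ℕ} {M : ℝ} {z : ℝ × ℝ} {q : ℝ × Sp n} (ho : q ∈ Om n) (hc : q ∈ cone n M) :
    1 + |z.2| + (tau z.1 - 1) * phi q.1 ≤ Zf M z q.1 - ‖q.2‖ := by
  have : ‖q.2‖ ≤ M + phi q.1 := hc
  rw [Zf_sub]; linarith

lemma d_one {n : ℕ} {M : ℝ} {z : ℝ × ℝ} {q : ℝ × Sp n} (ho : q ∈ Om n) (hc : q ∈ cone n M) :
    1 ≤ Zf M z q.1 - ‖q.2‖ := by
  refine le_trans ?_ (d_ge ho hc)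
  have h1 := one_le_tau z.1
  have h2 := phi_nonneg (mem_Om.1 ho).le
  nlinarith [abs_nonneg z.2]

lemma W_one {n : ℕ} {M : ℝ} {z : ℝ × ℝ} {q : ℝ × Sp n} (ho : q ∈ Om n) (hc : q ∈ cone n M) :
    0 < Wz n M z q := by
  rw [Wz_eq]
  have := d_one (z := z) ho hc
  have := norm_nonneg q.2
  nlinarith

/-- pointwise kernel bounds -/
lemma kern_bd {m d z W : ℝ} (hm : 0 < m) (hd : 0 < d) (hdz : d ≤ z) (hW : d * z ≤ W) :
    W ^ (-m) ≤ d ^ (-m) * z ^ (-m) ∧ z * W ^ (-m-1) ≤ d ^ (-m-1) * z ^ (-m) ∧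
    W ^ (-m-1) ≤ d ^ (-m-2) * z ^ (-m) ∧ z ^ 2 * W ^ (-m-2) ≤ d ^ (-m-2) * z ^ (-m) := by
  have hz : 0 < z := hd.trans_le hdz
  have hdz0 : 0 < d * z := by positivity
  have key : ∀ e : ℝ, e ≤ 0 → W ^ e ≤ d ^ e * z ^ e := by
    intro e he
    rw [← Real.mul_rpow hd.le hz.le]
    exact Real.rpow_le_rpow_of_nonpos hdz0 hW he
  refine ⟨key _ (by linarith), ?_, ?_, ?_⟩
  · calc z * W ^ (-m-1) ≤ z * (d ^ (-m-1) * z ^ (-m-1)) := by gcongr; exact key _ (by linarith)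
      _ = d ^ (-m-1) * z ^ (-m) := by
        rw [show (-m : ℝ) = (-m-1) + 1 by ring, Real.rpow_add hz, Real.rpow_one]; ring_nf
  · refine (key _ (by linarith)).trans ?_
    have e1 : z ^ (-m-1) = z ^ (-m) * z⁻¹ := by
      rw [Real.rpow_sub hz, Real.rpow_one]; rfl
    have e2 : d ^ (-m-2) = d ^ (-m-1) * d⁻¹ := by
      rw [show -m-2 = -m-1-1 by ring, Real.rpow_sub hd, Real.rpow_one]; rfl
    rw [e1, e2]
    have : z⁻¹ ≤ d⁻¹ := inv_anti₀ hd hdz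
    calc d ^ (-m-1) * (z ^ (-m) * z⁻¹) ≤ d ^ (-m-1) * (z ^ (-m) * d⁻¹) := by gcongr
      _ = _ := by ring
  · calc z ^ 2 * W ^ (-m-2) ≤ z ^ 2 * (d ^ (-m-2) * z ^ (-m-2)) := by
          gcongr; exact key _ (by linarith)
      _ = d ^ (-m-2) * z ^ (-m) := by
        rw [show (-m : ℝ) = (-m-2) + 2 by ring, Real.rpow_add hz]
        norm_num; ring_nf

lemma kern_bd' {n : ℕ} {M : ℝ} (hn : 2 ≤ n) {z : ℝ × ℝ} {q : ℝ × Sp n}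
    (ho : q ∈ Om n) (hc : q ∈ cone n M) {d : ℝ} (hd : d = Zf M z q.1 - ‖q.2‖) :
    Wz n M z q ^ (-mm n) ≤ d ^ (-mm n) * Zf M z q.1 ^ (-mm n) ∧
    |Hz (mm n) (Zf M z q.1) (Wz n M z q)| ≤ 2 * mm n * (d ^ (-mm n-1) * Zf M z q.1 ^ (-mm n)) ∧
    |Hzz (mm n) (Zf M z q.1) (Wz n M z q)| ≤
      (2 * mm n + 4 * mm n * (mm n + 1)) * (d ^ (-mm n-2) * Zf M z q.1 ^ (-mm n)) := by
  have hm : 0 < mm n := by linarith [mm_pos hn]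
  have h1 := d_one (z := z) ho hc
  rw [← hd] at h1
  have hx := norm_nonneg q.2
  have hdz : d ≤ Zf M z q.1 := by rw [hd]; linarith
  have hW : d * Zf M z q.1 ≤ Wz n M z q := by
    rw [Wz_eq, ← hd]; gcongr; linarith
  have hWp := W_one (z := z) ho hc
  have hz : 0 < Zf M z q.1 := by linarith
  obtain ⟨a1, a2, a3, a4⟩ := kern_bd hm (by linarith) hdz hW
  refine ⟨a1, ?_, ?_⟩
  · unfold Hz
    rw [abs_mul, abs_neg, abs_of_pos (show 0 < 2 * mm n by linarith), abs_of_pos (by positivity)]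
    gcongr
  · unfold Hzz
    refine (abs_add_le _ _).trans ?_
    rw [abs_mul, abs_neg, abs_of_pos (show 0 < 2 * mm n by linarith), abs_of_pos (by positivity),
      abs_of_pos (by positivity), add_mul]
    gcongr

lemma rp_le {x y e : ℝ} (hx : 0 < x) (h : x ≤ y) (he : e ≤ 0) : y ^ e ≤ x ^ e :=
  Real.rpow_le_rpow_of_nonpos hx h he

set_option maxHeartbeats 1000000 in
/-- coarse bounds -/
lemma coarse {n : ℕ} {M t1 R : ℝ} (hn : 2 ≤ n) (h1 : 0 < t1) :
    ∃ C, 0 < C ∧ ∀ z : ℝ × ℝ, ∀ q ∈ slab n M t1 R,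
      |k0 n M z q| ≤ C * ((tau z.1)⁻¹ * (1 + |z.2|) ^ (-(2 * mm n))) ∧
      |k1 n M z q| ≤ C * ((tau z.1)⁻¹ * (1 + |z.2|) ^ (-(2 * mm n))) ∧
      |k2 n M z q| ≤ C * ((tau z.1)⁻¹ * (1 + |z.2|) ^ (-(2 * mm n))) ∧
      |z.1 * Hz (mm n) (Zf M z q.1) (Wz n M z q)| ≤ C * (tau z.1)⁻¹ := by
  have hm : 0 < mm n := by linarith [mm_pos hn]
  have hm2 := mm_pos hn
  set c0 := min 1 (phi t1) with hc0
  have hc00 : 0 < c0 := lt_min one_pos (phi_pos h1)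
  have hc01 : c0 ≤ 1 := min_le_left _ _
  set m := mm n with hmd
  set B := c0 ^ (-(2*m) - 2) with hB
  have hB1 : c0 ^ (-(2*m)) ≤ B := Real.rpow_le_rpow_of_exponent_ge hc00 hc01 (by linarith)
  have hB2 : c0 ^ (-(2*m) - 1) ≤ B := Real.rpow_le_rpow_of_exponent_ge hc00 hc01 (by linarith)
  have hBp : 0 < B := by positivity
  set S := max 1 (R ^ ((1:ℝ)/2)) with hS
  set S' := (2 * t1 ^ ((1:ℝ)/2))⁻¹ with hS'
  have hS1 : 1 ≤ S := le_max_left _ _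
  have hS'0 : 0 < S' := by positivity
  have hR0 : 0 ≤ |R| := abs_nonneg R
  set C1 := 2 * m * B with hC1
  set C2 := (2 * m + 4 * m * (m+1)) * B with hC2
  have hC1p : 0 < C1 := by positivity
  have hC2p : 0 < C2 := by positivity
  refine ⟨B + S * C1 + (|R| * C2 + S' * C1) + C1, by positivity, fun z q hq => ?_⟩
  have ho := slab_sub_Om h1 hq
  have hc := slab_sub_cone hq
  have ht : 0 < q.1 := mem_Om.1 ho
  have hd1 := d_one (z := z) ho hc
  have hdge := d_ge (z := z) ho hc
  have hτ := one_le_tau z.1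
  have hτ0 := tau_pos z.1
  obtain ⟨a1, a2, a3⟩ := kern_bd' (z := z) hn ho hc rfl
  rw [← hmd] at a1 a2 a3
  set d := Zf M z q.1 - ‖q.2‖ with hd
  set a := 1 + |z.2| with ha
  have ha1 : 1 ≤ a := by have := abs_nonneg z.2; linarith
  have hdz : d ≤ Zf M z q.1 := by have := norm_nonneg q.2; linarith
  have hyt : c0 ≤ phi q.1 := (min_le_right _ _).trans (phi_mono h1.le hq.1.1)
  have hdc1 : c0 * a ≤ d := by
    have : 0 ≤ (tau z.1 - 1) * phi q.1 := mul_nonneg (by linarith) (phi_nonneg ht.le)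
    nlinarith
  have hdc2 : c0 * tau z.1 ≤ d := by
    have h : (tau z.1 - 1) * c0 ≤ (tau z.1 - 1) * phi q.1 := by gcongr
    have := abs_nonneg z.2
    nlinarith
  have hdp : 0 < d := by linarith
  -- d^(-2m) bound and inverse bound
  have e1 : d ^ (-(2*m)) ≤ c0 ^ (-(2*m)) * a ^ (-(2*m)) := by
    rw [← Real.mul_rpow hc00.le (by linarith)]
    exact rp_le (by positivity) hdc1 (by linarith)
  have e2 : d⁻¹ ≤ c0⁻¹ * (tau z.1)⁻¹ := by
    rw [← mul_inv]; exact inv_anti₀ (by positivity) hdc2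
  have zd : Zf M z q.1 ^ (-m) ≤ d ^ (-m) := rp_le hdp hdz (by linarith)
  have f0 : d ^ (-m) * Zf M z q.1 ^ (-m) ≤ B * a ^ (-(2*m)) := by
    calc _ ≤ d ^ (-m) * d ^ (-m) := by gcongr
      _ = d ^ (-(2*m)) := by rw [← Real.rpow_add hdp]; congr 1; ring
      _ ≤ _ := e1
      _ ≤ _ := by gcongr
  have f1 : d ^ (-m-1) * Zf M z q.1 ^ (-m) ≤ B * a ^ (-(2*m)) * (tau z.1)⁻¹ := by
    calc _ ≤ d ^ (-m-1) * d ^ (-m) := by gcongr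
      _ = d ^ (-(2*m)) * d⁻¹ := by
        rw [← Real.rpow_add hdp, ← Real.rpow_neg_one d, ← Real.rpow_add hdp]; congr 1; ring
      _ ≤ (c0 ^ (-(2*m)) * a ^ (-(2*m))) * (c0⁻¹ * (tau z.1)⁻¹) := by gcongr
      _ = (c0 ^ (-(2*m) - 1)) * a ^ (-(2*m)) * (tau z.1)⁻¹ := by
        rw [Real.rpow_sub hc00, Real.rpow_one]; ring
      _ ≤ _ := by gcongr
  have f2 : d ^ (-m-2) * Zf M z q.1 ^ (-m) ≤ B * a ^ (-(2*m)) * ((tau z.1)⁻¹ * (tau z.1)⁻¹) := by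
    calc _ ≤ d ^ (-m-2) * d ^ (-m) := by gcongr
      _ = d ^ (-(2*m)) * (d⁻¹ * d⁻¹) := by
        rw [← Real.rpow_add hdp, ← Real.rpow_neg_one d, ← Real.rpow_add hdp, ← Real.rpow_add hdp]
        congr 1; ring
      _ ≤ (c0 ^ (-(2*m)) * a ^ (-(2*m))) * ((c0⁻¹ * (tau z.1)⁻¹) * (c0⁻¹ * (tau z.1)⁻¹)) := by gcongr
      _ = B * a ^ (-(2*m)) * ((tau z.1)⁻¹ * (tau z.1)⁻¹) := by
        rw [hB, show -(2*m)-2 = -(2*m)-1-1 by ring, Real.rpow_sub hc00, Real.rpow_sub hc00, Real.rpow_one]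
        ring
  set A := a ^ (-(2*m)) with hA
  have hAp : 0 < A := by positivity
  set i := (tau z.1)⁻¹ with hi
  have hip : 0 < i := by positivity
  have hsq : q.1 ^ ((1:ℝ)/2) ≤ S :=
    (Real.rpow_le_rpow ht.le hq.1.2 (by norm_num)).trans (le_max_right _ _)
  have hsq' : 1 / (2 * q.1 ^ ((1:ℝ)/2)) ≤ S' := by
    rw [hS', one_div]
    have := Real.rpow_le_rpow h1.le hq.1.1 (show (0:ℝ) ≤ 1/2 by norm_num)
    exact inv_anti₀ (by positivity) (by linarith)
  have g1 : |Hz m (Zf M z q.1) (Wz n M z q)| ≤ C1 * (i * A) := by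
    refine a2.trans ?_
    calc _ ≤ 2 * m * (B * A * i) := by gcongr
      _ = _ := by rw [hC1]; ring
  have g2 : |Hzz m (Zf M z q.1) (Wz n M z q)| ≤ C2 * (i * A) * i := by
    refine a3.trans ?_
    calc _ ≤ (2 * m + 4 * m * (m+1)) * (B * A * (i * i)) := by gcongr
      _ = _ := by rw [hC2]; ring
  have hiA : 0 < i * A := by positivity
  have b0 : |k0 n M z q| ≤ B * (i * A) := by
    unfold k0
    rw [abs_mul, abs_of_pos hip, abs_of_pos (Real.rpow_pos_of_pos (W_one ho hc) _)]
    calc _ ≤ i * (B * A) := by gcongr; exact a1.trans f0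
      _ = _ := by ring
  have b1 : |k1 n M z q| ≤ S * C1 * (i * A) := by
    unfold k1
    rw [abs_mul, abs_of_pos (show 0 < q.1 ^ ((1:ℝ)/2) by positivity), mul_assoc]
    gcongr
  have b2 : |k2 n M z q| ≤ (|R| * C2 + S' * C1) * (i * A) := by
    unfold k2
    refine (abs_add_le _ _).trans ?_
    rw [add_mul]
    refine add_le_add ?_ ?_
    · rw [abs_mul]
      have hq1 : |q.1 * ((tau z.1) ^ 2 - 1) / tau z.1| ≤ |R| * tau z.1 := by
        rw [abs_div, abs_of_pos hτ0, div_le_iff₀ hτ0, abs_mul, abs_of_pos ht,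
          abs_of_nonneg (sub_nonneg.2 (one_le_pow₀ hτ)), mul_assoc]
        have h5 : q.1 ≤ |R| := hq.1.2.trans (le_abs_self R)
        have h6 : tau z.1 ^ 2 - 1 ≤ tau z.1 * tau z.1 := by rw [sq]; linarith
        exact mul_le_mul h5 h6 (sub_nonneg.2 (one_le_pow₀ hτ)) hR0
      calc _ ≤ (|R| * tau z.1) * (C2 * (i * A) * i) := by gcongr
        _ = |R| * C2 * (i * A) * (tau z.1 * i) := by ring
        _ = _ := by rw [hi, mul_inv_cancel₀ hτ0.ne', mul_one]
    · rw [abs_mul, abs_of_pos (show 0 < 1 / (2 * q.1 ^ ((1:ℝ)/2)) by positivity), mul_assoc]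
      gcongr
  have b3 : |z.1 * Hz m (Zf M z q.1) (Wz n M z q)| ≤ C1 * i := by
    rw [abs_mul]
    have h5 : d ^ (-m-1) * Zf M z q.1 ^ (-m) ≤ B * (i * i) := by
      calc _ ≤ d ^ (-m-1) * d ^ (-m) := by gcongr
        _ = d ^ (-(2*m) - 1) := by rw [← Real.rpow_add hdp]; congr 1; ring
        _ ≤ d ^ (-1 + -1 : ℝ) := Real.rpow_le_rpow_of_exponent_le hd1 (by linarith)
        _ = d⁻¹ * d⁻¹ := by rw [Real.rpow_add hdp, Real.rpow_neg_one]
        _ ≤ (c0⁻¹ * i) * (c0⁻¹ * i) := by gcongr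
        _ = c0 ^ (-1 + -1 : ℝ) * (i * i) := by rw [Real.rpow_add hc00, Real.rpow_neg_one]; ring
        _ ≤ B * (i * i) := by
          gcongr 1
          exact Real.rpow_le_rpow_of_exponent_ge hc00 hc01 (by linarith)
    calc _ ≤ tau z.1 * (2 * m * (B * (i * i))) := by
          gcongr
          · exact abs_le_tau _
          · exact a2.trans (by gcongr)
      _ = C1 * i * (tau z.1 * i) := by rw [hC1]; ring
      _ = _ := by rw [hi, mul_inv_cancel₀ hτ0.ne', mul_one]
  have p1 : 0 ≤ B * (i * A) := by positivity
  have p2 : 0 ≤ S * C1 * (i * A) := by positivity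
  have p3 : 0 ≤ (|R| * C2 + S' * C1) * (i * A) := by positivity
  have p4 : 0 ≤ C1 * (i * A) := by positivity
  have p5 : 0 ≤ (B + S * C1 + (|R| * C2 + S' * C1)) * i := by positivity
  refine ⟨?_, ?_, ?_, ?_⟩ <;> linarith
end Tric

namespace Tric

lemma phi_meas : Measurable phi := phi_cont.measurable
lemma tau_meas : Measurable tau := tau_cont.measurable

lemma Zf_meas {n : ℕ} (M : ℝ) : Measurable fun w : (ℝ × ℝ) × (ℝ × Sp n) => Zf M w.1 w.2.1 := by
  unfold Zf
  have h1 : Measurable fun w : (ℝ × ℝ) × (ℝ × Sp n) => tau w.1.1 := tau_meas.comp (by fun_prop)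
  have h2 : Measurable fun w : (ℝ × ℝ) × (ℝ × Sp n) => phi w.2.1 := phi_meas.comp (by fun_prop)
  have h3 : Measurable fun w : (ℝ × ℝ) × (ℝ × Sp n) => |w.1.2| := continuous_abs.measurable.comp (by fun_prop)
  exact (h3.const_add _).add (h1.mul h2)

lemma Wz_meas {n : ℕ} (M : ℝ) : Measurable fun w : (ℝ × ℝ) × (ℝ × Sp n) => Wz n M w.1 w.2 := by
  have h : (fun w : (ℝ × ℝ) × (ℝ × Sp n) => Wz n M w.1 w.2) =
      fun w => (Zf M w.1 w.2.1) ^ 2 - ‖w.2.2‖ ^ 2 := by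
    funext w; rw [Wz_eq]; ring
  rw [h]
  have h4 : Measurable fun w : (ℝ × ℝ) × (ℝ × Sp n) => ‖w.2.2‖ := (by fun_prop)
  exact ((Zf_meas M).pow_const 2).sub (h4.pow_const 2)

lemma Hz_meas {n : ℕ} (m M : ℝ) : Measurable fun w : (ℝ × ℝ) × (ℝ × Sp n) => Hz m (Zf M w.1 w.2.1) (Wz n M w.1 w.2) := by
  unfold Hz
  exact ((Zf_meas M).mul ((Wz_meas M).pow_const _)).const_mul _

lemma Hzz_meas {n : ℕ} (m M : ℝ) : Measurable fun w : (ℝ × ℝ) × (ℝ × Sp n) => Hzz m (Zf M w.1 w.2.1) (Wz n M w.1 w.2) := by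
  unfold Hzz
  exact (((Wz_meas M).pow_const _).const_mul _).add
    ((((Zf_meas M).pow_const 2).mul ((Wz_meas M).pow_const _)).const_mul _)

lemma tauw_meas {n : ℕ} : Measurable fun w : (ℝ × ℝ) × (ℝ × Sp n) => tau w.1.1 := tau_meas.comp (by fun_prop)
lemma tw_meas {n : ℕ} : Measurable fun w : (ℝ × ℝ) × (ℝ × Sp n) => w.2.1 := by fun_prop

lemma k0_meas (n : ℕ) (M : ℝ) : Measurable (Function.uncurry (k0 n M)) := by
  unfold Function.uncurry k0
  exact tauw_meas.inv.mul ((Wz_meas M).pow_const _)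
lemma k1_meas (n : ℕ) (M : ℝ) : Measurable (Function.uncurry (k1 n M)) := by
  unfold Function.uncurry k1
  exact (tw_meas.pow_const _).mul (Hz_meas _ M)
lemma k2_meas (n : ℕ) (M : ℝ) : Measurable (Function.uncurry (k2 n M)) := by
  unfold Function.uncurry k2
  refine Measurable.add ?_ ?_
  · exact ((tw_meas.mul ((tauw_meas.pow_const 2).sub_const 1)).div tauw_meas).mul (Hzz_meas _ M)
  · exact (((tw_meas.pow_const _).const_mul 2).const_div 1).mul (Hz_meas _ M)

lemma rhoHz_deriv {n : ℕ} {M a : ℝ} {q : ℝ × Sp n} (ho : q ∈ Om n) (hc : q ∈ cone n M) (ρ : ℝ) :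
    HasDerivAt (fun ρ => ρ * Hz (mm n) (Zf M (ρ, a) q.1) (Wz n M (ρ, a) q))
      (2 * q.1 ^ ((1:ℝ)/2) * k2 n M (ρ, a) q) ρ := by
  have ht := mem_Om.1 ho
  have hW := W_one (z := (ρ, a)) ho hc
  have hZ : HasDerivAt (fun ρ => Zf M (ρ, a) q.1) (3 * ρ ^ 5 / tau ρ * phi q.1) ρ := by
    exact ((tau_deriv ρ).mul_const (phi q.1)).const_add (M + 1 + |a|)
  have hWd : HasDerivAt (fun ρ => Wz n M (ρ, a) q)
      (2 * Zf M (ρ, a) q.1 * (3 * ρ ^ 5 / tau ρ * phi q.1)) ρ := by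
    have e : (fun ρ => Wz n M (ρ, a) q) = fun ρ => (Zf M (ρ, a) q.1) ^ 2 - ‖q.2‖ ^ 2 := by
      funext ρ; rw [Wz_eq]; ring
    rw [e]
    refine ((hZ.pow 2).sub_const _).congr_deriv ?_
    simp
  have hr : HasDerivAt (fun ρ => Wz n M (ρ, a) q ^ (-mm n - 1)) _ ρ := hWd.rpow_const (p := -mm n - 1) (Or.inl hW.ne')
  unfold Hz
  have := (hasDerivAt_id ρ).mul ((hZ.mul hr).const_mul (-(2 * mm n)))
  refine this.congr_deriv ?_
  unfold k2 Hz Hzz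
  have hph := phi_half ht
  have hs := half_sq ht
  have hs0 : 0 < q.1 ^ ((1:ℝ)/2) := by positivity
  have h6 : tau ρ ^ 2 - 1 = ρ ^ 6 := by rw [tau_sq]; ring
  have hτ := (tau_pos ρ).ne'
  simp only [id, Pi.mul_apply]
  rw [show -mm n - 1 - 1 = -mm n - 2 by ring, h6]
  have hph' : phi q.1 = 2 / 3 * (q.1 * q.1 ^ ((1:ℝ)/2)) := by linarith
  rw [hph']
  generalize q.1 ^ ((1:ℝ)/2) = s at *
  generalize Wz n M (ρ, a) q ^ (-mm n - 1) = w1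
  generalize Wz n M (ρ, a) q ^ (-mm n - 2) = w2
  generalize Zf M (ρ, a) q.1 = Z
  field_simp
  ring

lemma slab_self {n : ℕ} {M : ℝ} {q : ℝ × Sp n} (hc : q ∈ cone n M) : q ∈ slab n M q.1 q.1 :=
  ⟨⟨le_rfl, le_rfl⟩, hc⟩

/-- integrable majorant -/
lemma maj_int {ν : Measure ℝ} [SFinite ν] {m : ℝ} (hν : Integrable (fun a => (1 + |a|) ^ (-(2 * m))) ν) (C : ℝ) :
    Integrable (fun z : ℝ × ℝ => C * ((tau z.1)⁻¹ * (1 + |z.2|) ^ (-(2 * m)))) ((volume : Measure ℝ).prod ν) :=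
  (tau_inv_int.mul_prod hν).const_mul C

lemma k_int {ν : Measure ℝ} [SFinite ν] {n : ℕ} {M : ℝ} (hn : 2 ≤ n)
    (hν : Integrable (fun a => (1 + |a|) ^ (-(2 * mm n))) ν) {q : ℝ × Sp n} (ho : q ∈ Om n) (hc : q ∈ cone n M) :
    Integrable (fun z => k0 n M z q) ((volume : Measure ℝ).prod ν) ∧
    Integrable (fun z => k1 n M z q) ((volume : Measure ℝ).prod ν) ∧
    Integrable (fun z => k2 n M z q) ((volume : Measure ℝ).prod ν) := by
  obtain ⟨C, hC, h⟩ := coarse (M := M) (R := q.1) hn (mem_Om.1 ho)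
  have hm := maj_int hν C
  have hs := slab_self hc
  have ms : ∀ k : ℝ × ℝ → ℝ × Sp n → ℝ, Measurable (Function.uncurry k) → Measurable fun z => k z q :=
    fun k hk => hk.comp (measurable_id.prodMk measurable_const)
  refine ⟨hm.mono' (ms _ (k0_meas n M)).aestronglyMeasurable (.of_forall fun z => (h z q hs).1),
    hm.mono' (ms _ (k1_meas n M)).aestronglyMeasurable (.of_forall fun z => (h z q hs).2.1),
    hm.mono' (ms _ (k2_meas n M)).aestronglyMeasurable (.of_forall fun z => (h z q hs).2.2.1)⟩

lemma k2_zero {ν : Measure ℝ} [SFinite ν] {n : ℕ} {M : ℝ} (hn : 2 ≤ n)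
    (hν : Integrable (fun a => (1 + |a|) ^ (-(2 * mm n))) ν) {q : ℝ × Sp n} (ho : q ∈ Om n) (hc : q ∈ cone n M) :
    ∫ z, k2 n M z q ∂((volume : Measure ℝ).prod ν) = 0 := by
  have hi := (k_int hn hν ho hc).2.2
  rw [integral_prod_symm _ hi]
  refine integral_eq_zero_of_ae (.of_forall fun a => ?_)
  obtain ⟨C, hC, h⟩ := coarse (M := M) (R := q.1) hn (mem_Om.1 ho)
  have hs := slab_self hc
  have ht := mem_Om.1 ho
  have mk : Measurable fun ρ => k2 n M (ρ, a) q :=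
    (k2_meas n M).comp ((measurable_id.prodMk measurable_const).prodMk measurable_const)
  have i1 : Integrable fun ρ => 2 * q.1 ^ ((1:ℝ)/2) * k2 n M (ρ, a) q := by
    refine Integrable.const_mul ?_ _
    refine (tau_inv_int.const_mul (C * (1 + |a|) ^ (-(2 * mm n)))).mono' mk.aestronglyMeasurable (.of_forall fun ρ => ?_)
    have := (h (ρ, a) q hs).2.2.1
    rw [Real.norm_eq_abs]
    refine this.trans (le_of_eq ?_); simp only; ring
  have i2 : Integrable fun ρ => ρ * Hz (mm n) (Zf M (ρ, a) q.1) (Wz n M (ρ, a) q) := by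
    refine (tau_inv_int.const_mul C).mono' ?_ (.of_forall fun ρ => (h (ρ, a) q hs).2.2.2)
    exact (continuous_iff_continuousAt.2 fun ρ => (rhoHz_deriv ho hc ρ).continuousAt).aestronglyMeasurable
  have := integral_eq_zero_of_hasDerivAt_of_integrable (fun ρ => rhoHz_deriv (a := a) ho hc ρ) i1 i2
  rw [integral_const_mul] at this
  have hp : 2 * q.1 ^ ((1:ℝ)/2) ≠ 0 := by positivity
  exact (mul_eq_zero.1 this).resolve_left hp

noncomputable def Ph (n : ℕ) (M : ℝ) (ν : Measure ℝ) (q : ℝ × Sp n) : ℝ :=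
  ∫ z, k0 n M z q ∂((volume : Measure ℝ).prod ν)
noncomputable def Ph1 (n : ℕ) (M : ℝ) (ν : Measure ℝ) (q : ℝ × Sp n) : ℝ :=
  ∫ z, k1 n M z q ∂((volume : Measure ℝ).prod ν)

lemma k0_cd {n : ℕ} {M : ℝ} (z : ℝ × ℝ) : ContDiffOn ℝ 2 (k0 n M z) (On n (M + 1) 1) := by
  unfold k0 Wz
  refine contDiffOn_const.mul ((Wf_cd (c := M + 1 + |z.2|) (κ := tau z.1)).mono fun q hq => ?_)
  refine ⟨hq.1, ?_⟩
  have := hq.2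
  have h2 : 1 * phi q.1 ≤ tau z.1 * phi q.1 :=
    mul_le_mul_of_nonneg_right (one_le_tau _) (phi_nonneg hq.1.le)
  linarith [abs_nonneg z.2]

lemma mem_On {n : ℕ} {M : ℝ} {q : ℝ × Sp n} (ho : q ∈ Om n) (hc : q ∈ cone n M) : q ∈ On n (M + 1) 1 := by
  have : ‖q.2‖ ≤ M + phi q.1 := hc
  exact ⟨mem_Om.1 ho, by linarith⟩

lemma On_sub {n : ℕ} {M : ℝ} {z : ℝ × ℝ} {q : ℝ × Sp n} (hq : q ∈ On n (M+1) 1) :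
    q ∈ On n (M + 1 + |z.2|) (tau z.1) := by
  refine ⟨hq.1, ?_⟩
  have := hq.2
  have h2 : 1 * phi q.1 ≤ tau z.1 * phi q.1 :=
    mul_le_mul_of_nonneg_right (one_le_tau _) (phi_nonneg hq.1.le)
  linarith [abs_nonneg z.2]

lemma k0_t {n : ℕ} {M : ℝ} (z : ℝ × ℝ) {q : ℝ × Sp n} (hq : q ∈ On n (M+1) 1) :
    fderiv ℝ (k0 n M z) q (1, 0) = k1 n M z q := by
  have hO := On_sub (z := z) hq
  have hd : DifferentiableAt ℝ (fun q => Wf n (M + 1 + |z.2|) (tau z.1) q ^ (-mm n)) q :=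
    ((Wf_cd (e := -mm n)).contDiffAt ((On_open _ _ _).mem_nhds hO)).differentiableAt (by norm_num)
  have : k0 n M z = fun q => (tau z.1)⁻¹ * Wf n (M + 1 + |z.2|) (tau z.1) q ^ (-mm n) := rfl
  rw [this, fderiv_const_mul hd, smul_apply, Wf_t hO]
  unfold k1 Hz Zf Wz
  have := (tau_pos z.1).ne'
  simp only [smul_eq_mul]
  field_simp

lemma Pop_const_mul {n : ℕ} {F : ℝ × Sp n → ℝ} {O : Set (ℝ × Sp n)} (hO : IsOpen O) (hF : ContDiffOn ℝ 2 F O) (c : ℝ)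
    {q : ℝ × Sp n} (hq : q ∈ O) : Pop (fun q => c * F q) q = c * Pop F q := by
  have hd : ∀ z ∈ O, DifferentiableAt ℝ F z := fun z hz =>
    (hF.contDiffAt (hO.mem_nhds hz)).differentiableAt (by norm_num)
  have hd2 : ∀ v, DifferentiableAt ℝ (fun z => fderiv ℝ F z v) q := fun v => by
    have := (hF.contDiffAt (hO.mem_nhds hq)).fderiv_right (m := 1) (by norm_num)
    exact (this.differentiableAt (by norm_num)).clm_apply (differentiableAt_const v)
  have e : ∀ v, (fun z => fderiv ℝ (fun q => c * F q) z v) =ᶠ[nhds q] fun z => c * fderiv ℝ F z v := by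
    intro v
    filter_upwards [hO.mem_nhds hq] with z hz
    rw [fderiv_const_mul (hd z hz)]; rfl
  have e2 : ∀ v, fderiv ℝ (fun z => fderiv ℝ (fun q => c * F q) z v) q v =
      c * fderiv ℝ (fun z => fderiv ℝ F z v) q v := by
    intro v
    rw [(e v).fderiv_eq, fderiv_const_mul (hd2 v)]; rfl
  unfold Pop
  simp only [e2]
  rw [← Finset.mul_sum]; ring

lemma k0_P {n : ℕ} {M : ℝ} (z : ℝ × ℝ) {q : ℝ × Sp n} (hq : q ∈ On n (M+1) 1) :
    Pop (k0 n M z) q = k2 n M z q := by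
  have hO := On_sub (z := z) hq
  have : k0 n M z = fun q => (tau z.1)⁻¹ * Wf n (M + 1 + |z.2|) (tau z.1) q ^ (-mm n) := rfl
  rw [this, Pop_const_mul (On_open _ _ _) (Wf_cd (e := -mm n)) _ hO, Wf_Pop (by unfold mm; ring) hO]
  unfold k2 Zf Wz
  have := (tau_pos z.1).ne'
  have : 0 < q.1 ^ ((1:ℝ)/2) := Real.rpow_pos_of_pos hO.1 _
  field_simp

theorem phiG {ν : Measure ℝ} [SFinite ν] {n : ℕ} {M p : ℝ} {u : ℝ × Sp n → ℝ} (S : Sol n M p u)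
    (hν : Integrable (fun a => (1 + |a|) ^ (-(2 * mm n))) ν) {t1 R : ℝ} (h1 : 0 < t1) (h2 : t1 ≤ R)
    {ψ ψ1 ψ2 : ℝ → ℝ} (hψ : ContDiff ℝ 2 ψ) (cψ1 : Continuous ψ1) (cψ2 : Continuous ψ2)
    (hψ1 : ∀ t, HasDerivAt ψ (ψ1 t) t) (hψ2 : ∀ t, HasDerivAt ψ1 (ψ2 t) t)
    (hR0 : ψ R = 0) (hR1 : ψ1 R = 0) :
    IntegrableOn (fun q => |u q| ^ p * ψ q.1 * Ph n M ν q) (slab n M t1 R) ∧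
    IntegrableOn (fun q => u q * (2 * ψ1 q.1 * Ph1 n M ν q + ψ2 q.1 * Ph n M ν q))
      (slab n M t1 R) ∧
    (∫ q in slab n M t1 R, |u q| ^ p * ψ q.1 * Ph n M ν q) +
      Dat u (fun q => Ph n M ν q * ψ q.1)
        (fun q => Ph1 n M ν q * ψ q.1 + Ph n M ν q * ψ1 q.1) t1 =
    ∫ q in slab n M t1 R, u q * (2 * ψ1 q.1 * Ph1 n M ν q + ψ2 q.1 * Ph n M ν q) := by
  obtain ⟨C, hC, h⟩ := coarse (M := M) (R := R) S.hn h1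
  exact lemT ((volume : Measure ℝ).prod ν) S (On_open n (M+1) 1) (fun q h h' => mem_On h h') h1 h2
    (h0 := k0 n M) (h1' := k1 n M) (h2' := k2 n M) (fun z => k0_cd z)
    (fun z q ho hc => k0_t z (mem_On ho hc)) (fun z q ho hc => k0_P z (mem_On ho hc))
    (k0_meas n M) (k1_meas n M) (k2_meas n M) (maj_int hν C)
    (fun z q hq => (h z q hq).1) (fun z q hq => (h z q hq).2.1) (fun z q hq => (h z q hq).2.2.1)
    (fun q hq => k2_zero S.hn hν (slab_sub_Om h1 hq) (slab_sub_cone hq)) hψ cψ1 cψ2 hψ1 hψ2 hR0 hR1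
end Tric

namespace Tric

lemma tau_sub_ge (ρ : ℝ) : ρ ^ 6 / 3 ≤ tau ρ - 1 ∨ |ρ| ^ 3 / 3 ≤ tau ρ - 1 := by
  have h6 : |ρ| ^ 6 = ρ ^ 6 := by rw [← abs_pow, abs_of_nonneg (by positivity)]
  rcases le_total |ρ| 1 with h | h
  · left
    have hx : ρ ^ 6 ≤ 1 := by rw [← h6]; exact pow_le_one₀ (abs_nonneg _) h
    have h0 : 0 ≤ ρ ^ 6 := by positivity
    have : 1 + ρ ^ 6 / 3 ≤ tau ρ := Real.le_sqrt_of_sq_le (by nlinarith)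
    linarith
  · right
    have hx : 1 ≤ |ρ| ^ 3 := one_le_pow₀ h
    have : 1 + |ρ| ^ 3 / 3 ≤ tau ρ := by
      refine Real.le_sqrt_of_sq_le ?_
      rw [← h6, show |ρ| ^ 6 = (|ρ| ^ 3) ^ 2 by ring]
      nlinarith
    linarith

lemma f_int {e : ℝ} (he : e ≤ -1) : Integrable (fun η : ℝ => (1 + η ^ 6 / 3) ^ e) ∧
    Integrable (fun η : ℝ => (1 + |η| ^ 3 / 3) ^ e) := by
  have key : ∀ B η : ℝ, (1 + η ^ 2) / 3 ≤ B → 1 ≤ B → ‖B ^ e‖ ≤ 3 * (1 + η ^ 2)⁻¹ := by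
    intro B η h1 h2
    rw [Real.norm_eq_abs, abs_of_pos (by positivity)]
    calc B ^ e ≤ B ^ (-1:ℝ) := Real.rpow_le_rpow_of_exponent_le h2 he
      _ = B⁻¹ := Real.rpow_neg_one B
      _ ≤ ((1 + η ^ 2) / 3)⁻¹ := inv_anti₀ (by positivity) h1
      _ = _ := by rw [inv_div]; ring
  have ha : ∀ η : ℝ, 0 ≤ |η| ^ 3 := fun η => by positivity
  have h6 : ∀ η : ℝ, 0 ≤ η ^ 6 := fun η => by positivity
  constructor
  · refine (integrable_inv_one_add_sq.const_mul 3).mono' ?_ (.of_forall fun η => key _ η ?_ ?_)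
    · refine Continuous.aestronglyMeasurable (Continuous.rpow_const (by fun_prop) fun η => Or.inl ?_)
      have := h6 η; positivity
    · nlinarith [sq_nonneg (η^2 - 1), sq_nonneg (η * (η^2 - 1)), sq_nonneg η, sq_nonneg (η^3)]
    · linarith [h6 η]
  · refine (integrable_inv_one_add_sq.const_mul 3).mono' ?_ (.of_forall fun η => key _ η ?_ ?_)
    · refine Continuous.aestronglyMeasurable (Continuous.rpow_const (by fun_prop) fun η => Or.inl ?_)
      have := ha η; positivity
    · rw [← sq_abs]
      have := abs_nonneg η
      nlinarith [sq_nonneg (|η| - 1), mul_nonneg this (sq_nonneg (|η| - 1))]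
    · linarith [ha η]

/-- the basic ρ-integral -/
lemma rho_int {e : ℝ} (he : e ≤ -1) : ∃ C, 0 < C ∧ ∀ D y : ℝ, 0 < D → 0 < y →
    Integrable (fun ρ => (D + y * (tau ρ - 1)) ^ e) ∧
    ∫ ρ, (D + y * (tau ρ - 1)) ^ e ≤ C * (D ^ e * ((D / y) ^ ((1:ℝ)/6) + (D / y) ^ ((1:ℝ)/3))) := by
  obtain ⟨i6, i3⟩ := f_int he
  set c6 := ∫ η : ℝ, (1 + η ^ 6 / 3) ^ e
  set c3 := ∫ η : ℝ, (1 + |η| ^ 3 / 3) ^ e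
  have h6 : ∀ η : ℝ, 0 ≤ η ^ 6 := fun η => by positivity
  have h3 : ∀ η : ℝ, 0 ≤ |η| ^ 3 := fun η => by positivity
  have hc6 : 0 ≤ c6 := integral_nonneg fun η => by have := h6 η; positivity
  have hc3 : 0 ≤ c3 := integral_nonneg fun η => by have := h3 η; positivity
  refine ⟨c6 + c3 + 1, by positivity, fun D y hD hy => ?_⟩
  set l6 := (y / D) ^ ((1:ℝ)/6) with hl6
  set l3 := (y / D) ^ ((1:ℝ)/3) with hl3
  have hyD : 0 < y / D := by positivity
  have l6p : 0 < l6 := by positivity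
  have l3p : 0 < l3 := by positivity
  have e6 : l6 ^ 6 = y / D := by
    rw [hl6, ← Real.rpow_natCast, ← Real.rpow_mul hyD.le]; norm_num
  have e3 : l3 ^ 3 = y / D := by
    rw [hl3, ← Real.rpow_natCast, ← Real.rpow_mul hyD.le]; norm_num
  have I6 := (i6.comp_mul_left' l6p.ne').const_mul (D ^ e)
  have I3 := (i3.comp_mul_left' l3p.ne').const_mul (D ^ e)
  have hpt : ∀ ρ, (D + y * (tau ρ - 1)) ^ e ≤
      D ^ e * (1 + (l6 * ρ) ^ 6 / 3) ^ e + D ^ e * (1 + |l3 * ρ| ^ 3 / 3) ^ e := by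
    intro ρ
    have g6 := h6 (l6 * ρ)
    have g3 := h3 (l3 * ρ)
    have p6 : 0 ≤ D ^ e * (1 + (l6 * ρ) ^ 6 / 3) ^ e := by positivity
    have p3 : 0 ≤ D ^ e * (1 + |l3 * ρ| ^ 3 / 3) ^ e := by positivity
    rcases tau_sub_ge ρ with h | h
    · refine le_trans ?_ (le_add_of_nonneg_right p3)
      rw [← Real.mul_rpow hD.le (by positivity)]
      refine rp_le (by positivity) ?_ (by linarith)
      rw [mul_pow, e6]
      have : D * (1 + y / D * ρ ^ 6 / 3) = D + y * (ρ ^ 6 / 3) := by field_simp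
      rw [this]; gcongr
    · refine le_trans ?_ (le_add_of_nonneg_left p6)
      rw [← Real.mul_rpow hD.le (by positivity)]
      refine rp_le (by positivity) ?_ (by linarith)
      rw [abs_mul, mul_pow, abs_of_pos l3p, e3]
      have : D * (1 + y / D * |ρ| ^ 3 / 3) = D + y * (|ρ| ^ 3 / 3) := by field_simp
      rw [this]; gcongr
  have hpos : ∀ ρ, 0 < D + y * (tau ρ - 1) := fun ρ => by
    have := one_le_tau ρ
    have : 0 ≤ y * (tau ρ - 1) := mul_nonneg hy.le (by linarith)
    linarith
  have hI : Integrable (fun ρ => (D + y * (tau ρ - 1)) ^ e) := by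
    refine (I6.add I3).mono' ?_ (.of_forall fun ρ => ?_)
    · refine Continuous.aestronglyMeasurable (Continuous.rpow_const ?_ fun η => Or.inl (hpos η).ne')
      have := tau_cont
      fun_prop
    · rw [Real.norm_eq_abs, abs_of_pos (Real.rpow_pos_of_pos (hpos ρ) _)]
      exact hpt ρ
  refine ⟨hI, (integral_mono hI (I6.add I3) hpt).trans ?_⟩
  have s : ∫ ρ, (D ^ e * (1 + (l6 * ρ) ^ 6 / 3) ^ e + D ^ e * (1 + |l3 * ρ| ^ 3 / 3) ^ e) =
      D ^ e * (l6⁻¹ * c6) + D ^ e * (l3⁻¹ * c3) := by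
    rw [integral_add I6 I3, integral_const_mul, integral_const_mul]
    have a6 := Measure.integral_comp_mul_left (fun η : ℝ => (1 + η ^ 6 / 3) ^ e) l6
    have a3 := Measure.integral_comp_mul_left (fun η : ℝ => (1 + |η| ^ 3 / 3) ^ e) l3
    rw [a6, a3, abs_of_pos (inv_pos.2 l6p), abs_of_pos (inv_pos.2 l3p)]; rfl
  have hs := s.le
  refine (le_trans (le_of_eq rfl) hs).trans ?_
  have r6 : l6⁻¹ = (D / y) ^ ((1:ℝ)/6) := by
    rw [hl6, ← Real.inv_rpow hyD.le, inv_div]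
  have r3 : l3⁻¹ = (D / y) ^ ((1:ℝ)/3) := by
    rw [hl3, ← Real.inv_rpow hyD.le, inv_div]
  rw [r6, r3]
  have q6 : 0 ≤ D ^ e * (D / y) ^ ((1:ℝ)/6) := by positivity
  have q3 : 0 ≤ D ^ e * (D / y) ^ ((1:ℝ)/3) := by positivity
  nlinarith [mul_nonneg hc6 q3, mul_nonneg hc3 q6]

/-- bounds on single-a integrals -/
lemma I1_bd {n : ℕ} {M : ℝ} (hn : 2 ≤ n) (hM : 0 ≤ M) : ∃ C, 0 < C ∧ ∀ a : ℝ, ∀ q ∈ Om n, q ∈ cone n M → ∀ D,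
    D = (M + 1 + phi q.1 - ‖q.2‖) + |a| →
    ∫ ρ, |k1 n M (ρ, a) q| ≤ C * (q.1 ^ ((1:ℝ)/2) * (D ^ (-mm n - 5/6) * phi q.1 ^ (-mm n - 1/6))) := by
  have hm := mm_pos hn
  obtain ⟨C, hC, h⟩ := rho_int (e := -mm n - 1) (by linarith)
  refine ⟨2 * (2 * mm n) * C, by positivity, fun a q ho hc D hD => ?_⟩
  have ht := mem_Om.1 ho
  set y := phi q.1 with hy
  have hyp : 0 < y := phi_pos ht
  have hD1 : 1 ≤ D := by
    have : ‖q.2‖ ≤ M + phi q.1 := hc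
    linarith [abs_nonneg a]
  obtain ⟨hI, hb⟩ := h D y (by linarith) hyp
  set m := mm n
  have hs0 : 0 < q.1 ^ ((1:ℝ)/2) := by positivity
  have Dp : 0 < D := by linarith
  -- pointwise
  have pt : ∀ Z0 : ℝ, 0 < Z0 → (∀ ρ, Z0 ≤ Zf M (ρ, a) q.1) → 
      ∀ ρ, |k1 n M (ρ, a) q| ≤ q.1 ^ ((1:ℝ)/2) * (2 * m) * Z0 ^ (-m) * (D + y * (tau ρ - 1)) ^ (-m - 1) := by
    intro Z0 hZ0 hZ ρ
    have b := (kern_bd' (z := (ρ, a)) hn ho hc rfl).2.1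
    have e : Zf M (ρ, a) q.1 - ‖q.2‖ = D + y * (tau ρ - 1) := by rw [Zf_sub, hD]; ring
    rw [e] at b
    unfold k1
    rw [abs_mul, abs_of_pos hs0]
    have hpos : 0 < D + y * (tau ρ - 1) := by
      have := one_le_tau ρ
      have : 0 ≤ y * (tau ρ - 1) := mul_nonneg hyp.le (by linarith)
      linarith
    calc _ ≤ q.1 ^ ((1:ℝ)/2) * (2 * m * ((D + y * (tau ρ - 1)) ^ (-m - 1) * Z0 ^ (-m))) := by
          gcongr
          refine b.trans ?_
          gcongr ?_ * (?_ * ?_)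
          exact rp_le hZ0 (hZ ρ) (by linarith)
      _ = _ := by ring
  have mk : Measurable fun ρ => k1 n M (ρ, a) q :=
    (k1_meas n M).comp ((measurable_id.prodMk measurable_const).prodMk measurable_const)
  have main : ∀ Z0 : ℝ, 0 < Z0 → (∀ ρ, Z0 ≤ Zf M (ρ, a) q.1) → ∫ ρ, |k1 n M (ρ, a) q| ≤
      q.1 ^ ((1:ℝ)/2) * (2 * m) * Z0 ^ (-m) * (C * (D ^ (-m - 1) * ((D / y) ^ ((1:ℝ)/6) + (D / y) ^ ((1:ℝ)/3)))) := by
    intro Z0 hZ0 hZ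
    have hJ := hI.const_mul (q.1 ^ ((1:ℝ)/2) * (2 * m) * Z0 ^ (-m))
    have hk : Integrable fun ρ => |k1 n M (ρ, a) q| :=
      hJ.mono' mk.norm.aestronglyMeasurable (.of_forall fun ρ => by
        rw [Real.norm_eq_abs, abs_abs]; exact pt Z0 hZ0 hZ ρ)
    refine (integral_mono hk hJ (pt Z0 hZ0 hZ)).trans ?_
    rw [integral_const_mul]
    gcongr
  have X : D ^ (-m - 1) * (D / y) ^ ((1:ℝ)/6) * y ^ (-m) = D ^ (-m - 5/6) * y ^ (-m - 1/6) := by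
    rw [Real.div_rpow Dp.le hyp.le, show -m - 5/6 = (-m - 1) + 1/6 by ring, Real.rpow_add Dp,
      Real.rpow_sub hyp]; ring
  rw [← X]
  rcases le_total D y with hle | hle
  · refine (main y hyp fun ρ => ?_).trans ?_
    · have : 1 * y ≤ tau ρ * y := mul_le_mul_of_nonneg_right (one_le_tau _) hyp.le
      unfold Zf; simp only; linarith [abs_nonneg a]
    · have : (D / y) ^ ((1:ℝ)/3) ≤ (D / y) ^ ((1:ℝ)/6) :=
        Real.rpow_le_rpow_of_exponent_ge (by positivity) ((div_le_one hyp).2 hle) (by norm_num)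
      calc _ ≤ q.1 ^ ((1:ℝ)/2) * (2 * m) * y ^ (-m) * (C * (D ^ (-m - 1) * ((D / y) ^ ((1:ℝ)/6) + (D / y) ^ ((1:ℝ)/6)))) := by
            gcongr
        _ = _ := by ring
  · refine (main D Dp fun ρ => ?_).trans ?_
    · have : 1 * y ≤ tau ρ * y := mul_le_mul_of_nonneg_right (one_le_tau _) hyp.le
      unfold Zf; simp only; linarith [abs_nonneg a, norm_nonneg q.2]
    · have h1 : 1 ≤ D / y := (one_le_div hyp).2 hle
      have e1 : (D / y) ^ ((1:ℝ)/6) ≤ (D / y) ^ ((1:ℝ)/3) :=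
        Real.rpow_le_rpow_of_exponent_le h1 (by norm_num)
      have e2 : D ^ (-m) * (D / y) ^ ((1:ℝ)/3) ≤ (D / y) ^ ((1:ℝ)/6) * y ^ (-m) := by
        have : D ^ (-m) = (D / y) ^ (-m) * y ^ (-m) := by
          rw [← Real.mul_rpow (by positivity) hyp.le]; congr 1; field_simp
        rw [this]
        calc _ = (D / y) ^ (-m + 1/3) * y ^ (-m) := by rw [Real.rpow_add (by positivity)]; ring
          _ ≤ (D / y) ^ ((1:ℝ)/6) * y ^ (-m) := by
            gcongr ?_ * _
            exact Real.rpow_le_rpow_of_exponent_le h1 (by linarith)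
      calc _ ≤ q.1 ^ ((1:ℝ)/2) * (2 * m) * D ^ (-m) * (C * (D ^ (-m - 1) * ((D / y) ^ ((1:ℝ)/3) + (D / y) ^ ((1:ℝ)/3)))) := by
            gcongr
        _ = q.1 ^ ((1:ℝ)/2) * (2 * m) * C * D ^ (-m-1) * 2 * (D ^ (-m) * (D / y) ^ ((1:ℝ)/3)) := by ring
        _ ≤ q.1 ^ ((1:ℝ)/2) * (2 * m) * C * D ^ (-m-1) * 2 * ((D / y) ^ ((1:ℝ)/6) * y ^ (-m)) := by gcongr
        _ = _ := by ring

lemma k0_pt {n : ℕ} {M : ℝ} (hn : 2 ≤ n) (hM : 0 ≤ M) {a : ℝ} {q : ℝ × Sp n} (ho : q ∈ Om n) (hc : q ∈ cone n M) {D Z0 : ℝ}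
    (hD : D = (M + 1 + phi q.1 - ‖q.2‖) + |a|) (Zp : 0 < Z0) (hDZ : Z0 = D ∨ Z0 = phi q.1) (ρ : ℝ) :
    |k0 n M (ρ, a) q| ≤ (D ^ (-mm n) * Z0 ^ (-mm n)) * (tau ρ)⁻¹ := by
  have hm := mm_pos hn
  have ht := mem_Om.1 ho
  have hyp : 0 < phi q.1 := phi_pos ht
  have hD1 : 1 ≤ D := by
    have : ‖q.2‖ ≤ M + phi q.1 := hc
    linarith [abs_nonneg a]
  have Dp : 0 < D := by linarith
  have b := (kern_bd' (z := (ρ, a)) hn ho hc rfl).1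
  have e : Zf M (ρ, a) q.1 - ‖q.2‖ = D + phi q.1 * (tau ρ - 1) := by rw [Zf_sub, hD]; ring
  rw [e] at b
  have h0 : 0 ≤ phi q.1 * (tau ρ - 1) := mul_nonneg hyp.le (by linarith [one_le_tau ρ])
  have hZ : Z0 ≤ Zf M (ρ, a) q.1 := by
    have e5 : Zf M (ρ, a) q.1 = M + 1 + |a| + tau ρ * phi q.1 := rfl
    have : 1 * phi q.1 ≤ tau ρ * phi q.1 := mul_le_mul_of_nonneg_right (one_le_tau _) hyp.le
    have := abs_nonneg a
    have := norm_nonneg q.2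
    rcases hDZ with h | h <;> rw [h, e5] <;> linarith
  unfold k0
  rw [abs_mul, abs_of_pos (inv_pos.2 (tau_pos ρ)), abs_of_pos (Real.rpow_pos_of_pos (W_one ho hc) _), mul_comm]
  have ti := (inv_pos.2 (tau_pos ρ)).le
  refine mul_le_mul_of_nonneg_right (b.trans ?_) ti
  have r1 : (D + phi q.1 * (tau ρ - 1)) ^ (-mm n) ≤ D ^ (-mm n) := rp_le Dp (by linarith) (by linarith)
  have r2 : Zf M (ρ, a) q.1 ^ (-mm n) ≤ Z0 ^ (-mm n) := rp_le Zp hZ (by linarith)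
  exact mul_le_mul r1 r2 (Real.rpow_nonneg (Zp.le.trans hZ) _) (Real.rpow_nonneg Dp.le _)

lemma abs_tau_int {g : ℝ → ℝ} {K : ℝ} (hg : Measurable g) (hK : 0 ≤ K) (h : ∀ ρ, |g ρ| ≤ K * (tau ρ)⁻¹) :
    ∫ ρ, |g ρ| ≤ ((∫ ρ, (tau ρ)⁻¹) + 1) * K := by
  have hJ := tau_inv_int.const_mul K
  have hk : Integrable fun ρ => |g ρ| :=
    hJ.mono' hg.norm.aestronglyMeasurable (.of_forall fun ρ => by
      rw [Real.norm_eq_abs, abs_abs]; exact h ρ)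
  refine (integral_mono hk hJ h).trans ?_
  rw [integral_const_mul]; linarith

lemma k0_measρ {n : ℕ} {M a : ℝ} {q : ℝ × Sp n} : Measurable fun ρ => k0 n M (ρ, a) q := by
  have h1 : Measurable fun ρ : ℝ => ((ρ, a), q) := (measurable_id.prodMk measurable_const).prodMk measurable_const
  have h2 := (k0_meas n M).comp h1
  unfold Function.uncurry Function.comp at h2
  exact h2

lemma I0_bd {n : ℕ} {M : ℝ} (hn : 2 ≤ n) (hM : 0 ≤ M) : ∃ C, 0 < C ∧ ∀ a : ℝ, ∀ q ∈ Om n, q ∈ cone n M → ∀ D,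
    D = (M + 1 + phi q.1 - ‖q.2‖) + |a| → ∀ Z0, (Z0 = D ∨ Z0 = phi q.1) →
    ∫ ρ, |k0 n M (ρ, a) q| ≤ C * (D ^ (-mm n) * Z0 ^ (-mm n)) := by
  have hc1p : 0 ≤ ∫ ρ, (tau ρ)⁻¹ := integral_nonneg fun ρ => (inv_pos.2 (tau_pos ρ)).le
  refine ⟨(∫ ρ, (tau ρ)⁻¹) + 1, by linarith, fun a q ho hc D hD Z0 hZ => ?_⟩
  have mk : Measurable fun ρ => k0 n M (ρ, a) q :=
    k0_measρ
  have Dp : 0 < D := by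
    have : ‖q.2‖ ≤ M + phi q.1 := hc
    linarith [abs_nonneg a]
  have yp := phi_pos (mem_Om.1 ho)
  have Zp : 0 < Z0 := by rcases hZ with h | h <;> rw [h] <;> assumption
  exact abs_tau_int mk (by positivity) fun ρ => k0_pt hn hM ho hc hD Zp hZ ρ

/-- combined bound -/
lemma I_bd {n : ℕ} {M γ : ℝ} (hn : 2 ≤ n) (hM : 0 ≤ M) (hγ0 : 0 ≤ γ) (hγ : 5/6 - mm n ≤ γ) :
    ∃ C, 0 < C ∧ ∀ a : ℝ, ∀ q ∈ Om n, q ∈ cone n M → 1 ≤ q.1 → ∀ δ,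
    δ = M + 1 + phi q.1 - ‖q.2‖ →
    ∫ ρ, |k1 n M (ρ, a) q| ≤ C * (q.1 ^ ((1:ℝ)/2) * phi q.1 ^ (-mm n - 1/6) * (δ ^ (-γ) * (δ + |a|) ^ (-mm n - 5/6 + γ))) ∧
    ∫ ρ, |k0 n M (ρ, a) q| ≤ C * (q.1 * (q.1 ^ ((1:ℝ)/2) * phi q.1 ^ (-mm n - 1/6) * (δ ^ (-γ) * (δ + |a|) ^ (-mm n - 5/6 + γ)))) := by
  obtain ⟨C1, hC1, b1⟩ := I1_bd (M := M) hn hM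
  obtain ⟨C0, hC0, b0⟩ := I0_bd (M := M) hn hM
  have hm := mm_pos hn
  set m := mm n
  set K := 3 * M + 3 with hK
  have hK1 : 1 ≤ K := by linarith
  set C2 := C0 * (3/2 * K ^ γ) with hC2
  have hC2p : 0 < C2 := by positivity
  refine ⟨C1 + C2, by positivity, fun a q ho hc h1 δ hδ => ?_⟩
  have ht := mem_Om.1 ho
  have B1 := b1 a q ho hc _ rfl
  have B0 := b0 a q ho hc _ rfl (max ((M + 1 + phi q.1 - ‖q.2‖) + |a|) (phi q.1)) (max_choice _ _)
  rw [← hδ] at B1 B0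
  set y := phi q.1 with hy
  have hyp : 0 < y := phi_pos ht
  have hy1 : 2/3 ≤ y := by
    have := phi_mono (by norm_num) h1
    have e : phi 1 = 2/3 := by simp [phi]
    linarith
  have hδ1 : 1 ≤ δ := by
    have : ‖q.2‖ ≤ M + phi q.1 := hc
    linarith
  have hδy : δ ≤ K * y := by
    have := norm_nonneg q.2
    have : (3 * M + 2) * (2/3) ≤ (3 * M + 2) * y := by gcongr
    rw [hK]; linarith
  have δp : 0 < δ := by linarith
  set D := δ + |a| with hD
  have hDδ : δ ≤ D := by linarith [abs_nonneg a]
  have Dp : 0 < D := by linarith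
  have hs0 : 0 < q.1 ^ ((1:ℝ)/2) := by positivity
  set T := δ ^ (-γ) * D ^ (-m - 5/6 + γ) with hT
  have Tp : 0 < T := by positivity
  have hT1 : D ^ (-m - 5/6) ≤ T := by
    rw [hT, Real.rpow_add Dp, Real.rpow_neg δp.le, mul_comm (D ^ (-m - 5/6)), ← mul_assoc]
    refine le_mul_of_one_le_left (by positivity) ?_
    rw [← div_eq_inv_mul, one_le_div (by positivity)]
    gcongr
  constructor
  · refine B1.trans ?_
    calc _ ≤ C1 * (q.1 ^ ((1:ℝ)/2) * (T * y ^ (-m - 1/6))) := by gcongr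
      _ ≤ (C1 + C2) * (q.1 ^ ((1:ℝ)/2) * (T * y ^ (-m - 1/6))) := by gcongr; linarith
      _ = _ := by ring
  · refine B0.trans ?_
    -- D^-m max^-m ≤ K^γ * y^(5/6-m) * T
    have key : D ^ (-m) * (max D y) ^ (-m) ≤ K ^ γ * (y ^ (5/6 - m) * T) := by
      have Kg : 1 ≤ K ^ γ := Real.one_le_rpow hK1 hγ0
      rcases le_total D y with hle | hle
      · rw [max_eq_right hle]
        have e : D ^ (-m) * y ^ (-m) ≤ y ^ (5/6 - m) * D ^ (-m - 5/6) := by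
          have e1 : y ^ (5/6 - m) = y ^ (5/6:ℝ) * y ^ (-m) := by rw [← Real.rpow_add hyp]; congr 1
          have e2 : D ^ (-m) = D ^ (-m - 5/6) * D ^ (5/6:ℝ) := by rw [← Real.rpow_add Dp]; congr 1; ring
          rw [e1, e2]
          have : D ^ (5/6:ℝ) ≤ y ^ (5/6:ℝ) := by gcongr
          calc _ = (D ^ (-m - 5/6) * y ^ (-m)) * D ^ (5/6:ℝ) := by ring
            _ ≤ (D ^ (-m - 5/6) * y ^ (-m)) * y ^ (5/6:ℝ) := by gcongr
            _ = _ := by ring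
        calc _ ≤ y ^ (5/6 - m) * D ^ (-m - 5/6) := e
          _ ≤ y ^ (5/6 - m) * T := by gcongr
          _ ≤ _ := le_mul_of_one_le_left (by positivity) Kg
      · rw [max_eq_left hle]
        have h1 : 1 ≤ D / y := (one_le_div hyp).2 hle
        have hDy : D / y ≤ K * (D / δ) := by
          rw [div_le_iff₀ hyp, mul_assoc, ← mul_div_right_comm, mul_div_assoc', le_div_iff₀ δp]
          nlinarith
        have e : (D / y) ^ (5/6 - m) ≤ K ^ γ * (D / δ) ^ γ := by
          rw [← Real.mul_rpow (by positivity) (by positivity)]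
          exact (Real.rpow_le_rpow_of_exponent_le h1 hγ).trans (by gcongr)
        have e1 : D ^ (-m) * D ^ (-m) = (D / y) ^ (5/6 - m) * (y ^ (5/6 - m) * D ^ (-m - 5/6)) := by
          rw [Real.div_rpow Dp.le hyp.le, ← Real.rpow_add Dp, div_mul_eq_mul_div, mul_left_comm,
            mul_div_assoc, eq_comm]
          rw [← Real.rpow_add Dp, mul_div_assoc', mul_comm, mul_div_assoc, div_self (by positivity), mul_one]
          congr 1; ring
        have e2 : T = (D / δ) ^ γ * D ^ (-m - 5/6) := by
          rw [hT, Real.div_rpow Dp.le δp.le, Real.rpow_add Dp, Real.rpow_neg δp.le]; ring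
        rw [e1, e2]
        calc _ ≤ (K ^ γ * (D / δ) ^ γ) * (y ^ (5/6 - m) * D ^ (-m - 5/6)) := by gcongr
          _ = _ := by ring
    have e3 : y ^ (5/6 - m) = 2/3 * (q.1 * q.1 ^ ((1:ℝ)/2)) * y ^ (-m - 1/6) := by
      have : 2/3 * (q.1 * q.1 ^ ((1:ℝ)/2)) = y := by have := phi_half ht; linarith
      rw [this, show 5/6 - m = 1 + (-m - 1/6) by ring, Real.rpow_add hyp, Real.rpow_one]
    calc _ ≤ C0 * (K ^ γ * (y ^ (5/6 - m) * T)) := by gcongr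
      _ = (C2 * (4/9)) * (q.1 * (q.1 ^ ((1:ℝ)/2) * y ^ (-m - 1/6) * T)) := by rw [e3, hC2]; ring
      _ ≤ _ := by gcongr; linarith
end Tric

namespace Tric

lemma hold {n : ℕ} {M p t1 R : ℝ} {u : ℝ × Sp n → ℝ} (S : Sol n M p u) (h1 : 0 < t1)
    {w g F : ℝ × Sp n → ℝ} (hw : ContinuousOn w (slab n M t1 R)) (hw0 : ∀ q ∈ slab n M t1 R, 0 ≤ w q)
    (hg : ContinuousOn g (slab n M t1 R)) (hg0 : ∀ q ∈ slab n M t1 R, 0 ≤ g q)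
    (hF : ∀ q ∈ slab n M t1 R, |F q| ≤ |u q| * (w q ^ (1/p) * g q)) :
    |∫ q in slab n M t1 R, F q| ≤ (∫ q in slab n M t1 R, |u q| ^ p * w q) ^ (1/p) *
      (∫ q in slab n M t1 R, g q ^ (p / (p - 1))) ^ (1 - 1/p) := by
  have hp := S.hp
  have hp0 : 0 < p := by linarith
  have hK := slab_compact n M t1 R h1.le
  have hm := slab_meas n M t1 R h1.le
  set f : ℝ × Sp n → ℝ := fun q => |u q| * w q ^ (1/p) with hf
  have cu := S.cont.mono (slab_sub_Om (M := M) (R := R) h1)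
  have cf : ContinuousOn f (slab n M t1 R) :=
    cu.abs.mul (hw.rpow_const fun q _ => Or.inr (by positivity))
  have hf0 : ∀ q ∈ slab n M t1 R, 0 ≤ f q := fun q hq => by
    have := hw0 q hq; positivity
  haveI : IsFiniteMeasure (volume.restrict (slab n M t1 R)) := ⟨by
    rw [Measure.restrict_apply_univ]; exact hK.measure_lt_top⟩
  have ml : ∀ {h : ℝ × Sp n → ℝ} (r : ENNReal), ContinuousOn h (slab n M t1 R) →
      MemLp h r (volume.restrict (slab n M t1 R)) := by
    intro h r hh
    obtain ⟨C, hC⟩ := hK.exists_bound_of_continuousOn hh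
    exact MemLp.of_bound (hh.aestronglyMeasurable hm) C
      ((ae_restrict_iff' hm).2 (.of_forall hC))
  have hpq : p.HolderConjugate (p / (p-1)) := Real.HolderConjugate.conjExponent hp
  have H := integral_mul_le_Lp_mul_Lq_of_nonneg hpq (μ := volume.restrict (slab n M t1 R))
    (f := f) (g := g) ((ae_restrict_iff' hm).2 (.of_forall hf0)) ((ae_restrict_iff' hm).2 (.of_forall hg0))
    (ml _ cf) (ml _ hg)
  have e1 : ∫ q in slab n M t1 R, f q ^ p = ∫ q in slab n M t1 R, |u q| ^ p * w q := by
    refine setIntegral_congr_fun hm fun q hq => ?_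
    simp only [hf]
    rw [Real.mul_rpow (abs_nonneg _) (Real.rpow_nonneg (hw0 q hq) _), ← Real.rpow_mul (hw0 q hq),
      one_div, inv_mul_cancel₀ hp0.ne', Real.rpow_one]
  have e2 : 1 / (p / (p - 1)) = 1 - 1/p := by
    have : p - 1 ≠ 0 := by linarith
    field_simp
  rw [e1, e2] at H
  refine le_trans ?_ H
  rw [← Real.norm_eq_abs]
  refine norm_integral_le_of_norm_le ((cf.mul hg).integrableOn_compact hK) ((ae_restrict_iff' hm).2 (.of_forall fun q hq => ?_))
  rw [Real.norm_eq_abs]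
  refine (hF q hq).trans (le_of_eq ?_)
  simp only [hf]; ring

lemma slab_int_le {n : ℕ} {M R B : ℝ} (hR : 1 ≤ R) {G : ℝ × Sp n → ℝ} (hG : ContinuousOn G (slab n M 1 R))
    (hG0 : ∀ q ∈ slab n M 1 R, 0 ≤ G q)
    (hB : ∀ t, 1 ≤ t → t ≤ R → ∫ x in closedBall (0 : Sp n) (M + phi t), G (t, x) ≤ B) :
    ∫ q in slab n M 1 R, G q ≤ B * R := by
  have hm := slab_meas n M 1 R zero_le_one
  set G' := (cone n M).indicator G with hG'
  have hc : ContinuousOn G' (slab n M 1 R) := hG.congr fun q hq => indicator_of_mem (slab_sub_cone hq) _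
  have e := (int_slab one_pos hc (fun q _ hq => indicator_of_notMem hq _)).2
  have e0 : ∫ q in slab n M 1 R, G q = ∫ q in slab n M 1 R, G' q :=
    setIntegral_congr_fun hm fun q hq => (indicator_of_mem (slab_sub_cone hq) _).symm
  rw [e0, e]
  have sl : ∀ t, ∫ x, G' (t, x) = ∫ x in closedBall (0 : Sp n) (M + phi t), G (t, x) := by
    intro t
    rw [← integral_indicator measurableSet_closedBall]
    refine integral_congr_ae (.of_forall fun x => ?_)
    simp only [hG']
    by_cases h : ‖x‖ ≤ M + phi t
    · rw [indicator_of_mem (show (t, x) ∈ cone n M from h), indicator_of_mem (by simpa using h)]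
    · rw [indicator_of_notMem (show (t, x) ∉ cone n M from h), indicator_of_notMem (by simpa using h)]
  have hB0 : 0 ≤ B := (setIntegral_nonneg measurableSet_closedBall fun x hx => hG0 _
    ⟨⟨le_rfl, hR⟩, by simpa using hx⟩).trans (hB 1 le_rfl hR)
  have := norm_setIntegral_le_of_norm_le_const (μ := volume) (s := Icc (1:ℝ) R) (f := fun t => ∫ x, G' (t, x)) (C := B)
    (by simp) (fun t ht => by
      rw [Real.norm_eq_abs, sl, abs_of_nonneg]
      · exact hB t ht.1 ht.2
      · exact setIntegral_nonneg measurableSet_closedBall fun x hx => hG0 _ ⟨ht, by simpa using hx⟩)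
  refine (le_abs_self _).trans (this.trans ?_)
  have : volume.real (Icc 1 R) = R - 1 := by simp [hR]
  rw [this]
  exact mul_le_mul_of_nonneg_left (by linarith) hB0

lemma ball_int {n : ℕ} (hn : 2 ≤ n) {L e Λ : ℝ} (hL : 0 ≤ L) (hΛ : ∫ s in (0:ℝ)..L, (1 + s) ^ (-e) ≤ Λ) :
    ∫ x in closedBall (0 : Sp n) L, (1 + L - ‖x‖) ^ (-e) ≤
      (n * volume.real (ball (0 : Sp n) 1)) * (L ^ (n - 1) * Λ) := by
  haveI : Nontrivial (Sp n) := by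
    haveI : Nonempty (Fin n) := ⟨⟨0, by omega⟩⟩
    infer_instance
  have e1 : ∫ x in closedBall (0 : Sp n) L, (1 + L - ‖x‖) ^ (-e) =
      ∫ x : Sp n, (fun r => (Iic L).indicator (fun r => (1 + L - r) ^ (-e)) r) ‖x‖ := by
    rw [← integral_indicator measurableSet_closedBall]
    refine integral_congr_ae (.of_forall fun x => ?_)
    by_cases h : ‖x‖ ≤ L
    · rw [indicator_of_mem (by simpa using h)]
      simp [h]
    · rw [indicator_of_notMem (by simpa using h)]
      simp [h]
  rw [e1, integral_fun_norm_addHaar]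
  simp only [finrank_euclideanSpace, Fintype.card_fin, smul_eq_mul, nsmul_eq_mul]
  rw [mul_assoc]
  have e2 : ∫ r in Ioi (0:ℝ), r ^ (n-1) * (Iic L).indicator (fun r => (1 + L - r) ^ (-e)) r =
      ∫ r in (0:ℝ)..L, r ^ (n-1) * (1 + L - r) ^ (-e) := by
    rw [intervalIntegral.integral_of_le hL, ← Ioi_inter_Iic, ← setIntegral_indicator measurableSet_Iic]
    congr 1; ext r
    simp [indicator_apply]
  have hc : ContinuousOn (fun r => (1 + L - r) ^ (-e)) (uIcc 0 L) := by
    rw [uIcc_of_le hL]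
    refine ContinuousOn.rpow_const (by fun_prop) fun r hr => Or.inl ?_
    have := hr.2; intro h; linarith
  have b : ∫ r in (0:ℝ)..L, r ^ (n-1) * (1 + L - r) ^ (-e) ≤ ∫ r in (0:ℝ)..L, L ^ (n-1) * (1 + L - r) ^ (-e) := by
    refine intervalIntegral.integral_mono_on hL ((by fun_prop : ContinuousOn _ _).mul hc).intervalIntegrable
      (continuousOn_const.mul hc).intervalIntegrable fun r hr => ?_
    have h1 : r ^ (n-1) ≤ L ^ (n-1) := pow_le_pow_left₀ hr.1 hr.2 _
    have h2 : 0 ≤ (1 + L - r) ^ (-e) := Real.rpow_nonneg (by linarith [hr.2]) _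
    exact mul_le_mul_of_nonneg_right h1 h2
  have e3 : ∫ r in (0:ℝ)..L, (1 + L - r) ^ (-e) = ∫ s in (0:ℝ)..L, (1 + s) ^ (-e) := by
    have := intervalIntegral.integral_comp_sub_left (a := 0) (b := L) (fun s => (1 + s) ^ (-e)) L
    simp only [sub_self, sub_zero] at this
    rw [← this]
    congr 1; ext r; congr 1; ring
  rw [intervalIntegral.integral_const_mul, e3] at b
  rw [e2]
  have hv : 0 ≤ volume.real (ball (0 : Sp n) 1) := measureReal_nonneg
  have hLn : 0 ≤ L ^ (n-1) := by positivity
  exact mul_le_mul_of_nonneg_left (mul_le_mul_of_nonneg_left (b.trans (mul_le_mul_of_nonneg_left hΛ hLn)) hv) (by positivity)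

lemma delta_cont {n : ℕ} {M e : ℝ} {s : Set (ℝ × Sp n)} (hs : s ⊆ cone n M) :
    ContinuousOn (fun q : ℝ × Sp n => (M + 1 + phi q.1 - ‖q.2‖) ^ e) s := by
  refine ContinuousOn.rpow_const ?_ fun q hq => Or.inl ?_
  · exact ((continuous_const.add (phi_cont.comp continuous_fst)).sub continuous_snd.norm).continuousOn
  · have : ‖q.2‖ ≤ M + phi q.1 := hs hq
    intro h; linarith

lemma tpow_cont {n : ℕ} {M e R : ℝ} : ContinuousOn (fun q : ℝ × Sp n => q.1 ^ e) (slab n M 1 R) :=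
  ContinuousOn.rpow_const continuous_fst.continuousOn fun q hq => Or.inl (by
    have := hq.1.1; intro h; linarith)

lemma slabG {n : ℕ} {M : ℝ} (hn : 2 ≤ n) (hM : 1 < M) : ∃ C, 0 < C ∧ ∀ e R Λ : ℝ, 1 ≤ R →
    (∀ L, 0 ≤ L → L ≤ M + phi R → ∫ s in (0:ℝ)..L, (1 + s) ^ (-e) ≤ Λ) →
    ∫ q in slab n M 1 R, q.1 ^ (-(3 * ((n:ℝ) - 1) / 2)) * (M + 1 + phi q.1 - ‖q.2‖) ^ (-e) ≤ C * Λ * R := by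
  set c := n * volume.real (ball (0 : Sp n) 1) with hc
  have hc0 : 0 ≤ c := by have : 0 ≤ volume.real (ball (0 : Sp n) 1) := measureReal_nonneg
                         positivity
  refine ⟨c * (M + 1) ^ (n-1) + 1, by positivity, fun e R Λ hR hΛ => ?_⟩
  have hn' : (n - 1 : ℕ) = ((n:ℝ) - 1) := by rw [Nat.cast_sub (by omega)]; simp
  have hΛ0 : 0 ≤ Λ := by
    have := hΛ 0 le_rfl (by have := phi_nonneg (t := R) (by linarith); linarith)
    simpa using this
  refine slab_int_le hR (tpow_cont.mul (delta_cont slab_sub_cone)) ?_ ?_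
  · intro q hq
    have : ‖q.2‖ ≤ M + phi q.1 := hq.2
    exact mul_nonneg (Real.rpow_nonneg (by linarith [hq.1.1]) _) (Real.rpow_nonneg (by linarith) _)
  · intro t h1 h2
    have hph := phi_nonneg (t := t) (by linarith)
    have hL : 0 ≤ M + phi t := by linarith
    have := ball_int hn hL (hΛ _ hL (by linarith [phi_mono (by linarith) h2]))
    simp only
    rw [integral_const_mul]
    have e1 : ∫ x in closedBall (0 : Sp n) (M + phi t), (M + 1 + phi t - ‖x‖) ^ (-e) =
        ∫ x in closedBall (0 : Sp n) (M + phi t), (1 + (M + phi t) - ‖x‖) ^ (-e) := by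
      congr 1; ext x; congr 1; ring
    rw [e1]
    have tp : 0 < t := by linarith
    have ht0 : 0 < t ^ (-(3 * ((n:ℝ) - 1) / 2)) := by positivity
    refine (mul_le_mul_of_nonneg_left this ht0.le).trans ?_
    have hL2 : (M + phi t) ^ (n-1) ≤ (M+1) ^ (n-1) * t ^ (3 * ((n:ℝ) - 1) / 2) := by
      have : M + phi t ≤ (M + 1) * t ^ ((3:ℝ)/2) := by
        have : 1 ≤ t ^ ((3:ℝ)/2) := Real.one_le_rpow h1 (by norm_num)
        unfold phi; nlinarith
      refine (pow_le_pow_left₀ hL this _).trans (le_of_eq ?_)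
      rw [mul_pow, ← Real.rpow_natCast (t ^ ((3:ℝ)/2)), ← Real.rpow_mul tp.le, hn']
      congr 2; ring
    have ei : t ^ (-(3 * ((n:ℝ) - 1) / 2)) * t ^ (3 * ((n:ℝ) - 1) / 2) = 1 := by
      rw [← Real.rpow_add tp]; simp
    calc _ ≤ t ^ (-(3 * ((n:ℝ) - 1) / 2)) * (c * ((M+1) ^ (n-1) * t ^ (3 * ((n:ℝ) - 1) / 2) * Λ)) := by
          refine mul_le_mul_of_nonneg_left (mul_le_mul_of_nonneg_left (mul_le_mul_of_nonneg_right hL2 hΛ0) hc0) ht0.le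
      _ = (t ^ (-(3 * ((n:ℝ) - 1) / 2)) * t ^ (3 * ((n:ℝ) - 1) / 2)) * (c * (M+1) ^ (n-1)) * Λ := by ring
      _ ≤ _ := by rw [ei]; nlinarith
end Tric

namespace Tric

noncomputable def ps (j : ℕ) (R t : ℝ) : ℝ := (1 - t / R) ^ (j + 3)
noncomputable def ps1 (j : ℕ) (R t : ℝ) : ℝ := -(((j:ℝ) + 3) / R) * (1 - t / R) ^ (j + 2)
noncomputable def ps2 (j : ℕ) (R t : ℝ) : ℝ := ((j:ℝ) + 3) * (j + 2) / R ^ 2 * (1 - t / R) ^ (j + 1)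

lemma ps_cd (j : ℕ) (R : ℝ) : ContDiff ℝ 2 (ps j R) := by unfold ps; fun_prop
lemma ps1_c (j : ℕ) (R : ℝ) : Continuous (ps1 j R) := by unfold ps1; fun_prop
lemma ps2_c (j : ℕ) (R : ℝ) : Continuous (ps2 j R) := by unfold ps2; fun_prop
lemma ps_lin (R t : ℝ) : HasDerivAt (fun t => 1 - t / R) (-(1/R)) t := by
  have := ((hasDerivAt_id t).div_const R).const_sub 1
  exact this
lemma ps_d (j : ℕ) (R t : ℝ) : HasDerivAt (ps j R) (ps1 j R t) t := by
  have := (ps_lin R t).pow (j + 3)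
  refine this.congr_deriv ?_
  unfold ps1; push_cast; ring
lemma ps1_d (j : ℕ) (R t : ℝ) : HasDerivAt (ps1 j R) (ps2 j R t) t := by
  have := ((ps_lin R t).pow (j + 2)).const_mul (-(((j:ℝ) + 3) / R))
  refine this.congr_deriv ?_
  unfold ps2; push_cast; ring
lemma ps_R (j : ℕ) {R : ℝ} (hR : R ≠ 0) : ps j R R = 0 ∧ ps1 j R R = 0 := by
  unfold ps ps1; simp [div_self hR]

noncomputable def Vf (n : ℕ) (M p : ℝ) (u : ℝ × Sp n → ℝ) (σ : ℝ) (j : ℕ) (R : ℝ) : ℝ :=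
  ∫ q in slab n M 1 R, |u q| ^ p * (q.1 ^ (-σ) * (q.1 / R * (1 - q.1 / R) ^ (j + 2)))

/-- pointwise bound of the error kernel -/
lemma err_pt {j : ℕ} {R t C0 B P P1 : ℝ} (ht : 1 ≤ t) (hR : t ≤ R) (hB : 0 ≤ B) (hC0 : 0 ≤ C0)
    (h1 : |P1| ≤ C0 * B) (h0 : |P| ≤ C0 * (t * B)) :
    |2 * ps1 j R t * P1 + ps2 j R t * P| ≤ (2 * (j + 3) + (j + 3) * (j + 2)) * C0 * (R⁻¹ * ((1 - t / R) ^ (j + 1) * B)) := by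
  have Rp : 0 < R := by linarith
  set x := 1 - t / R with hx
  have hx0 : 0 ≤ x := by rw [hx, sub_nonneg]; exact (div_le_one Rp).2 hR
  have hx1 : x ≤ 1 := by rw [hx]; have : 0 ≤ t / R := by positivity
                         linarith
  have a1 : |ps1 j R t| ≤ (j + 3) * (R⁻¹ * x ^ (j+1)) := by
    unfold ps1
    rw [abs_mul, abs_neg, abs_of_nonneg (by positivity), abs_of_nonneg (by positivity), ← hx, pow_succ]
    have : x ^ (j+1) * x ≤ x ^ (j+1) * 1 := by gcongr
    calc _ ≤ (j + 3) / R * (x ^ (j+1) * 1) := by gcongr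
      _ = _ := by ring
  have a2 : |ps2 j R t| * t ≤ (j + 3) * (j + 2) * (R⁻¹ * x ^ (j+1)) := by
    unfold ps2
    rw [← hx, abs_of_nonneg (by positivity)]
    calc _ ≤ ((j:ℝ) + 3) * (j + 2) / R ^ 2 * x ^ (j + 1) * R := by gcongr
      _ = _ := by field_simp
  calc _ ≤ |2 * ps1 j R t * P1| + |ps2 j R t * P| := abs_add_le _ _
    _ = 2 * |ps1 j R t| * |P1| + |ps2 j R t| * |P| := by simp [abs_mul]
    _ ≤ 2 * ((j + 3) * (R⁻¹ * x ^ (j+1))) * (C0 * B) + |ps2 j R t| * (C0 * (t * B)) := by gcongr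
    _ = 2 * ((j + 3) * (R⁻¹ * x ^ (j+1))) * (C0 * B) + (|ps2 j R t| * t) * (C0 * B) := by ring
    _ ≤ 2 * ((j + 3) * (R⁻¹ * x ^ (j+1))) * (C0 * B) + ((j + 3) * (j + 2) * (R⁻¹ * x ^ (j+1))) * (C0 * B) := by gcongr
    _ = _ := by ring

lemma claimH {n : ℕ} {M p : ℝ} {u : ℝ × Sp n → ℝ} (S : Sol n M p u) {σ κ β C0 : ℝ} {j : ℕ}
    (hj : ((j:ℝ) + 2) / p ≤ j + 1) (hC0 : 0 ≤ C0) {P P1 : ℝ × Sp n → ℝ}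
    (b1 : ∀ q ∈ Om n, q ∈ cone n M → 1 ≤ q.1 → |P1 q| ≤ C0 * (q.1 ^ ((1:ℝ)/2) * phi q.1 ^ (-κ) * (M + 1 + phi q.1 - ‖q.2‖) ^ (-β)))
    (b0 : ∀ q ∈ Om n, q ∈ cone n M → 1 ≤ q.1 → |P q| ≤ C0 * (q.1 * (q.1 ^ ((1:ℝ)/2) * phi q.1 ^ (-κ) * (M + 1 + phi q.1 - ‖q.2‖) ^ (-β))))
    (hσ : (1/2 - 3 * κ / 2 + σ / p - 1/p) * (p / (p-1)) = -(3 * ((n:ℝ) - 1) / 2)) :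
    ∃ C, 0 < C ∧ ∀ R Λ : ℝ, 1 ≤ R → (∀ L, 0 ≤ L → L ≤ M + phi R → ∫ s in (0:ℝ)..L, (1 + s) ^ (-(β * (p / (p - 1)))) ≤ Λ) →
      |∫ q in slab n M 1 R, u q * (2 * ps1 j R q.1 * P1 q + ps2 j R q.1 * P q)| ≤
        C * (Vf n M p u σ j R ^ (1/p) * Λ ^ (1 - 1/p)) := by
  have hp := S.hp
  have hp0 : 0 < p := by linarith
  have hp1 : 0 < p - 1 := by linarith
  obtain ⟨Cg, hCg, G⟩ := slabG S.hn S.hM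
  set K := (2 * ((j:ℝ) + 3) + (j + 3) * (j + 2)) * C0 * (2/3) ^ (-κ) + 1 with hK
  have hKp : 0 < K := by positivity
  set p' := p / (p - 1) with hp'
  have hp'p : 0 < p' := by positivity
  have h11 : p' * (1 - 1/p) = 1 := by rw [hp']; field_simp
  have h1p : 0 < 1 - 1/p := by rw [sub_pos, div_lt_one hp0]; exact hp
  refine ⟨(K ^ p' * Cg) ^ (1 - 1/p), by positivity, fun R Λ hR hΛ => ?_⟩
  have Rp : 0 < R := by linarith
  have hΛ0 : 0 ≤ Λ := by
    have := hΛ 0 le_rfl (by have := phi_nonneg (t := R) (by linarith); linarith [S.hM])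
    simpa using this
  set e2 := 1/2 - 3 * κ / 2 + σ / p - 1/p with he2
  set w : ℝ × Sp n → ℝ := fun q => q.1 ^ (-σ) * (q.1 / R * (1 - q.1 / R) ^ (j + 2)) with hw
  set g : ℝ × Sp n → ℝ := fun q => K * R ^ (-(1 - 1/p)) * (q.1 ^ e2 * (M + 1 + phi q.1 - ‖q.2‖) ^ (-β)) with hg
  have cw : ContinuousOn w (slab n M 1 R) := tpow_cont.mul (by fun_prop)
  have cg : ContinuousOn g (slab n M 1 R) := continuousOn_const.mul (tpow_cont.mul (delta_cont slab_sub_cone))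
  have basics : ∀ q ∈ slab n M 1 R, 0 < q.1 ∧ 0 ≤ 1 - q.1 / R ∧ 1 - q.1 / R ≤ 1 ∧ 1 ≤ M + 1 + phi q.1 - ‖q.2‖ := by
    intro q hq
    have h1 := hq.1.1
    have h2 : ‖q.2‖ ≤ M + phi q.1 := hq.2
    have : 0 < q.1 := by linarith
    refine ⟨by linarith, sub_nonneg.2 ((div_le_one Rp).2 hq.1.2), ?_, by linarith⟩
    have : 0 ≤ q.1 / R := by positivity
    linarith
  have H := hold S one_pos (F := fun q => u q * (2 * ps1 j R q.1 * P1 q + ps2 j R q.1 * P q)) cw (fun q hq => by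
      obtain ⟨a, b, c, d⟩ := basics q hq
      simp only [hw]; positivity) cg (fun q hq => by
      obtain ⟨a, b, c, d⟩ := basics q hq
      have : 0 < M + 1 + phi q.1 - ‖q.2‖ := by linarith
      simp only [hg]; positivity) ?_
  · refine H.trans ?_
    have e3 : ∫ q in slab n M 1 R, g q ^ p' = (K ^ p' * R⁻¹) *
        ∫ q in slab n M 1 R, q.1 ^ (-(3 * ((n:ℝ) - 1) / 2)) * (M + 1 + phi q.1 - ‖q.2‖) ^ (-(β * p')) := by
      rw [← integral_const_mul]
      refine setIntegral_congr_fun (slab_meas n M 1 R zero_le_one) fun q hq => ?_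
      obtain ⟨a, b, c, d⟩ := basics q hq
      have d0 : 0 < M + 1 + phi q.1 - ‖q.2‖ := by linarith
      simp only [hg]
      rw [Real.mul_rpow (by positivity) (by positivity), Real.mul_rpow (by positivity) (by positivity),
        Real.mul_rpow (by positivity) (by positivity), ← Real.rpow_mul Rp.le, ← Real.rpow_mul a.le,
        ← Real.rpow_mul d0.le, hσ, show -(1 - 1/p) * p' = -1 by linarith, Real.rpow_neg_one, neg_mul]
    have e4 : ∫ q in slab n M 1 R, g q ^ p' ≤ (K ^ p' * Cg) * Λ := by
      rw [e3]
      calc _ ≤ (K ^ p' * R⁻¹) * (Cg * Λ * R) := by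
            refine mul_le_mul_of_nonneg_left (G _ R Λ hR hΛ) (by positivity)
        _ = _ := by field_simp
    have e5 : 0 ≤ ∫ q in slab n M 1 R, g q ^ p' := by
      refine setIntegral_nonneg (slab_meas n M 1 R zero_le_one) fun q hq => ?_
      obtain ⟨a, b, c, d⟩ := basics q hq
      have : 0 < M + 1 + phi q.1 - ‖q.2‖ := by linarith
      simp only [hg]; positivity
    have hV0 : 0 ≤ Vf n M p u σ j R := by
      refine setIntegral_nonneg (slab_meas n M 1 R zero_le_one) fun q hq => ?_
      obtain ⟨a, b, c, d⟩ := basics q hq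
      positivity
    change Vf n M p u σ j R ^ (1/p) * _ ≤ _
    calc _ ≤ Vf n M p u σ j R ^ (1/p) * ((K ^ p' * Cg) * Λ) ^ (1 - 1/p) := by gcongr
      _ = _ := by rw [Real.mul_rpow (by positivity) hΛ0]; ring
  · intro q hq
    obtain ⟨a, b, c, d⟩ := basics q hq
    have d0 : 0 < M + 1 + phi q.1 - ‖q.2‖ := by linarith
    have ho := slab_sub_Om one_pos hq
    have hph := phi_pos a
    rw [abs_mul]
    refine mul_le_mul_of_nonneg_left ?_ (abs_nonneg _)
    set δ := M + 1 + phi q.1 - ‖q.2‖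
    set B := q.1 ^ ((1:ℝ)/2) * phi q.1 ^ (-κ) * δ ^ (-β) with hB
    refine (err_pt (B := B) hq.1.1 hq.1.2 (by positivity) hC0 (b1 q ho hq.2 hq.1.1) (b0 q ho hq.2 hq.1.1)).trans ?_
    set x := 1 - q.1 / R with hx
    have x1 : x ^ (j + 1) ≤ (x ^ (j+2)) ^ (1/p) := by
      rw [← Real.rpow_natCast x (j+1), ← Real.rpow_natCast x (j+2), ← Real.rpow_mul b]
      refine Real.rpow_le_rpow_of_exponent_ge_of_imp b c ?_ ?_
      · push_cast; rw [mul_one_div]; exact hj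
      · intro _ h; exfalso; norm_cast at h
    have y1 : phi q.1 ^ (-κ) = (2/3) ^ (-κ) * q.1 ^ (-(3 * κ / 2)) := by
      unfold phi
      rw [Real.mul_rpow (by norm_num) (by positivity), ← Real.rpow_mul a.le]; congr 2; ring
    have w1 : w q ^ (1/p) = q.1 ^ (-(σ / p)) * (q.1 ^ (1/p) * R ^ (-(1/p)) * (x ^ (j+2)) ^ (1/p)) := by
      simp only [hw]
      rw [Real.mul_rpow (by positivity) (by positivity), Real.mul_rpow (by positivity) (by positivity),
        Real.div_rpow a.le Rp.le, ← Real.rpow_mul a.le, Real.rpow_neg Rp.le]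
      congr 2; ring
    have hpw : w q ^ (1/p) * g q = K * (R⁻¹ * ((x ^ (j+2)) ^ (1/p) * (q.1 ^ (1/2 - 3 * κ / 2) * δ ^ (-β)))) := by
      have r1 : R ^ (-(1/p)) * R ^ (-(1 - 1/p)) = R⁻¹ := by
        rw [← Real.rpow_add Rp, ← Real.rpow_neg_one]; congr 1; ring
      have r2 : q.1 ^ (-(σ / p)) * q.1 ^ (1/p) * q.1 ^ e2 = q.1 ^ (1/2 - 3 * κ / 2) := by
        rw [← Real.rpow_add a, ← Real.rpow_add a]; congr 1; rw [he2]; ring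
      rw [w1, ← r1, ← r2]; simp only [hg]; ring
    rw [hpw, hB, y1]
    have r3 : q.1 ^ ((1:ℝ)/2 - 3 * κ / 2) = q.1 ^ ((1:ℝ)/2) * q.1 ^ (-(3 * κ / 2)) := by
      rw [← Real.rpow_add a]; congr 1
    rw [r3]
    set A := q.1 ^ ((1:ℝ)/2) * q.1 ^ (-(3 * κ / 2)) * δ ^ (-β) with hA
    have hA0 : 0 ≤ A := by positivity
    calc _ = ((2 * ((j:ℝ) + 3) + (j + 3) * (j + 2)) * C0 * (2/3) ^ (-κ)) * (R⁻¹ * (x ^ (j+1) * A)) := by rw [hA]; ring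
      _ ≤ K * (R⁻¹ * ((x ^ (j+2)) ^ (1/p) * A)) := by
        gcongr
        rw [hK]; linarith
end Tric

namespace Tric

lemma Sol.crit {n : ℕ} {M p : ℝ} {u : ℝ × Sp n → ℝ} (S : Sol n M p u) : 3 * (n:ℝ) * (p * (p - 1)) = 2 * p ^ 2 + 6 := by
  have := S.hcrit; nlinarith

lemma Sol.hσ {n : ℕ} {M p : ℝ} {u : ℝ × Sp n → ℝ} (S : Sol n M p u) {σ κ : ℝ} (hκ : κ = mm n + 1/6) (hσ : σ = 3/2 * (κ - 1/p)) :
    (1/2 - 3 * κ / 2 + σ / p - 1/p) * (p / (p-1)) = -(3 * ((n:ℝ) - 1) / 2) := by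
  have hp := S.hp
  have h1 : p ≠ 0 := by linarith
  have h2 : p - 1 ≠ 0 := by linarith
  have hc := S.crit
  rw [hσ, hκ]; unfold mm
  field_simp
  linear_combination 6 * hc

lemma Sol.n2 {n : ℕ} {M p : ℝ} {u : ℝ × Sp n → ℝ} (S : Sol n M p u) : n = 2 → 2 < p := by
  intro h
  have hc := S.crit
  have hp := S.hp
  rw [h] at hc; push_cast at hc
  nlinarith

lemma Sol.kap {n : ℕ} {M p : ℝ} {u : ℝ × Sp n → ℝ} (S : Sol n M p u) : 1/p < mm n + 1/6 := by
  have hp := S.hp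
  have hp0 : 0 < p := by linarith
  have hn := S.hn
  rcases hn.eq_or_lt with h | h
  · have := S.n2 h.symm
    have h3 : 1/p < 1/2 := by rw [div_lt_div_iff₀ hp0 two_pos]; linarith
    unfold mm; rw [← h]; push_cast; linarith
  · have h3 : 1/p < 1 := by rw [div_lt_one hp0]; exact hp
    have : (3:ℝ) ≤ n := by exact_mod_cast h
    unfold mm; linarith

lemma Ph_bd {ν : Measure ℝ} [SFinite ν] {n : ℕ} {M γ β C' : ℝ} (hn : 2 ≤ n) (hM : 0 ≤ M) (hγ0 : 0 ≤ γ) (hγ : 5/6 - mm n ≤ γ)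
    (hν : Integrable (fun a => (1 + |a|) ^ (-(2 * mm n))) ν)
    (hi : ∀ δ, 1 ≤ δ → Integrable (fun a => (δ + |a|) ^ (-mm n - 5/6 + γ)) ν)
    (hb : ∀ δ, 1 ≤ δ → ∫ a, (δ + |a|) ^ (-mm n - 5/6 + γ) ∂ν ≤ C' * δ ^ (γ - β)) :
    ∃ C, 0 ≤ C ∧ ∀ q ∈ Om n, q ∈ cone n M → 1 ≤ q.1 →
    |Ph1 n M ν q| ≤ C * (q.1 ^ ((1:ℝ)/2) * phi q.1 ^ (-(mm n + 1/6)) * (M + 1 + phi q.1 - ‖q.2‖) ^ (-β)) ∧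
    |Ph n M ν q| ≤ C * (q.1 * (q.1 ^ ((1:ℝ)/2) * phi q.1 ^ (-(mm n + 1/6)) * (M + 1 + phi q.1 - ‖q.2‖) ^ (-β))) := by
  obtain ⟨C, hC, B⟩ := I_bd (M := M) hn hM hγ0 hγ
  refine ⟨C * |C'|, by positivity, fun q ho hc h1 => ?_⟩
  have hx : ‖q.2‖ ≤ M + phi q.1 := hc
  set δ := M + 1 + phi q.1 - ‖q.2‖ with hδ
  have d1 : 1 ≤ δ := by rw [hδ]; linarith
  have d0 : 0 < δ := by linarith
  have ht : 0 < q.1 := mem_Om.1 ho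
  have hph := phi_pos ht
  have ek : -(mm n + 1/6) = -mm n - 1/6 := by ring
  obtain ⟨i0, i1, -⟩ := k_int hn hν ho hc
  set E := q.1 ^ ((1:ℝ)/2) * phi q.1 ^ (-mm n - 1/6) with hE
  have hE0 : 0 ≤ E := by positivity
  have hfin : δ ^ (-γ) * ∫ a, (δ + |a|) ^ (-mm n - 5/6 + γ) ∂ν ≤ |C'| * δ ^ (-β) := by
    calc _ ≤ δ ^ (-γ) * (|C'| * δ ^ (γ - β)) := by
          refine mul_le_mul_of_nonneg_left ((hb δ d1).trans ?_) (by positivity)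
          exact mul_le_mul_of_nonneg_right (le_abs_self _) (by positivity)
      _ = |C'| * (δ ^ (-γ) * δ ^ (γ - β)) := by ring
      _ = _ := by rw [← Real.rpow_add d0]; congr 2; ring
  have key : ∀ f : ℝ × ℝ → ℝ, ∀ c : ℝ, 0 ≤ c → Integrable f ((volume : Measure ℝ).prod ν) →
      (∀ a, ∫ ρ, |f (ρ, a)| ≤ C * (c * (E * (δ ^ (-γ) * (δ + |a|) ^ (-mm n - 5/6 + γ))))) →
      |∫ z, f z ∂((volume : Measure ℝ).prod ν)| ≤ C * |C'| * (c * (E * δ ^ (-β))) := by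
    intro f c hc0 hf hb2
    calc _ ≤ ∫ z, |f z| ∂((volume : Measure ℝ).prod ν) := abs_integral_le_integral_abs
      _ = ∫ a, (∫ ρ, |f (ρ, a)|) ∂ν := integral_prod_symm _ hf.abs
      _ ≤ ∫ a, C * (c * (E * (δ ^ (-γ) * (δ + |a|) ^ (-mm n - 5/6 + γ)))) ∂ν := by
        refine integral_mono_of_nonneg (Filter.Eventually.of_forall fun a => integral_nonneg fun ρ => abs_nonneg _) ?_
          (Filter.Eventually.of_forall hb2)
        exact ((((hi δ d1).const_mul _).const_mul _).const_mul _).const_mul _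
      _ = C * (c * (E * (δ ^ (-γ) * ∫ a, (δ + |a|) ^ (-mm n - 5/6 + γ) ∂ν))) := by
        simp only [integral_const_mul]
      _ ≤ C * (c * (E * (|C'| * δ ^ (-β)))) := by
        refine mul_le_mul_of_nonneg_left (mul_le_mul_of_nonneg_left (mul_le_mul_of_nonneg_left hfin hE0) hc0) hC.le
      _ = _ := by ring
  constructor
  · have := key (fun z => k1 n M z q) 1 zero_le_one i1 (fun a => by
      rw [one_mul]; exact (B a q ho hc h1 δ hδ).1)
    rw [one_mul] at this; rw [ek]; exact this
  · have := key (fun z => k0 n M z q) q.1 ht.le i0 (fun a => (B a q ho hc h1 δ hδ).2)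
    rw [ek]; exact this

/-- measurability and boundedness of Ph on slabs -/
lemma Ph_meas (n : ℕ) (M : ℝ) (ν : Measure ℝ) [SFinite ν] : Measurable (Ph n M ν) ∧ Measurable (Ph1 n M ν) := by
  constructor
  · exact ((k0_meas n M).stronglyMeasurable.integral_prod_left (μ := (volume : Measure ℝ).prod ν)).measurable
  · exact ((k1_meas n M).stronglyMeasurable.integral_prod_left (μ := (volume : Measure ℝ).prod ν)).measurable

lemma Ph_bdd {n : ℕ} {M t1 R : ℝ} {ν : Measure ℝ} [SFinite ν] (hn : 2 ≤ n) (h1 : 0 < t1)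
    (hν : Integrable (fun a => (1 + |a|) ^ (-(2 * mm n))) ν) :
    ∃ C, 0 ≤ C ∧ ∀ q ∈ slab n M t1 R, |Ph n M ν q| ≤ C ∧ |Ph1 n M ν q| ≤ C := by
  obtain ⟨C, hC, h⟩ := coarse (M := M) (R := R) hn h1
  have hi := maj_int hν C
  refine ⟨∫ z : ℝ × ℝ, C * ((tau z.1)⁻¹ * (1 + |z.2|) ^ (-(2 * mm n))) ∂((volume : Measure ℝ).prod ν), ?_, fun q hq => ⟨?_, ?_⟩⟩
  · refine integral_nonneg fun z => ?_
    have := tau_pos z.1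
    positivity
  · exact norm_integral_le_of_norm_le (f := fun z => k0 n M z q) hi (Filter.Eventually.of_forall fun z => (h z q hq).1)
  · exact norm_integral_le_of_norm_le (f := fun z => k1 n M z q) hi (Filter.Eventually.of_forall fun z => (h z q hq).2.1)

lemma Ph_nonneg {n : ℕ} {M : ℝ} {ν : Measure ℝ} {q : ℝ × Sp n} (ho : q ∈ Om n) (hc : q ∈ cone n M) : 0 ≤ Ph n M ν q := by
  refine integral_nonneg fun z => ?_
  have := tau_pos z.1
  have := W_one (z := z) ho hc
  simp only [k0, Pi.zero_apply]; positivity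

lemma Lam_gt {e : ℝ} (he : 1 < e) {L : ℝ} (hL : 0 ≤ L) : ∫ s in (0:ℝ)..L, (1 + s) ^ (-e) ≤ 1 / (e - 1) := by
  have h1 : ∫ s in (0:ℝ)..L, (1 + s) ^ (-e) = ∫ s in (1:ℝ)..(1+L), s ^ (-e) := by
    have := intervalIntegral.integral_comp_add_left (a := 0) (b := L) (fun s : ℝ => s ^ (-e)) 1
    rw [this]; norm_num
  rw [h1, integral_rpow (Or.inr ⟨by linarith, by
    rw [uIcc_of_le (by linarith)]; intro h; linarith [h.1]⟩)]
  have h2 : 0 ≤ (1 + L) ^ (-e + 1) := by positivity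
  rw [Real.one_rpow, show ((1 + L) ^ (-e + 1) - 1) / (-e + 1) = (1 - (1 + L) ^ (-e + 1)) / (e - 1) by
    rw [← neg_div_neg_eq]; congr 1 <;> ring]
  have : 0 < e - 1 := by linarith
  gcongr; linarith

lemma Lam_one {M : ℝ} (hM : 1 < M) : ∃ C, 0 < C ∧ ∀ R L : ℝ, 1 ≤ R → 0 ≤ L → L ≤ M + phi R →
    ∫ s in (0:ℝ)..L, (1 + s) ^ (-(1:ℝ)) ≤ C * (1 + Real.log R) := by
  refine ⟨M + 3/2, by linarith, fun R L hR hL h => ?_⟩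
  have h1 : ∫ s in (0:ℝ)..L, (1 + s) ^ (-(1:ℝ)) = ∫ s in (1:ℝ)..(1+L), s⁻¹ := by
    have := intervalIntegral.integral_comp_add_left (a := 0) (b := L) (fun s : ℝ => s⁻¹) 1
    rw [add_zero] at this
    rw [← this]; simp only [Real.rpow_neg_one]
  rw [h1, integral_inv (by rw [uIcc_of_le (by linarith)]; intro h; linarith [h.1]), div_one]
  have h2 : 1 + L ≤ (M + 2) * R ^ ((3:ℝ)/2) := by
    have : 1 ≤ R ^ ((3:ℝ)/2) := Real.one_le_rpow hR (by norm_num)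
    unfold phi at h; nlinarith
  have h3 : 0 < R ^ ((3:ℝ)/2) := by positivity
  have h4 := Real.log_nonneg hR
  calc Real.log (1 + L) ≤ Real.log ((M + 2) * R ^ ((3:ℝ)/2)) := Real.log_le_log (by linarith) h2
    _ = Real.log (M + 2) + 3/2 * Real.log R := by
      rw [Real.log_mul (by linarith) h3.ne', Real.log_rpow (by linarith)]
    _ ≤ (M + 3/2) * (1 + Real.log R) := by
      have := Real.log_le_sub_one_of_pos (show 0 < M + 2 by linarith)
      nlinarith

end Tric

open Filter Topology
namespace Tric

lemma Sol.c1 {n : ℕ} {M p : ℝ} {u : ℝ × Sp n → ℝ} (S : Sol n M p u) : ContDiffOn ℝ 1 u (Om n) :=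
  S.c2.of_le (by norm_num)

lemma mul_int {n : ℕ} {M C t : ℝ} {G P : ℝ × Sp n → ℝ} (hG : ContinuousOn G (Om n))
    (hs : ∀ q ∈ Om n, q ∉ cone n M → G q = 0) (ht : 0 < t) (hP : Measurable P)
    (hb : ∀ q ∈ slab n M t t, |P q| ≤ C) : Integrable fun x => G (t, x) * P (t, x) := by
  refine ((slice_int hG hs ht).abs.const_mul C).mono' ?_ (Eventually.of_forall fun x => ?_)
  · exact (slice_cont hG ht).aestronglyMeasurable.mul (hP.comp (by fun_prop : Measurable fun x : Sp n => (t, x))).aestronglyMeasurable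
  · rw [Real.norm_eq_abs, abs_mul, mul_comm]
    by_cases h : (t, x) ∈ cone n M
    · exact mul_le_mul_of_nonneg_right (hb _ (slab_self h)) (abs_nonneg _)
    · rw [hs _ (mem_Om.2 ht) h]; simp

lemma ut_off {n : ℕ} {M p : ℝ} {u : ℝ × Sp n → ℝ} (S : Sol n M p u) :
    ContinuousOn (fun q => fderiv ℝ u q (1, 0)) (Om n) ∧ ∀ q ∈ Om n, q ∉ cone n M → fderiv ℝ u q (1, 0) = 0 := by
  refine ⟨C1_fderiv S.c1 _, fun q hq hc => ?_⟩
  rw [fderiv_off S.supp hq hc]; rfl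

lemma D_lin {n : ℕ} {M p : ℝ} {u : ℝ × Sp n → ℝ} (S : Sol n M p u) {P P1 : ℝ × Sp n → ℝ}
    (hP : Measurable P) (hP1 : Measurable P1) {C : ℝ} (hb : ∀ q ∈ slab n M 1 1, |P q| ≤ C ∧ |P1 q| ≤ C) (ψ ψ1 : ℝ → ℝ) :
    Dat u (fun q => P q * ψ q.1) (fun q => P1 q * ψ q.1 + P q * ψ1 q.1) 1 =
      ψ 1 * Dat u P P1 1 - ψ1 1 * ∫ x, u (1, x) * P (1, x) := by
  unfold Dat
  have i1 := mul_int (ut_off S).1 (ut_off S).2 one_pos hP (fun q hq => (hb q hq).1)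
  have i2 := mul_int S.cont S.supp one_pos hP (fun q hq => (hb q hq).1)
  have i3 := mul_int S.cont S.supp one_pos hP1 (fun q hq => (hb q hq).2)
  have i4 : Integrable fun x => ψ 1 * (fderiv ℝ u (1, x) (1, 0) * P (1, x) - u (1, x) * P1 (1, x)) := (i1.sub i3).const_mul _
  rw [← integral_const_mul, ← integral_const_mul, ← integral_sub i4 (i2.const_mul _)]
  congr 1; funext x; ring

def Qc (n : ℕ) (M : ℝ) : Set (ℝ × Sp n) := {q | 1 ≤ q.1 ∧ ‖q.2‖ ≤ M + phi q.1}

lemma slab_sub_Qc {n : ℕ} {M R : ℝ} : slab n M 1 R ⊆ Qc n M := fun q hq => ⟨hq.1.1, hq.2⟩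
lemma Qc_meas (n : ℕ) (M : ℝ) : MeasurableSet (Qc n M) := by
  have : IsClosed (Qc n M) := (isClosed_le continuous_const continuous_fst).inter (cone_closed n M)
  exact this.measurableSet
lemma Qc_Om {n : ℕ} {M : ℝ} {q : ℝ × Sp n} (h : q ∈ Qc n M) : q ∈ Om n := mem_Om.2 (lt_of_lt_of_le one_pos h.1)

lemma slab_cover (n : ℕ) (M : ℝ) {Rk : ℕ → ℝ} (hk : Tendsto Rk atTop atTop) :
    AECover (volume.restrict (Qc n M)) atTop (fun k => slab n M 1 (Rk k)) where
  ae_eventually_mem := by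
    refine (ae_restrict_iff' (Qc_meas n M)).2 (Eventually.of_forall fun q hq => ?_)
    filter_upwards [hk.eventually_ge_atTop q.1] with k h
    exact ⟨⟨hq.1, h⟩, hq.2⟩
  measurableSet := fun k => slab_meas n M 1 _ zero_le_one

lemma restr_slab {n : ℕ} {M R : ℝ} : (volume.restrict (Qc n M)).restrict (slab n M 1 R) = volume.restrict (slab n M 1 R) := by
  rw [Measure.restrict_restrict (slab_meas n M 1 R zero_le_one), inter_eq_left.2 slab_sub_Qc]

lemma ps_bd {j : ℕ} {R t : ℝ} (ht : 0 ≤ t) (hR : t ≤ R) : 0 ≤ ps j R t ∧ ps j R t ≤ 1 := by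
  rcases (ht.trans hR).eq_or_lt with h | h
  · unfold ps; rw [← h]; simp
  · have h1 : 0 ≤ t / R := by positivity
    have h2 : t / R ≤ 1 := (div_le_one h).2 hR
    unfold ps
    exact ⟨pow_nonneg (by linarith) _, pow_le_one₀ (by linarith) (by linarith)⟩

lemma ps_lim (j : ℕ) (t : ℝ) {Rk : ℕ → ℝ} (hk : Tendsto Rk atTop atTop) : Tendsto (fun k => ps j (Rk k) t) atTop (𝓝 1) := by
  unfold ps
  have := (((tendsto_const_nhds (x := t)).div_atTop hk).const_sub 1).pow (j + 3)
  simpa using this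

lemma ps1_lim (j : ℕ) (t : ℝ) {Rk : ℕ → ℝ} (hk : Tendsto Rk atTop atTop) : Tendsto (fun k => ps1 j (Rk k) t) atTop (𝓝 0) := by
  unfold ps1
  have := (((tendsto_const_nhds (x := t)).div_atTop hk).const_sub 1).pow (j + 2)
  have h2 := ((tendsto_const_nhds (x := (j:ℝ) + 3)).div_atTop hk).neg.mul this
  simpa using h2

lemma lim_int {n : ℕ} {M : ℝ} {F : ℝ × Sp n → ℝ} (j : ℕ) (hF0 : ∀ q ∈ Qc n M, 0 ≤ F q)
    (hF : ∀ R, IntegrableOn F (slab n M 1 R)) {Rk : ℕ → ℝ} (hk : Tendsto Rk atTop atTop) {X : ℝ}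
    (hX : Tendsto (fun k => ∫ q in slab n M 1 (Rk k), F q * ps j (Rk k) q.1) atTop (𝓝 X)) :
    IntegrableOn F (Qc n M) ∧ ∫ q in Qc n M, F q = X := by
  have hFp : ∀ k, IntegrableOn (fun q => F q * ps j (Rk k) q.1) (slab n M 1 (Rk k)) := fun k => by
    refine (hF (Rk k)).mono' ((hF (Rk k)).aestronglyMeasurable.mul ?_) ?_
    · exact ((ps_cd j (Rk k)).continuous.comp continuous_fst).aestronglyMeasurable
    · refine (ae_restrict_iff' (slab_meas n M 1 _ zero_le_one)).2 (Eventually.of_forall fun q hq => ?_)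
      have h0 := hF0 q (slab_sub_Qc hq)
      have h1 := ps_bd (j := j) (zero_le_one.trans hq.1.1) hq.1.2
      rw [Real.norm_eq_abs, abs_of_nonneg (mul_nonneg h0 h1.1)]
      nlinarith
  have hb : ∀ r : ℝ, 1 ≤ r → ∫ q in slab n M 1 r, F q ≤ X := by
    intro r hr
    have h1 : Tendsto (fun k => ps j (Rk k) r * ∫ q in slab n M 1 r, F q) atTop (𝓝 (1 * ∫ q in slab n M 1 r, F q)) :=
      (ps_lim j r hk).mul_const _
    rw [one_mul] at h1
    refine le_of_tendsto_of_tendsto h1 hX ?_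
    filter_upwards [hk.eventually_ge_atTop r] with k hkr
    have hsub : slab n M 1 r ⊆ slab n M 1 (Rk k) := fun q hq => ⟨⟨hq.1.1, hq.1.2.trans hkr⟩, hq.2⟩
    rw [← integral_const_mul]
    calc _ ≤ ∫ q in slab n M 1 r, F q * ps j (Rk k) q.1 := by
          refine setIntegral_mono_on ((hF r).const_mul _) ((hFp k).mono_set hsub) (slab_meas n M 1 _ zero_le_one) fun q hq => ?_
          rw [mul_comm]
          refine mul_le_mul_of_nonneg_left ?_ (hF0 q (slab_sub_Qc hq))
          unfold ps
          have Rp : 0 < Rk k := by linarith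
          have : r / Rk k ≤ 1 := (div_le_one Rp).2 hkr
          have : q.1 / Rk k ≤ r / Rk k := by gcongr; exact hq.1.2
          gcongr
      _ ≤ _ := by
          refine setIntegral_mono_set (hFp k) ?_ hsub.eventuallyLE
          refine (ae_restrict_iff' (slab_meas n M 1 _ zero_le_one)).2 (Eventually.of_forall fun q hq => ?_)
          exact mul_nonneg (hF0 q (slab_sub_Qc hq)) (ps_bd (zero_le_one.trans hq.1.1) hq.1.2).1
  have hcov := slab_cover n M (tendsto_natCast_atTop_atTop (R := ℝ))
  have hI : IntegrableOn F (Qc n M) := by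
    refine hcov.integrable_of_integral_bounded_of_nonneg_ae X (fun k => ?_) ?_ ?_
    · rw [IntegrableOn, restr_slab]; exact hF _
    · exact (ae_restrict_iff' (Qc_meas n M)).2 (Eventually.of_forall hF0)
    · filter_upwards [eventually_ge_atTop 1] with k hk1
      rw [restr_slab]; exact hb k (by exact_mod_cast hk1)
  refine ⟨hI, ?_⟩
  have h2 : Tendsto (fun k => ∫ q in Qc n M, (slab n M 1 (Rk k)).indicator (fun q => F q * ps j (Rk k) q.1) q) atTop (𝓝 (∫ q in Qc n M, F q)) := by
    refine tendsto_integral_of_dominated_convergence F (fun k => ?_) hI (fun k => ?_) ?_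
    · have := (hFp k).integrable_indicator (slab_meas n M 1 _ zero_le_one)
      exact this.integrableOn.aestronglyMeasurable
    · refine (ae_restrict_iff' (Qc_meas n M)).2 (Eventually.of_forall fun q hq => ?_)
      have h0 := hF0 q hq
      by_cases h : q ∈ slab n M 1 (Rk k)
      · have h1 := ps_bd (j := j) (zero_le_one.trans h.1.1) h.1.2
        rw [indicator_of_mem h, Real.norm_eq_abs, abs_of_nonneg (mul_nonneg h0 h1.1)]
        nlinarith
      · rw [indicator_of_notMem h, norm_zero]; exact h0
    · refine (ae_restrict_iff' (Qc_meas n M)).2 (Eventually.of_forall fun q hq => ?_)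
      have h1 : Tendsto (fun k => F q * ps j (Rk k) q.1) atTop (𝓝 (F q * 1)) := (ps_lim j q.1 hk).const_mul _
      rw [mul_one] at h1
      refine h1.congr' ?_
      filter_upwards [hk.eventually_ge_atTop q.1] with k h
      rw [indicator_of_mem]; exact ⟨⟨hq.1, h⟩, hq.2⟩
  refine tendsto_nhds_unique h2 (hX.congr fun k => ?_)
  rw [integral_indicator (slab_meas n M 1 _ zero_le_one), restr_slab]

/-- general consequence: if error terms tend to zero along a sequence -/
lemma UPh_slab {n : ℕ} {M p : ℝ} {u : ℝ × Sp n → ℝ} (S : Sol n M p u) {P : ℝ × Sp n → ℝ} (hP : Measurable P) {R C : ℝ}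
    (hb : ∀ q ∈ slab n M 1 R, |P q| ≤ C) : IntegrableOn (fun q => |u q| ^ p * P q) (slab n M 1 R) := by
  have h1 : IntegrableOn (fun q => |u q| ^ p) (slab n M 1 R) :=
    (S.contU.mono (slab_sub_Om one_pos)).integrableOn_compact (slab_compact n M 1 R zero_le_one)
  refine (h1.const_mul C).mono' (h1.aestronglyMeasurable.mul hP.aestronglyMeasurable) ?_
  refine (ae_restrict_iff' (slab_meas n M 1 _ zero_le_one)).2 (Eventually.of_forall fun q hq => ?_)
  rw [norm_mul, mul_comm, Real.norm_eq_abs, Real.norm_of_nonneg (by positivity)]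
  exact mul_le_mul_of_nonneg_right (hb q hq) (by positivity)

lemma errlim {n : ℕ} {M p : ℝ} {u : ℝ × Sp n → ℝ} (S : Sol n M p u) {P P1 : ℝ × Sp n → ℝ} (hP : Measurable P) (hP1 : Measurable P1)
    (hb : ∀ R, ∃ C, ∀ q ∈ slab n M 1 R, |P q| ≤ C ∧ |P1 q| ≤ C) (hP0 : ∀ q ∈ Qc n M, 0 ≤ P q) (j : ℕ)
    {Rk : ℕ → ℝ} (hk : Tendsto Rk atTop atTop) {E : ℕ → ℝ} (hE : Tendsto E atTop (𝓝 0))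
    (hid : ∀ᶠ k in atTop, (∫ q in slab n M 1 (Rk k), |u q| ^ p * ps j (Rk k) q.1 * P q) +
      Dat u (fun q => P q * ps j (Rk k) q.1) (fun q => P1 q * ps j (Rk k) q.1 + P q * ps1 j (Rk k) q.1) 1 = E k) :
    IntegrableOn (fun q => |u q| ^ p * P q) (Qc n M) ∧ ∫ q in Qc n M, |u q| ^ p * P q = - Dat u P P1 1 := by
  refine lim_int j (fun q hq => mul_nonneg (by positivity) (hP0 q hq)) (fun R => ?_) hk ?_
  · obtain ⟨C, hC⟩ := hb R
    exact UPh_slab S hP fun q hq => (hC q hq).1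
  · obtain ⟨C, hC⟩ := hb 1
    set J := ∫ x, u (1, x) * P (1, x)
    have h1 : Tendsto (fun k => E k - (ps j (Rk k) 1 * Dat u P P1 1 - ps1 j (Rk k) 1 * J)) atTop
        (𝓝 (0 - (1 * Dat u P P1 1 - 0 * J))) :=
      hE.sub (((ps_lim j 1 hk).mul_const _).sub ((ps1_lim j 1 hk).mul_const _))
    rw [show (0 - (1 * Dat u P P1 1 - 0 * J)) = - Dat u P P1 1 by ring] at h1
    refine h1.congr' ?_
    filter_upwards [hid] with k h
    rw [← D_lin S hP hP1 hC, ← h, add_sub_cancel_right]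
    congr 1; funext q; ring

lemma caseB {n : ℕ} {M p : ℝ} {u : ℝ × Sp n → ℝ} (S : Sol n M p u) {σ : ℝ} (hσ : σ = 3/2 * (mm n + 1/6 - 1/p)) {j : ℕ}
    (hj : ((j:ℝ) + 2) / p ≤ j + 1) {Rk : ℕ → ℝ} (hk : Tendsto Rk atTop atTop)
    (hV : Tendsto (fun k => Vf n M p u σ j (Rk k)) atTop (𝓝 0)) (α : ℝ) :
    IntegrableOn (fun q => |u q| ^ p * Ph n M (Measure.dirac α) q) (Qc n M) ∧
    ∫ q in Qc n M, |u q| ^ p * Ph n M (Measure.dirac α) q = - Dat u (Ph n M (Measure.dirac α)) (Ph1 n M (Measure.dirac α)) 1 := by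
  have hp := S.hp
  have hm := mm_pos S.hn
  have hM0 : 0 ≤ M := by linarith [S.hM]
  have hνf : ∀ f : ℝ → ℝ, Integrable f (Measure.dirac α) := fun f => integrable_dirac (by simp)
  have hpp : 1 < p / (p - 1) := by rw [lt_div_iff₀ (by linarith)]; linarith
  have hbp : 1 < (mm n + 5/6) * (p / (p-1)) := by nlinarith
  obtain ⟨C0, hC0, B⟩ := Ph_bd (ν := Measure.dirac α) (γ := mm n + 5/6) (β := mm n + 5/6) (C' := 1) S.hn hM0 (by linarith) (by linarith)
    (hνf _) (fun δ _ => hνf _) (fun δ hδ => by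
      rw [integral_dirac]; rw [show -mm n - 5/6 + (mm n + 5/6) = 0 by ring, sub_self]; simp)
  obtain ⟨C, hC, H⟩ := claimH S hj hC0 (fun q ho hc h1 => (B q ho hc h1).1) (fun q ho hc h1 => (B q ho hc h1).2) (S.hσ rfl hσ)
  obtain ⟨mP, mP1⟩ := Ph_meas n M (Measure.dirac α)
  set Λ := 1 / ((mm n + 5/6) * (p / (p-1)) - 1)
  refine errlim S mP mP1 (fun R => ?_) (fun q hq => Ph_nonneg (Qc_Om hq) hq.2) j hk
    (E := fun k => ∫ q in slab n M 1 (Rk k), u q * (2 * ps1 j (Rk k) q.1 * Ph1 n M (Measure.dirac α) q + ps2 j (Rk k) q.1 * Ph n M (Measure.dirac α) q)) ?_ ?_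
  · obtain ⟨C, -, h⟩ := Ph_bdd (M := M) (R := R) (ν := Measure.dirac α) S.hn one_pos (hνf _)
    exact ⟨C, h⟩
  · refine squeeze_zero_norm' (a := fun k => C * (Vf n M p u σ j (Rk k) ^ (1/p) * Λ ^ (1 - 1/p))) ?_ ?_
    · filter_upwards [hk.eventually_ge_atTop 1] with k h
      exact H (Rk k) Λ h fun L hL _ => Lam_gt hbp hL
    · have h1 : Tendsto (fun k => C * (Vf n M p u σ j (Rk k) ^ (1/p) * Λ ^ (1 - 1/p))) atTop (𝓝 (C * (0 ^ (1/p) * Λ ^ (1 - 1/p)))) :=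
        (((hV.rpow_const (Or.inr (by positivity))).mul_const _).const_mul _)
      rwa [Real.zero_rpow (by positivity), zero_mul, mul_zero] at h1
  · filter_upwards [hk.eventually_ge_atTop 1] with k h
    obtain ⟨-, -, id⟩ := phiG (ν := Measure.dirac α) S (hνf _) one_pos h (ps_cd j (Rk k)) (ps1_c j _) (ps2_c j _) (ps_d j _) (ps1_d j _)
      (ps_R j (by linarith)).1 (ps_R j (by linarith)).2
    exact id
end Tric

namespace Tric

noncomputable def nu (b : ℝ) : Measure ℝ :=
  (volume.restrict (Ioi (0:ℝ))).withDensity (fun a => ((a ^ (b - 1)).toNNReal : ENNReal))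

instance (b : ℝ) : SFinite (nu b) := by unfold nu; infer_instance

lemma nu_dm (b : ℝ) : Measurable (fun a : ℝ => (a ^ (b - 1)).toNNReal) := by fun_prop

lemma nu_int {b : ℝ} {g : ℝ → ℝ} : Integrable g (nu b) ↔ IntegrableOn (fun a => a ^ (b-1) * g a) (Ioi 0) := by
  unfold nu
  rw [integrable_withDensity_iff_integrable_smul (nu_dm b)]
  refine integrableOn_congr_fun (fun a ha => ?_) measurableSet_Ioi
  have : (0:ℝ) ≤ a ^ (b-1) := Real.rpow_nonneg (le_of_lt ha) _
  simp only [NNReal.smul_def, Real.coe_toNNReal _ this, smul_eq_mul]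

lemma nu_val {b : ℝ} {g : ℝ → ℝ} : ∫ a, g a ∂(nu b) = ∫ a in Ioi (0:ℝ), a ^ (b-1) * g a := by
  unfold nu
  rw [integral_withDensity_eq_integral_smul (nu_dm b)]
  refine setIntegral_congr_fun measurableSet_Ioi (fun a ha => ?_)
  have : (0:ℝ) ≤ a ^ (b-1) := Real.rpow_nonneg (le_of_lt ha) _
  simp only [NNReal.smul_def, Real.coe_toNNReal _ this, smul_eq_mul]

lemma beta_int {b e : ℝ} (hb : 0 < b) (he : b < e) {δ : ℝ} (hδ : 0 < δ) :
    IntegrableOn (fun a : ℝ => a ^ (b-1) * (δ + |a|) ^ (-e)) (Ioi 0) := by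
  have hm : AEStronglyMeasurable (fun a : ℝ => a ^ (b-1) * (δ + |a|) ^ (-e)) volume := by
    have : Measurable (fun a : ℝ => a ^ (b-1) * (δ + |a|) ^ (-e)) := by fun_prop
    exact this.aestronglyMeasurable
  rw [← Ioc_union_Ioi_eq_Ioi (zero_le_one (α := ℝ))]
  refine IntegrableOn.union ?_ ?_
  · have h1 : IntegrableOn (fun a : ℝ => δ ^ (-e) * a ^ (b-1)) (Ioc 0 1) := by
      have := (intervalIntegral.intervalIntegrable_rpow' (a := 0) (b := 1) (show -1 < b - 1 by linarith))
      rw [intervalIntegrable_iff_integrableOn_Ioc_of_le zero_le_one] at this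
      exact this.const_mul _
    refine h1.mono' hm.restrict ((ae_restrict_iff' measurableSet_Ioc).2 (Eventually.of_forall fun a ha => ?_))
    have h0 : 0 < a := ha.1
    rw [Real.norm_of_nonneg (by positivity), mul_comm]
    refine mul_le_mul_of_nonneg_right ?_ (by positivity)
    exact rp_le hδ (by linarith [abs_nonneg a]) (by linarith)
  · have h1 : IntegrableOn (fun a : ℝ => a ^ (b - 1 - e)) (Ioi 1) := integrableOn_Ioi_rpow_of_lt (by linarith) one_pos
    refine h1.mono' hm.restrict ((ae_restrict_iff' measurableSet_Ioi).2 (Eventually.of_forall fun a ha => ?_))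
    have h0 : 0 < a := one_pos.trans ha
    rw [Real.norm_of_nonneg (by positivity), sub_eq_add_neg (b-1) e, Real.rpow_add h0]
    refine mul_le_mul_of_nonneg_left ?_ (by positivity)
    exact rp_le h0 (by rw [abs_of_pos h0]; linarith) (by linarith)

lemma beta_val {b e : ℝ} {δ : ℝ} (hδ : 0 < δ) :
    ∫ a in Ioi (0:ℝ), a ^ (b-1) * (δ + |a|) ^ (-e) = (∫ a in Ioi (0:ℝ), a ^ (b-1) * (1 + |a|) ^ (-e)) * δ ^ (b - e) := by
  have h := integral_comp_mul_left_Ioi (fun a : ℝ => a ^ (b-1) * (δ + |a|) ^ (-e)) 0 hδ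
  rw [mul_zero, smul_eq_mul] at h
  have h2 : ∫ a in Ioi (0:ℝ), (δ * a) ^ (b-1) * (δ + |δ * a|) ^ (-e) = δ ^ (b - 1 - e) * ∫ a in Ioi (0:ℝ), a ^ (b-1) * (1 + |a|) ^ (-e) := by
    rw [← integral_const_mul]
    refine setIntegral_congr_fun measurableSet_Ioi (fun a ha => ?_)
    have h0 : (0:ℝ) < a := ha
    rw [abs_mul, abs_of_pos hδ, show δ + δ * |a| = δ * (1 + |a|) by ring, Real.mul_rpow hδ.le h0.le,
      Real.mul_rpow hδ.le (by positivity), sub_eq_add_neg (b-1) e, Real.rpow_add hδ]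
    ring
  rw [h2] at h
  have h3 : δ ^ (b - e) = δ * δ ^ (b - 1 - e) := by
    nth_rewrite 2 [← Real.rpow_one δ]; rw [← Real.rpow_add hδ]; congr 1; ring
  rw [h3]
  field_simp at h
  linarith

/-- the step 2 lower bound -/
lemma Ph_low {n : ℕ} {M b : ℝ} (hn : 2 ≤ n) (hM : 1 < M) (hb : 0 < b)
    (hν : Integrable (fun a => (1 + |a|) ^ (-(2 * mm n))) (nu b)) :
    ∃ c, 0 < c ∧ ∀ q ∈ Qc n M, c * q.1 ^ (-(3/2 * (2 * mm n - b))) ≤ Ph n M (nu b) q := by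
  have hm := mm_pos hn
  set m := mm n with hmdef
  set K := 2 * M + 10 with hK
  set c1 := (1/2) * K ^ (-(2*m)) * (((2:ℝ) ^ b - 1) / b) with hc1
  have h2b : 0 < (2:ℝ) ^ b - 1 := by
    have := Real.one_lt_rpow (show (1:ℝ) < 2 by norm_num) hb
    linarith
  have hKp : 0 < K := by linarith
  refine ⟨c1 * (2/3) ^ (b - 2 * m), by positivity, fun q hq => ?_⟩
  have ho := Qc_Om hq
  have hc : q ∈ cone n M := hq.2
  have ht : 0 < q.1 := mem_Om.1 ho
  have hy := phi_pos ht
  set y := phi q.1 with hydef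
  have hy1 : 2/3 ≤ y := by
    have : 1 ≤ q.1 ^ ((3:ℝ)/2) := Real.one_le_rpow hq.1 (by norm_num)
    rw [hydef]; unfold phi; linarith
  obtain ⟨i0, -, -⟩ := k_int hn hν ho hc
  have k0n : ∀ z, 0 ≤ k0 n M z q := fun z => by
    have := tau_pos z.1
    have := W_one (z := z) ho hc
    simp only [k0]; positivity
  set c0 := (1/2) * (K * y) ^ (-(2*m)) with hc0
  have hlow : ∀ ρ ∈ Ioc (0:ℝ) 1, ∀ a ∈ Ioc y (2*y), c0 ≤ k0 n M (ρ, a) q := by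
    intro ρ hρ a ha
    have t1 := tau_pos ρ
    have t2 : tau ρ ≤ 2 := by
      unfold tau
      rw [Real.sqrt_le_left (by norm_num)]
      have : ρ ^ 6 ≤ 1 := pow_le_one₀ hρ.1.le hρ.2
      linarith
    have W0 := W_one (z := (ρ, a)) ho hc
    have Zp : Zf M (ρ, a) q.1 = M + 1 + |a| + tau ρ * y := rfl
    have ha0 : |a| = a := abs_of_pos (hy.trans ha.1)
    have hW : Wz n M (ρ, a) q ≤ (K * y) ^ 2 := by
      have : Wz n M (ρ, a) q = (Zf M (ρ, a) q.1) ^ 2 - ‖q.2‖ ^ 2 := by rw [Wz_eq]; ring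
      rw [this, Zp, ha0]
      have h3 : M + 1 + a + tau ρ * y ≤ K * y := by have := ha.2; nlinarith
      have h4 : 0 ≤ M + 1 + a + tau ρ * y := by
        have h5 : 0 < a := hy.trans ha.1
        have h6 : 0 < M := by linarith
        positivity
      nlinarith [sq_nonneg ‖q.2‖]
    simp only [k0, hc0]
    have e1 : (K * y) ^ (-(2*m)) = ((K * y) ^ 2) ^ (-m) := by
      rw [← Real.rpow_natCast, ← Real.rpow_mul (by positivity)]; congr 1; push_cast; ring
    rw [e1]
    refine mul_le_mul ?_ (rp_le W0 hW (by linarith)) (by positivity) (by positivity)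
    rw [one_div]; exact inv_anti₀ t1 t2
  have hin : ∀ᵐ a ∂(nu b), Integrable (fun ρ => k0 n M (ρ, a) q) := i0.prod_left_ae
  have step1 : Ph n M (nu b) q = ∫ a in Ioi (0:ℝ), a ^ (b-1) * ∫ ρ, k0 n M (ρ, a) q := by
    rw [← nu_val (g := fun a => ∫ ρ, k0 n M (ρ, a) q)]
    exact integral_prod_symm _ i0
  have iI : IntegrableOn (fun a => a ^ (b-1) * ∫ ρ, k0 n M (ρ, a) q) (Ioi 0) := nu_int.1 i0.integral_prod_right
  have hsub : Ioc y (2*y) ⊆ Ioi 0 := fun a ha => hy.trans ha.1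
  have ibp : IntegrableOn (fun a : ℝ => a ^ (b-1) * c0) (Ioc y (2*y)) := by
    have := (intervalIntegral.intervalIntegrable_rpow' (a := y) (b := 2*y) (show -1 < b - 1 by linarith))
    rw [intervalIntegrable_iff_integrableOn_Ioc_of_le (by linarith)] at this
    exact this.mul_const _
  have kint : ∀ a, Integrable (fun ρ => k0 n M (ρ, a) q) := by
    intro a
    have := (k_int (ν := Measure.dirac a) hn (integrable_dirac (by simp)) ho hc).1
    have h2 := this.prod_left_ae
    rwa [ae_dirac_eq] at h2
  have step2 : c0 * (y ^ b * ((2 ^ b - 1) / b)) ≤ Ph n M (nu b) q := by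
    rw [step1]
    calc _ = ∫ a in Ioc y (2*y), a ^ (b-1) * c0 := by
          rw [integral_mul_const, ← intervalIntegral.integral_of_le (by linarith), integral_rpow (Or.inl (by linarith))]
          rw [sub_add_cancel, Real.mul_rpow (by norm_num) hy.le]; ring
      _ ≤ ∫ a in Ioc y (2*y), a ^ (b-1) * ∫ ρ, k0 n M (ρ, a) q := by
          refine setIntegral_mono_on ibp (iI.mono_set hsub) measurableSet_Ioc fun a ha => ?_
          refine mul_le_mul_of_nonneg_left ?_ (Real.rpow_nonneg (hsub ha).le _)
          calc c0 = ∫ ρ in Ioc (0:ℝ) 1, c0 := by simp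
            _ ≤ ∫ ρ in Ioc (0:ℝ) 1, k0 n M (ρ, a) q :=
              setIntegral_mono_on (by simp) (kint a).integrableOn measurableSet_Ioc fun ρ hρ => hlow ρ hρ a ha
            _ ≤ _ := setIntegral_le_integral (kint a) (Eventually.of_forall fun ρ => k0n _)
      _ ≤ _ := by
          refine setIntegral_mono_set iI ?_ hsub.eventuallyLE
          refine (ae_restrict_iff' measurableSet_Ioi).2 (Eventually.of_forall fun a ha => ?_)
          exact mul_nonneg (Real.rpow_nonneg (le_of_lt ha) _) (integral_nonneg fun ρ => k0n _)
  refine le_trans (le_of_eq ?_) step2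
  have y1 : (2/3) ^ (b - 2 * m) * q.1 ^ (-(3/2 * (2 * m - b))) = y ^ (b - 2 * m) := by
    rw [hydef]; unfold phi
    rw [Real.mul_rpow (by norm_num) (by positivity), ← Real.rpow_mul ht.le]; congr 2; ring
  rw [mul_assoc, y1, sub_eq_add_neg b, Real.rpow_add hy, hc1, hc0, Real.mul_rpow hKp.le hy.le]
  ring

lemma wcont {n : ℕ} {M : ℝ} {G : ℝ × Sp n → ℝ} (hG : ContinuousOn G (Om n))
    (hs : ∀ q ∈ Om n, q ∉ cone n M → G q = 0) : ContinuousOn (fun t => ∫ x, G (t, x)) (Ioi 0) := by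
  intro t ht
  have ht0 : (0:ℝ) < t := ht
  have h := continuousOn_integral_of_compact_support (μ := (volume : Measure (Sp n))) (f := fun t x => G (t, x)) (s := Ioo 0 (t+1))
    (k := closedBall (0 : Sp n) (M + phi (t+1))) (isCompact_closedBall _ _) ?_ ?_
  · exact (h.continuousAt (Ioo_mem_nhds ht0 (by linarith))).continuousWithinAt
  · exact hG.mono (prod_mono (fun x hx => hx.1) (subset_univ _))
  · intro s x hs1 hx
    refine hs _ (mem_Om.2 hs1.1) fun hc => hx ?_
    rw [mem_closedBall, dist_zero_right]
    have h1 : ‖x‖ ≤ M + phi s := hc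
    exact h1.trans (by have := phi_mono hs1.1.le hs1.2.le; linarith)

lemma caseA {n : ℕ} {M p : ℝ} {u : ℝ × Sp n → ℝ} (S : Sol n M p u) {σ : ℝ} (hσ : σ = 3/2 * (mm n + 1/6 - 1/p)) {j : ℕ}
    (hj : ((j:ℝ) + 2) / p ≤ j + 1) {c R0 : ℝ} (hc : 0 < c) (hV : ∀ R, R0 ≤ R → c ≤ Vf n M p u σ j R) : False := by
  have hp := S.hp
  have hp0 : 0 < p := by linarith
  have hm := mm_pos S.hn
  have hM0 : 0 ≤ M := by linarith [S.hM]
  have hkap := S.kap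
  set m := mm n with hmd
  set b := m - 1/6 + 1/p with hb
  have hip : 0 < 1/p := by positivity
  have hip1 : 1/p < 1 := by rw [div_lt_one hp0]; exact hp
  have hb0 : 0 < b := by rw [hb]; linarith
  obtain ⟨γ, hγ0, hγ, hγp⟩ : ∃ γ, 0 ≤ γ ∧ 5/6 - m ≤ γ ∧ γ + 1/p < 1 := by
    rcases S.hn.eq_or_lt with h | h
    · have := S.n2 h.symm
      have h3 : 1/p < 1/2 := by rw [div_lt_div_iff₀ hp0 two_pos]; linarith
      exact ⟨1/3, by norm_num, by linarith, by linarith⟩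
    · have : (3:ℝ) ≤ n := by exact_mod_cast h
      exact ⟨0, le_rfl, by rw [hmd]; unfold mm; linarith, by linarith⟩
  have hν : Integrable (fun a => (1 + |a|) ^ (-(2 * m))) (nu b) := nu_int.2 (beta_int hb0 (by rw [hb]; linarith) one_pos)
  have ee : -m - 5/6 + γ = -(m + 5/6 - γ) := by ring
  obtain ⟨C0, hC0, B⟩ := Ph_bd (M := M) (ν := nu b) (γ := γ) (β := 1 - 1/p) (C' := ∫ a in Ioi (0:ℝ), a ^ (b-1) * (1 + |a|) ^ (-(m + 5/6 - γ))) S.hn hM0 hγ0 hγ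
    hν (fun δ hδ => by
      rw [← hmd, ee]
      exact nu_int.2 (beta_int hb0 (by rw [hb]; linarith) (by linarith)))
    (fun δ hδ => by
      rw [← hmd, ee, nu_val, beta_val (by linarith)]
      refine le_of_eq ?_
      congr 2; rw [hb]; ring)
  obtain ⟨C, hC, H⟩ := claimH S hj hC0 (fun q ho hc h1 => (B q ho hc h1).1) (fun q ho hc h1 => (B q ho hc h1).2) (S.hσ rfl hσ)
  obtain ⟨c1, hc1, hlow⟩ := Ph_low S.hn S.hM hb0 hν
  obtain ⟨Cl, hCl, hLam⟩ := Lam_one S.hM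
  obtain ⟨mP, mP1⟩ := Ph_meas n M (nu b)
  have e1 : (1 - 1/p) * (p / (p-1)) = 1 := by
    have : p - 1 ≠ 0 := by linarith
    field_simp
  rw [e1] at H
  set w : ℝ → ℝ := fun t => t ^ (-σ) * ∫ x, |u (t, x)| ^ p with hw
  have cw : ContinuousOn w (Ioi 0) := by
    refine ContinuousOn.mul (ContinuousOn.rpow_const continuousOn_id fun x hx => Or.inl (ne_of_gt hx)) (wcont S.contU S.suppU)
  have conv : ∀ R, 1 ≤ R → ∀ ψ : ℝ → ℝ, Continuous ψ → ∫ q in slab n M 1 R, |u q| ^ p * (q.1 ^ (-σ) * ψ q.1) = ∫ t in (1:ℝ)..R, w t * ψ t := by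
    intro R hR ψ hψ
    rw [(int_slab (G := fun q => |u q| ^ p * (q.1 ^ (-σ) * ψ q.1)) one_pos ?_ ?_).2, integral_Icc_eq_integral_Ioc,
      ← intervalIntegral.integral_of_le hR]
    · congr 1; funext t; simp only [hw]; rw [integral_mul_const]; ring
    · exact (S.contU.mono (slab_sub_Om one_pos)).mul (tpow_cont.mul (hψ.comp continuous_fst).continuousOn)
    · intro q ho hq; rw [S.suppU q ho hq, zero_mul]
  set Y : ℝ → ℝ := fun R => ∫ t in (1:ℝ)..R, w t * (1 - t / R) ^ (j + 2 + 1) with hY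
  set R1 := max R0 2 with hR1
  have hR12 : 2 ≤ R1 := le_max_right _ _
  obtain ⟨C2, hC2, hPb⟩ := Ph_bdd (M := M) (t1 := 1) (R := 1) S.hn one_pos hν
  set D := Dat u (Ph n M (nu b)) (Ph1 n M (nu b)) 1
  set J := ∫ x, u (1, x) * Ph n M (nu b) (1, x)
  refine ode_false (p := p) (k := ((j + 2 : ℕ):ℝ) + 1) (c := c) (C0 := (|D| + (j + 3) * |J|) / c1) (C := C * Cl ^ (1 - 1/p) / c1) (R0 := R1) (Y := Y) (V := Vf n M p u σ j)
    hp (by positivity) hc (by positivity) (by linarith) ?_ ?_ ?_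
  · intro R hR
    have h1 : 1 ≤ R := by linarith
    have := Yk_deriv (j + 2) cw (R := R) (by linarith)
    have e2 : Vf n M p u σ j R = ∫ t in (1:ℝ)..R, w t * (t / R * (1 - t / R) ^ (j+2)) := by
      unfold Vf
      exact conv R h1 (fun t => t / R * (1 - t / R) ^ (j+2)) (by fun_prop)
    rw [e2]; exact this
  · intro R hR; exact hV R ((le_max_left _ _).trans hR)
  · intro R hR
    have h1 : 1 ≤ R := by linarith
    have hlog := Real.log_nonneg h1
    have hV0 : 0 ≤ Vf n M p u σ j R := hc.le.trans (hV R ((le_max_left _ _).trans hR))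
    obtain ⟨I1, I2, id⟩ := phiG (ν := nu b) S hν one_pos h1 (ps_cd j R) (ps1_c j _) (ps2_c j _) (ps_d j _) (ps1_d j _)
      (ps_R j (by linarith)).1 (ps_R j (by linarith)).2
    have hH := H R (Cl * (1 + Real.log R)) h1 (fun L hL hL2 => hLam R L h1 hL hL2)
    rw [← id, D_lin S mP mP1 hPb] at hH
    have hp1 := ps_bd (j := j) zero_le_one h1
    have hp2 : |ps1 j R 1| ≤ j + 3 := by
      unfold ps1
      have h3 : 0 ≤ 1 - 1/R := by rw [sub_nonneg, div_le_one (by linarith)]; exact h1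
      have h4 : (1 - 1/R) ^ (j+2) ≤ 1 := pow_le_one₀ h3 (by have : 0 ≤ 1/R := by positivity
                                                            linarith)
      rw [abs_mul, abs_neg, abs_of_nonneg (by positivity), abs_of_nonneg (by positivity)]
      have h5 : ((j:ℝ) + 3) / R ≤ j + 3 := div_le_self (by positivity) h1
      calc _ ≤ ((j:ℝ) + 3) * 1 := mul_le_mul h5 h4 (by positivity) (by positivity)
        _ = _ := mul_one _
    have hD1 : |ps j R 1 * D - ps1 j R 1 * J| ≤ |D| + (j + 3) * |J| := by
      calc _ ≤ |ps j R 1 * D| + |ps1 j R 1 * J| := abs_sub _ _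
        _ = ps j R 1 * |D| + |ps1 j R 1| * |J| := by rw [abs_mul, abs_mul, abs_of_nonneg hp1.1]
        _ ≤ 1 * |D| + (j + 3) * |J| := by gcongr; exact hp1.2
        _ = _ := by ring
    have hX : c1 * Y R ≤ ∫ q in slab n M 1 R, |u q| ^ p * ps j R q.1 * Ph n M (nu b) q := by
      have e3 : Y R = ∫ q in slab n M 1 R, |u q| ^ p * (q.1 ^ (-σ) * (1 - q.1 / R) ^ (j+3)) := 
        (conv R h1 (fun t => (1 - t/R) ^ (j+3)) (by fun_prop)).symm
      rw [e3, ← integral_const_mul]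
      refine setIntegral_mono_on ?_ I1 (slab_meas n M 1 R zero_le_one) fun q hq => ?_
      · refine Integrable.const_mul ?_ _
        refine ContinuousOn.integrableOn_compact (slab_compact n M 1 R zero_le_one) ?_
        exact (S.contU.mono (slab_sub_Om one_pos)).mul (tpow_cont.mul (by fun_prop))
      · have h6 := hlow q (slab_sub_Qc hq)
        rw [show -(3/2 * (2 * mm n - b)) = -σ by rw [hσ, hb, ← hmd]; ring] at h6
        have h7 := ps_bd (j := j) (zero_le_one.trans hq.1.1) hq.1.2
        calc c1 * (|u q| ^ p * (q.1 ^ (-σ) * (1 - q.1 / R) ^ (j+3))) = (|u q| ^ p * ps j R q.1) * (c1 * q.1 ^ (-σ)) := by unfold ps; ring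
          _ ≤ _ := mul_le_mul_of_nonneg_left h6 (mul_nonneg (by positivity) h7.1)
    have hfin : c1 * Y R ≤ (|D| + (j + 3) * |J|) + C * Cl ^ (1 - 1/p) * (Vf n M p u σ j R ^ (1/p) * (1 + Real.log R) ^ (1 - 1/p)) := by
      rw [Real.mul_rpow hCl.le (by linarith)] at hH
      have a1 := (abs_le.1 hH).2
      have a2 := (abs_le.1 hD1).1
      nlinarith
    calc Y R = (c1 * Y R) / c1 := by field_simp
      _ ≤ _ := div_le_div_of_nonneg_right hfin hc1.le
      _ = _ := by ring
end Tric

namespace Tric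

lemma bern {X Y m : ℝ} (hm : 0 ≤ m) (hY : 0 < Y) (h : Y ≤ X) :
    Y ^ (-m) - X ^ (-m) ≤ m * Y ^ (-m-1) * (X - Y) := by
  have hX : 0 < X := hY.trans_le h
  have hz : 0 < X / Y := div_pos hX hY
  have e1 : X ^ (-m) = Y ^ (-m) * (X / Y) ^ (-m) := by
    rw [← Real.mul_rpow hY.le hz.le]; congr 1; field_simp
  have e2 : 1 - m * (X / Y - 1) ≤ (X / Y) ^ (-m) := by
    rw [Real.rpow_def_of_pos hz]
    have h1 := Real.add_one_le_exp (Real.log (X/Y) * -m)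
    have h2 := Real.log_le_sub_one_of_pos hz
    nlinarith
  have e3 : Y ^ (-m-1) = Y ^ (-m) / Y := by rw [Real.rpow_sub_one hY.ne']
  rw [e1, e3]
  have h3 : 0 < Y ^ (-m) := Real.rpow_pos_of_pos hY _
  have e4 : m * (Y ^ (-m) / Y) * (X - Y) = Y ^ (-m) * (m * (X / Y - 1)) := by field_simp
  rw [e4]
  nlinarith

noncomputable def KK (e : ℝ) : ℝ := ∫ η : ℝ, (1 + |η| ^ 3) ^ (-e)
noncomputable def GB (e b : ℝ) : ℝ := ∫ ρ : ℝ, (1 + b * tau ρ) ^ (-e)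
noncomputable def BB (m b : ℝ) : ℝ := ∫ ρ : ℝ, (tau ρ)⁻¹ * (1 + b * tau ρ) ^ (-(2 * m))
noncomputable def cc : ℝ := ∫ ρ : ℝ, (tau ρ)⁻¹

lemma cube_int {e : ℝ} (he : 1 ≤ e) : Integrable fun η : ℝ => (1 + |η| ^ 3) ^ (-e) := by
  refine tau_inv_int.mono' ?_ (Eventually.of_forall fun η => ?_)
  · refine Continuous.aestronglyMeasurable ?_
    refine Continuous.rpow_const (by fun_prop) fun x => Or.inl (by positivity)
  · have h1 : 1 ≤ 1 + |η| ^ 3 := by have : 0 ≤ |η| ^ 3 := by positivity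
                                    linarith
    rw [Real.norm_eq_abs, abs_of_nonneg (by positivity)]
    calc (1 + |η| ^ 3) ^ (-e) ≤ (1 + |η| ^ 3) ^ (-1:ℝ) := Real.rpow_le_rpow_of_exponent_le h1 (by linarith)
      _ = (1 + |η| ^ 3)⁻¹ := Real.rpow_neg_one _
      _ ≤ _ := by
        refine inv_anti₀ (tau_pos η) ?_
        refine Real.sqrt_le_iff.2 ⟨by positivity, ?_⟩
        have h2 : η ^ 6 = (|η| ^ 3) ^ 2 := by rw [← pow_mul]; exact (Even.pow_abs (by decide) η).symm
        rw [h2]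
        have : 0 ≤ |η| ^ 3 := by positivity
        nlinarith

lemma KK_pos {e : ℝ} (he : 1 ≤ e) : 0 < KK e := by
  refine (integral_pos_iff_support_of_nonneg (fun η => by positivity) (cube_int he)).2 ?_
  have : Function.support (fun η : ℝ => (1 + |η| ^ 3) ^ (-e)) = univ := by
    ext η; simp only [Function.mem_support, mem_univ, iff_true]; positivity
  rw [this]; simp

lemma cc_pos : 0 < cc := by
  refine (integral_pos_iff_support_of_nonneg (fun η => (inv_pos.2 (tau_pos η)).le) tau_inv_int).2 ?_
  have : Function.support (fun η : ℝ => (tau η)⁻¹) = univ := by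
    ext η; simp only [Function.mem_support, mem_univ, iff_true]; exact (inv_pos.2 (tau_pos η)).ne'
  rw [this]; simp

lemma cube_scale {e b : ℝ} (he : 1 ≤ e) (hb : 0 < b) :
    Integrable (fun ρ : ℝ => (1 + b * |ρ| ^ 3) ^ (-e)) ∧
    ∫ ρ : ℝ, (1 + b * |ρ| ^ 3) ^ (-e) = KK e * b ^ (-(1:ℝ)/3) := by
  set c := b ^ ((1:ℝ)/3) with hc
  have hc0 : 0 < c := Real.rpow_pos_of_pos hb _
  have hc3 : c ^ 3 = b := by
    rw [hc, ← Real.rpow_natCast, ← Real.rpow_mul hb.le]; norm_num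
  have e1 : (fun ρ : ℝ => (1 + b * |ρ| ^ 3) ^ (-e)) = fun ρ => (fun η : ℝ => (1 + |η| ^ 3) ^ (-e)) (c * ρ) := by
    funext ρ; simp only [abs_mul, mul_pow, abs_of_pos hc0, hc3]
  refine ⟨?_, ?_⟩
  · rw [e1]; exact (cube_int he).comp_mul_left' hc0.ne'
  · rw [e1, Measure.integral_comp_mul_left (fun η : ℝ => (1 + |η| ^ 3) ^ (-e)), abs_of_pos (by positivity), smul_eq_mul, mul_comm]
    unfold KK; congr 1
    rw [hc, ← Real.rpow_neg hb.le]; congr 1; ring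

lemma tau_cube (ρ : ℝ) : |ρ| ^ 3 ≤ tau ρ ∧ tau ρ - |ρ| ^ 3 ≤ (tau ρ)⁻¹ := by
  have h1 := tau_sq ρ
  have h2 : ρ ^ 6 = (|ρ| ^ 3) ^ 2 := by rw [← pow_mul]; exact (Even.pow_abs (by decide) ρ).symm
  have h3 : 0 ≤ |ρ| ^ 3 := by positivity
  have h4 := tau_pos ρ
  rw [h2] at h1
  have h5 : |ρ| ^ 3 ≤ tau ρ := by nlinarith
  refine ⟨h5, ?_⟩
  rw [← one_div, le_div_iff₀ h4]; nlinarith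

lemma gcont {b : ℝ} (hb : 0 ≤ b) (e : ℝ) : Continuous fun ρ : ℝ => (1 + b * tau ρ) ^ (-e) := by
  have := tau_cont
  refine Continuous.rpow_const (by fun_prop) fun x => Or.inl ?_
  have := tau_pos x; positivity

lemma GB_bd {e b : ℝ} (he : 1 ≤ e) (hb : 0 < b) :
    Integrable (fun ρ : ℝ => (1 + b * tau ρ) ^ (-e)) ∧
    GB e b ≤ KK e * b ^ (-(1:ℝ)/3) ∧ KK e * b ^ (-(1:ℝ)/3) - GB e b ≤ e * cc * b := by
  obtain ⟨i1, v1⟩ := cube_scale he hb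
  have hle : ∀ ρ : ℝ, (1 + b * tau ρ) ^ (-e) ≤ (1 + b * |ρ| ^ 3) ^ (-e) := fun ρ => by
    refine rp_le (by positivity) ?_ (by linarith)
    have := (tau_cube ρ).1; nlinarith
  have i2 : Integrable (fun ρ : ℝ => (1 + b * tau ρ) ^ (-e)) := by
    refine i1.mono' (gcont hb.le e).aestronglyMeasurable (Eventually.of_forall fun ρ => ?_)
    have := tau_pos ρ
    rw [Real.norm_eq_abs, abs_of_nonneg (by positivity)]
    exact hle ρ
  refine ⟨i2, ?_, ?_⟩
  · rw [← v1]; exact integral_mono i2 i1 hle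
  · rw [← v1]; unfold GB; rw [← integral_sub i1 i2]
    calc _ ≤ ∫ ρ : ℝ, e * b * (tau ρ)⁻¹ := by
          refine integral_mono (i1.sub i2) (tau_inv_int.const_mul _) fun ρ => ?_
          have h0 : 0 ≤ b * |ρ| ^ 3 := by positivity
          have h1 := (tau_cube ρ).1
          have h2 := bern (m := e) (Y := 1 + b * |ρ| ^ 3) (X := 1 + b * tau ρ) (by linarith) (by positivity) (by nlinarith)
          refine h2.trans ?_
          have h3 : (1 + b * |ρ| ^ 3) ^ (-e-1) ≤ 1 := Real.rpow_le_one_of_one_le_of_nonpos (by linarith) (by linarith)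
          calc e * (1 + b * |ρ| ^ 3) ^ (-e-1) * (1 + b * tau ρ - (1 + b * |ρ| ^ 3)) ≤ e * 1 * (b * (tau ρ)⁻¹) := by
                refine mul_le_mul (mul_le_mul_of_nonneg_left h3 (by linarith)) ?_ (by nlinarith) (by linarith)
                have := (tau_cube ρ).2; nlinarith
            _ = _ := by ring
      _ = _ := by rw [integral_const_mul]; unfold cc; ring

lemma BB_int {m b : ℝ} (hm : 0 ≤ m) (hb : 0 ≤ b) : Integrable fun ρ : ℝ => (tau ρ)⁻¹ * (1 + b * tau ρ) ^ (-(2 * m)) := by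
  refine tau_inv_int.mono' ?_ (Eventually.of_forall fun ρ => ?_)
  · exact ((tau_cont.inv₀ fun ρ => (tau_pos ρ).ne').mul (gcont hb _)).aestronglyMeasurable
  · have := tau_pos ρ
    rw [Real.norm_eq_abs, abs_of_nonneg (by positivity)]
    refine mul_le_of_le_one_right (by positivity) ?_
    exact Real.rpow_le_one_of_one_le_of_nonpos (by nlinarith) (by linarith)

lemma BB_cont {m : ℝ} (hm : 0 ≤ m) : ContinuousOn (BB m) (Ici 0) := by
  unfold BB
  refine continuousOn_of_dominated (bound := fun ρ => (tau ρ)⁻¹) ?_ ?_ tau_inv_int ?_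
  · intro b hb; exact (BB_int hm hb).1
  · intro b hb
    refine Eventually.of_forall fun ρ => ?_
    have := tau_pos ρ
    have hb' : 0 ≤ b := hb
    rw [Real.norm_eq_abs, abs_of_nonneg (by positivity)]
    refine mul_le_of_le_one_right (by positivity) ?_
    exact Real.rpow_le_one_of_one_le_of_nonpos (by nlinarith) (by linarith)
  · refine Eventually.of_forall fun ρ => ?_
    refine continuousOn_const.mul (ContinuousOn.rpow_const (by fun_prop) fun b hb => Or.inl ?_)
    have := tau_pos ρ
    have hb' : 0 ≤ b := hb
    positivity

lemma BB_deriv {m b : ℝ} (hm : 0 ≤ m) (hb : 0 < b) : HasDerivAt (BB m) (-(2 * m) * GB (2 * m + 1) b) b := by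
  have he : 1 ≤ 2 * m + 1 := by linarith
  have h := hasDerivAt_integral_of_dominated_loc_of_deriv_le (μ := volume) (x₀ := b) (s := Ioi (b/2))
    (F := fun b ρ => (tau ρ)⁻¹ * (1 + b * tau ρ) ^ (-(2 * m)))
    (F' := fun b ρ => -(2 * m) * (1 + b * tau ρ) ^ (-(2 * m + 1)))
    (bound := fun ρ => 2 * m * (1 + b/2 * tau ρ) ^ (-(2 * m + 1)))
    (Ioi_mem_nhds (by linarith)) ?_ (BB_int hm hb.le) ?_ ?_ ?_ ?_
  · have h2 := h.2
    rw [integral_const_mul] at h2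
    exact h2
  · filter_upwards [Ioi_mem_nhds hb] with x hx
    exact (BB_int hm (le_of_lt hx)).1
  · exact (continuous_const.mul (gcont hb.le _)).aestronglyMeasurable
  · refine Eventually.of_forall fun ρ x hx => ?_
    have hx1 : b / 2 < x := hx
    have := tau_pos ρ
    have hx0 : 0 < x := by linarith
    rw [Real.norm_eq_abs, abs_mul, abs_neg, abs_of_nonneg (by positivity : 0 ≤ 2 * m), abs_of_nonneg (by positivity)]
    refine mul_le_mul_of_nonneg_left ?_ (by positivity)
    refine rp_le (by positivity) ?_ (by linarith)
    nlinarith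
  · exact (GB_bd he (by linarith)).1.const_mul _
  · refine Eventually.of_forall fun ρ x hx => ?_
    have hx1 : b / 2 < x := hx
    have ht := tau_pos ρ
    have hx0 : 0 < x := by linarith
    have h1 : HasDerivAt (fun x => 1 + x * tau ρ) (tau ρ) x := by
      simpa using ((hasDerivAt_id x).mul_const (tau ρ)).const_add 1
    have h2 := (h1.rpow_const (p := -(2 * m)) (Or.inl (by positivity))).const_mul ((tau ρ)⁻¹)
    refine h2.congr_deriv ?_
    rw [show -(2 * m) - 1 = -(2 * m + 1) by ring]
    field_simp

/-- expansion of B near zero -/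
lemma BB_bd {m b : ℝ} (hm : 0 < m) (hb : 0 < b) :
    0 ≤ BB m b - cc + 3 * m * KK (2 * m + 1) * b ^ ((2:ℝ)/3) ∧
    BB m b - cc + 3 * m * KK (2 * m + 1) * b ^ ((2:ℝ)/3) ≤ m * (2 * m + 1) * cc * b ^ 2 := by
  have he : 1 ≤ 2 * m + 1 := by linarith
  set K := KK (2 * m + 1)
  have hd : ∀ x, 0 < x → HasDerivAt (fun x => BB m x + 3 * m * K * x ^ ((2:ℝ)/3)) (2 * m * (K * x ^ (-(1:ℝ)/3) - GB (2 * m + 1) x)) x := by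
    intro x hx
    have h1 := (Real.hasDerivAt_rpow_const (p := (2:ℝ)/3) (Or.inl hx.ne')).const_mul (3 * m * K)
    refine ((BB_deriv hm.le hx).add h1).congr_deriv ?_
    rw [show (2:ℝ)/3 - 1 = -(1:ℝ)/3 by norm_num]; ring
  have hc : ContinuousOn (fun x => BB m x + 3 * m * K * x ^ ((2:ℝ)/3)) (Ici 0) :=
    (BB_cont hm.le).add (continuousOn_const.mul (ContinuousOn.rpow_const continuousOn_id fun x hx => Or.inr (by norm_num)))
  have h0 : BB m 0 = cc := by unfold BB cc; simp
  have hint : interior (Ici (0:ℝ)) = Ioi 0 := interior_Ici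
  constructor
  · have := monotoneOn_of_deriv_nonneg (convex_Ici 0) hc
      (by rw [hint]; exact fun x hx => (hd x hx).differentiableAt.differentiableWithinAt)
      (by rw [hint]; intro x hx; rw [(hd x hx).deriv]; have := (GB_bd he hx).2.1; exact mul_nonneg (by linarith) (by linarith))
    have := this (show (0:ℝ) ∈ Ici 0 by simp) (show b ∈ Ici 0 from hb.le) hb.le
    simp only [h0, Real.zero_rpow (show (2:ℝ)/3 ≠ 0 by norm_num)] at this
    linarith
  · have hd2 : ∀ x, 0 < x → HasDerivAt (fun x => m * (2 * m + 1) * cc * x ^ 2 - (BB m x + 3 * m * K * x ^ ((2:ℝ)/3)))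
        (m * (2 * m + 1) * cc * (2 * x) - 2 * m * (K * x ^ (-(1:ℝ)/3) - GB (2 * m + 1) x)) x := by
      intro x hx
      refine HasDerivAt.sub ?_ (hd x hx)
      simpa using (hasDerivAt_pow 2 x).const_mul (m * (2 * m + 1) * cc)
    have := monotoneOn_of_deriv_nonneg (convex_Ici 0) (ContinuousOn.sub (f := fun x => m * (2 * m + 1) * cc * x ^ 2) (by fun_prop) hc)
      (by rw [hint]; exact fun x hx => (hd2 x hx).differentiableAt.differentiableWithinAt)
      (by
        rw [hint]; intro x hx
        have e := (hd2 x hx).deriv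
        have h3 := (GB_bd he hx).2.2
        refine le_of_le_of_eq ?_ e.symm
        nlinarith)
    have := this (show (0:ℝ) ∈ Ici 0 by simp) (show b ∈ Ici 0 from hb.le) hb.le
    simp only [Pi.sub_apply, h0, Real.zero_rpow (show (2:ℝ)/3 ≠ 0 by norm_num)] at this
    linarith
end Tric

namespace Tric

lemma dirac_int {f : ℝ × ℝ → ℝ} (hf : Measurable f) (α : ℝ) :
    ∫ z, f z ∂((volume : Measure ℝ).prod (Measure.dirac α)) = ∫ ρ, f (ρ, α) := by
  rw [Measure.prod_dirac, integral_map (by fun_prop) hf.aestronglyMeasurable]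

lemma k0_mq (n : ℕ) (M : ℝ) (q : ℝ × Sp n) : Measurable fun z => k0 n M z q := by
  have h1 : Measurable fun z : ℝ × ℝ => (z, q) := measurable_prodMk_right
  have h2 := (k0_meas n M).comp h1
  unfold Function.uncurry Function.comp at h2; exact h2
lemma k1_mq (n : ℕ) (M : ℝ) (q : ℝ × Sp n) : Measurable fun z => k1 n M z q := by
  have h1 : Measurable fun z : ℝ × ℝ => (z, q) := measurable_prodMk_right
  have h2 := (k1_meas n M).comp h1
  unfold Function.uncurry Function.comp at h2; exact h2

/-- normalised test function and its time derivative -/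
noncomputable def Sa (n : ℕ) (M α : ℝ) (q : ℝ × Sp n) : ℝ := (M + 1 + α) ^ (2 * mm n) * Ph n M (Measure.dirac α) q
noncomputable def Sb (n : ℕ) (M α : ℝ) (q : ℝ × Sp n) : ℝ := (M + 1 + α) ^ (2 * mm n) * Ph1 n M (Measure.dirac α) q
/-- the small parameter -/
noncomputable def th (M α : ℝ) : ℝ := ((M + 1 + α)⁻¹) ^ ((2:ℝ)/3)

lemma Wz_sc {n : ℕ} {M α ρ : ℝ} {q : ℝ × Sp n} (hA : 0 < M + 1 + α) (hα : 0 ≤ α) :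
    Wz n M (ρ, α) q = (M + 1 + α) ^ 2 * ((1 + phi q.1 / (M + 1 + α) * tau ρ) ^ 2 - (‖q.2‖ / (M + 1 + α)) ^ 2) ∧
    Zf M (ρ, α) q.1 = (M + 1 + α) * (1 + phi q.1 / (M + 1 + α) * tau ρ) := by
  unfold Wz Wf Zf
  simp only [abs_of_nonneg hα]
  constructor <;> field_simp

lemma Sa_eq {n : ℕ} {M α : ℝ} {q : ℝ × Sp n} (hA : 0 < M + 1 + α) (hα : 0 ≤ α)
    (hW : ∀ ρ, 0 ≤ (1 + phi q.1 / (M + 1 + α) * tau ρ) ^ 2 - (‖q.2‖ / (M + 1 + α)) ^ 2) :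
    Sa n M α q = ∫ ρ, (tau ρ)⁻¹ * ((1 + phi q.1 / (M + 1 + α) * tau ρ) ^ 2 - (‖q.2‖ / (M + 1 + α)) ^ 2) ^ (-mm n) := by
  unfold Sa Ph
  rw [dirac_int (k0_mq n M q), ← integral_const_mul]
  congr 1; funext ρ
  unfold k0
  rw [(Wz_sc hA hα).1, Real.mul_rpow (by positivity) (hW ρ), ← Real.rpow_natCast, ← Real.rpow_mul hA.le]
  have : (M + 1 + α) ^ (2 * mm n) * (M + 1 + α) ^ (((2:ℕ):ℝ) * -mm n) = 1 := by
    rw [← Real.rpow_add hA]; simp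
  calc _ = ((M + 1 + α) ^ (2 * mm n) * (M + 1 + α) ^ (((2:ℕ):ℝ) * -mm n)) * ((tau ρ)⁻¹ * ((1 + phi q.1 / (M + 1 + α) * tau ρ) ^ 2 - (‖q.2‖ / (M + 1 + α)) ^ 2) ^ (-mm n)) := by ring
    _ = _ := by rw [this, one_mul]

lemma Sb_eq {n : ℕ} {M α : ℝ} {q : ℝ × Sp n} (hA : 0 < M + 1 + α) (hα : 0 ≤ α)
    (hW : ∀ ρ, 0 ≤ (1 + phi q.1 / (M + 1 + α) * tau ρ) ^ 2 - (‖q.2‖ / (M + 1 + α)) ^ 2) :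
    Sb n M α q = -(2 * mm n) * q.1 ^ ((1:ℝ)/2) * (M + 1 + α)⁻¹ * ∫ ρ, (1 + phi q.1 / (M + 1 + α) * tau ρ) * ((1 + phi q.1 / (M + 1 + α) * tau ρ) ^ 2 - (‖q.2‖ / (M + 1 + α)) ^ 2) ^ (-mm n - 1) := by
  unfold Sb Ph1
  rw [dirac_int (k1_mq n M q), ← integral_const_mul, ← integral_const_mul]
  congr 1; funext ρ
  unfold k1 Hz
  rw [(Wz_sc hA hα).1, (Wz_sc hA hα).2, Real.mul_rpow (by positivity) (hW ρ), ← Real.rpow_natCast (M + 1 + α) 2, ← Real.rpow_mul hA.le]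
  have : (M + 1 + α) ^ (2 * mm n) * (M + 1 + α) ^ (((2:ℕ):ℝ) * (-mm n-1)) * (M + 1 + α) = (M + 1 + α)⁻¹ := by
    rw [← Real.rpow_add hA, ← Real.rpow_add_one hA.ne', ← Real.rpow_neg_one]; congr 1; push_cast; ring
  rw [← this]; push_cast
  ring

lemma S_pt {n : ℕ} {M α : ℝ} {q : ℝ × Sp n} (hM : 1 < M) (hα : 0 ≤ α) (ha : M ^ 2 * (M + 1 + α)⁻¹ ≤ 1/2) (hq : q ∈ Qc n M) (ρ : ℝ) :
    1 ≤ (1 + phi q.1 / (M + 1 + α) * tau ρ) ^ 2 - (‖q.2‖ / (M + 1 + α)) ^ 2 := by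
  have hA : 0 < M + 1 + α := by linarith
  set a := (M + 1 + α)⁻¹ with had
  have ha0 : 0 < a := inv_pos.2 hA
  have h1 : 2/3 ≤ phi q.1 := by
    have := phi_mono zero_le_one hq.1
    have h2 : phi 1 = 2/3 := by unfold phi; simp
    linarith
  rw [div_eq_mul_inv, div_eq_mul_inv, ← had]
  set y := phi q.1
  have h3 : ‖q.2‖ ≤ M + y := hq.2
  have h4 := one_le_tau ρ
  have hb : 0 < y * a := by positivity
  have h5 : 1 + y * a ≤ 1 + y * a * tau ρ := by nlinarith
  have h6 : (1 + y * a) ^ 2 ≤ (1 + y * a * tau ρ) ^ 2 := pow_le_pow_left₀ (by positivity) h5 2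
  have h7 : (‖q.2‖ * a) ^ 2 ≤ ((M + y) * a) ^ 2 := pow_le_pow_left₀ (by positivity) (mul_le_mul_of_nonneg_right h3 ha0.le) 2
  have h8 : M * a ≤ 1/2 := by nlinarith
  have h9 : M ^ 2 * a * a ≤ 1/2 * a := mul_le_mul_of_nonneg_right ha ha0.le
  have h10 : M * a * (y * a) ≤ 1/2 * (y * a) := mul_le_mul_of_nonneg_right h8 hb.le
  have h11 : 2/3 * a ≤ y * a := mul_le_mul_of_nonneg_right h1 ha0.le
  nlinarith
lemma th_t {M α t : ℝ} (hA : 0 < M + 1 + α) (ht : 0 < t) :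
    (phi t / (M + 1 + α)) ^ ((2:ℝ)/3) = (2/3) ^ ((2:ℝ)/3) * (th M α * t) ∧ (th M α * t) ^ 3 = (t ^ ((3:ℝ)/2) / (M + 1 + α)) ^ 2 := by
  unfold phi th
  have ha : 0 ≤ (M + 1 + α)⁻¹ := (inv_pos.2 hA).le
  constructor
  · rw [div_eq_mul_inv, Real.mul_rpow (by positivity) ha, Real.mul_rpow (by norm_num) (by positivity), ← Real.rpow_mul ht.le]
    norm_num; ring
  · have e1 : (((M + 1 + α)⁻¹) ^ ((2:ℝ)/3)) ^ 3 = ((M + 1 + α)⁻¹) ^ 2 := by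
      rw [← Real.rpow_natCast _ 3, ← Real.rpow_mul ha, ← Real.rpow_natCast _ 2]; norm_num
    have e2 : (t ^ ((3:ℝ)/2)) ^ 2 = t ^ 3 := by
      rw [← Real.rpow_natCast _ 2, ← Real.rpow_mul ht.le, ← Real.rpow_natCast _ 3]; norm_num
    rw [mul_pow, e1, div_pow, e2]; field_simp

lemma th_lim (M : ℝ) : Tendsto (th M) atTop (𝓝 0) ∧ Tendsto (fun α => (M + 1 + α)⁻¹) atTop (𝓝 0) := by
  have h1 : Tendsto (fun α => (M + 1 + α)⁻¹) atTop (𝓝 0) := tendsto_inv_atTop_zero.comp (tendsto_atTop_add_const_left _ _ tendsto_id)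
  refine ⟨?_, h1⟩
  have := h1.rpow_const (p := (2:ℝ)/3) (Or.inr (by norm_num))
  rwa [Real.zero_rpow (by norm_num)] at this

lemma Sint {m b s : ℝ} (hm : 0 ≤ m) (hb : 0 ≤ b) (hW : ∀ ρ, 1 ≤ (1 + b * tau ρ) ^ 2 - s ^ 2) :
    Integrable fun ρ => (tau ρ)⁻¹ * ((1 + b * tau ρ) ^ 2 - s ^ 2) ^ (-m) := by
  have hc := tau_cont
  refine tau_inv_int.mono' ?_ (Eventually.of_forall fun ρ => ?_)
  · refine ((tau_cont.inv₀ fun ρ => (tau_pos ρ).ne').mul ?_).aestronglyMeasurable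
    refine Continuous.rpow_const (by fun_prop) fun x => Or.inl ?_
    have := hW x; linarith
  · have := tau_pos ρ
    have h1 := hW ρ
    have h2 : 0 ≤ (1 + b * tau ρ) ^ 2 - s ^ 2 := by linarith
    rw [Real.norm_eq_abs, abs_of_nonneg (by positivity)]
    refine mul_le_of_le_one_right (by positivity) ?_
    exact Real.rpow_le_one_of_one_le_of_nonpos h1 (by linarith)

lemma sq_rp {w e : ℝ} (hw : 0 < w) : (w ^ 2) ^ e = w ^ (2 * e) := by
  rw [← Real.rpow_natCast, ← Real.rpow_mul hw.le]; norm_num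

lemma S_low {m b s : ℝ} (hm : 0 ≤ m) (hb : 0 ≤ b) (hW : ∀ ρ, 1 ≤ (1 + b * tau ρ) ^ 2 - s ^ 2) :
    BB m b ≤ ∫ ρ, (tau ρ)⁻¹ * ((1 + b * tau ρ) ^ 2 - s ^ 2) ^ (-m) ∧
    (∫ ρ, (tau ρ)⁻¹ * ((1 + b * tau ρ) ^ 2 - s ^ 2) ^ (-m)) ≤ cc ∧
    (∫ ρ, (tau ρ)⁻¹ * ((1 + b * tau ρ) ^ 2 - s ^ 2) ^ (-m)) - BB m b ≤ m * cc * s ^ 2 := by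
  have i1 := Sint hm hb hW
  have i2 := BB_int hm hb
  have hw : ∀ ρ, 0 < 1 + b * tau ρ := fun ρ => by have := tau_pos ρ; positivity
  have e1 : ∀ ρ, (1 + b * tau ρ) ^ (-(2 * m)) = ((1 + b * tau ρ) ^ 2) ^ (-m) := fun ρ => by rw [sq_rp (hw ρ)]; congr 1; ring
  refine ⟨?_, ?_, ?_⟩
  · refine integral_mono i2 i1 fun ρ => ?_
    simp only [e1]
    refine mul_le_mul_of_nonneg_left ?_ (inv_pos.2 (tau_pos ρ)).le
    exact rp_le (by linarith [hW ρ]) (by nlinarith) (by linarith)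
  · refine integral_mono i1 tau_inv_int fun ρ => ?_
    exact mul_le_of_le_one_right (inv_pos.2 (tau_pos ρ)).le (Real.rpow_le_one_of_one_le_of_nonpos (hW ρ) (by linarith))
  · unfold BB
    rw [← integral_sub i1 i2]
    calc _ ≤ ∫ ρ, m * s ^ 2 * (tau ρ)⁻¹ := by
          refine integral_mono (i1.sub i2) (tau_inv_int.const_mul _) fun ρ => ?_
          simp only [e1]
          have h1 := hW ρ
          have h2 := bern hm (by linarith) (show (1 + b * tau ρ) ^ 2 - s ^ 2 ≤ (1 + b * tau ρ) ^ 2 by nlinarith)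
          have h3 : ((1 + b * tau ρ) ^ 2 - s ^ 2) ^ (-m-1) ≤ 1 := Real.rpow_le_one_of_one_le_of_nonpos h1 (by linarith)
          have h4 := inv_pos.2 (tau_pos ρ)
          rw [sub_sub_cancel] at h2
          have h5 : m * ((1 + b * tau ρ) ^ 2 - s ^ 2) ^ (-m-1) * s ^ 2 ≤ m * s ^ 2 := by
            have : 0 ≤ m * s ^ 2 := by positivity
            nlinarith
          nlinarith
      _ = _ := by rw [integral_const_mul]; unfold cc; ring

lemma S_der {m b s : ℝ} (hm : 0 < m) (hb : 0 < b) (hs : s ^ 2 ≤ 1/4) (hW : ∀ ρ, 1 ≤ (1 + b * tau ρ) ^ 2 - s ^ 2) :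
    GB (2 * m + 1) b ≤ ∫ ρ, (1 + b * tau ρ) * ((1 + b * tau ρ) ^ 2 - s ^ 2) ^ (-m-1) ∧
    (∫ ρ, (1 + b * tau ρ) * ((1 + b * tau ρ) ^ 2 - s ^ 2) ^ (-m-1)) ≤ GB (2 * m + 1) b + (m+1) * (3/4) ^ (-(m+2)) * s ^ 2 * GB (2 * m + 1) b := by
  have hw : ∀ ρ, 1 < 1 + b * tau ρ := fun ρ => by have := tau_pos ρ; have : 0 < b * tau ρ := by positivity
                                                  linarith
  have hw0 : ∀ ρ, 0 < 1 + b * tau ρ := fun ρ => by linarith [hw ρ]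
  have hc := tau_cont
  have iG := (GB_bd (e := 2 * m + 1) (by linarith) hb).1
  have l1 : ∀ ρ, (1 + b * tau ρ) ^ (-(2 * m + 1)) ≤ (1 + b * tau ρ) * ((1 + b * tau ρ) ^ 2 - s ^ 2) ^ (-m-1) := by
    intro ρ
    have h0 := hw0 ρ
    have h1 : ((1 + b * tau ρ) ^ 2) ^ (-m-1) ≤ ((1 + b * tau ρ) ^ 2 - s ^ 2) ^ (-m-1) := rp_le (by linarith [hW ρ]) (by nlinarith) (by linarith)
    rw [sq_rp h0] at h1
    calc _ = (1 + b * tau ρ) * (1 + b * tau ρ) ^ (2 * (-m-1)) := by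
          rw [mul_comm (1 + b * tau ρ), ← Real.rpow_add_one h0.ne']; congr 1; ring
      _ ≤ _ := mul_le_mul_of_nonneg_left h1 h0.le
  have l2 : ∀ ρ, (1 + b * tau ρ) * ((1 + b * tau ρ) ^ 2 - s ^ 2) ^ (-m-1) ≤ (1 + (m+1) * (3/4) ^ (-(m+2)) * s ^ 2) * (1 + b * tau ρ) ^ (-(2 * m + 1)) := by
    intro ρ
    have h0 := hw0 ρ
    have h2 := bern (m := m + 1) (by linarith) (by linarith [hW ρ]) (show (1 + b * tau ρ) ^ 2 - s ^ 2 ≤ (1 + b * tau ρ) ^ 2 by nlinarith)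
    rw [sub_sub_cancel, sq_rp h0, show -(m+1) = -m-1 by ring] at h2
    have h3 : ((1 + b * tau ρ) ^ 2 - s ^ 2) ^ (-m-1-1) ≤ (3/4 * (1 + b * tau ρ) ^ 2) ^ (-m-1-1) := by
      refine rp_le (by positivity) ?_ (by linarith)
      have := hw ρ; nlinarith
    rw [Real.mul_rpow (by norm_num) (by positivity), sq_rp h0] at h3
    have h4 : (1 + b * tau ρ) ^ (2 * (-m-1-1)) ≤ (1 + b * tau ρ) ^ (2 * (-m-1)) := Real.rpow_le_rpow_of_exponent_le (hw ρ).le (by linarith)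
    have h5 : ((1 + b * tau ρ) ^ 2 - s ^ 2) ^ (-m-1-1) ≤ (3/4) ^ (-(m+2)) * (1 + b * tau ρ) ^ (2 * (-m-1)) := by
      refine h3.trans ?_
      rw [show -m-1-1 = -(m+2) by ring] at *
      exact mul_le_mul_of_nonneg_left h4 (by positivity)
    have h6 : ((1 + b * tau ρ) ^ 2 - s ^ 2) ^ (-m-1) ≤ (1 + (m+1) * (3/4) ^ (-(m+2)) * s ^ 2) * (1 + b * tau ρ) ^ (2 * (-m-1)) := by
      have : (m + 1) * ((1 + b * tau ρ) ^ 2 - s ^ 2) ^ (-m-1-1) * s ^ 2 ≤ (m + 1) * ((3/4) ^ (-(m+2)) * (1 + b * tau ρ) ^ (2 * (-m-1))) * s ^ 2 :=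
        mul_le_mul_of_nonneg_right (mul_le_mul_of_nonneg_left h5 (by linarith)) (sq_nonneg s)
      linarith
    calc _ ≤ (1 + b * tau ρ) * ((1 + (m+1) * (3/4) ^ (-(m+2)) * s ^ 2) * (1 + b * tau ρ) ^ (2 * (-m-1))) := mul_le_mul_of_nonneg_left h6 h0.le
      _ = (1 + (m+1) * (3/4) ^ (-(m+2)) * s ^ 2) * ((1 + b * tau ρ) ^ (2 * (-m-1)) * (1 + b * tau ρ)) := by ring
      _ = _ := by rw [← Real.rpow_add_one h0.ne']; congr 2; ring
  have iI : Integrable fun ρ => (1 + b * tau ρ) * ((1 + b * tau ρ) ^ 2 - s ^ 2) ^ (-m-1) := by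
    refine (iG.const_mul (1 + (m+1) * (3/4) ^ (-(m+2)) * s ^ 2)).mono' ?_ (Eventually.of_forall fun ρ => ?_)
    · refine Continuous.aestronglyMeasurable (Continuous.mul (by fun_prop) ?_)
      refine Continuous.rpow_const (by fun_prop) fun x => Or.inl ?_
      have := hW x; linarith
    · have h1 := hW ρ
      have h2 : 0 ≤ (1 + b * tau ρ) ^ 2 - s ^ 2 := by linarith
      have := hw0 ρ
      rw [Real.norm_eq_abs, abs_of_nonneg (by positivity)]
      exact l2 ρ
  refine ⟨integral_mono iG iI l1, ?_⟩
  calc _ ≤ ∫ ρ, (1 + (m+1) * (3/4) ^ (-(m+2)) * s ^ 2) * (1 + b * tau ρ) ^ (-(2 * m + 1)) := integral_mono iI (iG.const_mul _) l2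
    _ = _ := by rw [integral_const_mul]; unfold GB; ring

set_option maxHeartbeats 1000000 in
theorem S_facts {n : ℕ} {M : ℝ} (hn : 2 ≤ n) (hM : 1 < M) : ∃ c2 C ε : ℝ, 0 < c2 ∧ 0 ≤ C ∧ 0 < ε ∧ ∀ᶠ α in atTop,
    0 < th M α ∧
    (∀ q ∈ Qc n M, 0 ≤ Sa n M α q ∧ Sa n M α q ≤ cc ∧ cc - c2 * (th M α * q.1) ≤ Sa n M α q ∧
      (th M α * q.1 ≤ ε → Sa n M α q ≤ cc - c2 * (th M α * q.1) + C * (th M α * q.1) ^ 3)) ∧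
    (∀ q ∈ slab n M 1 1, |Sb n M α q + c2 * th M α| ≤ C * th M α ^ 3) := by
  set m := mm n with hmd
  have hm0 := mm_pos hn
  have hm : 0 < m := by linarith
  set K := KK (2 * m + 1) with hK
  have hKp : 0 < K := KK_pos (by linarith)
  have hcc := cc_pos
  set C1 := m * (2 * m + 1) * cc + m * cc * (M+1) ^ 2 with hC1
  set C2 := 2 * m * ((2 * m + 1) * cc + (m+1) * (3/4) ^ (-(m+2)) * (M+1) ^ 2 * (K * (3/2))) with hC2
  have hC1p : 0 ≤ C1 := by positivity
  have hC2p : 0 ≤ C2 := by positivity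
  refine ⟨3 * m * K * (2/3) ^ ((2:ℝ)/3), C1 + C2, 1 / (2 * (M+1)), by positivity, by positivity, by positivity, ?_⟩
  have hev : ∀ᶠ α in atTop, th M α < 1 / (2 * (M+1)) := (th_lim M).1.eventually_lt_const (by positivity)
  have hev2 : ∀ᶠ α in atTop, (M + 1 + α)⁻¹ < 1 / (2 * M ^ 2) := (th_lim M).2.eventually_lt_const (by positivity)
  filter_upwards [hev, hev2, eventually_ge_atTop 0] with α h1 h2 hα
  have hA : 0 < M + 1 + α := by linarith
  have ha : M ^ 2 * (M + 1 + α)⁻¹ ≤ 1/2 := by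
    rw [lt_div_iff₀ (by positivity)] at h2; linarith
  have hth : 0 < th M α := Real.rpow_pos_of_pos (inv_pos.2 hA) _
  have main : ∀ q ∈ Qc n M, 0 < phi q.1 / (M + 1 + α) ∧ (phi q.1 / (M + 1 + α)) ^ 2 ≤ (th M α * q.1) ^ 3 ∧
      (‖q.2‖ / (M + 1 + α)) ^ 2 ≤ (M + 1) ^ 2 * (th M α * q.1) ^ 3 := by
    intro q hq
    have ht : 0 < q.1 := by linarith [hq.1]
    have e := (th_t hA ht).2
    have ht1 : 1 ≤ q.1 ^ ((3:ℝ)/2) := Real.one_le_rpow hq.1 (by norm_num)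
    have hphi : phi q.1 = 2/3 * q.1 ^ ((3:ℝ)/2) := rfl
    have hq2 : ‖q.2‖ ≤ M + phi q.1 := hq.2
    refine ⟨div_pos (phi_pos ht) hA, ?_, ?_⟩
    · rw [e]
      refine pow_le_pow_left₀ (div_pos (phi_pos ht) hA).le ?_ 2
      refine div_le_div_of_nonneg_right ?_ hA.le
      rw [hphi]; linarith
    · rw [e, ← mul_pow]
      refine pow_le_pow_left₀ (by positivity) ?_ 2
      rw [← mul_div_assoc]
      refine div_le_div_of_nonneg_right ?_ hA.le
      rw [hphi] at hq2; nlinarith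
  refine ⟨hth, fun q hq => ?_, fun q hq => ?_⟩
  · have ht : 0 < q.1 := by linarith [hq.1]
    obtain ⟨m1, m2, m3⟩ := main q hq
    have hW := S_pt hM hα ha hq
    have hW0 : ∀ ρ, 0 ≤ (1 + phi q.1 / (M + 1 + α) * tau ρ) ^ 2 - (‖q.2‖ / (M + 1 + α)) ^ 2 := fun ρ => zero_le_one.trans (hW ρ)
    rw [Sa_eq hA hα hW0]
    obtain ⟨s1, s2, s3⟩ := S_low hm.le m1.le hW
    obtain ⟨b1, b2⟩ := BB_bd hm m1
    rw [(th_t hA ht).1] at b1 b2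
    rw [← hK] at b1 b2
    refine ⟨integral_nonneg fun ρ => mul_nonneg (inv_pos.2 (tau_pos ρ)).le (Real.rpow_nonneg (hW0 ρ) _), s2, by linarith, fun hε => ?_⟩
    have hx : 0 ≤ (th M α * q.1) ^ 3 := by positivity
    have k1 : m * (2 * m + 1) * cc * (phi q.1 / (M + 1 + α)) ^ 2 ≤ m * (2 * m + 1) * cc * (th M α * q.1) ^ 3 := mul_le_mul_of_nonneg_left m2 (by positivity)
    have k2 : m * cc * (‖q.2‖ / (M + 1 + α)) ^ 2 ≤ m * cc * ((M+1) ^ 2 * (th M α * q.1) ^ 3) := mul_le_mul_of_nonneg_left m3 (by positivity)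
    have k3 : 0 ≤ C2 * (th M α * q.1) ^ 3 := by positivity
    rw [add_mul, hC1]
    linarith
  · have hq1 : q.1 = 1 := le_antisymm hq.1.2 hq.1.1
    have hqc : q ∈ Qc n M := slab_sub_Qc hq
    obtain ⟨m1, m2, m3⟩ := main q hqc
    have hW := S_pt hM hα ha hqc
    have hW0 : ∀ ρ, 0 ≤ (1 + phi q.1 / (M + 1 + α) * tau ρ) ^ 2 - (‖q.2‖ / (M + 1 + α)) ^ 2 := fun ρ => zero_le_one.trans (hW ρ)
    rw [Sb_eq hA hα hW0]
    rw [hq1, mul_one] at m3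
    have e3 := (th_t hA (show (0:ℝ) < 1 by norm_num)).2
    rw [mul_one, Real.one_rpow] at e3
    set a := (M + 1 + α)⁻¹ with had
    have ha0 : 0 < a := inv_pos.2 hA
    have e4 : th M α ^ 3 = a ^ 2 := by rw [e3, had, one_div]
    have hM1 : 1/(2 * (M+1)) ≤ 1/4 := by
      rw [div_le_div_iff₀ (by positivity) (by norm_num)]; linarith
    have hsq : (‖q.2‖ / (M + 1 + α)) ^ 2 ≤ 1/4 := by
      refine m3.trans ?_
      have : (M+1) * th M α ≤ 1/2 := by
        rw [lt_div_iff₀ (by positivity)] at h1; linarith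
      have h0 : 0 ≤ (M+1) * th M α := by positivity
      have : ((M+1) * th M α) ^ 2 ≤ (1/2) ^ 2 := pow_le_pow_left₀ h0 this 2
      have h5 : th M α ≤ 1 := by linarith
      calc (M+1) ^ 2 * th M α ^ 3 = ((M+1) * th M α) ^ 2 * th M α := by ring
        _ ≤ (1/2) ^ 2 * 1 := mul_le_mul this h5 hth.le (by positivity)
        _ = _ := by norm_num
    obtain ⟨d1, d2⟩ := S_der hm m1 hsq hW
    obtain ⟨_, g1, g2⟩ := GB_bd (e := 2 * m + 1) (by linarith) m1
    rw [← hK] at g1 g2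
    set s := ‖q.2‖ / (M + 1 + α)
    set J := ∫ ρ, (1 + phi q.1 / (M + 1 + α) * tau ρ) * ((1 + phi q.1 / (M + 1 + α) * tau ρ) ^ 2 - s ^ 2) ^ (-m - 1)
    have hb : phi q.1 / (M + 1 + α) = 2/3 * a := by rw [hq1]; unfold phi; rw [Real.one_rpow]; rw [div_eq_mul_inv, mul_one]
    rw [hb] at d1 d2 g1 g2
    have hy : a * (2/3 * a) ^ (-(1:ℝ)/3) = 3/2 * ((2/3) ^ ((2:ℝ)/3) * th M α) := by
      have : th M α = a ^ ((2:ℝ)/3) := rfl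
      rw [this, ← Real.mul_rpow (by norm_num) ha0.le]
      have e5 : (2/3 * a) ^ ((2:ℝ)/3) = (2/3 * a) ^ (-(1:ℝ)/3) * (2/3 * a) := by
        rw [← Real.rpow_add_one (by positivity)]; norm_num
      rw [e5]; ring
    have ha1 : a ≤ 1 := inv_le_one_of_one_le₀ (by linarith)
    have hy2 : a * (2/3 * a) ^ (-(1:ℝ)/3) ≤ 3/2 := by
      have : (2/3 * a) ^ (-(1:ℝ)/3) ≤ (2/3 * a) ^ (-1:ℝ) := Real.rpow_le_rpow_of_exponent_ge (by positivity) (by linarith) (by norm_num)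
      rw [Real.rpow_neg_one] at this
      calc _ ≤ a * (2/3 * a)⁻¹ := mul_le_mul_of_nonneg_left this ha0.le
        _ = 3/2 := by field_simp
    set X := (2/3 * a) ^ (-(1:ℝ)/3)
    set G := GB (2 * m + 1) (2/3 * a)
    set c3 := (m+1) * (3/4) ^ (-(m+2)) with hc3
    have hc3p : 0 ≤ c3 := by positivity
    have hval : -(2 * m) * q.1 ^ ((1:ℝ)/2) * a * J + 3 * m * K * (2/3) ^ ((2:ℝ)/3) * th M α = 2 * m * (a * (K * X - J)) := by
      rw [hq1, Real.one_rpow]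
      have : 3 * m * K * (2/3) ^ ((2:ℝ)/3) * th M α = 2 * m * K * (3/2 * ((2/3) ^ ((2:ℝ)/3) * th M α)) := by ring
      rw [this, ← hy]; ring
    rw [hval, e4, abs_le]
    have u1 : K * X - J ≤ (2 * m + 1) * cc * a := by
      have : (2 * m + 1) * cc * (2/3 * a) ≤ (2 * m + 1) * cc * a := mul_le_mul_of_nonneg_left (by linarith) (by positivity)
      linarith
    have u2 : a * (K * X - J) ≤ (2 * m + 1) * cc * a ^ 2 := by
      calc _ ≤ a * ((2 * m + 1) * cc * a) := mul_le_mul_of_nonneg_left u1 ha0.le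
        _ = _ := by ring
    have u3 : a * (J - K * X) ≤ c3 * (M+1) ^ 2 * (K * (3/2)) * a ^ 2 := by
      have w1 : J - K * X ≤ c3 * s ^ 2 * (K * X) := by
        have : c3 * s ^ 2 * G ≤ c3 * s ^ 2 * (K * X) := mul_le_mul_of_nonneg_left g1 (by positivity)
        linarith
      rw [e4] at m3
      calc a * (J - K * X) ≤ a * (c3 * s ^ 2 * (K * X)) := mul_le_mul_of_nonneg_left w1 ha0.le
        _ = c3 * K * (s ^ 2 * (a * X)) := by ring
        _ ≤ c3 * K * (((M+1) ^ 2 * a ^ 2) * (3/2)) := by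
            refine mul_le_mul_of_nonneg_left ?_ (by positivity)
            exact mul_le_mul m3 hy2 (by positivity) (by positivity)
        _ = _ := by ring
    have p1 : 0 ≤ C1 * a ^ 2 := by positivity
    have p2 : 0 ≤ (2 * m + 1) * cc * a ^ 2 := by positivity
    have p3 : 0 ≤ c3 * (M+1) ^ 2 * (K * (3/2)) * a ^ 2 := by positivity
    have hC2' : C2 * a ^ 2 = 2 * m * ((2 * m + 1) * cc * a ^ 2 + c3 * (M+1) ^ 2 * (K * (3/2)) * a ^ 2) := by rw [hC2]; ring
    rw [add_mul, hC2']
    have hm2 : 0 ≤ 2 * m := by linarith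
    constructor
    · have : 2 * m * (a * (J - K * X)) ≤ 2 * m * ((2 * m + 1) * cc * a ^ 2 + c3 * (M+1) ^ 2 * (K * (3/2)) * a ^ 2) := mul_le_mul_of_nonneg_left (by linarith) hm2
      linarith
    · have : 2 * m * (a * (K * X - J)) ≤ 2 * m * ((2 * m + 1) * cc * a ^ 2 + c3 * (M+1) ^ 2 * (K * (3/2)) * a ^ 2) := mul_le_mul_of_nonneg_left (by linarith) hm2
      linarith
end Tric

namespace Tric

/-- pairs (test function, time derivative) for which the global Green identity holds -/
structure Good (n : ℕ) (M p : ℝ) (u P P1 : ℝ × Sp n → ℝ) : Prop where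
  m : Measurable P
  m1 : Measurable P1
  bd : ∃ C, ∀ q ∈ slab n M 1 1, |P q| ≤ C ∧ |P1 q| ≤ C
  int : IntegrableOn (fun q => |u q| ^ p * P q) (Qc n M)
  id : ∫ q in Qc n M, |u q| ^ p * P q = - Dat u P P1 1

lemma Good.lin {n : ℕ} {M p : ℝ} {u P P1 R R1 : ℝ × Sp n → ℝ} (S : Sol n M p u) (h : Good n M p u P P1)
    (g : Good n M p u R R1) (c d : ℝ) : Good n M p u (fun q => c * P q + d * R q) (fun q => c * P1 q + d * R1 q) := by
  obtain ⟨C, hC⟩ := h.bd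
  obtain ⟨D, hD⟩ := g.bd
  have hb : ∀ a b : ℝ, ∀ q ∈ slab n M 1 1, |a| ≤ C → |b| ≤ D → |c * a + d * b| ≤ |c| * C + |d| * D := by
    intro a b q hq ha hb
    calc _ ≤ |c * a| + |d * b| := abs_add_le _ _
      _ = |c| * |a| + |d| * |b| := by rw [abs_mul, abs_mul]
      _ ≤ _ := add_le_add (mul_le_mul_of_nonneg_left ha (abs_nonneg _)) (mul_le_mul_of_nonneg_left hb (abs_nonneg _))
  have e : (fun q => |u q| ^ p * (c * P q + d * R q)) = fun q => c * (|u q| ^ p * P q) + d * (|u q| ^ p * R q) := by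
    funext q; ring
  have j1 : IntegrableOn (fun q => c * (|u q| ^ p * P q)) (Qc n M) := h.int.const_mul c
  have j2 : IntegrableOn (fun q => d * (|u q| ^ p * R q)) (Qc n M) := g.int.const_mul d
  refine ⟨(h.m.const_mul c).add (g.m.const_mul d), (h.m1.const_mul c).add (g.m1.const_mul d), ⟨|c| * C + |d| * D, fun q hq => ?_⟩, ?_, ?_⟩
  · exact ⟨hb _ _ q hq (hC q hq).1 (hD q hq).1, hb _ _ q hq (hC q hq).2 (hD q hq).2⟩
  · rw [e]; exact j1.add j2
  · rw [e, integral_add j1 j2, integral_const_mul, integral_const_mul, h.id, g.id]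
    unfold Dat
    have i1 := mul_int (ut_off S).1 (ut_off S).2 one_pos h.m (fun q hq => (hC q hq).1)
    have i2 := mul_int S.cont S.supp one_pos h.m1 (fun q hq => (hC q hq).2)
    have i3 := mul_int (ut_off S).1 (ut_off S).2 one_pos g.m (fun q hq => (hD q hq).1)
    have i4 := mul_int S.cont S.supp one_pos g.m1 (fun q hq => (hD q hq).2)
    have k1 : Integrable fun x => c * (fderiv ℝ u (1, x) (1, 0) * P (1, x) - u (1, x) * P1 (1, x)) := (i1.sub i2).const_mul _
    have k2 : Integrable fun x => d * (fderiv ℝ u (1, x) (1, 0) * R (1, x) - u (1, x) * R1 (1, x)) := (i3.sub i4).const_mul _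
    rw [mul_neg, mul_neg, ← neg_add, ← integral_const_mul, ← integral_const_mul, ← integral_add k1 k2]
    congr 2; funext x; ring

/-- size of the data at time 1 -/
noncomputable def I1 {n : ℕ} (u : ℝ × Sp n → ℝ) : ℝ := ∫ x, (|fderiv ℝ u (1, x) (1, 0)| + |u (1, x)|)

lemma I1_nonneg {n : ℕ} (u : ℝ × Sp n → ℝ) : 0 ≤ I1 u := integral_nonneg fun x => by positivity

lemma Dat_bd {n : ℕ} {M p : ℝ} {u P P1 : ℝ × Sp n → ℝ} (S : Sol n M p u) {e : ℝ}
    (he : ∀ q ∈ slab n M 1 1, |P q| ≤ e ∧ |P1 q| ≤ e) : |Dat u P P1 1| ≤ e * I1 u := by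
  unfold Dat I1
  rw [← integral_const_mul]
  have i1 := slice_int (ut_off S).1 (ut_off S).2 (one_pos : (0:ℝ) < 1)
  have i2 := slice_int S.cont S.supp (one_pos : (0:ℝ) < 1)
  have h := norm_integral_le_of_norm_le (μ := volume) (f := fun x => fderiv ℝ u (1, x) (1, 0) * P (1, x) - u (1, x) * P1 (1, x)) ((i1.abs.add i2.abs).const_mul e) (Eventually.of_forall fun x => ?_)
  · exact h
  · rw [Real.norm_eq_abs]
    simp only [Pi.add_apply]
    by_cases hc : ((1:ℝ), x) ∈ cone n M
    · have := he _ (slab_self hc)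
      calc _ ≤ |fderiv ℝ u (1, x) (1, 0) * P (1, x)| + |u (1, x) * P1 (1, x)| := abs_sub _ _
        _ = |fderiv ℝ u (1, x) (1, 0)| * |P (1, x)| + |u (1, x)| * |P1 (1, x)| := by rw [abs_mul, abs_mul]
        _ ≤ |fderiv ℝ u (1, x) (1, 0)| * e + |u (1, x)| * e := add_le_add (mul_le_mul_of_nonneg_left this.1 (abs_nonneg _)) (mul_le_mul_of_nonneg_left this.2 (abs_nonneg _))
        _ = _ := by ring
    · rw [S.supp _ (mem_Om.2 one_pos) hc, (ut_off S).2 _ (mem_Om.2 one_pos) hc]; simp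

lemma Good.lim {n : ℕ} {M p : ℝ} {u P P1 : ℝ × Sp n → ℝ} (S : Sol n M p u) {Pk Pk1 : ℝ → ℝ × Sp n → ℝ} {e : ℝ → ℝ} {G : ℝ × Sp n → ℝ}
    (h : ∀ᶠ k in atTop, Good n M p u (Pk k) (Pk1 k)) (hP : Measurable P) (hP1 : Measurable P1)
    (bd : ∃ C, ∀ q ∈ slab n M 1 1, |P q| ≤ C ∧ |P1 q| ≤ C)
    (hd : ∀ᶠ k in atTop, ∀ q ∈ Qc n M, |Pk k q| ≤ G q) (hG : IntegrableOn (fun q => |u q| ^ p * G q) (Qc n M))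
    (hl : ∀ q ∈ Qc n M, Tendsto (fun k => Pk k q) atTop (𝓝 (P q)))
    (he : Tendsto e atTop (𝓝 0)) (hk : ∀ᶠ k in atTop, ∀ q ∈ slab n M 1 1, |Pk k q - P q| ≤ e k ∧ |Pk1 k q - P1 q| ≤ e k) :
    Good n M p u P P1 := by
  have hU : AEStronglyMeasurable (fun q => |u q| ^ p) (volume.restrict (Qc n M)) :=
    (S.contU.mono fun q hq => Qc_Om hq).aestronglyMeasurable (Qc_meas n M)
  have hbound : ∀ᶠ k in atTop, ∀ᵐ q ∂(volume.restrict (Qc n M)), ‖|u q| ^ p * Pk k q‖ ≤ |u q| ^ p * G q := by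
    filter_upwards [hd] with k hk
    refine (ae_restrict_iff' (Qc_meas n M)).2 (Eventually.of_forall fun q hq => ?_)
    rw [norm_mul, Real.norm_of_nonneg (by positivity), Real.norm_eq_abs]
    exact mul_le_mul_of_nonneg_left (hk q hq) (by positivity)
  have hlim : ∀ᵐ q ∂(volume.restrict (Qc n M)), Tendsto (fun k => |u q| ^ p * Pk k q) atTop (𝓝 (|u q| ^ p * P q)) :=
    (ae_restrict_iff' (Qc_meas n M)).2 (Eventually.of_forall fun q hq => (hl q hq).const_mul _)
  have T1 := tendsto_integral_filter_of_dominated_convergence (μ := volume.restrict (Qc n M)) (fun q => |u q| ^ p * G q)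
    (h.mono fun k hk => hk.int.1) hbound hG hlim
  have hPG : ∀ q ∈ Qc n M, |P q| ≤ G q := fun q hq => by
    refine le_of_tendsto (hl q hq).abs (hd.mono fun k hk => hk q hq)
  have hint : IntegrableOn (fun q => |u q| ^ p * P q) (Qc n M) := by
    refine hG.mono' (hU.mul hP.aestronglyMeasurable) ?_
    refine (ae_restrict_iff' (Qc_meas n M)).2 (Eventually.of_forall fun q hq => ?_)
    rw [norm_mul, Real.norm_of_nonneg (by positivity), Real.norm_eq_abs]
    exact mul_le_mul_of_nonneg_left (hPG q hq) (by positivity)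
  refine ⟨hP, hP1, bd, hint, ?_⟩
  obtain ⟨C, hC⟩ := bd
  have T2 : Tendsto (fun k => -Dat u (Pk k) (Pk1 k) 1) atTop (𝓝 (-Dat u P P1 1)) := by
    refine Tendsto.neg ?_
    rw [tendsto_iff_dist_tendsto_zero]
    have hz : Tendsto (fun k => e k * I1 u) atTop (𝓝 0) := by simpa using he.mul_const (I1 u)
    refine squeeze_zero' (Eventually.of_forall fun k => dist_nonneg) ?_ hz
    filter_upwards [h, hk] with k g hk
    obtain ⟨D, hD⟩ := g.bd
    have i1 := mul_int (ut_off S).1 (ut_off S).2 one_pos g.m (fun q hq => (hD q hq).1)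
    have i2 := mul_int S.cont S.supp one_pos g.m1 (fun q hq => (hD q hq).2)
    have i3 := mul_int (ut_off S).1 (ut_off S).2 one_pos hP (fun q hq => (hC q hq).1)
    have i4 := mul_int S.cont S.supp one_pos hP1 (fun q hq => (hC q hq).2)
    have := Dat_bd S hk
    rw [Real.dist_eq]
    refine le_of_eq_of_le ?_ this
    congr 1
    unfold Dat
    have k1 : Integrable fun x => (fderiv ℝ u (1, x) (1, 0) * Pk k (1, x) - u (1, x) * Pk1 k (1, x)) := i1.sub i2
    have k2 : Integrable fun x => (fderiv ℝ u (1, x) (1, 0) * P (1, x) - u (1, x) * P1 (1, x)) := i3.sub i4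
    rw [← integral_sub k1 k2]
    congr 1; funext x; ring
  exact tendsto_nhds_unique (T1.congr' (h.mono fun k hk => hk.id)) T2

lemma Good.bound {n : ℕ} {M p : ℝ} {u P P1 : ℝ × Sp n → ℝ} (S : Sol n M p u) (h : Good n M p u P P1) {e : ℝ}
    (he : ∀ q ∈ slab n M 1 1, |P q| ≤ e ∧ |P1 q| ≤ e) : ∫ q in Qc n M, |u q| ^ p * P q ≤ e * I1 u := by
  rw [h.id]; exact (neg_le_abs _).trans (Dat_bd S he)

lemma bdd_int {n : ℕ} {M B : ℝ} {F : ℝ × Sp n → ℝ} (h0 : ∀ q ∈ Qc n M, 0 ≤ F q) (hi : ∀ R, IntegrableOn F (slab n M 1 R))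
    (hB : ∀ R, 1 ≤ R → ∫ q in slab n M 1 R, F q ≤ B) : IntegrableOn F (Qc n M) := by
  refine (slab_cover n M tendsto_natCast_atTop_atTop).integrable_of_integral_bounded_of_nonneg_ae B (fun i => ?_) ?_ ?_
  · rw [IntegrableOn, restr_slab]; exact hi _
  · exact (ae_restrict_iff' (Qc_meas n M)).2 (Eventually.of_forall h0)
  · filter_upwards [eventually_ge_atTop 1] with i hi1
    rw [restr_slab]; exact hB _ (by exact_mod_cast hi1)

lemma Sa_good {n : ℕ} {M p : ℝ} {u : ℝ × Sp n → ℝ} (S : Sol n M p u)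
    (HB : ∀ α, IntegrableOn (fun q => |u q| ^ p * Ph n M (Measure.dirac α) q) (Qc n M) ∧
      ∫ q in Qc n M, |u q| ^ p * Ph n M (Measure.dirac α) q = - Dat u (Ph n M (Measure.dirac α)) (Ph1 n M (Measure.dirac α)) 1) (α : ℝ) :
    Good n M p u (Sa n M α) (Sb n M α) := by
  obtain ⟨m, m1⟩ := Ph_meas n M (Measure.dirac α)
  obtain ⟨C, hC, hb⟩ := Ph_bdd (M := M) (t1 := 1) (R := 1) (ν := Measure.dirac α) S.hn one_pos (integrable_dirac (by simp))
  have g : Good n M p u (Ph n M (Measure.dirac α)) (Ph1 n M (Measure.dirac α)) := ⟨m, m1, ⟨C, hb⟩, (HB α).1, (HB α).2⟩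
  have := g.lin S g ((M + 1 + α) ^ (2 * mm n)) 0
  simp only [zero_mul, add_zero] at this
  exact this
end Tric

namespace Tric

lemma Good.sl {n : ℕ} {M p : ℝ} {u P P1 w : ℝ × Sp n → ℝ} (S : Sol n M p u) (h : Good n M p u P P1) (h0 : ∀ q ∈ Qc n M, 0 ≤ P q)
    {e : ℝ} (he : ∀ q ∈ slab n M 1 1, |P q| ≤ e ∧ |P1 q| ≤ e) {A : Set (ℝ × Sp n)} (hA : MeasurableSet A) (hAQ : A ⊆ Qc n M)
    (hi : IntegrableOn (fun q => |u q| ^ p * w q) A) (hw : ∀ q ∈ A, w q ≤ P q) :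
    ∫ q in A, |u q| ^ p * w q ≤ e * I1 u := by
  refine le_trans ?_ (h.bound S he)
  calc _ ≤ ∫ q in A, |u q| ^ p * P q := setIntegral_mono_on hi (h.int.mono_set hAQ) hA fun q hq =>
        mul_le_mul_of_nonneg_left (hw q hq) (by positivity)
    _ ≤ _ := setIntegral_mono_set h.int ((ae_restrict_iff' (Qc_meas n M)).2 (Eventually.of_forall fun q hq =>
        mul_nonneg (by positivity) (h0 q hq))) (LE.le.eventuallyLE hAQ)

lemma Uw_slab {n : ℕ} {M p : ℝ} {u w : ℝ × Sp n → ℝ} (S : Sol n M p u) (hw : ContinuousOn w (Om n)) (R : ℝ) :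
    IntegrableOn (fun q => |u q| ^ p * w q) (slab n M 1 R) :=
  ((S.contU.mul hw).mono fun q hq => Qc_Om (slab_sub_Qc hq)).integrableOn_compact (slab_compact n M 1 R zero_le_one)

lemma dyad {t : ℝ} (h1 : 1 ≤ t) (K : ℕ) (h2 : t < 2 ^ K) :
    t ^ ((3:ℝ)/2) ≤ ∑ k ∈ Finset.range K, if (2:ℝ) ^ k ≤ t then (3:ℝ) ^ (k + 1) else 0 := by
  induction K with
  | zero => simp at h2; linarith
  | succ K ih =>
    rw [Finset.sum_range_succ]
    rcases lt_or_ge t (2 ^ K) with h | h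
    · have := ih h
      have h3 : (0:ℝ) ≤ if (2:ℝ) ^ K ≤ t then (3:ℝ) ^ (K + 1) else 0 := by split_ifs <;> positivity
      linarith
    · rw [if_pos h]
      have h3 : (0:ℝ) ≤ ∑ k ∈ Finset.range K, if (2:ℝ) ^ k ≤ t then (3:ℝ) ^ (k + 1) else 0 :=
        Finset.sum_nonneg fun k _ => by split_ifs <;> positivity
      have h4 : t ^ ((3:ℝ)/2) ≤ (3:ℝ) ^ (K + 1) := by
        have h5 : (2:ℝ) ^ ((3:ℝ)/2) ≤ 3 := by
          have : ((2:ℝ) ^ ((3:ℝ)/2)) ^ 2 = 8 := by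
            rw [← Real.rpow_natCast, ← Real.rpow_mul (by norm_num)]; norm_num
          nlinarith [Real.rpow_nonneg (show (0:ℝ) ≤ 2 by norm_num) ((3:ℝ)/2)]
        calc t ^ ((3:ℝ)/2) ≤ ((2:ℝ) ^ (K + 1)) ^ ((3:ℝ)/2) := Real.rpow_le_rpow (by linarith) h2.le (by norm_num)
          _ = ((2:ℝ) ^ ((3:ℝ)/2)) ^ (K + 1) := by
            rw [← Real.rpow_natCast, ← Real.rpow_natCast, ← Real.rpow_mul (by norm_num), ← Real.rpow_mul (by norm_num), mul_comm]
          _ ≤ _ := pow_le_pow_left₀ (by positivity) h5 _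
      linarith

lemma moments {n : ℕ} {M p : ℝ} {u : ℝ × Sp n → ℝ} (S : Sol n M p u)
    (SG : ∀ α, Good n M p u (Sa n M α) (Sb n M α)) :
    IntegrableOn (fun q => |u q| ^ p * q.1) (Qc n M) ∧
    ∃ B, ∀ s, 1 ≤ s → ∫ q in Qc n M ∩ {q | s ≤ q.1}, |u q| ^ p * q.1 ≤ B / s ^ 2 := by
  obtain ⟨c2, C, ε, hc2, hC, hε, hS⟩ := S_facts S.hn S.hM
  have hcc := cc_pos
  have hI := I1_nonneg u
  have hlim := (th_lim M).1
  have hU0 : ∀ q, 0 ≤ |u q| ^ p := fun q => by positivity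
  have htm : Measurable fun q : ℝ × Sp n => q.1 := measurable_fst
  -- Step 1
  have i0 : IntegrableOn (fun q => |u q| ^ p * (cc / 2)) (Qc n M) := by
    refine bdd_int (B := (cc + c2 + C) * I1 u) (fun q _ => mul_nonneg (hU0 q) (by linarith)) (fun R => Uw_slab S continuousOn_const R) fun R hR => ?_
    have ev : ∀ᶠ α in atTop, th M α < min 1 (cc / (2 * c2 * R)) := hlim.eventually_lt_const (by positivity)
    obtain ⟨α, ⟨h1, h2, h3⟩, h4⟩ := (hS.and ev).exists
    have h5 := h4.trans_le (min_le_left _ _)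
    have h6 := h4.trans_le (min_le_right _ _)
    rw [lt_div_iff₀ (by positivity)] at h6
    refine (SG α).sl S (fun q hq => (h2 q hq).1) (fun q hq => ?_) (slab_meas n M 1 R zero_le_one) slab_sub_Qc (Uw_slab S continuousOn_const R) fun q hq => ?_
    · have a := h2 q (slab_sub_Qc hq)
      have b := h3 q hq
      have c : th M α ^ 3 ≤ 1 := pow_le_one₀ h1.le h5.le
      have d : C * th M α ^ 3 ≤ C := by nlinarith
      have e : c2 * th M α ≤ c2 := by nlinarith
      have e0 : 0 < c2 * th M α := by positivity
      rw [abs_le] at b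
      exact ⟨by rw [abs_of_nonneg a.1]; linarith, by rw [abs_le]; constructor <;> linarith⟩
    · have a := (h2 q (slab_sub_Qc hq)).2.2.1
      have b : th M α * q.1 ≤ th M α * R := mul_le_mul_of_nonneg_left hq.1.2 h1.le
      nlinarith
  have i0' : IntegrableOn (fun q => |u q| ^ p * cc) (Qc n M) := by
    have := i0.const_mul 2
    refine this.congr (Eventually.of_forall fun q => ?_); ring
  -- slab facts
  have hsl : ∀ α, 0 < th M α → th M α ≤ ε → (∀ q ∈ Qc n M, 0 ≤ Sa n M α q ∧ Sa n M α q ≤ cc ∧ cc - c2 * (th M α * q.1) ≤ Sa n M α q ∧ (th M α * q.1 ≤ ε → Sa n M α q ≤ cc - c2 * (th M α * q.1) + C * (th M α * q.1) ^ 3)) →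
      (∀ q ∈ slab n M 1 1, |Sa n M α q - cc + c2 * th M α| ≤ C * th M α ^ 3) := by
    intro α h1 h2 h3 q hq
    have a := h3 q (slab_sub_Qc hq)
    have hq1 : q.1 = 1 := le_antisymm hq.1.2 hq.1.1
    rw [hq1, mul_one] at a
    have b := a.2.2.2 h2
    rw [abs_of_nonneg (by linarith [a.2.2.1])]; linarith
  have evε : ∀ᶠ α in atTop, th M α ≤ ε := hlim.eventually_le_const hε
  have ev1 : ∀ᶠ α in atTop, th M α ≤ 1 := hlim.eventually_le_const one_pos
  -- Step 2
  have G1 : Good n M p u (fun _ => cc) (fun _ => 0) := by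
    refine Good.lim S (Pk := fun α => Sa n M α) (Pk1 := fun α => Sb n M α) (e := fun α => c2 * th M α + C * th M α ^ 3) (G := fun _ => cc)
      (Eventually.of_forall SG) measurable_const measurable_const ⟨cc, fun q _ => ⟨by rw [abs_of_pos hcc], by simpa using hcc.le⟩⟩ ?_ i0' ?_ ?_ ?_
    · filter_upwards [hS] with α h q hq
      rw [abs_of_nonneg (h.2.1 q hq).1]; exact (h.2.1 q hq).2.1
    · intro q hq
      have : Tendsto (fun α => cc - c2 * (th M α * q.1)) atTop (𝓝 (cc)) := by
        simpa using ((hlim.mul_const q.1).const_mul c2).const_sub (cc)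
      refine tendsto_of_tendsto_of_tendsto_of_le_of_le' this tendsto_const_nhds ?_ ?_
      · filter_upwards [hS] with α h using (h.2.1 q hq).2.2.1
      · filter_upwards [hS] with α h using (h.2.1 q hq).2.1
    · simpa using (hlim.const_mul c2).add ((hlim.pow 3).const_mul C)
    · filter_upwards [hS, evε] with α h h' q hq
      have a := hsl α h.1 h' h.2.1 q hq
      have b := h.2.2 q hq
      have e0 : 0 < c2 * th M α := mul_pos hc2 h.1
      rw [abs_le] at a b
      constructor
      · rw [abs_le]; constructor <;> linarith
      · rw [sub_zero, abs_le]; constructor <;> linarith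
  -- Step 3
  have GW : ∀ᶠ α in atTop, Good n M p u (fun q => (th M α)⁻¹ * (cc - Sa n M α q)) (fun q => (th M α)⁻¹ * (- Sb n M α q)) := by
    filter_upwards with α
    have := G1.lin S (SG α) (th M α)⁻¹ (-(th M α)⁻¹)
    convert this using 2 <;> ring
  have i1 : IntegrableOn (fun q => |u q| ^ p * (c2 / 2 * q.1)) (Qc n M) := by
    refine bdd_int (B := (c2 + C) * I1 u) (fun q hq => mul_nonneg (hU0 q) (mul_nonneg (by linarith) (by linarith [hq.1]))) (fun R => Uw_slab S (by fun_prop) R) fun R hR => ?_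
    have ev : ∀ᶠ α in atTop, th M α < min ε (Real.sqrt (c2 / (2 * (C + 1)))) / R := hlim.eventually_lt_const (by positivity)
    obtain ⟨α, ⟨⟨⟨⟨h1, h2, h3⟩, h4⟩, hε'⟩, hg⟩, h1'⟩ := ((((hS.and ev).and evε).and GW).and ev1).exists
    rw [lt_div_iff₀ (by linarith)] at h4
    have h5 := h4.le.trans (min_le_left _ _)
    have h6 := h4.le.trans (min_le_right _ _)
    have h7 : C * (th M α * R) ^ 2 ≤ c2 / 2 := by
      have : (th M α * R) ^ 2 ≤ c2 / (2 * (C + 1)) := by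
        rw [← Real.sq_sqrt (show 0 ≤ c2 / (2 * (C + 1)) by positivity)]
        exact pow_le_pow_left₀ (by positivity) h6 2
      rw [le_div_iff₀ (by positivity)] at this
      nlinarith [sq_nonneg (th M α * R)]
    refine hg.sl S (fun q hq => mul_nonneg (inv_nonneg.2 h1.le) (by linarith [(h2 q hq).2.1])) (fun q hq => ?_) (slab_meas n M 1 R zero_le_one) slab_sub_Qc (Uw_slab S (by fun_prop) R) fun q hq => ?_
    · have a := hsl α h1 hε' h2 q hq
      have b := h3 q hq
      have e0 : C * th M α ^ 3 ≤ C * th M α := mul_le_mul_of_nonneg_left (pow_le_of_le_one h1.le h1' (by norm_num)) hC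
      rw [abs_mul, abs_mul, abs_of_pos (inv_pos.2 h1)]
      rw [abs_le] at a b
      have e1 : 0 < c2 * th M α := mul_pos hc2 h1
      constructor
      · rw [inv_mul_le_iff₀ h1, abs_le]; constructor <;> nlinarith
      · rw [inv_mul_le_iff₀ h1, abs_le]; constructor <;> nlinarith
    · have hx : th M α * q.1 ≤ th M α * R := mul_le_mul_of_nonneg_left hq.1.2 h1.le
      have hx0 : 0 ≤ th M α * q.1 := mul_nonneg h1.le (by linarith [hq.1.1])
      have a := (h2 q (slab_sub_Qc hq)).2.2.2 (hx.trans h5)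
      have h8 : C * (th M α * q.1) ^ 2 ≤ c2 / 2 := le_trans (mul_le_mul_of_nonneg_left (pow_le_pow_left₀ hx0 hx 2) hC) h7
      have h9 : C * (th M α * q.1) ^ 3 ≤ c2 / 2 * (th M α * q.1) := by
        have := mul_le_mul_of_nonneg_right h8 hx0
        calc _ = C * (th M α * q.1) ^ 2 * (th M α * q.1) := by ring
          _ ≤ _ := this
      rw [le_inv_mul_iff₀ h1]
      linarith
  have i1' : IntegrableOn (fun q => |u q| ^ p * (c2 * q.1)) (Qc n M) := by
    have := i1.const_mul 2
    refine this.congr (Eventually.of_forall fun q => ?_); ring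
  have i1'' : IntegrableOn (fun q => |u q| ^ p * q.1) (Qc n M) := by
    have := i1'.const_mul c2⁻¹
    refine this.congr (Eventually.of_forall fun q => ?_)
    show c2⁻¹ * (|u q| ^ p * (c2 * q.1)) = _
    field_simp
  -- Step 4
  have G2 : Good n M p u (fun q => c2 * q.1) (fun _ => c2) := by
    refine Good.lim S (e := fun α => C * th M α ^ 2) (G := fun q => c2 * q.1)
      GW (htm.const_mul c2) measurable_const ⟨c2, fun q hq => ?_⟩ ?_ i1' ?_ ?_ ?_
    · have hq1 : q.1 = 1 := le_antisymm hq.1.2 hq.1.1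
      rw [hq1, mul_one, abs_of_pos hc2]; exact ⟨le_rfl, le_rfl⟩
    · filter_upwards [hS] with α h q hq
      have a := h.2.1 q hq
      rw [abs_of_nonneg (mul_nonneg (inv_nonneg.2 h.1.le) (by linarith)), inv_mul_le_iff₀ h.1]
      linarith
    · intro q hq
      have T : Tendsto (fun α => c2 * q.1 - C * th M α ^ 2 * q.1 ^ 3) atTop (𝓝 (c2 * q.1)) := by
        simpa using (((hlim.pow 2).const_mul C).mul_const (q.1 ^ 3)).const_sub (c2 * q.1)
      have evq : ∀ᶠ α in atTop, th M α * q.1 ≤ ε := by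
        have : Tendsto (fun α => th M α * q.1) atTop (𝓝 0) := by simpa using hlim.mul_const q.1
        exact this.eventually_le_const hε
      refine tendsto_of_tendsto_of_tendsto_of_le_of_le' T tendsto_const_nhds ?_ ?_
      · filter_upwards [hS, evq] with α h h'
        have a := (h.2.1 q hq).2.2.2 h'
        rw [le_inv_mul_iff₀ h.1]
        have : th M α * (c2 * q.1 - C * th M α ^ 2 * q.1 ^ 3) = c2 * (th M α * q.1) - C * (th M α * q.1) ^ 3 := by ring
        linarith
      · filter_upwards [hS] with α h
        rw [inv_mul_le_iff₀ h.1]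
        have := (h.2.1 q hq).2.2.1
        linarith
    · simpa using (hlim.pow 2).const_mul C
    · filter_upwards [hS, evε] with α h h' q hq
      have a := hsl α h.1 h' h.2.1 q hq
      have b := h.2.2 q hq
      have hq1 : q.1 = 1 := le_antisymm hq.1.2 hq.1.1
      have hne := h.1.ne'
      have e1 : (th M α)⁻¹ * (cc - Sa n M α q) - c2 * q.1 = -((th M α)⁻¹ * (Sa n M α q - cc + c2 * th M α)) := by
        rw [hq1]; field_simp; ring
      have e2 : (th M α)⁻¹ * (-Sb n M α q) - c2 = -((th M α)⁻¹ * (Sb n M α q + c2 * th M α)) := by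
        field_simp; ring
      rw [e1, e2, abs_neg, abs_neg, abs_mul, abs_mul, abs_of_pos (inv_pos.2 h.1), inv_mul_le_iff₀ h.1, inv_mul_le_iff₀ h.1]
      constructor
      · linarith [show th M α * (C * th M α ^ 2) = C * th M α ^ 3 by ring]
      · linarith [show th M α * (C * th M α ^ 2) = C * th M α ^ 3 by ring]
  -- Step 5
  refine ⟨i1'', ?_⟩
  obtain ⟨α0, hα0⟩ := eventually_atTop.1 (hS.and evε)
  set T0 := 2 * cc / c2 with hT0
  have hT0p : 0 < T0 := by positivity
  set s0 := max 1 (T0 * (max (M + 1 + α0) 1) ^ ((2:ℝ)/3)) with hs0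
  have key : ∀ s, s0 ≤ s → ∫ q in Qc n M ∩ {q | s ≤ q.1}, |u q| ^ p * q.1 ≤ (2 / c2 * C * T0 ^ 2 * I1 u) / s ^ 2 := by
    intro s hs
    have hs1 : 1 ≤ s := (le_max_left _ _).trans hs
    have hsp : 0 < s := by linarith
    set α := (s / T0) ^ ((3:ℝ)/2) - M - 1 with hα
    have hth : th M α = T0 / s := by
      unfold th
      have : M + 1 + α = (s / T0) ^ ((3:ℝ)/2) := by rw [hα]; ring
      rw [this, ← Real.inv_rpow (by positivity), ← Real.rpow_mul (by positivity)]
      norm_num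
    have hαα : α0 ≤ α := by
      have h1 : (max (M + 1 + α0) 1) ^ ((2:ℝ)/3) ≤ s / T0 := by
        rw [le_div_iff₀ hT0p, mul_comm]; exact (le_max_right _ _).trans hs
      have h2 := Real.rpow_le_rpow (by positivity) h1 (show (0:ℝ) ≤ 3/2 by norm_num)
      rw [← Real.rpow_mul (by positivity)] at h2
      norm_num at h2
      rw [hα]; linarith [h2.1]
    obtain ⟨⟨h1, h2, h3⟩, hε'⟩ := hα0 α hαα
    have g : Good n M p u (fun q => (th M α)⁻¹ * (2 / c2) * (Sa n M α q - cc + c2 * (th M α * q.1))) (fun q => (th M α)⁻¹ * (2 / c2) * (Sb n M α q + c2 * th M α)) := by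
      have g1 := (SG α).lin S G1 1 (-1)
      have g2 := g1.lin S G2 ((th M α)⁻¹ * (2 / c2)) ((th M α)⁻¹ * (2 / c2) * th M α)
      convert g2 using 2 <;> ring
    have hK : 0 ≤ (th M α)⁻¹ * (2 / c2) := by positivity
    have := g.sl S (w := fun q => q.1) (A := Qc n M ∩ {q | s ≤ q.1}) (e := (th M α)⁻¹ * (2 / c2) * (C * th M α ^ 3)) (fun q hq => mul_nonneg hK ?_) (fun q hq => ?_) ((Qc_meas n M).inter (measurableSet_le measurable_const htm)) inter_subset_left
      (i1''.mono_set inter_subset_left) (fun q hq => ?_)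
    · refine this.trans (le_of_eq ?_)
      rw [hth]; field_simp
    · linarith [(h2 q hq).2.2.1]
    · have a := hsl α h1 hε' h2 q hq
      have hq1 : q.1 = 1 := le_antisymm hq.1.2 hq.1.1
      rw [abs_mul (_ * _), abs_of_nonneg hK, abs_mul (_ * _), abs_of_nonneg hK, hq1, mul_one]
      exact ⟨mul_le_mul_of_nonneg_left a hK, mul_le_mul_of_nonneg_left (h3 q hq) hK⟩
    · have a := (h2 q hq.1).1
      have hq : s ≤ q.1 := hq.2
      have b : T0 ≤ th M α * q.1 := by rw [hth, div_mul_eq_mul_div, le_div_iff₀ hsp]; exact mul_le_mul_of_nonneg_left hq hT0p.le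
      have c : cc ≤ c2 / 2 * (th M α * q.1) := by
        have := mul_le_mul_of_nonneg_left b (show 0 ≤ c2 / 2 by positivity)
        have e : c2 / 2 * T0 = cc := by rw [hT0]; field_simp
        linarith
      have d : c2 / 2 * (th M α * q.1) ≤ Sa n M α q - cc + c2 * (th M α * q.1) := by linarith
      calc q.1 = (th M α)⁻¹ * (2 / c2) * (c2 / 2 * (th M α * q.1)) := by field_simp
        _ ≤ _ := mul_le_mul_of_nonneg_left d hK
  have hs01 : 1 ≤ s0 := le_max_left _ _
  set m1 := ∫ q in Qc n M, |u q| ^ p * q.1 with hm1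
  have hm10 : 0 ≤ m1 := setIntegral_nonneg (Qc_meas n M) fun q hq => mul_nonneg (hU0 q) (by linarith [hq.1])
  have hK0 : 0 ≤ 2 / c2 * C * T0 ^ 2 * I1 u := by positivity
  refine ⟨2 / c2 * C * T0 ^ 2 * I1 u + m1 * s0 ^ 2, fun s hs => ?_⟩
  rcases le_total s0 s with h | h
  · refine (key s h).trans ?_
    gcongr
    have : 0 ≤ m1 * s0 ^ 2 := by positivity
    linarith
  · have : ∫ q in Qc n M ∩ {q | s ≤ q.1}, |u q| ^ p * q.1 ≤ m1 :=
      setIntegral_mono_set i1'' ((ae_restrict_iff' (Qc_meas n M)).2 (Eventually.of_forall fun q hq => mul_nonneg (hU0 q) (by linarith [hq.1]))) (LE.le.eventuallyLE inter_subset_left)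
    refine this.trans ?_
    rw [le_div_iff₀ (by positivity)]
    have : s ^ 2 ≤ s0 ^ 2 := pow_le_pow_left₀ (by linarith) h 2
    have := mul_le_mul_of_nonneg_left this hm10
    linarith

lemma mom52 {n : ℕ} {M p : ℝ} {u : ℝ × Sp n → ℝ} (S : Sol n M p u)
    (SG : ∀ α, Good n M p u (Sa n M α) (Sb n M α)) :
    IntegrableOn (fun q => |u q| ^ p * q.1 ^ ((5:ℝ)/2)) (Qc n M) := by
  obtain ⟨i1, B, hB⟩ := moments S SG
  have hU0 : ∀ q, 0 ≤ |u q| ^ p := fun q => by positivity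
  have hB0 : 0 ≤ B := by
    have := hB 1 le_rfl
    have h2 : 0 ≤ ∫ q in Qc n M ∩ {q | 1 ≤ q.1}, |u q| ^ p * q.1 := setIntegral_nonneg ((Qc_meas n M).inter (measurableSet_le measurable_const measurable_fst)) fun q hq => mul_nonneg (hU0 q) (by linarith [hq.1.1])
    norm_num at this; linarith
  have hcont : ContinuousOn (fun q : ℝ × Sp n => q.1 ^ ((5:ℝ)/2)) (Om n) :=
    (continuous_fst.rpow_const fun q => Or.inr (by norm_num)).continuousOn
  refine bdd_int (B := 12 * B) (fun q hq => mul_nonneg (hU0 q) (Real.rpow_nonneg (by linarith [hq.1]) _)) (fun R => Uw_slab S hcont R) fun R hR => ?_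
  obtain ⟨K, hK⟩ := pow_unbounded_of_one_lt R (one_lt_two (α := ℝ))
  have hms : ∀ k : ℕ, MeasurableSet {q : ℝ × Sp n | (2:ℝ) ^ k ≤ q.1} := fun k => measurableSet_le measurable_const measurable_fst
  have hii : ∀ k ∈ Finset.range K, Integrable (fun q => (3:ℝ) ^ (k + 1) * ({q : ℝ × Sp n | (2:ℝ) ^ k ≤ q.1}.indicator (fun q => |u q| ^ p * q.1) q)) (volume.restrict (Qc n M)) :=
    fun k _ => (i1.indicator (hms k)).const_mul _
  have hn0 : ∀ q ∈ Qc n M, 0 ≤ ∑ k ∈ Finset.range K, (3:ℝ) ^ (k + 1) * ({q : ℝ × Sp n | (2:ℝ) ^ k ≤ q.1}.indicator (fun q => |u q| ^ p * q.1) q) := fun q hq =>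
    Finset.sum_nonneg fun k _ => mul_nonneg (by positivity) (indicator_apply_nonneg fun _ => mul_nonneg (hU0 q) (by linarith [hq.1]))
  calc _ ≤ ∫ q in slab n M 1 R, ∑ k ∈ Finset.range K, (3:ℝ) ^ (k + 1) * ({q : ℝ × Sp n | (2:ℝ) ^ k ≤ q.1}.indicator (fun q => |u q| ^ p * q.1) q) := by
        refine setIntegral_mono_on (Uw_slab S hcont R) (IntegrableOn.mono_set (integrable_finsetSum _ hii) slab_sub_Qc) (slab_meas n M 1 R zero_le_one) fun q hq => ?_
        have hd := dyad hq.1.1 K (hq.1.2.trans_lt hK)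
        have hq0 : 0 < q.1 := by linarith [hq.1.1]
        have e : q.1 ^ ((5:ℝ)/2) = q.1 * q.1 ^ ((3:ℝ)/2) := by
          rw [← Real.rpow_one_add' hq0.le (by norm_num)]; norm_num
        have h2 := mul_le_mul_of_nonneg_left hd (mul_nonneg (hU0 q) hq0.le)
        rw [e, ← mul_assoc]
        refine h2.trans (le_of_eq ?_)
        rw [Finset.mul_sum]
        refine Finset.sum_congr rfl fun k _ => ?_
        by_cases hk : (2:ℝ) ^ k ≤ q.1
        · rw [if_pos hk, indicator_of_mem (by exact hk)]; ring
        · rw [if_neg hk, indicator_of_notMem (by exact hk)]; ring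
    _ ≤ ∫ q in Qc n M, ∑ k ∈ Finset.range K, (3:ℝ) ^ (k + 1) * ({q : ℝ × Sp n | (2:ℝ) ^ k ≤ q.1}.indicator (fun q => |u q| ^ p * q.1) q) :=
        setIntegral_mono_set (integrable_finsetSum _ hii) ((ae_restrict_iff' (Qc_meas n M)).2 (Eventually.of_forall hn0)) (LE.le.eventuallyLE slab_sub_Qc)
    _ = ∑ k ∈ Finset.range K, (3:ℝ) ^ (k + 1) * ∫ q in Qc n M ∩ {q | (2:ℝ) ^ k ≤ q.1}, |u q| ^ p * q.1 := by
        rw [integral_finsetSum _ hii]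
        refine Finset.sum_congr rfl fun k _ => ?_
        rw [integral_const_mul, setIntegral_indicator (hms k)]
    _ ≤ ∑ k ∈ Finset.range K, 3 * B * (3/4:ℝ) ^ k := by
        refine Finset.sum_le_sum fun k _ => ?_
        refine (mul_le_mul_of_nonneg_left (hB (2 ^ k) (one_le_pow₀ one_le_two)) (by positivity)).trans (le_of_eq ?_)
        have : ((2:ℝ) ^ k) ^ 2 = 4 ^ k := by rw [← pow_mul, mul_comm, pow_mul]; norm_num
        rw [this, div_pow, pow_succ]; ring
    _ = 3 * B * ∑ k ∈ Finset.range K, (3/4:ℝ) ^ k := by rw [Finset.mul_sum]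
    _ ≤ 3 * B * 4 := by
        refine mul_le_mul_of_nonneg_left ?_ (by positivity)
        rw [geom_sum_eq (by norm_num)]
        have : (0:ℝ) ≤ (3/4) ^ K := by positivity
        rw [div_le_iff_of_neg (by norm_num)]; linarith
    _ = 12 * B := by ring
end Tric

namespace Tric

/-- bump data -/
structure Bmp (c c1 c2 : ℝ → ℝ) (A X : ℝ) : Prop where
  cd : ContDiff ℝ 2 c
  d0 : ∀ v, HasDerivAt c (c1 v) v
  d1 : ∀ v, HasDerivAt c1 (c2 v) v
  k1 : Continuous c1
  k2 : Continuous c2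
  X0 : 0 ≤ X
  b0 : ∀ v, |c v| ≤ X
  b1 : ∀ v, |c1 v| ≤ X
  b2 : ∀ v, |c2 v| ≤ X
  n0 : ∀ v, 0 ≤ c v
  pos : ∀ v ∈ Ioo A (A + 1), 0 < c v
  z0 : ∀ v, v ∉ Icc A (A + 1) → c v = 0
  z1 : ∀ v, v ∉ Icc A (A + 1) → c1 v = 0

lemma bmp_ex (A : ℝ) : ∃ c c1 c2 X, Bmp c c1 c2 A X := by
  let f : ContDiffBump (A + 1/2 : ℝ) := ⟨1/4, 1/2, by norm_num, by norm_num⟩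
  have hcd : ContDiff ℝ 3 (f : ℝ → ℝ) := f.contDiff
  have hcs : HasCompactSupport (f : ℝ → ℝ) := f.hasCompactSupport
  have hc1 : ContDiff ℝ 2 (deriv (f : ℝ → ℝ)) := (contDiff_succ_iff_deriv (n := 2)).1 (by exact_mod_cast hcd) |>.2.2
  have hc2 : ContDiff ℝ 1 (deriv (deriv (f : ℝ → ℝ))) := (contDiff_succ_iff_deriv (n := 1)).1 (by exact_mod_cast hc1) |>.2.2
  obtain ⟨X0, h0⟩ := hcs.exists_bound_of_continuous hcd.continuous
  obtain ⟨X1, h1⟩ := hcs.deriv.exists_bound_of_continuous hc1.continuous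
  obtain ⟨X2, h2⟩ := hcs.deriv.deriv.exists_bound_of_continuous hc2.continuous
  have hball : ball (A + 1/2 : ℝ) (1/2) = Ioo A (A + 1) := by rw [Real.ball_eq_Ioo]; congr 1 <;> ring
  have hcball : closedBall (A + 1/2 : ℝ) (1/2) = Icc A (A + 1) := by rw [Real.closedBall_eq_Icc]; congr 1 <;> ring
  have hts : tsupport (f : ℝ → ℝ) = Icc A (A + 1) := by rw [f.tsupport_eq]; exact hcball
  refine ⟨f, deriv f, deriv (deriv f), max X0 (max X1 X2), hcd.of_le (by norm_num), fun v => (hcd.differentiable (by norm_num) v).hasDerivAt,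
    fun v => (hc1.differentiable (by norm_num) v).hasDerivAt, hc1.continuous, hc2.continuous, ?_, fun v => (h0 v).trans (le_max_left _ _),
    fun v => (h1 v).trans ((le_max_left _ _).trans (le_max_right _ _)), fun v => (h2 v).trans ((le_max_right _ _).trans (le_max_right _ _)),
    fun v => f.nonneg, fun v hv => f.pos_of_mem_ball ?_, fun v hv => ?_, fun v hv => ?_⟩
  · exact (norm_nonneg _).trans ((h0 0).trans (le_max_left _ _))
  · show v ∈ ball (A + 1/2 : ℝ) (1/2); rw [hball]; exact hv
  · exact image_eq_zero_of_notMem_tsupport (by rwa [hts])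
  · refine image_eq_zero_of_notMem_tsupport (fun h => hv ?_)
    rw [← hts]; exact tsupport_deriv_subset h

/-- the weight -/
noncomputable def om (μ : ℝ) : ℝ := (max (1 - μ ^ 2) 0) ^ (-(5:ℝ)/6)
/-- one-sided weight -/
noncomputable def pp (x : ℝ) : ℝ := (Ioc (0:ℝ) 2).indicator (fun x => x ^ (-(5:ℝ)/6)) x

lemma om_meas : Measurable om := by unfold om; fun_prop
lemma om_nonneg (μ : ℝ) : 0 ≤ om μ := Real.rpow_nonneg (le_max_right _ _) _
lemma om_zero {μ : ℝ} (h : μ ∉ Ioo (-1:ℝ) 1) : om μ = 0 := by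
  unfold om
  have : 1 - μ ^ 2 ≤ 0 := by
    by_contra h'
    push Not at h'
    exact h ⟨by nlinarith, by nlinarith⟩
  rw [max_eq_right this, Real.zero_rpow (by norm_num)]
lemma om_eq {μ : ℝ} (h : μ ∈ Ioo (-1:ℝ) 1) : om μ = (1 - μ ^ 2) ^ (-(5:ℝ)/6) := by
  unfold om; rw [max_eq_left]; nlinarith [h.1, h.2]
lemma om_pos {μ : ℝ} (h : μ ∈ Ioo (-1:ℝ) 1) : 0 < om μ := by
  rw [om_eq h]; exact Real.rpow_pos_of_pos (by nlinarith [h.1, h.2]) _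

lemma pp_nonneg (x : ℝ) : 0 ≤ pp x := indicator_nonneg (fun x hx => Real.rpow_nonneg hx.1.le _) x

lemma rp_int (b : ℝ) : IntegrableOn (fun x : ℝ => x ^ (-(5:ℝ)/6)) (Ioc 0 b) := by
  rcases le_total 0 b with h | h
  · exact (intervalIntegrable_iff_integrableOn_Ioc_of_le h).1 (intervalIntegral.intervalIntegrable_rpow' (by norm_num))
  · rw [Ioc_eq_empty (not_lt.2 h)]; exact integrableOn_empty

lemma pp_integrable : Integrable pp := (rp_int 2).integrable_indicator measurableSet_Ioc

lemma om_le (μ : ℝ) : om μ ≤ pp (1 - μ) + pp (1 + μ) := by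
  by_cases h : μ ∈ Ioo (-1:ℝ) 1
  · obtain ⟨h1, h2⟩ := h
    rw [om_eq ⟨h1, h2⟩]
    rcases le_total 0 μ with h0 | h0
    · have e : pp (1 - μ) = (1 - μ) ^ (-(5:ℝ)/6) := by unfold pp; rw [indicator_of_mem]; exact ⟨by linarith, by linarith⟩
      have := rp_le (x := 1 - μ) (y := 1 - μ ^ 2) (e := -(5:ℝ)/6) (by linarith) (by nlinarith) (by norm_num)
      linarith [pp_nonneg (1 + μ)]
    · have e : pp (1 + μ) = (1 + μ) ^ (-(5:ℝ)/6) := by unfold pp; rw [indicator_of_mem]; exact ⟨by linarith, by linarith⟩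
      have := rp_le (x := 1 + μ) (y := 1 - μ ^ 2) (e := -(5:ℝ)/6) (by linarith) (by nlinarith) (by norm_num)
      linarith [pp_nonneg (1 - μ)]
  · rw [om_zero h]; exact add_nonneg (pp_nonneg _) (pp_nonneg _)

lemma om_int : Integrable om := by
  have i1 : Integrable fun μ => pp (1 - μ) := pp_integrable.comp_sub_left 1
  have i2 : Integrable fun μ => pp (1 + μ) := pp_integrable.comp_add_left 1
  refine (i1.add i2).mono' om_meas.aestronglyMeasurable (Eventually.of_forall fun μ => ?_)
  rw [Real.norm_of_nonneg (om_nonneg μ)]; exact om_le μ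

lemma pp_Icc {a h : ℝ} (hh : 0 < h) : ∫ x in Icc a (a + h), pp x ≤ 12 * (h * (max a h) ^ (-(5:ℝ)/6)) := by
  rcases le_total h a with hc | hc
  · rw [max_eq_left hc]
    have ha : 0 < a := by linarith
    have hb : ∀ x ∈ Icc a (a + h), pp x ≤ a ^ (-(5:ℝ)/6) := by
      intro x hx
      unfold pp
      by_cases h2 : x ∈ Ioc (0:ℝ) 2
      · rw [indicator_of_mem h2]; exact rp_le ha hx.1 (by norm_num)
      · rw [indicator_of_notMem h2]; positivity
    calc _ ≤ ∫ x in Icc a (a + h), a ^ (-(5:ℝ)/6) := setIntegral_mono_on pp_integrable.integrableOn (integrableOn_const (by simp)) measurableSet_Icc hb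
      _ = h * a ^ (-(5:ℝ)/6) := by simp [hh.le]
      _ ≤ _ := by have : 0 ≤ h * a ^ (-(5:ℝ)/6) := by positivity
                  linarith
  · rw [max_eq_right hc]
    have e1 : ∫ x in Icc a (a + h), pp x ≤ ∫ x in Ioc 0 (2 * h), x ^ (-(5:ℝ)/6) := by
      rw [← integral_indicator measurableSet_Icc, ← integral_indicator measurableSet_Ioc]
      refine integral_mono (pp_integrable.indicator measurableSet_Icc) ((rp_int _).integrable_indicator measurableSet_Ioc) fun x => ?_
      by_cases h1 : x ∈ Icc a (a + h)
      · rw [indicator_of_mem h1]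
        unfold pp
        by_cases h2 : x ∈ Ioc (0:ℝ) 2
        · rw [indicator_of_mem h2, indicator_of_mem (show x ∈ Ioc 0 (2*h) from ⟨h2.1, by linarith [h1.2]⟩)]
        · rw [indicator_of_notMem h2]; exact indicator_nonneg (fun x hx => Real.rpow_nonneg hx.1.le _) x
      · rw [indicator_of_notMem h1]; exact indicator_nonneg (fun x hx => Real.rpow_nonneg hx.1.le _) x
    refine e1.trans ?_
    rw [← intervalIntegral.integral_of_le (by positivity), integral_rpow (Or.inl (by norm_num)), show (-(5:ℝ)/6 + 1) = 1/6 by norm_num, Real.zero_rpow (by norm_num),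
      Real.mul_rpow (by norm_num) hh.le]
    have e2 : h * h ^ (-(5:ℝ)/6) = h ^ ((1:ℝ)/6) := by
      rw [← Real.rpow_one_add' hh.le (by norm_num)]; norm_num
    have e3 : (2:ℝ) ^ ((1:ℝ)/6) ≤ 2 := by
      calc _ ≤ (2:ℝ) ^ (1:ℝ) := Real.rpow_le_rpow_of_exponent_le (by norm_num) (by norm_num)
        _ = 2 := by simp
    rw [e2]
    have : 0 ≤ h ^ ((1:ℝ)/6) := by positivity
    nlinarith

lemma pp_bd {a y δ D : ℝ} (hy : 0 < y) (hδ : 0 < δ) (hD : 1 ≤ D) (h : δ ≤ D * max a 1) :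
    ∫ x in Icc (a / y) (a / y + 1 / y), pp x ≤ 12 * D * (y ^ (-(1:ℝ)/6) * δ ^ (-(5:ℝ)/6)) := by
  refine (pp_Icc (by positivity)).trans ?_
  have hm : max (a / y) (1 / y) = max a 1 / y := (max_div_div_right hy.le _ _)
  have h1 : 0 < max a 1 := lt_of_lt_of_le one_pos (le_max_right _ _)
  have e1 : (max a 1) ^ (-(5:ℝ)/6) ≤ D * δ ^ (-(5:ℝ)/6) := by
    calc _ ≤ (δ / D) ^ (-(5:ℝ)/6) := rp_le (by positivity) (by rw [div_le_iff₀ (by linarith)]; linarith) (by norm_num)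
      _ = D ^ ((5:ℝ)/6) * δ ^ (-(5:ℝ)/6) := by
        rw [Real.div_rpow hδ.le (by linarith), show (-(5:ℝ)/6) = -((5:ℝ)/6) by ring, Real.rpow_neg (x := D) (by linarith), div_inv_eq_mul, mul_comm]
      _ ≤ D * δ ^ (-(5:ℝ)/6) := by
        refine mul_le_mul_of_nonneg_right ?_ (by positivity)
        calc D ^ ((5:ℝ)/6) ≤ D ^ (1:ℝ) := Real.rpow_le_rpow_of_exponent_le hD (by norm_num)
          _ = D := Real.rpow_one D
  have e2 : 1 / y * (max a 1 / y) ^ (-(5:ℝ)/6) = y ^ (-(1:ℝ)/6) * (max a 1) ^ (-(5:ℝ)/6) := by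
    rw [Real.div_rpow h1.le hy.le]
    have : 1 / y / y ^ (-(5:ℝ)/6) = y ^ (-(1:ℝ)/6) := by
      rw [one_div, ← Real.rpow_neg_one, ← Real.rpow_sub hy]; norm_num
    rw [← this]; ring
  rw [hm, e2]
  have := mul_le_mul_of_nonneg_left e1 (show 0 ≤ y ^ (-(1:ℝ)/6) by positivity)
  nlinarith

/-- main plane wave estimate -/
lemma pw_bd {A M y s X : ℝ} (hA : 0 ≤ A) (hM : 0 ≤ M) (hX : 0 ≤ X) (hy : 0 < y) (hs : |s| ≤ M + y) {g : ℝ → ℝ} (hg : ∀ μ, |g μ| ≤ X * om μ)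
    (hz : ∀ μ, μ * y + s ∉ Icc A (A + 1) → g μ = 0) :
    |∫ μ, g μ| ≤ 24 * X * (M + A + 3) * (y ^ (-(1:ℝ)/6) * (1 + (M + y) - |s|) ^ (-(5:ℝ)/6)) := by
  set δ := 1 + (M + y) - |s| with hδ
  have hδ1 : 1 ≤ δ := by linarith
  set a1 := y + s - A - 1
  set a2 := y - s + A
  set J1 := Icc (a1 / y) (a1 / y + 1 / y)
  set J2 := Icc (a2 / y) (a2 / y + 1 / y)
  have b1 := pp_bd (a := a1) (D := M + A + 3) hy (by linarith : 0 < δ) (by linarith) (by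
    have := le_max_left a1 1
    have h1 := le_max_right a1 1
    have := neg_le_abs s
    nlinarith)
  have b2 := pp_bd (a := a2) (D := M + A + 3) hy (by linarith : 0 < δ) (by linarith) (by
    have := le_max_left a2 1
    have h1 := le_max_right a2 1
    have := le_abs_self s
    nlinarith)
  have i1 : Integrable fun μ => J1.indicator pp (1 - μ) := (pp_integrable.indicator measurableSet_Icc).comp_sub_left 1
  have i2 : Integrable fun μ => J2.indicator pp (1 + μ) := (pp_integrable.indicator measurableSet_Icc).comp_add_left 1
  have H := norm_integral_le_of_norm_le (μ := volume) (f := g) ((i1.add i2).const_mul X) (Eventually.of_forall fun μ => ?_)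
  · rw [Real.norm_eq_abs] at H
    refine H.trans ?_
    simp only [Pi.add_apply]
    rw [integral_const_mul, integral_add i1 i2, integral_sub_left_eq_self (fun x => J1.indicator pp x) volume 1,
      integral_add_left_eq_self (fun x => J2.indicator pp x) 1, integral_indicator measurableSet_Icc, integral_indicator measurableSet_Icc]
    have := mul_le_mul_of_nonneg_left (add_le_add b1 b2) hX
    refine this.trans (le_of_eq ?_); ring
  · rw [Real.norm_eq_abs]
    simp only [Pi.add_apply]
    by_cases h : μ * y + s ∈ Icc A (A + 1)
    · obtain ⟨h1, h2⟩ := h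
      have m1 : 1 - μ ∈ J1 := by
        refine ⟨?_, ?_⟩
        · rw [div_le_iff₀ hy]; simp only [a1]; linarith
        · rw [← add_div, le_div_iff₀ hy]; simp only [a1]; linarith
      have m2 : 1 + μ ∈ J2 := by
        refine ⟨?_, ?_⟩
        · rw [div_le_iff₀ hy]; simp only [a2]; linarith
        · rw [← add_div, le_div_iff₀ hy]; simp only [a2]; linarith
      rw [indicator_of_mem m1, indicator_of_mem m2]
      exact (hg μ).trans (mul_le_mul_of_nonneg_left (om_le μ) hX)
    · rw [hz μ h, abs_zero]
      exact mul_nonneg hX (add_nonneg (indicator_nonneg (fun _ _ => pp_nonneg _) _) (indicator_nonneg (fun _ _ => pp_nonneg _) _))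
end Tric

namespace Tric

/-- phase -/
noncomputable def pz (n : ℕ) (i : Fin n) (ς μ : ℝ) (q : ℝ × Sp n) : ℝ := μ * phi q.1 + ς * q.2 i
noncomputable def g0 (n : ℕ) (i : Fin n) (ς : ℝ) (c : ℝ → ℝ) (μ : ℝ) (q : ℝ × Sp n) : ℝ := om μ * c (pz n i ς μ q)
noncomputable def g1 (n : ℕ) (i : Fin n) (ς : ℝ) (c1 : ℝ → ℝ) (μ : ℝ) (q : ℝ × Sp n) : ℝ :=
  om μ * (μ * q.1 ^ ((1:ℝ)/2) * c1 (pz n i ς μ q))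
noncomputable def g2 (n : ℕ) (i : Fin n) (ς : ℝ) (c1 c2 : ℝ → ℝ) (μ : ℝ) (q : ℝ × Sp n) : ℝ :=
  om μ * (μ / (2 * q.1 ^ ((1:ℝ)/2)) * c1 (pz n i ς μ q) - q.1 * (1 - μ ^ 2) * c2 (pz n i ς μ q))
noncomputable def Th (n : ℕ) (i : Fin n) (ς : ℝ) (c : ℝ → ℝ) (q : ℝ × Sp n) : ℝ := ∫ μ, g0 n i ς c μ q
noncomputable def Th1 (n : ℕ) (i : Fin n) (ς : ℝ) (c1 : ℝ → ℝ) (q : ℝ × Sp n) : ℝ := ∫ μ, g1 n i ς c1 μ q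

lemma pz_cont (n : ℕ) (i : Fin n) (ς : ℝ) : Continuous fun z : ℝ × (ℝ × Sp n) => pz n i ς z.1 z.2 := by
  unfold pz
  have := phi_cont
  fun_prop

lemma g_meas (n : ℕ) (i : Fin n) (ς : ℝ) {c c1 c2 : ℝ → ℝ} (h0 : Continuous c) (h1 : Continuous c1) (h2 : Continuous c2) :
    Measurable (Function.uncurry (g0 n i ς c)) ∧ Measurable (Function.uncurry (g1 n i ς c1)) ∧ Measurable (Function.uncurry (g2 n i ς c1 c2)) := by
  have ho : Measurable fun z : ℝ × (ℝ × Sp n) => om z.1 := om_meas.comp measurable_fst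
  have k0 : Measurable fun z : ℝ × (ℝ × Sp n) => c (pz n i ς z.1 z.2) := (h0.comp (pz_cont n i ς)).measurable
  have k1 : Measurable fun z : ℝ × (ℝ × Sp n) => c1 (pz n i ς z.1 z.2) := (h1.comp (pz_cont n i ς)).measurable
  have k2 : Measurable fun z : ℝ × (ℝ × Sp n) => c2 (pz n i ς z.1 z.2) := (h2.comp (pz_cont n i ς)).measurable
  have ht : Measurable fun z : ℝ × (ℝ × Sp n) => z.2.1 := measurable_fst.comp measurable_snd
  have hm : Measurable fun z : ℝ × (ℝ × Sp n) => z.1 := measurable_fst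
  have hh : Measurable fun z : ℝ × (ℝ × Sp n) => z.2.1 ^ ((1:ℝ)/2) := ht.pow_const _
  refine ⟨?_, ?_, ?_⟩
  · exact ho.mul k0
  · exact ho.mul ((hm.mul hh).mul k1)
  · exact ho.mul (((hm.div (hh.const_mul 2)).mul k1).sub ((ht.mul ((hm.pow_const 2).const_sub 1)).mul k2))

lemma Th_meas (n : ℕ) (i : Fin n) (ς : ℝ) {c c1 : ℝ → ℝ} (h0 : Continuous c) (h1 : Continuous c1) :
    Measurable (Th n i ς c) ∧ Measurable (Th1 n i ς c1) := by
  obtain ⟨a, b, -⟩ := g_meas n i ς h0 h1 h1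
  exact ⟨(a.stronglyMeasurable.integral_prod_left (μ := volume)).measurable, (b.stronglyMeasurable.integral_prod_left (μ := volume)).measurable⟩

lemma pz_fd {n : ℕ} (i : Fin n) (ς μ : ℝ) {q : ℝ × Sp n} (hq : 0 < q.1) :
    HasFDerivAt (pz n i ς μ) (μ • ((q.1 ^ ((1:ℝ)/2)) • ContinuousLinearMap.fst ℝ ℝ (Sp n)) +
      ς • ((EuclideanSpace.proj i).comp (ContinuousLinearMap.snd ℝ ℝ (Sp n)))) q := by
  have hx : HasFDerivAt (fun q : ℝ × Sp n => q.2 i)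
        ((EuclideanSpace.proj i).comp (ContinuousLinearMap.snd ℝ ℝ (Sp n))) q :=
      ((EuclideanSpace.proj (𝕜 := ℝ) i).comp (ContinuousLinearMap.snd ℝ ℝ (Sp n))).hasFDerivAt
  exact ((phi_fd hq).const_mul μ).add (hx.const_mul ς)

lemma g0_cd {n : ℕ} (i : Fin n) (ς μ : ℝ) {c : ℝ → ℝ} (h : ContDiff ℝ 2 c) : ContDiffOn ℝ 2 (g0 n i ς c μ) (Om n) := by
  unfold g0
  refine contDiffOn_const.mul (h.comp_contDiffOn ?_)
  unfold pz phi
  have h1 : ContDiffOn ℝ 2 (fun q : ℝ × Sp n => q.1 ^ ((3:ℝ)/2)) (Om n) :=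
    contDiff_fst.contDiffOn.rpow_const_of_ne fun q hq => (mem_Om.1 hq).ne'
  have h2 : ContDiff ℝ 2 (fun q : ℝ × Sp n => q.2 i) := ((EuclideanSpace.proj (𝕜 := ℝ) i).comp (ContinuousLinearMap.snd ℝ ℝ (Sp n))).contDiff
  exact (contDiffOn_const.mul (contDiffOn_const.mul h1)).add (contDiffOn_const.mul h2.contDiffOn)

lemma g0_t {n : ℕ} (i : Fin n) (ς μ : ℝ) {c c1 : ℝ → ℝ} (h : ∀ v, HasDerivAt c (c1 v) v) {q : ℝ × Sp n} (hq : 0 < q.1) :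
    fderiv ℝ (g0 n i ς c μ) q (1, 0) = g1 n i ς c1 μ q := by
  have D : HasFDerivAt (g0 n i ς c μ) _ q := ((h (pz n i ς μ q)).comp_hasFDerivAt q (pz_fd i ς μ hq)).const_mul (om μ)
  rw [D.fderiv]
  simp [g1]
  left; ring

lemma g0_x {n : ℕ} (i : Fin n) (ς μ : ℝ) {c c1 : ℝ → ℝ} (h : ∀ v, HasDerivAt c (c1 v) v) {q : ℝ × Sp n} (hq : 0 < q.1) (k : Fin n) :
    fderiv ℝ (g0 n i ς c μ) q (eX n k) = (ς * if i = k then 1 else 0) * g0 n i ς c1 μ q := by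
  have D : HasFDerivAt (g0 n i ς c μ) _ q := ((h (pz n i ς μ q)).comp_hasFDerivAt q (pz_fd i ς μ hq)).const_mul (om μ)
  rw [D.fderiv]
  by_cases hk : i = k
  · simp [g0, eX, hk]; ring
  · simp [g0, eX, hk]

lemma g0_Pop {n : ℕ} (i : Fin n) {ς : ℝ} (hς : ς ^ 2 = 1) (μ : ℝ) {c c1 c2 : ℝ → ℝ} (h : ∀ v, HasDerivAt c (c1 v) v) (h' : ∀ v, HasDerivAt c1 (c2 v) v)
    {q : ℝ × Sp n} (ho : q ∈ Om n) : Pop (g0 n i ς c μ) q = g2 n i ς c1 c2 μ q := by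
  have hq := mem_Om.1 ho
  have hO := (Om_open n).mem_nhds ho
  unfold Pop
  have e1 : (fun z => fderiv ℝ (g0 n i ς c μ) z (1, 0)) =ᶠ[𝓝 q] fun q => g1 n i ς c1 μ q := by
    filter_upwards [hO] with z hz using g0_t i ς μ h (mem_Om.1 hz)
  have e2 : ∀ k, (fun z => fderiv ℝ (g0 n i ς c μ) z (eX n k)) =ᶠ[𝓝 q] fun q => (ς * if i = k then 1 else 0) * g0 n i ς c1 μ q := by
    intro k; filter_upwards [hO] with z hz using g0_x i ς μ h (mem_Om.1 hz) k
  have D0 : HasFDerivAt (g0 n i ς c1 μ) _ q := ((h' (pz n i ς μ q)).comp_hasFDerivAt q (pz_fd i ς μ hq)).const_mul (om μ)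
  have D2 : ∀ k, fderiv ℝ (fun z => fderiv ℝ (g0 n i ς c μ) z (eX n k)) q (eX n k) = if i = k then g0 n i ς c2 μ q else 0 := by
    intro k
    rw [(e2 k).fderiv_eq, (D0.differentiableAt.hasFDerivAt.const_mul _).fderiv]
    simp only [smul_apply, smul_eq_mul, g0_x i ς μ h' hq k]
    by_cases hk : i = k
    · simp only [hk, if_true]; linear_combination (g0 n k ς c2 μ q) * hς
    · simp [hk]
  have d1 : HasFDerivAt (fun q : ℝ × Sp n => q.1 ^ ((1:ℝ)/2))
      ((1/2 * q.1 ^ ((1:ℝ)/2 - 1)) • ContinuousLinearMap.fst ℝ ℝ (Sp n)) q :=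
    (hasFDerivAt_fst (𝕜 := ℝ) (p := q)).rpow_const (p := 1/2) (Or.inl hq.ne')
  have D1 : HasFDerivAt (fun q => g1 n i ς c1 μ q) _ q := ((d1.const_mul μ).mul ((h' (pz n i ς μ q)).comp_hasFDerivAt q (pz_fd i ς μ hq))).const_mul (om μ)
  rw [e1.fderiv_eq, D1.fderiv, Finset.sum_congr rfl fun k _ => D2 k]
  have hs := half_sq hq
  have hs0 : 0 < q.1 ^ ((1:ℝ)/2) := by positivity
  have es : q.1 ^ ((1:ℝ)/2 - 1) = (q.1 ^ ((1:ℝ)/2))⁻¹ := by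
    rw [← Real.rpow_neg hq.le]; norm_num
  rw [es]
  simp only [Finset.sum_ite_eq, Finset.mem_univ, if_true, g0, g2]
  simp only [smul_apply, add_apply, smul_eq_mul, Function.comp]
  simp
  have hsd2 : q.1 ^ ((2:ℝ)⁻¹) = q.1 ^ ((1:ℝ)/2) := by norm_num
  rw [hsd2]
  generalize hsd : q.1 ^ ((1:ℝ)/2) = s at *
  rw [← hs]
  field_simp
  ring

lemma g2_zero {n : ℕ} (i : Fin n) (ς : ℝ) {c1 c2 : ℝ → ℝ} {X : ℝ} (h' : ∀ v, HasDerivAt c1 (c2 v) v) (k2 : Continuous c2)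
    (b1 : ∀ v, |c1 v| ≤ X) (b2 : ∀ v, |c2 v| ≤ X) {q : ℝ × Sp n} (hq : 0 < q.1) : ∫ μ, g2 n i ς c1 c2 μ q = 0 := by
  have hy := phi_pos hq
  set y := phi q.1 with hyd
  set s := ς * q.2 i
  have hX : 0 ≤ X := (abs_nonneg _).trans (b1 0)
  have k1 : Continuous c1 := continuous_iff_continuousAt.2 fun v => (h' v).continuousAt
  set f' : ℝ → ℝ := fun μ => om μ * (-(μ / 3) * c1 (μ * y + s) + (1 - μ ^ 2) * y * c2 (μ * y + s)) with hf'
  have hii : Integrable f' := by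
    have hm : Measurable f' := om_meas.mul (by fun_prop : Continuous fun μ => (-(μ / 3) * c1 (μ * y + s) + (1 - μ ^ 2) * y * c2 (μ * y + s))).measurable
    refine (om_int.mul_const (X + y * X)).mono' hm.aestronglyMeasurable (Eventually.of_forall fun μ => ?_)
    rw [hf', norm_mul, Real.norm_of_nonneg (om_nonneg μ), Real.norm_eq_abs]
    by_cases hμ : μ ∈ Ioo (-1:ℝ) 1
    · refine mul_le_mul_of_nonneg_left ((abs_add_le _ _).trans (add_le_add ?_ ?_)) (om_nonneg μ)
      · rw [abs_mul]
        have : |-(μ/3)| ≤ 1 := by rw [abs_le]; constructor <;> linarith [hμ.1, hμ.2]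
        nlinarith [b1 (μ * y + s), abs_nonneg (c1 (μ * y + s))]
      · have h1 : |(1 - μ ^ 2) * y| ≤ y := by
          rw [abs_of_nonneg (mul_nonneg (by nlinarith [hμ.1, hμ.2]) hy.le)]; nlinarith [sq_nonneg μ]
        rw [abs_mul]
        exact mul_le_mul h1 (b2 _) (abs_nonneg _) hy.le
    · rw [om_zero hμ]; simp
  have hF : ∫ μ in (-1:ℝ)..1, f' μ = 0 := by
    rw [intervalIntegral.integral_eq_sub_of_hasDerivAt_of_le (by norm_num) (f := fun μ => (1 - μ ^ 2) ^ ((1:ℝ)/6) * c1 (μ * y + s)) ?_ ?_ hii.intervalIntegrable]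
    · norm_num
    · refine Continuous.continuousOn (Continuous.mul ?_ (by fun_prop))
      exact (by fun_prop : Continuous fun μ : ℝ => 1 - μ ^ 2).rpow_const fun _ => Or.inr (by norm_num)
    · intro μ hμ
      have hp : 0 < 1 - μ ^ 2 := by nlinarith [hμ.1, hμ.2]
      have a1 : HasDerivAt (fun μ : ℝ => 1 - μ ^ 2) (-(2 * μ)) μ := by
        simpa using (hasDerivAt_pow 2 μ).const_sub 1
      have a2 : HasDerivAt (fun μ : ℝ => (1 - μ ^ 2) ^ ((1:ℝ)/6)) (-(2 * μ) * (1/6) * (1 - μ ^ 2) ^ ((1:ℝ)/6 - 1)) μ := a1.rpow_const (Or.inl hp.ne')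
      have a3 : HasDerivAt (fun μ : ℝ => μ * y + s) y μ := by simpa using ((hasDerivAt_id μ).mul_const y).add_const s
      have a4 : HasDerivAt (fun μ : ℝ => c1 (μ * y + s)) (c2 (μ * y + s) * y) μ := (h' (μ * y + s)).comp μ a3
      have a5 : HasDerivAt (fun μ : ℝ => (1 - μ ^ 2) ^ ((1:ℝ)/6) * c1 (μ * y + s)) _ μ := a2.mul a4
      refine a5.congr_deriv ?_
      rw [hf']
      simp only
      rw [om_eq hμ]
      have e1 : (1 - μ ^ 2) ^ ((1:ℝ)/6) = (1 - μ ^ 2) * (1 - μ ^ 2) ^ (-(5:ℝ)/6) := by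
        nth_rewrite 2 [← Real.rpow_one (1 - μ ^ 2)]
        rw [← Real.rpow_add hp]; norm_num
      rw [e1, show (1:ℝ)/6 - 1 = -(5:ℝ)/6 by norm_num]; ring
  have hF2 : ∫ μ, f' μ = 0 := by
    rw [intervalIntegral.integral_of_le (by norm_num)] at hF
    rw [← hF, setIntegral_eq_integral_of_forall_compl_eq_zero]
    intro μ hμ
    rw [hf']; simp only
    rw [om_zero (fun h => hμ ⟨h.1, h.2.le⟩), zero_mul]
  have hg : (fun μ => g2 n i ς c1 c2 μ q) = fun μ => -(q.1 / y) * f' μ := by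
    funext μ
    have hs0 : 0 < q.1 ^ ((1:ℝ)/2) := by positivity
    have hs := half_sq hq
    have e : y = 2/3 * (q.1 * q.1 ^ ((1:ℝ)/2)) := by
      rw [hyd]; unfold phi; rw [← Real.rpow_one_add' hq.le (by norm_num)]; norm_num
    have e2 : 1 / (2 * q.1 ^ ((1:ℝ)/2)) = q.1 / (3 * y) := by rw [e]; field_simp
    rw [hf']; unfold g2
    have : pz n i ς μ q = μ * y + s := rfl
    rw [this, div_eq_mul_one_div μ, e2]
    field_simp
    ring
  rw [hg, integral_const_mul, hF2, mul_zero]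
end Tric

namespace Tric

/-- even truncation of a function -/
noncomputable def ev (L : ℝ) (f : ℝ → ℝ) (x : ℝ) : ℝ := (Iic L).indicator f |x|

lemma ev_nonneg {L : ℝ} {f : ℝ → ℝ} (hf : ∀ s, 0 ≤ s → s ≤ L → 0 ≤ f s) (x : ℝ) : 0 ≤ ev L f x := by
  unfold ev
  by_cases h : |x| ∈ Iic L
  · rw [indicator_of_mem h]; exact hf _ (abs_nonneg x) h
  · rw [indicator_of_notMem h]

lemma ev_eq {L : ℝ} {f : ℝ → ℝ} {x : ℝ} (h : |x| ≤ L) : ev L f x = f |x| := by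
  unfold ev; exact indicator_of_mem (s := Iic L) h _

lemma ev_integrable {L : ℝ} {f : ℝ → ℝ} (hf : ContinuousOn f (Icc 0 L)) : Integrable (ev L f) := by
  have e : ev L f = (Icc (-L) L).indicator (fun x => f |x|) := by
    funext x
    unfold ev
    by_cases h : |x| ≤ L
    · rw [indicator_of_mem (s := Iic L) h, indicator_of_mem (s := Icc (-L) L) (abs_le.1 h)]
    · rw [indicator_of_notMem (s := Iic L) h, indicator_of_notMem (s := Icc (-L) L) (fun h2 => h (abs_le.2 h2))]
  rw [e]
  refine IntegrableOn.integrable_indicator (ContinuousOn.integrableOn_Icc ?_) measurableSet_Icc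
  exact hf.comp continuous_abs.continuousOn fun x hx => ⟨abs_nonneg x, abs_le.2 hx⟩

lemma ev_int {L : ℝ} (hL : 0 ≤ L) (f : ℝ → ℝ) : ∫ x, ev L f x = 2 * ∫ s in (0:ℝ)..L, f s := by
  unfold ev
  rw [integral_comp_abs, intervalIntegral.integral_of_le hL, setIntegral_indicator measurableSet_Iic, Ioi_inter_Iic]

lemma evA_int {e L : ℝ} (he : 1 < e) (hL : 0 ≤ L) : ∫ x, ev L (fun s => (1 + L - s) ^ (-e)) x ≤ 2 / (e - 1) := by
  rw [ev_int hL]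
  have h := intervalIntegral.integral_comp_sub_left (a := 0) (b := L) (fun s : ℝ => (1 + s) ^ (-e)) L
  have h2 : ∫ s in (0:ℝ)..L, (1 + L - s) ^ (-e) = ∫ s in (0:ℝ)..L, (1 + s) ^ (-e) := by
    simp only [sub_self, sub_zero] at h
    rw [← h]; congr 1; funext s; congr 1; ring
  rw [h2]
  have := Lam_gt he hL
  calc _ ≤ 2 * (1 / (e - 1)) := by linarith
    _ = _ := by ring

lemma evB_int {L : ℝ} (hL : 0 < L) : ∫ x, ev L (fun s => (1 + s ^ 2 / (2 * L)) ^ (-(1:ℝ)/4)) x ≤ 8 * L ^ ((3:ℝ)/4) := by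
  rw [ev_int hL.le]
  have h0 : IntervalIntegrable (fun s : ℝ => (2 * L) ^ ((1:ℝ)/4) * s ^ (-(1:ℝ)/2)) volume 0 L :=
    (intervalIntegral.intervalIntegrable_rpow' (by norm_num)).const_mul _
  have h1 : ∫ s in (0:ℝ)..L, (1 + s ^ 2 / (2 * L)) ^ (-(1:ℝ)/4) ≤ ∫ s in (0:ℝ)..L, (2 * L) ^ ((1:ℝ)/4) * s ^ (-(1:ℝ)/2) := by
    refine intervalIntegral.integral_mono_on_of_le_Ioo hL.le ?_ h0 fun s hs => ?_
    · refine Continuous.intervalIntegrable ?_ _ _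
      refine Continuous.rpow_const (by fun_prop) fun s => Or.inl ?_
      positivity
    · have hs0 : 0 < s := hs.1
      have e1 : (s ^ 2 / (2 * L)) ^ (-(1:ℝ)/4) = (2 * L) ^ ((1:ℝ)/4) * s ^ (-(1:ℝ)/2) := by
        rw [Real.div_rpow (by positivity) (by positivity), ← Real.rpow_natCast, ← Real.rpow_mul hs0.le,
          show -(1:ℝ)/4 = -(1/4) by norm_num, Real.rpow_neg (x := 2 * L) (by positivity), div_inv_eq_mul, mul_comm]
        norm_num
      rw [← e1]
      exact rp_le (by positivity) (by linarith) (by norm_num)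
  have h2 : ∫ s in (0:ℝ)..L, (2 * L) ^ ((1:ℝ)/4) * s ^ (-(1:ℝ)/2) = (2 * L) ^ ((1:ℝ)/4) * (2 * L ^ ((1:ℝ)/2)) := by
    rw [intervalIntegral.integral_const_mul, integral_rpow (Or.inl (by norm_num)), show -(1:ℝ)/2 + 1 = 1/2 by norm_num, Real.zero_rpow (by norm_num)]
    ring
  have h3 : (2 * L) ^ ((1:ℝ)/4) ≤ 2 * L ^ ((1:ℝ)/4) := by
    rw [Real.mul_rpow (by norm_num) hL.le]
    refine mul_le_mul_of_nonneg_right ?_ (by positivity)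
    calc (2:ℝ) ^ ((1:ℝ)/4) ≤ 2 ^ (1:ℝ) := Real.rpow_le_rpow_of_exponent_le (by norm_num) (by norm_num)
      _ = 2 := by norm_num
  have h4 : L ^ ((3:ℝ)/4) = L ^ ((1:ℝ)/4) * L ^ ((1:ℝ)/2) := by rw [← Real.rpow_add hL]; norm_num
  rw [h2] at h1
  rw [h4]
  have h5 : (2 * L) ^ ((1:ℝ)/4) * (2 * L ^ ((1:ℝ)/2)) ≤ 2 * L ^ ((1:ℝ)/4) * (2 * L ^ ((1:ℝ)/2)) :=
    mul_le_mul_of_nonneg_right h3 (by positivity)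
  linarith

/-- integral over a ball of a function of the distance of one coordinate to the boundary -/
lemma slice_prod {n : ℕ} (i : Fin n) {e L : ℝ} (he : 1 < e - ((n:ℝ) - 1) / 4) (hL : 0 < L) :
    ∫ x in closedBall (0 : Sp n) L, (1 + L - |x i|) ^ (-e) ≤ 2 / (e - ((n:ℝ) - 1) / 4 - 1) * (8 * L ^ ((3:ℝ)/4)) ^ (n - 1) := by
  have hn : 1 ≤ n := by have := i.2; omega
  set e0 := e - ((n:ℝ) - 1) / 4 with he0
  set fA : ℝ → ℝ := fun s => (1 + L - s) ^ (-e0) with hfA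
  set fB : ℝ → ℝ := fun s => (1 + s ^ 2 / (2 * L)) ^ (-(1:ℝ)/4) with hfB
  have nA : ∀ s, 0 ≤ s → s ≤ L → 0 ≤ fA s := fun s _ h => Real.rpow_nonneg (by linarith) _
  have nB : ∀ s, 0 ≤ s → s ≤ L → 0 ≤ fB s := fun s _ _ => by simp only [hfB]; positivity
  have cA : ContinuousOn fA (Icc 0 L) := by
    refine ContinuousOn.rpow_const (by fun_prop) fun s hs => Or.inl ?_
    have := hs.2; intro h; linarith
  have cB : Continuous fB := Continuous.rpow_const (by fun_prop) fun s => Or.inl (by positivity)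
  set FF : Fin n → ℝ → ℝ := fun j => if j = i then ev L fA else ev L fB with hFF
  have Fi : FF i = ev L fA := by simp [hFF]
  have Fj : ∀ j, j ≠ i → FF j = ev L fB := fun j hj => by simp [hFF, hj]
  have Fint : ∀ j, Integrable (FF j) := by
    intro j
    by_cases hj : j = i
    · rw [hj, Fi]; exact ev_integrable cA
    · rw [Fj j hj]; exact ev_integrable cB.continuousOn
  have Fn : ∀ j x, 0 ≤ FF j x := by
    intro j x
    by_cases hj : j = i
    · rw [hj, Fi]; exact ev_nonneg nA x
    · rw [Fj j hj]; exact ev_nonneg nB x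
  have split : ∀ (G : Fin n → ℝ), ∏ j, G j = G i * ∏ j ∈ Finset.univ.erase i, G j := fun G =>
    (Finset.mul_prod_erase _ _ (Finset.mem_univ i)).symm
  have hcard : (Finset.univ.erase i).card = n - 1 := by rw [Finset.card_erase_of_mem (Finset.mem_univ i)]; simp
  have mp := PiLp.volume_preserving_ofLp (Fin n)
  have eI : ∫ x : Sp n, ∏ j, FF j (x j) = ∏ j, ∫ s, FF j s := by
    rw [← integral_fintype_prod_volume_eq_prod]
    exact mp.integral_comp (MeasurableEquiv.toLp 2 (Fin n → ℝ)).symm.measurableEmbedding (fun y : Fin n → ℝ => ∏ j, FF j (y j))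
  have Iint : Integrable fun x : Sp n => ∏ j, FF j (x j) := by
    have : Integrable (fun y : Fin n → ℝ => ∏ j, FF j (y j)) := Integrable.fintype_prod Fint
    exact (mp.integrable_comp_emb (MeasurableEquiv.toLp 2 (Fin n → ℝ)).symm.measurableEmbedding).2 this
  have key : ∀ x ∈ closedBall (0 : Sp n) L, (1 + L - |x i|) ^ (-e) ≤ ∏ j, FF j (x j) := by
    intro x hx
    have hxn : ‖x‖ ≤ L := by simpa using hx
    have hxj : ∀ j, |x j| ≤ L := fun j => (PiLp.norm_apply_le x j).trans hxn
    rw [split, Fi, ev_eq (hxj i)]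
    set a := 1 + L - |x i| with ha
    have ha1 : 1 ≤ a := by have := hxj i; linarith
    have hsq : ∀ j, j ≠ i → x j ^ 2 / (2 * L) ≤ L - |x i| := by
      intro j hj
      rw [div_le_iff₀ (by positivity)]
      have h1 : x i ^ 2 + x j ^ 2 ≤ L ^ 2 := by
        have h2 : ‖x‖ ^ 2 ≤ L ^ 2 := by gcongr
        rw [EuclideanSpace.real_norm_sq_eq] at h2
        have h3 : ∑ k ∈ {i, j}, x k ^ 2 ≤ ∑ k, x k ^ 2 := Finset.sum_le_univ_sum_of_nonneg fun k => sq_nonneg _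
        rw [Finset.sum_pair hj.symm] at h3
        linarith
      rw [← sq_abs (x i)] at h1
      nlinarith [hxj i, abs_nonneg (x i)]
    have hp : a ^ (-(((n:ℝ) - 1) / 4)) ≤ ∏ j ∈ Finset.univ.erase i, FF j (x j) := by
      have : a ^ (-(((n:ℝ) - 1) / 4)) = ∏ j ∈ Finset.univ.erase i, a ^ (-(1:ℝ)/4) := by
        rw [Finset.prod_const, hcard, ← Real.rpow_natCast, ← Real.rpow_mul (by linarith)]
        congr 1; rw [Nat.cast_sub hn]; push_cast; ring
      rw [this]
      refine Finset.prod_le_prod (fun j _ => by positivity) fun j hj => ?_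
      have hj' := Finset.ne_of_mem_erase hj
      rw [Fj j hj', ev_eq (hxj j)]
      refine rp_le (by positivity) ?_ (by norm_num)
      rw [sq_abs]; linarith [hsq j hj']
    have : a ^ (-e) = a ^ (-e0) * a ^ (-(((n:ℝ) - 1) / 4)) := by
      rw [← Real.rpow_add (by linarith)]; congr 1; rw [he0]; ring
    rw [this]
    exact mul_le_mul_of_nonneg_left hp (by positivity)
  have c1 : ContinuousOn (fun x : Sp n => (1 + L - |x i|) ^ (-e)) (closedBall 0 L) := by
    refine ContinuousOn.rpow_const (by fun_prop) fun x hx => Or.inl ?_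
    have hxn : ‖x‖ ≤ L := by simpa using hx
    have := (PiLp.norm_apply_le x i).trans hxn
    rw [Real.norm_eq_abs] at this
    intro h; linarith
  calc _ ≤ ∫ x in closedBall (0 : Sp n) L, ∏ j, FF j (x j) :=
        setIntegral_mono_on (c1.integrableOn_compact (isCompact_closedBall _ _)) Iint.integrableOn measurableSet_closedBall key
    _ ≤ ∫ x : Sp n, ∏ j, FF j (x j) := setIntegral_le_integral Iint (.of_forall fun x => Finset.prod_nonneg fun j _ => Fn _ _)
    _ = (∫ s, FF i s) * ∏ j ∈ Finset.univ.erase i, ∫ s, FF j s := by rw [eI, split]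
    _ ≤ _ := by
      refine mul_le_mul ?_ ?_ (Finset.prod_nonneg fun j _ => integral_nonneg (Fn j)) ?_
      · rw [Fi]; exact evA_int he hL.le
      · rw [← hcard, ← Finset.prod_const]
        refine Finset.prod_le_prod (fun j _ => integral_nonneg (Fn j)) fun j hj => ?_
        rw [Fj j (Finset.ne_of_mem_erase hj)]; exact evB_int hL
      · exact div_nonneg (by norm_num) (by linarith)
end Tric

namespace Tric

lemma coord_le {n : ℕ} (i : Fin n) (x : Sp n) : |x i| ≤ ‖x‖ := PiLp.norm_apply_le x i

lemma g_bd {n : ℕ} (i : Fin n) (ς : ℝ) {c c1 c2 : ℝ → ℝ} {A X : ℝ} (b : Bmp c c1 c2 A X) {q : ℝ × Sp n} (hq : 0 < q.1) (μ : ℝ) :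
    |g0 n i ς c μ q| ≤ X * om μ ∧ |g1 n i ς c1 μ q| ≤ X * q.1 ^ ((1:ℝ)/2) * om μ ∧
    |g2 n i ς c1 c2 μ q| ≤ X * ((q.1 ^ ((1:ℝ)/2))⁻¹ + q.1) * om μ := by
  have hs : 0 < q.1 ^ ((1:ℝ)/2) := by positivity
  have ho := om_nonneg μ
  have hX := b.X0
  unfold g0 g1 g2
  by_cases hμ : μ ∈ Ioo (-1:ℝ) 1
  · have hm : |μ| ≤ 1 := abs_le.2 ⟨hμ.1.le, hμ.2.le⟩
    refine ⟨?_, ?_, ?_⟩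
    · rw [abs_mul, abs_of_nonneg ho, mul_comm]
      exact mul_le_mul_of_nonneg_right (b.b0 _) ho
    · rw [abs_mul, abs_of_nonneg ho, mul_comm]
      refine mul_le_mul_of_nonneg_right ?_ ho
      rw [abs_mul, abs_mul, abs_of_pos hs, mul_comm]
      refine mul_le_mul (b.b1 _) ?_ (by positivity) hX
      nlinarith
    · rw [abs_mul, abs_of_nonneg ho, mul_comm]
      refine mul_le_mul_of_nonneg_right ?_ ho
      refine (abs_sub _ _).trans ?_
      rw [abs_mul, abs_mul, mul_add]
      refine add_le_add ?_ ?_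
      · rw [mul_comm]
        refine mul_le_mul (b.b1 _) ?_ (by positivity) hX
        rw [abs_div, abs_of_pos (by positivity : 0 < 2 * q.1 ^ ((1:ℝ)/2)), ← one_div, div_le_div_iff₀ (by positivity) hs]
        nlinarith
      · rw [mul_comm]
        refine mul_le_mul (b.b2 _) ?_ (by positivity) hX
        rw [abs_of_nonneg (mul_nonneg hq.le (by nlinarith [hμ.1, hμ.2]))]
        nlinarith [sq_nonneg μ]
  · rw [om_zero hμ]; simp

lemma phi_rp {t e : ℝ} (ht : 0 < t) : phi t ^ e = (2/3) ^ e * t ^ (3/2 * e) := by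
  unfold phi
  rw [Real.mul_rpow (by norm_num) (by positivity), ← Real.rpow_mul ht.le]

lemma Th_bd {n : ℕ} (i : Fin n) {ς M : ℝ} (hM : 0 ≤ M) (hς : |ς| = 1) {c c1 c2 : ℝ → ℝ} {A X : ℝ} (hA : 0 ≤ A) (b : Bmp c c1 c2 A X) :
    ∃ C, 0 ≤ C ∧ ∀ q ∈ Qc n M, |Th1 n i ς c1 q| ≤ C * (q.1 ^ ((1:ℝ)/4) * (1 + (M + phi q.1) - |q.2 i|) ^ (-(5:ℝ)/6)) ∧
      |Th n i ς c q| ≤ C * (q.1 * (q.1 ^ ((1:ℝ)/4) * (1 + (M + phi q.1) - |q.2 i|) ^ (-(5:ℝ)/6))) := by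
  have hX := b.X0
  refine ⟨24 * X * (M + A + 3) * (2/3) ^ (-(1:ℝ)/6), by positivity, fun q hq => ?_⟩
  have h1 : 1 ≤ q.1 := hq.1
  have h0 : 0 < q.1 := by linarith
  have hy := phi_pos h0
  have hn : ‖q.2‖ ≤ M + phi q.1 := hq.2
  have hx : |q.2 i| ≤ M + phi q.1 := (coord_le i q.2).trans hn
  have es : |ς * q.2 i| = |q.2 i| := by rw [abs_mul, hς, one_mul]
  have hd : 0 < 1 + (M + phi q.1) - |q.2 i| := by linarith
  have ey : phi q.1 ^ (-(1:ℝ)/6) = (2/3) ^ (-(1:ℝ)/6) * q.1 ^ (-(1:ℝ)/4) := by rw [phi_rp h0]; norm_num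
  have e4 : q.1 ^ ((1:ℝ)/2) * q.1 ^ (-(1:ℝ)/4) = q.1 ^ ((1:ℝ)/4) := by rw [← Real.rpow_add h0]; norm_num
  constructor
  · have := pw_bd (A := A) (M := M) (y := phi q.1) (s := ς * q.2 i) (X := X * q.1 ^ ((1:ℝ)/2)) (g := fun μ => g1 n i ς c1 μ q) hA hM (by positivity) hy (by rw [es]; exact hx)
      (fun μ => (g_bd i ς b h0 μ).2.1) (fun μ hμ => by unfold g1; rw [show c1 (pz n i ς μ q) = 0 from b.z1 _ hμ]; ring)
    unfold Th1
    refine this.trans (le_of_eq ?_)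
    rw [es, ey, ← e4]; ring
  · have := pw_bd (A := A) (M := M) (y := phi q.1) (s := ς * q.2 i) (X := X) (g := fun μ => g0 n i ς c μ q) hA hM hX hy (by rw [es]; exact hx)
      (fun μ => (g_bd i ς b h0 μ).1) (fun μ hμ => by unfold g0; rw [show c (pz n i ς μ q) = 0 from b.z0 _ hμ]; ring)
    unfold Th
    refine this.trans ?_
    rw [es, ey]
    have e5 : q.1 ^ (-(1:ℝ)/4) ≤ q.1 * q.1 ^ ((1:ℝ)/4) := by
      calc q.1 ^ (-(1:ℝ)/4) ≤ 1 := Real.rpow_le_one_of_one_le_of_nonpos h1 (by norm_num)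
        _ ≤ q.1 * q.1 ^ ((1:ℝ)/4) := by
          have := Real.one_le_rpow h1 (by norm_num : (0:ℝ) ≤ 1/4)
          nlinarith
    calc _ = 24 * X * (M + A + 3) * (2/3) ^ (-(1:ℝ)/6) * (q.1 ^ (-(1:ℝ)/4) * (1 + (M + phi q.1) - |q.2 i|) ^ (-(5:ℝ)/6)) := by ring
      _ ≤ 24 * X * (M + A + 3) * (2/3) ^ (-(1:ℝ)/6) * ((q.1 * q.1 ^ ((1:ℝ)/4)) * (1 + (M + phi q.1) - |q.2 i|) ^ (-(5:ℝ)/6)) := by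
          refine mul_le_mul_of_nonneg_left (mul_le_mul_of_nonneg_right e5 (by positivity)) (by positivity)
      _ = _ := by ring

lemma ThG {n : ℕ} {M p : ℝ} {u : ℝ × Sp n → ℝ} (S : Sol n M p u) (i : Fin n) {ς : ℝ} (hς : ς ^ 2 = 1) {c c1 c2 : ℝ → ℝ} {A X : ℝ} (b : Bmp c c1 c2 A X)
    {R : ℝ} (hR : 1 ≤ R) (j : ℕ) :
    (∫ q in slab n M 1 R, |u q| ^ p * ps j R q.1 * Th n i ς c q) +
      Dat u (fun q => Th n i ς c q * ps j R q.1) (fun q => Th1 n i ς c1 q * ps j R q.1 + Th n i ς c q * ps1 j R q.1) 1 =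
    ∫ q in slab n M 1 R, u q * (2 * ps1 j R q.1 * Th1 n i ς c1 q + ps2 j R q.1 * Th n i ς c q) := by
  obtain ⟨m0, m1, m2⟩ := g_meas n i ς b.cd.continuous b.k1 b.k2
  have hX := b.X0
  have Rp : 0 < R := by linarith
  have hG : Integrable (fun μ => X * (1 + R ^ ((1:ℝ)/2) + (1 + R)) * om μ) := om_int.const_mul _
  have B : ∀ μ, ∀ q ∈ slab n M 1 R, |g0 n i ς c μ q| ≤ X * (1 + R ^ ((1:ℝ)/2) + (1 + R)) * om μ ∧
      |g1 n i ς c1 μ q| ≤ X * (1 + R ^ ((1:ℝ)/2) + (1 + R)) * om μ ∧ |g2 n i ς c1 c2 μ q| ≤ X * (1 + R ^ ((1:ℝ)/2) + (1 + R)) * om μ := by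
    intro μ q hq
    have h1 : 1 ≤ q.1 := hq.1.1
    have h2 : q.1 ≤ R := hq.1.2
    obtain ⟨a0, a1, a2⟩ := g_bd i ς b (by linarith : 0 < q.1) μ
    have ho := om_nonneg μ
    have hs : q.1 ^ ((1:ℝ)/2) ≤ R ^ ((1:ℝ)/2) := Real.rpow_le_rpow (by linarith) h2 (by norm_num)
    have hs1 : 1 ≤ q.1 ^ ((1:ℝ)/2) := Real.one_le_rpow h1 (by norm_num)
    have hs2 : (q.1 ^ ((1:ℝ)/2))⁻¹ ≤ 1 := inv_le_one_of_one_le₀ hs1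
    refine ⟨a0.trans ?_, a1.trans ?_, a2.trans ?_⟩
    · refine mul_le_mul_of_nonneg_right ?_ ho
      nlinarith
    · refine mul_le_mul_of_nonneg_right (mul_le_mul_of_nonneg_left ?_ hX) ho
      linarith
    · refine mul_le_mul_of_nonneg_right (mul_le_mul_of_nonneg_left ?_ hX) ho
      linarith
  exact (lemT volume S (Om_open n) (fun q h _ => h) one_pos hR (fun μ => g0_cd i ς μ b.cd) (fun μ q hq _ => g0_t i ς μ b.d0 (mem_Om.1 hq))
    (fun μ q hq _ => g0_Pop i hς μ b.d0 b.d1 hq) m0 m1 m2 hG (fun μ q hq => (B μ q hq).1) (fun μ q hq => (B μ q hq).2.1) (fun μ q hq => (B μ q hq).2.2)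
    (fun q hq => g2_zero i ς b.d1 b.k2 b.b1 b.b2 (by have := hq.1.1; linarith))
    (ps_cd j R) (ps1_c j R) (ps2_c j R) (ps_d j R) (ps1_d j R) (ps_R j Rp.ne').1 (ps_R j Rp.ne').2).2.2
end Tric

namespace Tric

lemma Sol.p3 {n : ℕ} {M p : ℝ} {u : ℝ × Sp n → ℝ} (S : Sol n M p u) : p < 3 := by
  have hc := S.crit
  have hp := S.hp
  have hn : (2:ℝ) ≤ n := by exact_mod_cast S.hn
  by_contra h
  push Not at h
  have : 3 * 2 * (p * (p - 1)) ≤ 3 * (n:ℝ) * (p * (p - 1)) := by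
    have : 0 ≤ p * (p - 1) := mul_nonneg (by linarith) (by linarith)
    nlinarith
  nlinarith

lemma Sol.e0 {n : ℕ} {M p : ℝ} {u : ℝ × Sp n → ℝ} (S : Sol n M p u) : 1 < 5/6 * (p / (p - 1)) - ((n:ℝ) - 1) / 4 := by
  have hc := S.crit
  have hp := S.hp
  have h3 := S.p3
  have hp1 : 0 < p - 1 := by linarith
  have e : 5/6 * (p / (p - 1)) - ((n:ℝ) - 1) / 4 - 1 = (10 * p ^ 2 - 3 * (n:ℝ) * (p * (p - 1)) + 3 * (p * (p - 1)) - 12 * (p * (p - 1))) / (12 * (p * (p - 1))) := by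
    field_simp; ring
  have : 0 < 5/6 * (p / (p - 1)) - ((n:ℝ) - 1) / 4 - 1 := by
    rw [e, hc]; refine div_pos ?_ (by positivity); nlinarith
  linarith

lemma Sol.bneg {n : ℕ} {M p : ℝ} {u : ℝ × Sp n → ℝ} (S : Sol n M p u) :
    -(p / (p - 1)) + 1 + ((1/4 - 5 / (2 * p)) * (p / (p - 1)) + 9/8 * ((n:ℝ) - 1)) < 0 := by
  have hc := S.crit
  have hp := S.hp
  have hp1 : 0 < p - 1 := by linarith
  have e : -(p / (p - 1)) + 1 + ((1/4 - 5 / (2 * p)) * (p / (p - 1)) + 9/8 * ((n:ℝ) - 1)) =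
      (- 8 * p + 2 * p ^ 2 - 20 * p + 3 * (3 * (n:ℝ) * (p * (p - 1))) - 9 * (p * (p - 1))) / (8 * (p * (p - 1))) := by
    field_simp; ring
  rw [e, hc]; refine div_neg_of_neg_of_pos ?_ (by positivity); nlinarith

lemma phi_le {M t : ℝ} (hM : 0 ≤ M) (ht : 1 ≤ t) : M + phi t ≤ (M + 1) * t ^ ((3:ℝ)/2) := by
  have := Real.one_le_rpow ht (by norm_num : (0:ℝ) ≤ 3/2)
  unfold phi; nlinarith

lemma claimW {n : ℕ} {M p : ℝ} {u : ℝ × Sp n → ℝ} (S : Sol n M p u) (i : Fin n) {C0 : ℝ} (hC0 : 0 ≤ C0) {P P1 : ℝ × Sp n → ℝ} (j : ℕ)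
    (b : ∀ q ∈ Qc n M, |P1 q| ≤ C0 * (q.1 ^ ((1:ℝ)/4) * (1 + (M + phi q.1) - |q.2 i|) ^ (-(5:ℝ)/6)) ∧
      |P q| ≤ C0 * (q.1 * (q.1 ^ ((1:ℝ)/4) * (1 + (M + phi q.1) - |q.2 i|) ^ (-(5:ℝ)/6))))
    (hI : IntegrableOn (fun q => |u q| ^ p * q.1 ^ ((5:ℝ)/2)) (Qc n M)) :
    ∃ C θ : ℝ, 0 < θ ∧ ∀ R : ℝ, 1 ≤ R →
      |∫ q in slab n M 1 R, u q * (2 * ps1 j R q.1 * P1 q + ps2 j R q.1 * P q)| ≤ C * R ^ (-θ) := by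
  have hp := S.hp
  have hM := S.hM
  have hM0 : 0 ≤ M := by linarith
  have hp0 : 0 < p := by linarith
  have hp1 : 0 < p - 1 := by linarith
  have hn1 : 1 ≤ n := by have := S.hn; omega
  set p' := p / (p - 1) with hp'
  have hp'1 : 1 < p' := by rw [hp', lt_div_iff₀ hp1]; linarith
  have h1p : 0 < 1 - 1/p := by rw [sub_pos, div_lt_one hp0]; exact hp
  have he0 := S.e0
  have hbn := S.bneg
  rw [← hp'] at he0 hbn
  set a := 1/4 - 5 / (2 * p) with ha
  set bb := a * p' + 9/8 * ((n:ℝ) - 1) with hbb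
  set bm := max bb 0 with hbm
  have hbm0 : -p' + 1 + bm < 0 := by
    rcases max_cases bb 0 with ⟨h, -⟩ | ⟨h, -⟩ <;> rw [hbm, h] <;> linarith
  set K := (2 * ((j:ℝ) + 3) + (j + 3) * (j + 2)) * C0 + 1 with hK
  have hKp : 0 < K := by positivity
  set I := ∫ q in Qc n M, |u q| ^ p * q.1 ^ ((5:ℝ)/2) with hId
  set C1 := 2 / (5/6 * p' - ((n:ℝ) - 1) / 4 - 1) * (8 * (M + 1) ^ ((3:ℝ)/4)) ^ (n - 1) with hC1
  have hC1p : 0 < C1 := mul_pos (div_pos two_pos (by linarith)) (by positivity)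
  refine ⟨I ^ (1/p) * (K ^ p' * C1) ^ (1 - 1/p), -(-p' + 1 + bm) * (1 - 1/p), mul_pos (by linarith) h1p, fun R hR => ?_⟩
  have Rp : 0 < R := by linarith
  have basics : ∀ q ∈ slab n M 1 R, 0 < q.1 ∧ 0 ≤ 1 - q.1 / R ∧ 1 - q.1 / R ≤ 1 ∧ 0 < 1 + (M + phi q.1) - |q.2 i| := by
    intro q hq
    have h1 := hq.1.1
    have h2 : ‖q.2‖ ≤ M + phi q.1 := hq.2
    have h3 := coord_le i q.2
    have h4 : 0 < q.1 := by linarith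
    refine ⟨by linarith, sub_nonneg.2 ((div_le_one Rp).2 hq.1.2), ?_, by linarith⟩
    have : 0 ≤ q.1 / R := by positivity
    linarith
  have dc : ∀ e : ℝ, ContinuousOn (fun q : ℝ × Sp n => (1 + (M + phi q.1) - |q.2 i|) ^ e) (slab n M 1 R) := by
    intro e
    refine ContinuousOn.rpow_const ?_ fun q hq => Or.inl (basics q hq).2.2.2.ne'
    have := phi_cont
    exact Continuous.continuousOn (by fun_prop)
  set w : ℝ × Sp n → ℝ := fun q => q.1 ^ ((5:ℝ)/2) with hw
  set g : ℝ × Sp n → ℝ := fun q => K * R⁻¹ * (q.1 ^ a * (1 + (M + phi q.1) - |q.2 i|) ^ (-(5:ℝ)/6)) with hg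
  have cg : ContinuousOn g (slab n M 1 R) := continuousOn_const.mul (tpow_cont.mul (dc _))
  have H := hold S one_pos (F := fun q => u q * (2 * ps1 j R q.1 * P1 q + ps2 j R q.1 * P q)) (w := w) tpow_cont (fun q hq => by
      obtain ⟨a, b, c, d⟩ := basics q hq
      simp only [hw]; positivity) cg (fun q hq => by
      obtain ⟨a, b, c, d⟩ := basics q hq
      simp only [hg]; positivity) ?_
  · refine H.trans ?_
    have e3 : ∫ q in slab n M 1 R, g q ^ p' = (K ^ p' * R ^ (-p')) *
        ∫ q in slab n M 1 R, q.1 ^ (a * p') * (1 + (M + phi q.1) - |q.2 i|) ^ (-(5/6 * p')) := by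
      rw [← integral_const_mul]
      refine setIntegral_congr_fun (slab_meas n M 1 R zero_le_one) fun q hq => ?_
      obtain ⟨a1, b1, c1, d1⟩ := basics q hq
      simp only [hg]
      rw [Real.mul_rpow (by positivity) (by positivity), Real.mul_rpow (by positivity) (by positivity),
        Real.mul_rpow (by positivity) (by positivity), Real.inv_rpow Rp.le, ← Real.rpow_neg Rp.le, ← Real.rpow_mul a1.le,
        ← Real.rpow_mul d1.le, show -(5:ℝ)/6 * p' = -(5/6 * p') by ring]
    have e4 : ∫ q in slab n M 1 R, q.1 ^ (a * p') * (1 + (M + phi q.1) - |q.2 i|) ^ (-(5/6 * p')) ≤ C1 * R ^ bm * R := by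
      refine slab_int_le hR (tpow_cont.mul (dc _)) (fun q hq => by
        obtain ⟨a1, b1, c1, d1⟩ := basics q hq
        positivity) fun t ht htR => ?_
      have ht0 : 0 < t := by linarith
      simp only
      rw [integral_const_mul]
      have hL : 0 < M + phi t := by have := phi_pos ht0; linarith
      have h1 := slice_prod i he0 hL
      have h2 : (8 * (M + phi t) ^ ((3:ℝ)/4)) ^ (n - 1) ≤ (8 * (M + 1) ^ ((3:ℝ)/4)) ^ (n - 1) * t ^ (9/8 * ((n:ℝ) - 1)) := by
        have h3 : (M + phi t) ^ ((3:ℝ)/4) ≤ (M + 1) ^ ((3:ℝ)/4) * t ^ ((9:ℝ)/8) := by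
          calc _ ≤ ((M + 1) * t ^ ((3:ℝ)/2)) ^ ((3:ℝ)/4) := Real.rpow_le_rpow hL.le (phi_le hM0 ht) (by norm_num)
            _ = _ := by
              rw [Real.mul_rpow (by linarith) (by positivity), ← Real.rpow_mul ht0.le]; norm_num
        calc _ ≤ (8 * ((M + 1) ^ ((3:ℝ)/4) * t ^ ((9:ℝ)/8))) ^ (n - 1) := by
              refine pow_le_pow_left₀ (by positivity) ?_ _
              linarith
          _ = (8 * (M + 1) ^ ((3:ℝ)/4)) ^ (n - 1) * (t ^ ((9:ℝ)/8)) ^ (n - 1) := by rw [← mul_assoc, mul_pow]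
          _ = _ := by
            congr 1
            rw [← Real.rpow_natCast, ← Real.rpow_mul ht0.le, Nat.cast_sub hn1]; push_cast; rfl
      have hc : 0 < 2 / (5/6 * p' - ((n:ℝ) - 1) / 4 - 1) := div_pos two_pos (by linarith)
      calc _ ≤ t ^ (a * p') * (2 / (5/6 * p' - ((n:ℝ) - 1) / 4 - 1) * ((8 * (M + 1) ^ ((3:ℝ)/4)) ^ (n - 1) * t ^ (9/8 * ((n:ℝ) - 1)))) :=
            mul_le_mul_of_nonneg_left (h1.trans (mul_le_mul_of_nonneg_left h2 hc.le)) (by positivity)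
        _ = C1 * t ^ bb := by rw [hbb, Real.rpow_add ht0, hC1]; ring
        _ ≤ C1 * R ^ bm := by
          refine mul_le_mul_of_nonneg_left ?_ hC1p.le
          calc t ^ bb ≤ t ^ bm := Real.rpow_le_rpow_of_exponent_le ht (le_max_left _ _)
            _ ≤ R ^ bm := Real.rpow_le_rpow ht0.le htR (le_max_right _ _)
    have e5 : ∫ q in slab n M 1 R, g q ^ p' ≤ (K ^ p' * C1) * R ^ (-p' + 1 + bm) := by
      rw [e3]
      calc _ ≤ (K ^ p' * R ^ (-p')) * (C1 * R ^ bm * R) := mul_le_mul_of_nonneg_left e4 (by positivity)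
        _ = _ := by rw [Real.rpow_add Rp, Real.rpow_add Rp, Real.rpow_one]; ring
    have e6 : 0 ≤ ∫ q in slab n M 1 R, g q ^ p' := by
      refine setIntegral_nonneg (slab_meas n M 1 R zero_le_one) fun q hq => ?_
      obtain ⟨a1, b1, c1, d1⟩ := basics q hq
      simp only [hg]; positivity
    have n0 : ∀ q ∈ Qc n M, 0 ≤ |u q| ^ p * q.1 ^ ((5:ℝ)/2) := fun q hq => by
      have := hq.1
      have : 0 < q.1 := by linarith
      positivity
    have e7 : 0 ≤ ∫ q in slab n M 1 R, |u q| ^ p * w q :=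
      setIntegral_nonneg (slab_meas n M 1 R zero_le_one) fun q hq => n0 q (slab_sub_Qc hq)
    have e8 : ∫ q in slab n M 1 R, |u q| ^ p * w q ≤ I :=
      setIntegral_mono_set hI ((ae_restrict_iff' (Qc_meas n M)).2 (Eventually.of_forall n0)) (LE.le.eventuallyLE slab_sub_Qc)
    have hI0 : 0 ≤ I := e7.trans e8
    calc _ ≤ I ^ (1/p) * ((K ^ p' * C1) * R ^ (-p' + 1 + bm)) ^ (1 - 1/p) := by
          refine mul_le_mul (Real.rpow_le_rpow e7 e8 (by positivity)) (Real.rpow_le_rpow e6 e5 h1p.le) (Real.rpow_nonneg e6 _) (Real.rpow_nonneg hI0 _)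
      _ = _ := by
        rw [Real.mul_rpow (by positivity) (by positivity), ← Real.rpow_mul Rp.le, neg_mul, neg_neg]; ring
  · intro q hq
    obtain ⟨a1, b1, c1, d1⟩ := basics q hq
    have hb := b q (slab_sub_Qc hq)
    have E := err_pt (j := j) hq.1.1 hq.1.2 (by positivity) hC0 hb.1 hb.2
    rw [abs_mul]
    refine mul_le_mul_of_nonneg_left (E.trans ?_) (abs_nonneg _)
    simp only [hw, hg]
    have ew : (q.1 ^ ((5:ℝ)/2)) ^ (1/p) * q.1 ^ a = q.1 ^ ((1:ℝ)/4) := by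
      rw [← Real.rpow_mul a1.le, ← Real.rpow_add a1, ha]; congr 1; field_simp; ring
    set D := (1 + (M + phi q.1) - |q.2 i|) ^ (-(5:ℝ)/6) with hD
    have hD0 : 0 < D := Real.rpow_pos_of_pos d1 _
    calc _ ≤ K * (R⁻¹ * (1 * (q.1 ^ ((1:ℝ)/4) * D))) := by
          refine mul_le_mul (by rw [hK]; linarith) ?_ (by positivity) hKp.le
          refine mul_le_mul_of_nonneg_left (mul_le_mul_of_nonneg_right (pow_le_one₀ b1 c1) (by positivity)) (by positivity)
      _ = _ := by rw [← ew]; ring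
end Tric

namespace Tric

lemma ThZero {n : ℕ} {M p : ℝ} {u : ℝ × Sp n → ℝ} (S : Sol n M p u) (i : Fin n) {ς : ℝ} (hς : ς ^ 2 = 1) {c c1 c2 : ℝ → ℝ} {X : ℝ} (b : Bmp c c1 c2 (M + 2) X)
    (hI : IntegrableOn (fun q => |u q| ^ p * q.1 ^ ((5:ℝ)/2)) (Qc n M)) :
    IntegrableOn (fun q => |u q| ^ p * Th n i ς c q) (Qc n M) ∧ ∫ q in Qc n M, |u q| ^ p * Th n i ς c q = 0 := by
  have hM := S.hM
  have hς1 : |ς| = 1 := by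
    rw [← sq_abs] at hς
    nlinarith [abs_nonneg ς]
  obtain ⟨C0, hC0, B⟩ := Th_bd (n := n) i (M := M) (by linarith) hς1 (by linarith) b
  obtain ⟨C, θ, hθ, H⟩ := claimW S i hC0 0 B hI
  obtain ⟨mP, mP1⟩ := Th_meas n i ς b.cd.continuous b.k1
  have hk : Tendsto (fun k : ℕ => (k:ℝ)) atTop atTop := tendsto_natCast_atTop_atTop
  have key := errlim S mP mP1 (fun R => ?_) (fun q hq => integral_nonneg fun μ => mul_nonneg (om_nonneg μ) (b.n0 _)) 0 hk
    (E := fun k => ∫ q in slab n M 1 (k:ℝ), u q * (2 * ps1 0 k q.1 * Th1 n i ς c1 q + ps2 0 k q.1 * Th n i ς c q)) ?_ ?_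
  · refine ⟨key.1, key.2.trans ?_⟩
    rw [neg_eq_zero]
    unfold Dat
    have : ∀ x : Sp n, fderiv ℝ u (1, x) (1, 0) * Th n i ς c (1, x) - u (1, x) * Th1 n i ς c1 (1, x) = 0 := by
      intro x
      have h1 : ((1:ℝ), x) ∈ Om n := mem_Om.2 one_pos
      by_cases hx : ((1:ℝ), x) ∈ cone n M
      · have hx' : ‖x‖ ≤ M + phi 1 := hx
        have hphi : phi 1 = 2/3 := by unfold phi; norm_num
        rw [hphi] at hx'
        have out : ∀ μ ∈ Ioo (-1:ℝ) 1, pz n i ς μ (1, x) ∉ Icc (M + 2) (M + 2 + 1) := by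
          intro μ hμ h
          have h2 := h.1
          unfold pz at h2
          simp only [hphi] at h2
          have h3 : ς * x i ≤ M + 2/3 := by
            refine (le_abs_self _).trans ?_
            rw [abs_mul, hς1, one_mul]; exact (coord_le i x).trans hx'
          linarith [hμ.2]
        have z0 : Th n i ς c (1, x) = 0 := by
          unfold Th
          refine integral_eq_zero_of_ae (.of_forall fun μ => ?_)
          unfold g0
          by_cases hμ : μ ∈ Ioo (-1:ℝ) 1
          · simp [b.z0 _ (out μ hμ)]
          · simp [om_zero hμ]
        have z1 : Th1 n i ς c1 (1, x) = 0 := by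
          unfold Th1
          refine integral_eq_zero_of_ae (.of_forall fun μ => ?_)
          unfold g1
          by_cases hμ : μ ∈ Ioo (-1:ℝ) 1
          · simp [b.z1 _ (out μ hμ)]
          · simp [om_zero hμ]
        rw [z0, z1]; ring
      · rw [(ut_off S).2 _ h1 hx, S.supp _ h1 hx]; ring
    simp [this]
  · refine ⟨C0 * (R ^ ((1:ℝ)/4)) + C0 * (R * R ^ ((1:ℝ)/4)), fun q hq => ?_⟩
    have h1 : 1 ≤ q.1 := hq.1.1
    have h2 : q.1 ≤ R := hq.1.2
    have hx := coord_le i q.2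
    have hx2 : ‖q.2‖ ≤ M + phi q.1 := hq.2
    obtain ⟨B1, B0⟩ := B q (slab_sub_Qc hq)
    have hd : (1 + (M + phi q.1) - |q.2 i|) ^ (-(5:ℝ)/6) ≤ 1 := Real.rpow_le_one_of_one_le_of_nonpos (by linarith) (by norm_num)
    have hd0 : 0 ≤ (1 + (M + phi q.1) - |q.2 i|) ^ (-(5:ℝ)/6) := Real.rpow_nonneg (by linarith) _
    have ht : q.1 ^ ((1:ℝ)/4) ≤ R ^ ((1:ℝ)/4) := Real.rpow_le_rpow (by linarith) h2 (by norm_num)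
    have ht0 : 0 ≤ q.1 ^ ((1:ℝ)/4) := Real.rpow_nonneg (by linarith) _
    have hR0 : 0 ≤ R ^ ((1:ℝ)/4) := ht0.trans ht
    have m1 : q.1 ^ ((1:ℝ)/4) * (1 + (M + phi q.1) - |q.2 i|) ^ (-(5:ℝ)/6) ≤ R ^ ((1:ℝ)/4) := by
      calc _ ≤ R ^ ((1:ℝ)/4) * 1 := mul_le_mul ht hd hd0 hR0
        _ = _ := mul_one _
    have m2 : q.1 * (q.1 ^ ((1:ℝ)/4) * (1 + (M + phi q.1) - |q.2 i|) ^ (-(5:ℝ)/6)) ≤ R * R ^ ((1:ℝ)/4) :=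
      mul_le_mul h2 m1 (mul_nonneg ht0 hd0) (by linarith)
    have w1 : 0 ≤ C0 * R ^ ((1:ℝ)/4) := mul_nonneg hC0 hR0
    have w2 : 0 ≤ C0 * (R * R ^ ((1:ℝ)/4)) := mul_nonneg hC0 (mul_nonneg (by linarith) hR0)
    constructor
    · have := mul_le_mul_of_nonneg_left m2 hC0
      linarith
    · have := mul_le_mul_of_nonneg_left m1 hC0
      linarith
  · refine squeeze_zero_norm' (a := fun k : ℕ => C * (k:ℝ) ^ (-θ)) ?_ ?_
    · filter_upwards [hk.eventually_ge_atTop 1] with k h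
      exact H k h
    · have := ((tendsto_rpow_neg_atTop hθ).comp hk).const_mul C
      rw [mul_zero] at this
      exact this
  · filter_upwards [hk.eventually_ge_atTop 1] with k h
    exact ThG S i hς b h 0

lemma Th_pos {n : ℕ} (i : Fin n) {ς M : ℝ} (hM : 0 ≤ M) {c c1 c2 : ℝ → ℝ} {X : ℝ} (b : Bmp c c1 c2 (M + 2) X) {q : ℝ × Sp n} (hq : 0 < q.1)
    (hy : M + 3 ≤ phi q.1) (h0 : 0 ≤ ς * q.2 i) (h1 : ς * q.2 i ≤ M + phi q.1) : 0 < Th n i ς c q := by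
  unfold Th
  have hint : Integrable fun μ => g0 n i ς c μ q := by
    have m := (g_meas n i ς b.cd.continuous b.k1 b.k2).1
    have m' : Measurable fun μ => g0 n i ς c μ q := m.of_uncurry_right
    exact (om_int.const_mul X).mono' m'.aestronglyMeasurable (.of_forall fun μ => (g_bd i ς b hq μ).1)
  rw [integral_pos_iff_support_of_nonneg (f := fun μ => g0 n i ς c μ q) (fun μ => mul_nonneg (om_nonneg μ) (b.n0 _)) hint]
  set V : Set ℝ := Ioo (-1) 1 ∩ (fun μ => pz n i ς μ q) ⁻¹' (Ioo (M + 2) (M + 2 + 1)) with hV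
  have hc : Continuous fun μ => pz n i ς μ q := by unfold pz; fun_prop
  have Vo : IsOpen V := isOpen_Ioo.inter (isOpen_Ioo.preimage hc)
  have hyp : 0 < phi q.1 := by linarith
  have Vn : V.Nonempty := by
    refine ⟨(M + 2 + 1/2 - ς * q.2 i) / phi q.1, ⟨?_, ?_⟩, ?_⟩
    · rw [lt_div_iff₀ hyp]; linarith
    · rw [div_lt_one hyp]; linarith
    · show pz n i ς _ q ∈ Ioo (M + 2) (M + 2 + 1)
      unfold pz
      rw [div_mul_cancel₀ _ hyp.ne']
      constructor <;> linarith
  refine lt_of_lt_of_le (Vo.measure_pos volume Vn) (measure_mono fun μ hμ => ?_)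
  exact (mul_pos (om_pos hμ.1) (b.pos _ hμ.2)).ne'

lemma u_zero {n : ℕ} {M p : ℝ} {u : ℝ × Sp n → ℝ} (S : Sol n M p u)
    (hI : IntegrableOn (fun q => |u q| ^ p * q.1 ^ ((5:ℝ)/2)) (Qc n M)) : ∃ T, 0 < T ∧ ∀ q : ℝ × Sp n, T < q.1 → u q = 0 := by
  have hM := S.hM
  have hM0 : 0 ≤ M := by linarith
  have hp := S.hp
  have i : Fin n := ⟨0, by have := S.hn; omega⟩
  obtain ⟨c, c1, c2, X, b⟩ := bmp_ex (M + 2)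
  obtain ⟨I1, Z1⟩ := ThZero S i (ς := 1) (by norm_num) b hI
  obtain ⟨I2, Z2⟩ := ThZero S i (ς := -1) (by norm_num) b hI
  set G : ℝ × Sp n → ℝ := fun q => |u q| ^ p * Th n i 1 c q + |u q| ^ p * Th n i (-1) c q with hG
  have IG : IntegrableOn G (Qc n M) := I1.add I2
  have ZG : ∫ q in Qc n M, G q = 0 := by rw [hG, integral_add I1 I2, Z1, Z2, add_zero]
  have Tn : ∀ ς q, 0 ≤ Th n i ς c q := fun ς q => integral_nonneg fun μ => mul_nonneg (om_nonneg μ) (b.n0 _)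
  have Gn : ∀ q, 0 ≤ G q := fun q => by
    have h1 := Tn 1 q
    have h2 := Tn (-1) q
    simp only [hG]; positivity
  have hae := (setIntegral_eq_zero_iff_of_nonneg_ae (.of_forall Gn) IG).1 ZG
  refine ⟨2 * (M + 3), by linarith, ?_⟩
  by_contra hcon
  push Not at hcon
  obtain ⟨q0, ht0, hu0⟩ := hcon
  set W : Set (ℝ × Sp n) := {q | q ∈ Om n ∩ {q | 2 * (M + 3) < q.1} ∧ u q ∈ ({0}ᶜ : Set ℝ)} with hW
  have oOm : IsOpen (Om n ∩ {q : ℝ × Sp n | 2 * (M + 3) < q.1}) := (Om_open n).inter (isOpen_lt continuous_const continuous_fst)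
  have Wo : IsOpen W := (S.cont.mono inter_subset_left).isOpen_inter_preimage oOm isOpen_compl_singleton
  have Wn : W.Nonempty := ⟨q0, ⟨mem_Om.2 (by linarith), ht0⟩, hu0⟩
  have Wpos := Wo.measure_pos volume Wn
  have WQ : ∀ q ∈ W, q ∈ Qc n M ∧ 0 < G q := by
    rintro q ⟨⟨ho, ht⟩, hu⟩
    have ht' : 2 * (M + 3) < q.1 := ht
    have hq : 0 < q.1 := by linarith
    have hcone : q ∈ cone n M := by
      by_contra h; exact hu (S.supp q ho h)
    have hcn : ‖q.2‖ ≤ M + phi q.1 := hcone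
    refine ⟨⟨by linarith, hcn⟩, ?_⟩
    have hu' : u q ≠ 0 := hu
    have hU : 0 < |u q| ^ p := Real.rpow_pos_of_pos (abs_pos.2 hu') _
    have hphi : M + 3 ≤ phi q.1 := by
      have h1 : 1 ≤ q.1 ^ ((1:ℝ)/2) := Real.one_le_rpow (by linarith) (by norm_num)
      have h2 := phi_half hq
      nlinarith
    have hx := (coord_le i q.2).trans hcn
    have h1 := Tn 1 q
    have h2 := Tn (-1) q
    simp only [hG]
    rcases le_total 0 (q.2 i) with h | h
    · have := Th_pos i hM0 b (ς := 1) hq hphi (by linarith) (by linarith [le_abs_self (q.2 i)])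
      positivity
    · have := Th_pos i hM0 b (ς := -1) hq hphi (by linarith) (by linarith [neg_abs_le (q.2 i)])
      positivity
  have hz : volume W = 0 := by
    rw [EventuallyEq, ae_restrict_iff' (Qc_meas n M)] at hae
    refine measure_mono_null (fun q hq => ?_) hae
    obtain ⟨h1, h2⟩ := WQ q hq
    intro h
    exact h2.ne' (h h1)
  exact Wpos.ne' hz
end Tric

namespace Tric

/-- symmetry of second derivatives -/
lemma D_symm {n : ℕ} {u : ℝ × Sp n → ℝ} (h : ContDiffOn ℝ 2 u (Om n)) {q : ℝ × Sp n} (hq : q ∈ Om n) (v w : ℝ × Sp n) :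
    fderiv ℝ (fun z => fderiv ℝ u z v) q w = fderiv ℝ (fun z => fderiv ℝ u z w) q v := by
  have hc := h.contDiffAt ((Om_open n).mem_nhds hq)
  have hs : IsSymmSndFDerivAt ℝ u q := hc.isSymmSndFDerivAt (by simp)
  have hd : DifferentiableAt ℝ (fderiv ℝ u) q := (hc.fderiv_right (m := 1) (by norm_num)).differentiableAt one_ne_zero
  have e : ∀ v w, fderiv ℝ (fun z => fderiv ℝ u z v) q w = fderiv ℝ (fderiv ℝ u) q w v := by
    intro v w
    have := (hd.hasFDerivAt.clm_apply (hasFDerivAt_const v q)).fderiv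
    rw [this]; simp
  rw [e, e]; exact hs w v

/-- energy density -/
noncomputable def en {n : ℕ} (u : ℝ × Sp n → ℝ) (q : ℝ × Sp n) : ℝ :=
  (fderiv ℝ u q (1, 0)) ^ 2 + q.1 * ∑ i, (fderiv ℝ u q (eX n i)) ^ 2 + (u q) ^ 2

lemma D_off {n : ℕ} {M p : ℝ} {u : ℝ × Sp n → ℝ} (S : Sol n M p u) (v : ℝ × Sp n) : ∀ q ∈ Om n, q ∉ cone n M → fderiv ℝ u q v = 0 := by
  intro q hq hc; rw [fderiv_off S.supp hq hc]; rfl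

lemma en_cd {n : ℕ} {M p : ℝ} {u : ℝ × Sp n → ℝ} (S : Sol n M p u) : ContDiffOn ℝ 1 (en u) (Om n) := by
  have h := fun v => C2_D1 (Om_open n) S.c2 v
  unfold en
  exact (((h _).pow 2).add (contDiff_fst.contDiffOn.mul (ContDiffOn.sum fun i _ => (h _).pow 2))).add (S.c1.pow 2)

lemma en_off {n : ℕ} {M p : ℝ} {u : ℝ × Sp n → ℝ} (S : Sol n M p u) : ∀ q ∈ Om n, q ∉ cone n M → en u q = 0 := by
  intro q hq hc
  unfold en
  rw [S.supp q hq hc, D_off S _ q hq hc, Finset.sum_eq_zero fun i _ => by rw [D_off S _ q hq hc]; norm_num]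
  norm_num

lemma en_dt {n : ℕ} {M p : ℝ} {u : ℝ × Sp n → ℝ} (S : Sol n M p u) {q : ℝ × Sp n} (hq : q ∈ Om n) :
    fderiv ℝ (en u) q (1, 0) = 2 * fderiv ℝ u q (1, 0) * |u q| ^ p + 2 * u q * fderiv ℝ u q (1, 0) + ∑ i, (fderiv ℝ u q (eX n i)) ^ 2 +
      2 * q.1 * ∑ i, fderiv ℝ (fun z => fderiv ℝ u z (1, 0) * fderiv ℝ u z (eX n i)) q (eX n i) := by
  have d := fun v => (C1_diff (C2_D1 (Om_open n) S.c2 v) hq).hasFDerivAt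
  have d0 := (C1_diff S.c1 hq).hasFDerivAt
  have D : HasFDerivAt (en u) _ q := (((d (1, 0)).pow 2).add ((hasFDerivAt_fst (𝕜 := ℝ) (p := q)).mul
    (HasFDerivAt.fun_sum (u := Finset.univ) fun i _ => (d (eX n i)).pow 2))).add (d0.pow 2)
  have Di : ∀ i, fderiv ℝ (fun z => fderiv ℝ u z (1, 0) * fderiv ℝ u z (eX n i)) q (eX n i) =
      fderiv ℝ u q (1, 0) * fderiv ℝ (fun z => fderiv ℝ u z (eX n i)) q (eX n i) +
      fderiv ℝ u q (eX n i) * fderiv ℝ (fun z => fderiv ℝ u z (1, 0)) q (eX n i) := by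
    intro i
    have : HasFDerivAt (fun z => fderiv ℝ u z (1, 0) * fderiv ℝ u z (eX n i)) _ q := (d (1, 0)).mul (d (eX n i))
    rw [this.fderiv]; simp
  rw [D.fderiv, Finset.sum_congr rfl fun i _ => Di i]
  have hp := S.pde q hq
  unfold Pop at hp
  have hsy := fun i => D_symm S.c2 hq (eX n i) (1, 0)
  simp only [add_apply, smul_apply, smul_eq_mul, sum_apply, ContinuousLinearMap.coe_fst', hsy]
  rw [← hp, Finset.sum_add_distrib, ← Finset.mul_sum]
  simp only [nsmul_eq_mul, pow_one, Nat.add_one_sub_one]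
  have s1 : ∑ i, ((2:ℕ):ℝ) * fderiv ℝ u q (eX n i) * fderiv ℝ (fun z => fderiv ℝ u z (1, 0)) q (eX n i) =
      2 * ∑ i, fderiv ℝ u q (eX n i) * fderiv ℝ (fun z => fderiv ℝ u z (1, 0)) q (eX n i) := by
    rw [Finset.mul_sum]; refine Finset.sum_congr rfl fun i _ => ?_
    push_cast; ring
  rw [s1]
  push_cast
  ring

/-- energy identity -/
lemma en_int {n : ℕ} {M p : ℝ} {u : ℝ × Sp n → ℝ} (S : Sol n M p u) {t : ℝ} (ht : 0 < t) :
    HasDerivAt (fun s => ∫ x, en u (s, x)) (∫ x, (2 * fderiv ℝ u (t, x) (1, 0) * |u (t, x)| ^ p + 2 * u (t, x) * fderiv ℝ u (t, x) (1, 0) +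
      ∑ i, (fderiv ℝ u (t, x) (eX n i)) ^ 2)) t := by
  refine (div_a (en_cd S) (en_off S) ht).congr_deriv ?_
  have hF : ∀ i, ContDiffOn ℝ 1 (fun z => fderiv ℝ u z (1, 0) * fderiv ℝ u z (eX n i)) (Om n) := fun i =>
    (C2_D1 (Om_open n) S.c2 _).mul (C2_D1 (Om_open n) S.c2 _)
  have hFs : ∀ i, ∀ q ∈ Om n, q ∉ cone n M → fderiv ℝ u q (1, 0) * fderiv ℝ u q (eX n i) = 0 := fun i q hq hc => by
    rw [D_off S _ q hq hc, zero_mul]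
  have hi : ∀ i, Integrable fun x => fderiv ℝ (fun z => fderiv ℝ u z (1, 0) * fderiv ℝ u z (eX n i)) (t, x) (eX n i) := by
    intro i
    refine slice_int (C1_fderiv (hF i) _) (M := M) ?_ ht
    intro q hq hc
    rw [fderiv_off (hFs i) hq hc]; rfl
  have h0 : Integrable fun x => fderiv ℝ (en u) (t, x) (1, 0) := by
    refine slice_int (C1_fderiv (en_cd S) _) (M := M) ?_ ht
    intro q hq hc
    rw [fderiv_off (en_off S) hq hc]; rfl
  have e1 : ∫ x, 2 * t * ∑ i, fderiv ℝ (fun z => fderiv ℝ u z (1, 0) * fderiv ℝ u z (eX n i)) (t, x) (eX n i) = 0 := by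
    have hz : ∀ i, ∫ x, fderiv ℝ (fun z => fderiv ℝ u z (1, 0) * fderiv ℝ u z (eX n i)) (t, x) (eX n i) = 0 := fun i =>
      div_b (hF i) (hFs i) ht (EuclideanSpace.single i (1:ℝ))
    rw [integral_const_mul, integral_finsetSum _ (fun i _ => hi i), Finset.sum_eq_zero fun i _ => hz i, mul_zero]
  rw [← sub_zero (∫ x, fderiv ℝ _ (t, x) (1, 0)), ← e1, ← integral_sub h0 ((integrable_finsetSum _ (fun i _ => hi i)).const_mul _)]
  congr 1
  ext x
  rw [en_dt S (mem_Om.2 ht)]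
  ring

/-- backward uniqueness -/
lemma back {n : ℕ} {M p : ℝ} {u : ℝ × Sp n → ℝ} (S : Sol n M p u) {T : ℝ} (hT : 0 < T) (h : ∀ q : ℝ × Sp n, T < q.1 → u q = 0) :
    ∀ q ∈ Om n, u q = 0 := by
  rintro ⟨t0, x0⟩ hq0
  have ht0 : 0 < t0 := mem_Om.1 hq0
  have hp := S.hp
  by_cases hlt : T < t0
  · exact h _ hlt
  push Not at hlt
  set T1 := T + 1 with hT1
  have hpc : ContinuousOn (fun q => |u q| ^ (p - 1)) (slab n M t0 T1) :=
    (S.cont.abs.rpow_const fun _ _ => Or.inr (by linarith)).mono (slab_sub_Om ht0)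
  obtain ⟨K, hK⟩ := (slab_compact n M t0 T1 ht0.le).exists_bound_of_continuousOn hpc
  set C := |K| + 1 with hC
  have hC0 : 0 < C := by positivity
  set E : ℝ → ℝ := fun s => ∫ x, en u (s, x) with hE
  set E' : ℝ → ℝ := fun t => ∫ x, (2 * fderiv ℝ u (t, x) (1, 0) * |u (t, x)| ^ p + 2 * u (t, x) * fderiv ℝ u (t, x) (1, 0) +
      ∑ i, (fderiv ℝ u (t, x) (eX n i)) ^ 2) with hE'
  have dE : ∀ t, 0 < t → HasDerivAt E (E' t) t := fun t ht => en_int S ht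
  have enn : ∀ q ∈ Om n, 0 ≤ en u q := fun q hq => by
    have := mem_Om.1 hq
    unfold en
    positivity
  have pt : ∀ t ∈ Icc t0 T1, ∀ x, -C * en u (t, x) ≤ 2 * fderiv ℝ u (t, x) (1, 0) * |u (t, x)| ^ p + 2 * u (t, x) * fderiv ℝ u (t, x) (1, 0) +
      ∑ i, (fderiv ℝ u (t, x) (eX n i)) ^ 2 := by
    intro t ht x
    have htp : 0 < t := lt_of_lt_of_le ht0 ht.1
    have ho : (t, x) ∈ Om n := mem_Om.2 htp
    have hup : ∃ k, 0 ≤ k ∧ k ≤ |K| ∧ |u (t, x)| ^ p = k * |u (t, x)| := by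
      by_cases hc : (t, x) ∈ cone n M
      · refine ⟨|u (t, x)| ^ (p - 1), by positivity, ?_, ?_⟩
        · have := hK (t, x) ⟨ht, hc⟩
          exact (le_abs_self _).trans (this.trans (le_abs_self K))
        · rw [← Real.rpow_add_one' (abs_nonneg _) (by linarith)]; congr 1; ring
      · exact ⟨0, le_rfl, abs_nonneg _, by rw [S.suppU _ ho hc, zero_mul]⟩
    obtain ⟨k, hk0, hk, e⟩ := hup
    rw [e]
    unfold en
    have hS : 0 ≤ ∑ i, (fderiv ℝ u (t, x) (eX n i)) ^ 2 := by positivity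
    generalize fderiv ℝ u (t, x) (1, 0) = a at *
    generalize (∑ i, (fderiv ℝ u (t, x) (eX n i)) ^ 2) = s at *
    generalize hv : u (t, x) = v at *
    have h1 : -(a ^ 2 + v ^ 2) ≤ 2 * v * a := by nlinarith [sq_nonneg (a + v)]
    have h2 : -(a ^ 2 + v ^ 2) ≤ 2 * a * |v| := by nlinarith [sq_nonneg (a + |v|), sq_abs v]
    have h3 : -|K| * (a ^ 2 + v ^ 2) ≤ k * (2 * a * |v|) := by
      calc -|K| * (a ^ 2 + v ^ 2) ≤ -k * (a ^ 2 + v ^ 2) := mul_le_mul_of_nonneg_right (by linarith) (by positivity)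
        _ = k * -(a ^ 2 + v ^ 2) := by ring
        _ ≤ _ := mul_le_mul_of_nonneg_left h2 hk0
    have h4 : 0 ≤ C * (t * s) := by positivity
    rw [hC] at h4 ⊢
    linarith
  have ien : ∀ t, 0 < t → Integrable fun x => en u (t, x) := fun t ht => slice_int (en_cd S).continuousOn (en_off S) ht
  have ineq : ∀ t ∈ Icc t0 T1, 0 ≤ E' t + C * E t := by
    intro t ht
    have htp : 0 < t := lt_of_lt_of_le ht0 ht.1
    have i1 : Integrable fun x => (2 * fderiv ℝ u (t, x) (1, 0) * |u (t, x)| ^ p + 2 * u (t, x) * fderiv ℝ u (t, x) (1, 0) +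
      ∑ i, (fderiv ℝ u (t, x) (eX n i)) ^ 2) := by
      have c := fun v => C1_fderiv S.c1 v
      refine slice_int (G := fun q => 2 * fderiv ℝ u q (1, 0) * |u q| ^ p + 2 * u q * fderiv ℝ u q (1, 0) +
        ∑ i, (fderiv ℝ u q (eX n i)) ^ 2) (M := M) ?_ ?_ htp
      · exact (((continuousOn_const.mul (c _)).mul S.contU).add ((continuousOn_const.mul S.cont).mul (c _))).add
          (continuousOn_finsetSum _ fun i _ => (c _).pow 2)
      · intro q hq hc
        rw [S.supp q hq hc, D_off S _ q hq hc, Finset.sum_eq_zero fun i _ => by rw [D_off S _ q hq hc]; norm_num]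
        norm_num
    have := integral_mono ((ien t htp).const_mul (-C)) i1 (pt t ht)
    rw [integral_const_mul] at this
    simp only [hE', hE]
    linarith
  have hmono : MonotoneOn (fun t => E t * Real.exp (C * t)) (Icc t0 T1) := by
    have dd : ∀ t ∈ Icc t0 T1, HasDerivAt (fun t => E t * Real.exp (C * t)) ((E' t + C * E t) * Real.exp (C * t)) t := by
      intro t ht
      have h1 : HasDerivAt (fun t => Real.exp (C * t)) (Real.exp (C * t) * C) t := by
        simpa using ((hasDerivAt_id t).const_mul C).exp
      refine ((dE t (lt_of_lt_of_le ht0 ht.1)).mul h1).congr_deriv ?_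
      ring
    refine monotoneOn_of_deriv_nonneg (convex_Icc _ _) (fun t ht => (dd t ht).continuousAt.continuousWithinAt)
      (fun t ht => (dd t (interior_subset ht)).differentiableAt.differentiableWithinAt) fun t ht => ?_
    rw [(dd t (interior_subset ht)).deriv]
    exact mul_nonneg (ineq t (interior_subset ht)) (Real.exp_pos _).le
  have hz : E T1 = 0 := by
    have : ∀ x : Sp n, en u (T1, x) = 0 := by
      intro x
      have ev : u =ᶠ[𝓝 (T1, x)] fun _ => (0:ℝ) := by
        have ho : IsOpen {q : ℝ × Sp n | T < q.1} := isOpen_lt continuous_const continuous_fst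
        filter_upwards [ho.mem_nhds (show T < T1 by linarith)] with z hz using h z hz
      unfold en
      rw [ev.fderiv_eq, h (T1, x) (show T < T1 by linarith)]
      simp
    simp only [hE, this, integral_zero]
  have hle := hmono (left_mem_Icc.2 (by linarith)) (right_mem_Icc.2 (by linarith)) (by linarith : t0 ≤ T1)
  simp only [hz, zero_mul] at hle
  have hE0 : E t0 ≤ 0 := by
    by_contra hcon
    push Not at hcon
    have := mul_pos hcon (Real.exp_pos (C * t0))
    linarith
  have hE1 : E t0 = 0 := le_antisymm hE0 (integral_nonneg fun x => enn _ (mem_Om.2 ht0))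
  have hcont : Continuous fun x => en u (t0, x) := slice_cont (en_cd S).continuousOn ht0
  have hcs : HasCompactSupport fun x => en u (t0, x) := by
    refine HasCompactSupport.intro (isCompact_closedBall (0 : Sp n) (M + phi t0)) fun x hx => ?_
    refine en_off S _ (mem_Om.2 ht0) fun hc => hx ?_
    have hc' : ‖x‖ ≤ M + phi t0 := hc
    simpa using hc'
  have hx0 : en u (t0, x0) = 0 := by
    by_contra hne
    have := hcont.integral_pos_of_hasCompactSupport_nonneg_nonzero (μ := volume) (x := x0) hcs (fun x => enn _ (mem_Om.2 ht0)) hne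
    exact this.ne' hE1
  have hs : 0 ≤ t0 * ∑ i, (fderiv ℝ u (t0, x0) (eX n i)) ^ 2 := by positivity
  unfold en at hx0
  simp only at hx0
  have : u (t0, x0) ^ 2 = 0 := by nlinarith [sq_nonneg (u (t0, x0)), sq_nonneg (fderiv ℝ u (t0, x0) (1, 0))]
  exact pow_eq_zero_iff (two_ne_zero) |>.1 this
end Tric

namespace Tric

lemma Vf_nonneg {n : ℕ} {M p : ℝ} {u : ℝ × Sp n → ℝ} {σ : ℝ} {j : ℕ} {R : ℝ} : 0 ≤ Vf n M p u σ j R := by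
  unfold Vf
  refine setIntegral_nonneg (slab_meas n M 1 _ zero_le_one) fun q hq => ?_
  have h1 : 1 ≤ q.1 := hq.1.1
  have hR : q.1 ≤ R := hq.1.2
  have h2 : 0 ≤ 1 - q.1 / R := by rw [sub_nonneg]; exact (div_le_one (by linarith)).2 hR
  have h3 : 0 ≤ q.1 / R := div_nonneg (by linarith) (by linarith)
  have h4 : 0 ≤ q.1 ^ (-σ) := Real.rpow_nonneg (by linarith) _
  positivity

/-- every global solution vanishes -/
lemma no_sol {n : ℕ} {M p : ℝ} {u : ℝ × Sp n → ℝ} (S : Sol n M p u) : ∀ q ∈ Om n, u q = 0 := by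
  have hp := S.hp
  obtain ⟨j, hj⟩ : ∃ j : ℕ, ((j:ℝ) + 2) / p ≤ j + 1 := by
    obtain ⟨j, hj⟩ := exists_nat_gt (1 / (p - 1))
    refine ⟨j, ?_⟩
    rw [div_lt_iff₀ (by linarith)] at hj
    rw [div_le_iff₀ (by linarith)]
    nlinarith
  set σ := 3/2 * (mm n + 1/6 - 1/p) with hσ
  have hnot : ∀ k : ℕ, ∃ R, (k:ℝ) ≤ R ∧ Vf n M p u σ j R < 1 / ((k:ℝ) + 1) := by
    intro k
    by_contra hcon
    push Not at hcon
    exact caseA S hσ hj (c := 1 / ((k:ℝ) + 1)) (R0 := k) (by positivity) hcon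
  choose Rk hk1 hk2 using hnot
  have hk : Tendsto Rk atTop atTop := tendsto_atTop_mono hk1 tendsto_natCast_atTop_atTop
  have hV : Tendsto (fun k => Vf n M p u σ j (Rk k)) atTop (𝓝 0) :=
    squeeze_zero (fun k => Vf_nonneg) (fun k => (hk2 k).le) tendsto_one_div_add_atTop_nhds_zero_nat
  have HB := fun α => caseB S hσ hj hk hV α
  obtain ⟨T, hT, hz⟩ := u_zero S (mom52 S (Sa_good S HB))
  exact back S hT hz

lemma lap_eq {n : ℕ} {U : ℝ × Sp n → ℝ} (h : ContDiffOn ℝ 2 U (Om n)) {t : ℝ} (ht : 0 < t) (x : Sp n) :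
    spatialLaplacian (fun y => U (t, y)) x = ∑ i, fderiv ℝ (fun z => fderiv ℝ U z (eX n i)) (t, x) (eX n i) := by
  unfold spatialLaplacian
  refine Finset.sum_congr rfl fun i _ => ?_
  have h1 : ContDiffOn ℝ 1 U (Om n) := h.of_le (by norm_num)
  have e : (fun y => fderiv ℝ (fun y => U (t, y)) y (EuclideanSpace.single i (1:ℝ))) = fun y => fderiv ℝ U (t, y) (eX n i) := by
    ext y
    exact fderiv_slice (C1_diff h1 (mem_Om.2 ht)) _
  rw [e]
  exact fderiv_slice (F := fun z => fderiv ℝ U z (eX n i)) (C1_diff (C2_D1 (Om_open n) h _) (mem_Om.2 ht)) _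

lemma dtt_eq {n : ℕ} {U : ℝ × Sp n → ℝ} (h : ContDiffOn ℝ 2 U (Om n)) {t : ℝ} (ht : 0 < t) (x : Sp n) :
    deriv (deriv fun s => U (s, x)) t = fderiv ℝ (fun z => fderiv ℝ U z (1, 0)) (t, x) (1, 0) := by
  have h1 : ContDiffOn ℝ 1 U (Om n) := h.of_le (by norm_num)
  have e : (deriv fun s => U (s, x)) =ᶠ[𝓝 t] fun s => fderiv ℝ U (s, x) (1, 0) := by
    filter_upwards [Ioi_mem_nhds ht] with s hs
    exact (hasDerivAt_t (C1_diff h1 (mem_Om.2 hs))).deriv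
  rw [e.deriv_eq]
  exact (hasDerivAt_t (F := fun z => fderiv ℝ U z (1, 0)) (C1_diff (C2_D1 (Om_open n) h _) (mem_Om.2 ht))).deriv

lemma p_gt_one {n : ℕ} (hn : 2 ≤ n) {p : ℝ} (hp : 0 < p)
    (hcrit : (3 * (n : ℝ) - 2) * p ^ 2 - 3 * (n : ℝ) * p - 6 = 0) : 1 < p := by
  by_contra hcon
  push Not at hcon
  have hn' : (2:ℝ) ≤ n := by exact_mod_cast hn
  have h1 : p ^ 2 ≤ p := by nlinarith
  have h2 : (3 * (n : ℝ) - 2) * p ^ 2 ≤ (3 * (n : ℝ) - 2) * p := mul_le_mul_of_nonneg_left h1 (by linarith)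
  nlinarith

end Tric

/-- Blowup at the critical exponent: let `n ≥ 2`, `M > 1`, and let `p = p_crit(n)` be the
positive root of `(3n-2)p² - 3np - 6 = 0`.  If `f, g ∈ C_c^∞(ℝⁿ)` are supported in the
ball `B(0,M)`, nonnegative and each positive somewhere, then there is no global `C²`
solution `u` on `[0,∞) × ℝⁿ` of `∂_t²u - tΔu = |u|^p` with data `(f,g)` satisfying the
finite-propagation property `supp u(t,·) ⊆ {|x| ≤ M + (2/3)t^{3/2}}`. -/
theorem stmt0 (n : ℕ) (hn : 2 ≤ n) (M : ℝ) (hM : 1 < M) (p : ℝ) (hp : 0 < p)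
    (hcrit : (3 * (n : ℝ) - 2) * p ^ 2 - 3 * (n : ℝ) * p - 6 = 0)
    (f g : EuclideanSpace ℝ (Fin n) → ℝ)
    (hfsm : ContDiff ℝ (⊤ : ℕ∞) f) (hgsm : ContDiff ℝ (⊤ : ℕ∞) g)
    (hfsupp : Function.support f ⊆ ball (0 : EuclideanSpace ℝ (Fin n)) M)
    (hgsupp : Function.support g ⊆ ball (0 : EuclideanSpace ℝ (Fin n)) M)
    (hfpos : ∀ x, 0 ≤ f x) (hgpos : ∀ x, 0 ≤ g x)
    (hfne : ∃ x, 0 < f x) (hgne : ∃ x, 0 < g x) :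
    ¬ ∃ u : ℝ → EuclideanSpace ℝ (Fin n) → ℝ,
        ContDiffOn ℝ 2 (fun q : ℝ × EuclideanSpace ℝ (Fin n) => u q.1 q.2)
          (Ici (0 : ℝ) ×ˢ univ) ∧
        (∀ t ∈ Ici (0 : ℝ), ∀ x,
          deriv (deriv fun s => u s x) t - t * spatialLaplacian (u t) x = |u t x| ^ p) ∧
        u 0 = f ∧
        (∀ x, deriv (fun s => u s x) 0 = g x) ∧
        (∀ t ∈ Ici (0 : ℝ), Function.support (u t) ⊆
          closedBall (0 : EuclideanSpace ℝ (Fin n)) (M + (2 / 3) * t ^ ((3 : ℝ) / 2))) := by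
  rintro ⟨u, hc, hpde, h0, -, hs⟩
  obtain ⟨x, hx⟩ := hfne
  set U : ℝ × Tric.Sp n → ℝ := fun q => u q.1 q.2 with hU
  have hc2 : ContDiffOn ℝ 2 U (Tric.Om n) :=
    hc.mono (prod_mono Ioi_subset_Ici_self (Subset.refl _))
  have S : Tric.Sol n M p U := by
    refine ⟨hn, hM, Tric.p_gt_one hn hp hcrit, hcrit, hc2, ?_, ?_⟩
    · rintro ⟨t, y⟩ hq
      have ht : 0 < t := Tric.mem_Om.1 hq
      have h1 := hpde t (mem_Ici.2 ht.le) y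
      have h2 := Tric.dtt_eq hc2 ht y
      have h3 := Tric.lap_eq hc2 ht y
      unfold Tric.Pop
      rw [← h2, ← h3]
      exact h1
    · rintro ⟨t, y⟩ hq hcn
      have ht : 0 < t := Tric.mem_Om.1 hq
      by_contra hne
      have h1 := hs t (mem_Ici.2 ht.le) hne
      rw [mem_closedBall_zero_iff] at h1
      exact hcn h1
  have hz := Tric.no_sol S
  have hcx : ContinuousWithinAt (fun s : ℝ => U (s, x)) (Ici 0) 0 := by
    have h1 : ContinuousWithinAt U (Ici (0 : ℝ) ×ˢ univ) (0, x) := hc.continuousOn (0, x) ⟨mem_Ici.2 le_rfl, mem_univ _⟩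
    exact h1.comp (f := fun s : ℝ => (s, x)) (by fun_prop) (fun s hs => ⟨hs, mem_univ _⟩)
  have hcx' : Tendsto (fun s : ℝ => U (s, x)) (𝓝[>] 0) (𝓝 (U (0, x))) := hcx.mono Ioi_subset_Ici_self
  have h2 : Tendsto (fun s : ℝ => U (s, x)) (𝓝[>] 0) (𝓝 0) := by
    refine tendsto_const_nhds.congr' ?_
    filter_upwards [self_mem_nhdsWithin] with s hs
    exact (hz (s, x) (Tric.mem_Om.2 hs)).symm
  have h3 : U (0, x) = 0 := tendsto_nhds_unique hcx' h2
  have h4 : U (0, x) = f x := congrFun h0 x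
  linarith
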